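/- Let d ≥ 3. There exists α < d − 1 (depending only on d) such that for every (v₀, v₁) ∈ Ḣ¹(ℝ^d) × L²(ℝ^d), the divergence set of the wave solution satisfies dim_H D(v₀, v₁) ≤ α. In particular, the solution of the wave equation with data in the energy space Ḣ¹(ℝ^d) × L²(ℝ^d) cannot diverge on a set of Hausdorff dimension d − 1. -/

import Mathlib

open MeasureTheory Metric Filter Set
open scoped ENNReal InnerProductSpace Topology

noncomputable def cAlpha (d : ℕ) (α : ℝ) (μ : Measure (EuclideanSpace ℝ (Fin d))) : ℝ≥0∞ :=
  ⨆ (x : EuclideanSpace ℝ (Fin d)) (r : ℝ) (_ : 0 < r), μ (ball x r) / ENNReal.ofReal (r ^ α)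

def IsAlphaDimensional (d : ℕ) (α : ℝ) (μ : Measure (EuclideanSpace ℝ (Fin d))) : Prop :=
  μ (closedBall 0 1)ᶜ = 0 ∧ cAlpha d α μ ≠ ⊤

noncomputable def sphereMeasure (d : ℕ) : Measure (EuclideanSpace ℝ (Fin d)) :=
  (μH[(d : ℝ) - 1]).restrict (sphere (0 : EuclideanSpace ℝ (Fin d)) 1)

noncomputable def fourierMeasure {d : ℕ} (μ : Measure (EuclideanSpace ℝ (Fin d)))
    (ξ : EuclideanSpace ℝ (Fin d)) : ℂ :=
  (((2 * Real.pi) ^ (-(d : ℝ) / 2) : ℝ) : ℂ) *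
    ∫ x, Complex.exp (-Complex.I * ((⟪x, ξ⟫_ℝ : ℝ) : ℂ)) ∂μ

/-- The frequency-truncated wave evolution with data given on the Fourier side by
`F₀ = v̂₀` and `F₁ = v̂₁`:
`∫ ψ(|ξ|/N) (f̂₊(ξ) e^{i(x·ξ + t|ξ|)} + f̂₋(ξ) e^{i(x·ξ - t|ξ|)}) dξ`,
where `f̂_± = (1/2)(F₀ ∓ i|ξ|⁻¹ F₁)`. -/
noncomputable def wavePartial (d : ℕ) (ψ : SchwartzMap ℝ ℝ)
    (F₀ F₁ : EuclideanSpace ℝ (Fin d) → ℂ) (x : EuclideanSpace ℝ (Fin d)) (t N : ℝ) : ℂ :=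
  ∫ ξ, ((ψ (‖ξ‖ / N) : ℝ) : ℂ) *
    ((1 / 2 : ℂ) * (F₀ ξ - Complex.I * ((‖ξ‖⁻¹ : ℝ) : ℂ) * F₁ ξ) *
        Complex.exp (Complex.I * (((⟪x, ξ⟫_ℝ : ℝ) : ℂ) + (t : ℂ) * ((‖ξ‖ : ℝ) : ℂ))) +
      (1 / 2 : ℂ) * (F₀ ξ + Complex.I * ((‖ξ‖⁻¹ : ℝ) : ℂ) * F₁ ξ) *
        Complex.exp (Complex.I * (((⟪x, ξ⟫_ℝ : ℝ) : ℂ) - (t : ℂ) * ((‖ξ‖ : ℝ) : ℂ))))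

/-- The pointwise wave solution (junk value if the limit does not exist).  At `t = 0` this
is the canonical pointwise representative of the datum `v₀`. -/
noncomputable def waveSol (d : ℕ) (ψ : SchwartzMap ℝ ℝ)
    (F₀ F₁ : EuclideanSpace ℝ (Fin d) → ℂ) (x : EuclideanSpace ℝ (Fin d)) (t : ℝ) : ℂ :=
  limUnder atTop (fun N : ℝ => wavePartial d ψ F₀ F₁ x t N)

/-- The divergence set `D(v₀, v₁)`: the points `x` for which it fails that `v(x,t)` is
defined for all small `t` and `v(x,t) → v₀(x)` as `t → 0`. -/
def waveDivergenceSet (d : ℕ) (ψ : SchwartzMap ℝ ℝ)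
    (F₀ F₁ : EuclideanSpace ℝ (Fin d) → ℂ) : Set (EuclideanSpace ℝ (Fin d)) :=
  {x | ¬ ((∃ L : ℂ, Tendsto (fun N : ℝ => wavePartial d ψ F₀ F₁ x 0 N) atTop (𝓝 L)) ∧
      ∃ t₀ : ℝ, 0 < t₀ ∧
        (∀ t : ℝ, t ≠ 0 → |t| < t₀ →
          ∃ L : ℂ, Tendsto (fun N : ℝ => wavePartial d ψ F₀ F₁ x t N) atTop (𝓝 L)) ∧
        Tendsto (fun t => waveSol d ψ F₀ F₁ x t) (𝓝[≠] (0 : ℝ))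
          (𝓝 (waveSol d ψ F₀ F₁ x 0)))}

noncomputable def cis (t : ℝ) : ℂ := Complex.exp (Complex.I * t)

lemma norm_cis (t : ℝ) : ‖cis t‖ = 1 := by
  rw [cis, mul_comm]; exact Complex.norm_exp_ofReal_mul_I t

lemma cis_add (s t : ℝ) : cis (s + t) = cis s * cis t := by
  simp [cis, mul_add, Complex.exp_add]

lemma conj_cis (t : ℝ) : (starRingEnd ℂ) (cis t) = cis (-t) := by
  simp [cis, ← Complex.exp_conj]

lemma continuous_cis : Continuous cis := by unfold cis; fun_prop

lemma cis_sum {ι : Type*} (s : Finset ι) (f : ι → ℝ) :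
    cis (∑ k ∈ s, f k) = ∏ k ∈ s, cis (f k) := by
  simp [cis, Finset.mul_sum, Complex.exp_sum]

/-- The Cauchy weight. -/
noncomputable def cw (s : ℝ) : ℝ := (1 + s ^ 2)⁻¹

lemma cw_pos (s : ℝ) : 0 < cw s := by unfold cw; positivity
lemma cw_le_one (s : ℝ) : cw s ≤ 1 := by
  unfold cw; apply inv_le_one_of_one_le₀; nlinarith [sq_nonneg s]
lemma continuous_cw : Continuous cw := by
  unfold cw; exact Continuous.inv₀ (by fun_prop) (fun s => by positivity)
lemma cw_neg (s : ℝ) : cw (-s) = cw s := by simp [cw]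
lemma integrable_cw : Integrable cw := integrable_inv_one_add_sq

lemma cw_mul_cw_le (s t : ℝ) : cw s * cw (t - s) ≤ 2 * cw t := by
  unfold cw
  rw [← mul_inv, ← div_eq_mul_inv, inv_eq_one_div, div_le_div_iff₀ (by positivity) (by positivity)]
  nlinarith [sq_nonneg (t - 2 * s), sq_nonneg (s * (t - s))]

lemma cw_mul_le (s t : ℝ) : cw t * cw s ≤ 2 * cw (t - s) := by
  have := cw_mul_cw_le t (t - s)
  have h2 : t - s - t = - s := by ring
  rwa [h2, cw_neg] at this

/-- Fourier kernels with prescribed smooth compactly supported transform. -/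
lemma exists_kernel (b : ℝ → ℂ) (hb : ContDiff ℝ ((⊤ : ℕ∞) : WithTop ℕ∞) b) (hc : HasCompactSupport b) :
    ∃ k : ℝ → ℂ, Continuous k ∧
      (∀ m : ℕ, ∃ C : ℝ, 0 < C ∧ ∀ s, ‖k s‖ ≤ C * cw s ^ m) ∧
      (∀ s, k s = ((2 * Real.pi)⁻¹ : ℝ) * ∫ v, b v * cis (-(s * v))) ∧
      (∀ u, ∫ s, k s * cis (s * u) = b u) := by
  set β : SchwartzMap ℝ ℂ := hc.toSchwartzMap hb with hβ
  have hβb : ∀ x, β x = b x := fun x => rfl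
  set γ : SchwartzMap ℝ ℂ := FourierTransform.fourier β with hγ
  have hpi : (0:ℝ) < 2 * Real.pi := by positivity
  have hγv : ∀ σ, γ σ = ∫ v, b v * cis (-((2 * Real.pi * σ) * v)) := by
    intro σ
    rw [hγ, SchwartzMap.fourier_coe, Real.fourier_real_eq_integral_exp_smul]
    congr 1; ext v
    rw [hβb, smul_eq_mul, mul_comm, cis]
    congr 2; push_cast; ring
  refine ⟨fun s => ((2 * Real.pi)⁻¹ : ℝ) * γ (s / (2 * Real.pi)), ?_, ?_, ?_, ?_⟩
  · have := γ.continuous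
    fun_prop
  · intro m
    obtain ⟨C, hC⟩ : ∃ C, ∀ s, (1 + s^2)^m * ‖γ s‖ ≤ C := by
      obtain ⟨C, hC⟩ := γ.decay 0 0
      obtain ⟨C', hC'⟩ := γ.decay (2*m) 0
      refine ⟨2^m * (C + C'), fun s => ?_⟩
      have h1 := hC.2 s
      have h2 := hC'.2 s
      simp only [norm_iteratedFDeriv_zero, pow_zero, one_mul] at h1 h2
      have hs : (1 + s^2)^m ≤ 2^m * (1 + (s^2)^m) := by
        calc (1 + s^2)^m ≤ (2 * max 1 (s^2))^m := by
              gcongr; linarith [le_max_left 1 (s^2), le_max_right 1 (s^2)]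
          _ = 2^m * (max 1 (s^2))^m := by rw [mul_pow]
          _ ≤ 2^m * (1 + (s^2)^m) := by
              gcongr
              rcases max_cases 1 (s^2) with h | h <;> rw [h.1]
              · rw [one_pow]; nlinarith [pow_nonneg (sq_nonneg s) m]
              · linarith
      have h3 : ‖s‖^(2*m) = (s^2)^m := by rw [pow_mul, Real.norm_eq_abs, sq_abs]
      rw [h3] at h2
      calc (1 + s^2)^m * ‖γ s‖ ≤ (2^m * (1 + (s^2)^m)) * ‖γ s‖ := by gcongr
        _ = 2^m * (‖γ s‖ + (s^2)^m * ‖γ s‖) := by ring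
        _ ≤ _ := by gcongr
    have hC0 : 0 ≤ C := le_trans (by positivity) (hC 0)
    refine ⟨(2 * Real.pi)⁻¹ * ((2*Real.pi)^2)^m * (C + 1), by positivity, fun s => ?_⟩
    rw [norm_mul, Complex.norm_real, Real.norm_of_nonneg (by positivity)]
    have h1 := hC (s / (2 * Real.pi))
    have h4 : (0:ℝ) < (1 + (s / (2 * Real.pi))^2)^m := by positivity
    have h2 : ‖γ (s / (2 * Real.pi))‖ ≤ (C+1) * ((1 + (s / (2 * Real.pi))^2)^m)⁻¹ := by
      rw [← div_eq_mul_inv, le_div_iff₀ h4]; linarith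
    have h3 : ((1 + (s / (2 * Real.pi))^2)^m)⁻¹ ≤ ((2*Real.pi)^2)^m * cw s ^ m := by
      rw [← mul_pow, ← inv_pow]
      gcongr
      unfold cw
      rw [← div_eq_mul_inv, inv_eq_one_div, div_le_div_iff₀ (by positivity) (by positivity)]
      have : (2*Real.pi)^2 * (1 + (s / (2 * Real.pi))^2) = (2*Real.pi)^2 + s^2 := by
        field_simp
      rw [this]
      nlinarith [Real.pi_gt_three]
    calc _ ≤ (2 * Real.pi)⁻¹ * ((C+1) * (((2*Real.pi)^2)^m * cw s ^ m)) := by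
          gcongr; exact h2.trans (by gcongr)
      _ = _ := by ring
  · intro s
    simp only
    rw [hγv]
    congr 2; ext v; congr 3; field_simp
  · intro u
    have h1 := Continuous.fourierInv_fourier_eq (f := b) hb.continuous β.integrable γ.integrable
    have h2 := congrFun h1 u
    rw [Real.fourierInv_eq_fourier_neg, Real.fourier_real_eq_integral_exp_smul] at h2
    rw [← h2]
    have h5 : ∀ s : ℝ, (((2 * Real.pi)⁻¹ : ℝ):ℂ) * γ (s / (2 * Real.pi)) * cis (s * u)
        = (fun σ : ℝ => (((2 * Real.pi)⁻¹ : ℝ):ℂ) * (γ σ * cis (2 * Real.pi * σ * u))) (s / (2 * Real.pi)) := by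
      intro s
      simp only
      rw [mul_assoc]; congr 4; field_simp
    simp_rw [h5]
    rw [Measure.integral_comp_div (g := (fun σ : ℝ => (((2 * Real.pi)⁻¹ : ℝ):ℂ) * (γ σ * cis (2 * Real.pi * σ * u))))]
    rw [integral_const_mul, abs_of_pos hpi, Complex.real_smul, ← mul_assoc, ← Complex.ofReal_mul,
      mul_inv_cancel₀ hpi.ne', Complex.ofReal_one, one_mul]
    congr 1; ext v
    rw [smul_eq_mul, mul_comm, cis]
    congr 2
    push_cast; ring

/-- A smooth bump supported in `(-1, 1)` whose integer translates sum to one. -/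
noncomputable def kap (u : ℝ) : ℝ := Real.smoothTransition (u + 1) - Real.smoothTransition u

lemma contDiff_kap {n : ℕ∞} : ContDiff ℝ n kap := by
  unfold kap
  exact (Real.smoothTransition.contDiff.comp (by fun_prop)).sub Real.smoothTransition.contDiff

lemma continuous_kap : Continuous kap := (contDiff_kap (n := 0)).continuous

lemma kap_eq_zero {u : ℝ} (hu : 1 ≤ |u|) : kap u = 0 := by
  unfold kap
  rcases le_abs'.1 hu with h | h
  · rw [Real.smoothTransition.zero_of_nonpos (by linarith), Real.smoothTransition.zero_of_nonpos (by linarith), sub_zero]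
  · rw [Real.smoothTransition.one_of_one_le (by linarith), Real.smoothTransition.one_of_one_le (by linarith), sub_self]

lemma kap_zero : kap 0 = 1 := by
  unfold kap
  rw [Real.smoothTransition.zero_of_nonpos le_rfl, Real.smoothTransition.one_of_one_le (by norm_num), sub_zero]

lemma smoothTransition_mono : Monotone Real.smoothTransition := by
  intro x y hxy
  by_cases hx : x ≤ 0
  · rw [Real.smoothTransition.zero_of_nonpos hx]; exact Real.smoothTransition.nonneg y
  by_cases hy : 1 ≤ y
  · rw [Real.smoothTransition.one_of_one_le hy]; exact Real.smoothTransition.le_one x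
  push Not at hx hy
  unfold Real.smoothTransition
  have h1 : expNegInvGlue x ≤ expNegInvGlue y := expNegInvGlue.monotone hxy
  have h2 : expNegInvGlue (1 - y) ≤ expNegInvGlue (1 - x) := expNegInvGlue.monotone (by linarith)
  have h3 := Real.smoothTransition.pos_denom x
  have h4 := Real.smoothTransition.pos_denom y
  rw [div_le_div_iff₀ h3 h4]
  nlinarith [expNegInvGlue.nonneg x, expNegInvGlue.nonneg y, expNegInvGlue.nonneg (1-x), expNegInvGlue.nonneg (1-y)]

lemma kap_nonneg (u : ℝ) : 0 ≤ kap u := sub_nonneg.2 (smoothTransition_mono (by linarith))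
lemma kap_le_one (u : ℝ) : kap u ≤ 1 := by
  unfold kap; linarith [Real.smoothTransition.nonneg u, Real.smoothTransition.le_one (u + 1)]

lemma sum_kap (m : ℕ) (u : ℝ) (hu : |u| ≤ m) :
    ∑ q ∈ Finset.Icc (-(m:ℤ)) m, kap (u - q) = 1 := by
  have key : ∀ n : ℕ, ∑ q ∈ Finset.Ico (-(m:ℤ)) (-(m:ℤ) + n), kap (u - q)
      = Real.smoothTransition (u + m + 1) - Real.smoothTransition (u + m + 1 - n) := by
    intro n
    induction n with
    | zero => simp
    | succ n ih =>
      have : Finset.Ico (-(m:ℤ)) (-(m:ℤ) + (n+1:ℕ)) = insert (-(m:ℤ) + n) (Finset.Ico (-(m:ℤ)) (-(m:ℤ) + n)) := by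
        ext q; simp only [Finset.mem_Ico, Finset.mem_insert]; push_cast; omega
      rw [this, Finset.sum_insert (by simp), ih, kap]
      push_cast
      ring_nf
  have h := key (2*m+1)
  have h2 : Finset.Ico (-(m:ℤ)) (-(m:ℤ) + (2*m+1:ℕ)) = Finset.Icc (-(m:ℤ)) m := by
    ext q; simp only [Finset.mem_Ico, Finset.mem_Icc]; push_cast; omega
  rw [h2] at h
  rw [h, Real.smoothTransition.one_of_one_le (by linarith [neg_le_of_abs_le hu]),
    Real.smoothTransition.zero_of_nonpos (by push_cast; linarith [le_of_abs_le hu]), sub_zero]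

lemma hasCompactSupport_kapScale (a : ℝ) (ha : 0 < a) :
    HasCompactSupport (fun v => ((kap (a * v) : ℝ) : ℂ)) := by
  apply HasCompactSupport.of_support_subset_isCompact (isCompact_Icc (a := -a⁻¹) (b := a⁻¹))
  intro v hv
  by_contra h
  apply hv
  have : 1 ≤ |a * v| := by
    rw [abs_mul, abs_of_pos ha, ← div_le_iff₀' ha, one_div]
    rw [Set.mem_Icc, ← abs_le, not_le] at h
    exact h.le
  simp [kap_eq_zero this]

lemma exists_kap_kernel (a : ℝ) (ha : 0 < a) :
    ∃ k : ℝ → ℂ, Continuous k ∧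
      (∀ m : ℕ, ∃ C : ℝ, 0 < C ∧ ∀ s, ‖k s‖ ≤ C * cw s ^ m) ∧
      (∀ s, k s = ((2 * Real.pi)⁻¹ : ℝ) * ∫ v, ((kap (a * v) : ℝ) : ℂ) * cis (-(s * v))) ∧
      (∀ u, ∫ s, k s * cis (s * u) = (kap (a * u) : ℝ)) := by
  apply exists_kernel (fun v => ((kap (a * v) : ℝ) : ℂ)) _ (hasCompactSupport_kapScale a ha)
  exact Complex.ofRealCLM.contDiff.comp (contDiff_kap.comp (by fun_prop))

/-- A kernel whose transform equals one on `[-2, 2]`. -/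
lemma exists_repro_kernel :
    ∃ k : ℝ → ℂ, Continuous k ∧
      (∀ m : ℕ, ∃ C : ℝ, 0 < C ∧ ∀ s, ‖k s‖ ≤ C * cw s ^ m) ∧
      (∀ u, |u| ≤ 2 → ∫ s, k s * cis (s * u) = 1) := by
  set b : ℝ → ℂ := fun u => ((Real.smoothTransition (u + 3) - Real.smoothTransition (u - 2) : ℝ) : ℂ)
  have hb : ContDiff ℝ ((⊤ : ℕ∞) : WithTop ℕ∞) b :=
    Complex.ofRealCLM.contDiff.comp
      ((Real.smoothTransition.contDiff.comp (by fun_prop)).sub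
        (Real.smoothTransition.contDiff.comp (by fun_prop)))
  have hc : HasCompactSupport b := by
    apply HasCompactSupport.of_support_subset_isCompact (isCompact_Icc (a := -3) (b := 3))
    intro v hv
    by_contra h
    apply hv
    rw [Set.mem_Icc, ← abs_le, not_le] at h
    simp only [b]
    rcases lt_abs.1 h with h | h
    · rw [Real.smoothTransition.one_of_one_le (by linarith), Real.smoothTransition.one_of_one_le (by linarith), sub_self]; simp
    · rw [Real.smoothTransition.zero_of_nonpos (by linarith), Real.smoothTransition.zero_of_nonpos (by linarith), sub_zero]; simp
  obtain ⟨k, h1, h2, -, h4⟩ := exists_kernel b hb hc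
  refine ⟨k, h1, h2, fun u hu => ?_⟩
  rw [h4]
  simp only [b]
  rw [abs_le] at hu
  rw [Real.smoothTransition.one_of_one_le (by linarith), Real.smoothTransition.zero_of_nonpos (by linarith)]; simp

lemma integrable_of_le_cw {E : Type*} [NormedAddCommGroup E] {f : ℝ → E} (hf : AEStronglyMeasurable f)
    {C : ℝ} (h : ∀ s, ‖f s‖ ≤ C * cw s) : Integrable f :=
  (integrable_cw.const_mul C).mono' hf (Eventually.of_forall h)

lemma cw_pow_le_cw (s : ℝ) {m : ℕ} (hm : 1 ≤ m) : cw s ^ m ≤ cw s :=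
  pow_le_of_le_one (cw_pos s).le (cw_le_one s) (by omega)

/-- A positive weight comparable to the Cauchy weight with compactly supported transform. -/
lemma exists_theta : ∃ θ : ℝ → ℝ, Measurable θ ∧ (∃ c C : ℝ, 0 < c ∧ 0 < C ∧
    ∀ s, c * cw s ≤ θ s ∧ θ s ≤ C * cw s) ∧
    ∀ u : ℝ, 1 ≤ |u| → ∫ s, (θ s : ℂ) * cis (s * u) = 0 := by
  obtain ⟨k, hk, hd, hf, hi⟩ := exists_kap_kernel 2 (by norm_num)
  obtain ⟨C1, hC1, hk1⟩ := hd 1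
  set k2 : ℝ → ℝ := fun s => ‖k s‖^2
  have hk2c : Continuous k2 := by fun_prop
  have hk2 : ∀ s, k2 s ≤ C1^2 * cw s ^2 := fun s => by
    have := hk1 s
    rw [pow_one] at this
    simp only [k2]; rw [← mul_pow]; gcongr
  have hk20 : ∀ s, 0 ≤ k2 s := fun s => by positivity
  have hk2i : Integrable k2 := integrable_of_le_cw hk2c.aestronglyMeasurable (C := C1^2) fun s => by
    rw [Real.norm_of_nonneg (hk20 s)]
    exact (hk2 s).trans (by gcongr; exact cw_pow_le_cw s (by norm_num))
  have hpos : 0 < ∫ s, k2 s * cw s := by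
    have hint : Integrable (fun s => k2 s * cw s) := by
      refine hk2i.mono' (hk2c.mul continuous_cw).aestronglyMeasurable (Eventually.of_forall fun s => ?_)
      rw [Real.norm_of_nonneg (mul_nonneg (hk20 s) (cw_pos s).le)]
      exact mul_le_of_le_one_right (hk20 s) (cw_le_one s)
    have hex : ∃ s, k s ≠ 0 := by
      by_contra h
      push Not at h
      have := hi 0
      simp [h, kap_zero] at this
    obtain ⟨s0, hs0⟩ := hex
    rw [integral_pos_iff_support_of_nonneg (fun s => mul_nonneg (hk20 s) (cw_pos s).le) hint]
    refine (IsOpen.measure_pos _ (isOpen_ne.preimage (hk2c.mul continuous_cw)) ⟨s0, ?_⟩)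
    exact mul_ne_zero (by positivity) (cw_pos s0).ne'
  set θ : ℝ → ℝ := fun s => ∫ t, cw t * k2 (s - t) with hθ
  have hint : ∀ s, Integrable (fun t => cw t * k2 (s - t)) := fun s => by
    refine integrable_of_le_cw (C := C1^2) (continuous_cw.mul (by fun_prop)).aestronglyMeasurable fun t => ?_
    rw [Real.norm_of_nonneg (mul_nonneg (cw_pos t).le (hk20 _)), mul_comm]
    gcongr
    · exact (cw_pos t).le
    · exact (hk2 _).trans (mul_le_of_le_one_right (by positivity) (pow_le_one₀ (cw_pos _).le (cw_le_one _)))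
  have hcv : ∀ s, ∫ t, k2 (s - t) * cw (s - t) = ∫ t, k2 t * cw t := fun s =>
    integral_sub_left_eq_self (fun t => k2 t * cw t) volume s
  have hint2 : Integrable (fun s => k2 s * cw s) := by
    refine hk2i.mono' (hk2c.mul continuous_cw).aestronglyMeasurable (Eventually.of_forall fun s => ?_)
    rw [Real.norm_of_nonneg (mul_nonneg (hk20 s) (cw_pos s).le)]
    exact mul_le_of_le_one_right (hk20 s) (cw_le_one s)
  refine ⟨θ, ?_, ⟨(∫ s, k2 s * cw s) / 2, C1^2 * (2 * (∫ t, cw t)) + 1, by positivity, ?_, fun s => ⟨?_, ?_⟩⟩, ?_⟩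
  · refine StronglyMeasurable.measurable ?_
    exact StronglyMeasurable.integral_prod_right
      (f := fun s t => cw t * k2 (s - t)) (Continuous.stronglyMeasurable
        ((continuous_cw.comp continuous_snd).mul (hk2c.comp (by fun_prop))))
  · have : 0 ≤ ∫ t, cw t := integral_nonneg fun t => (cw_pos t).le
    positivity
  · rw [← hcv s, div_mul_eq_mul_div, div_le_iff₀ (by norm_num), hθ, ← integral_mul_const, ← integral_mul_const]
    refine integral_mono ((hint2.comp_sub_left s).mul_const _) ((hint s).mul_const _) fun t => ?_
    simp only
    have := cw_mul_cw_le (s - t) (-t)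
    have h2 : -t - (s - t) = -s := by ring
    rw [h2, cw_neg, cw_neg] at this
    nlinarith [hk20 (s - t)]
  · have h1 : θ s ≤ ∫ t, (C1^2 * (2 * cw s)) * cw (s - t) := by
      refine integral_mono (hint s) ((integrable_cw.comp_sub_left s).const_mul _) fun t => ?_
      simp only
      have h1 := hk2 (s - t)
      have h3 := cw_mul_cw_le t s
      have h4 := (cw_pos (s - t)).le
      calc cw t * k2 (s - t) ≤ cw t * (C1^2 * cw (s - t)^2) := by gcongr; exact (cw_pos t).le
        _ = C1^2 * (cw t * cw (s - t)) * cw (s - t) := by ring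
        _ ≤ C1^2 * (2 * cw s) * cw (s - t) := by gcongr
    rw [integral_const_mul, integral_sub_left_eq_self (fun t => cw t) volume s] at h1
    have := (cw_pos s).le
    nlinarith
  · intro u hu
    have hzero : ∫ s, (k2 s : ℂ) * cis (s * u) = 0 := by
      have e1 : ∀ s, (k2 s : ℂ) * cis (s * u) =
          ∫ v, ((2 * Real.pi)⁻¹ : ℝ) * (((kap (2 * v) : ℝ) : ℂ) * (starRingEnd ℂ (k s) * cis (s * (u - v)))) := by
        intro s
        have : (k2 s : ℂ) = k s * starRingEnd ℂ (k s) := by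
          rw [Complex.mul_conj, Complex.normSq_eq_norm_sq]
        rw [this]
        generalize hz : starRingEnd ℂ (k s) = z
        rw [hf s, ← integral_const_mul, ← integral_mul_const, ← integral_mul_const]
        congr 1; ext v
        rw [show s * (u - v) = -(s*v) + s * u by ring, cis_add]
        ring
      simp_rw [e1]
      rw [integral_integral_swap]
      · rw [← integral_zero ℝ ℂ (μ := volume)]
        congr 1; ext v
        rw [integral_const_mul, integral_const_mul]
        have h5 : ∫ s, starRingEnd ℂ (k s) * cis (s * (u - v)) = starRingEnd ℂ (∫ s, k s * cis (s * (v - u))) := by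
          rw [← integral_conj]
          congr 1; ext s
          rw [map_mul, conj_cis]; ring_nf
        rw [h5, hi]
        by_cases hv : 1 ≤ |2 * v|
        · rw [kap_eq_zero hv]; simp
        · have : 1 ≤ |2 * (v - u)| := by
            rw [abs_mul, abs_two] at hv ⊢
            push Not at hv
            have := abs_sub_abs_le_abs_sub u v
            rw [abs_sub_comm] at this
            linarith
          rw [kap_eq_zero this]; simp
      · have hk1i : Integrable (fun s => starRingEnd ℂ (k s)) :=
          integrable_of_le_cw (by fun_prop) (C := C1) fun s => by
            simpa using hk1 s
        have hkap : Integrable (fun v => ((kap (2 * v) : ℝ) : ℂ)) := by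
          apply Continuous.integrable_of_hasCompactSupport
          · have := continuous_kap; fun_prop
          · exact hasCompactSupport_kapScale 2 (by norm_num)
        have := ((hk1i.mul_prod hkap).const_mul (((2 * Real.pi)⁻¹ : ℝ) : ℂ)).bdd_mul (c := 1)
          (f := fun p : ℝ × ℝ => cis (p.1 * (u - p.2))) (continuous_cis.comp (by fun_prop)).aestronglyMeasurable
          (Eventually.of_forall fun p => (norm_cis _).le)
        refine this.congr (Eventually.of_forall fun p => ?_)
        simp only [Function.uncurry]; ring
    have hci := continuous_cis
    have hk2u : Integrable (fun s => (k2 s : ℂ) * cis (s * u)) :=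
      (hk2i.ofReal (𝕜 := ℂ)).mul_bdd (c := 1) (by fun_prop) (Eventually.of_forall fun p => (norm_cis _).le)
    have hcu : Integrable (fun s => (cw s : ℂ) * cis (s * u)) :=
      (integrable_cw.ofReal (𝕜 := ℂ)).mul_bdd (c := 1) (by fun_prop) (Eventually.of_forall fun p => (norm_cis _).le)
    have hconv := integral_convolution (L := ContinuousLinearMap.mul ℝ ℂ) hcu hk2u
    rw [hzero, ContinuousLinearMap.mul_apply', mul_zero] at hconv
    rw [← hconv]
    congr 1; ext s
    rw [MeasureTheory.convolution]
    simp only [ContinuousLinearMap.mul_apply', hθ]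
    rw [← integral_complex_ofReal, ← integral_mul_const]
    congr 1; ext t
    rw [show s * u = t * u + (s - t) * u by ring, cis_add]
    push_cast; ring

/-- The oscillatory integral with phase map `φ` and amplitude `g`. -/
noncomputable def osc {Ξ ι : Type*} [MeasurableSpace Ξ] [Fintype ι] (ν : Measure Ξ) (φ : Ξ → ι → ℝ)
    (g : Ξ → ℂ) (x : ι → ℝ) : ℂ := ∫ ξ, g ξ * cis (∑ k, x k * φ ξ k) ∂ν

/-- The square modulus as an extended nonnegative real. -/
noncomputable def msq {X : Type*} (f : X → ℂ) (x : X) : ℝ≥0∞ := ‖f x‖ₑ ^ 2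

/-- The product weight with polynomial decay. -/
noncomputable def wt {ι : Type*} [Fintype ι] (N : ℕ) (s : ι → ℝ) : ℝ≥0∞ :=
  ∏ k, ENNReal.ofReal (cw (s k) ^ N)

/-- Weighted averages at scale `T`. -/
noncomputable def avg {ι : Type*} [Fintype ι] (N : ℕ) (T : ℝ) (G : (ι → ℝ) → ℝ≥0∞) (x : ι → ℝ) : ℝ≥0∞ :=
  ∫⁻ s, G (x + T • s) * wt N s

section Basic

variable {Ξ ι : Type*} [MeasurableSpace Ξ] [Fintype ι] {ν : Measure Ξ} {φ : Ξ → ι → ℝ} {g : Ξ → ℂ}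

lemma continuous_phase (η : ι → ℝ) : Continuous fun x : ι → ℝ => cis (∑ k, x k * η k) :=
  continuous_cis.comp (by fun_prop)

lemma measurable_phase (hφ : Measurable φ) (x : ι → ℝ) : Measurable fun ξ => cis (∑ k, x k * φ ξ k) := by
  refine continuous_cis.measurable.comp ?_
  have : ∀ k, Measurable fun ξ => φ ξ k := fun k => (measurable_pi_apply k).comp hφ
  fun_prop

lemma integrable_osc (hg : Integrable g ν) (hφ : Measurable φ) (x : ι → ℝ) :
    Integrable (fun ξ => g ξ * cis (∑ k, x k * φ ξ k)) ν :=
  hg.mul_bdd (c := 1) (measurable_phase hφ x).aestronglyMeasurable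
    (Eventually.of_forall fun _ => (norm_cis _).le)

lemma continuous_osc (hg : Integrable g ν) (hφ : Measurable φ) : Continuous (osc ν φ g) := by
  refine continuous_of_dominated (bound := fun ξ => ‖g ξ‖) (fun x => (integrable_osc hg hφ x).1)
    (fun x => Eventually.of_forall fun ξ => ?_) hg.norm
    (Eventually.of_forall fun ξ => continuous_const.mul (continuous_phase _))
  rw [norm_mul, norm_cis, mul_one]

lemma norm_osc_le (x : ι → ℝ) : ‖osc ν φ g x‖ ≤ ∫ ξ, ‖g ξ‖ ∂ν := by
  refine (norm_integral_le_integral_norm _).trans (le_of_eq ?_)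
  congr 1; ext ξ; rw [norm_mul, norm_cis, mul_one]

lemma measurable_msq {X : Type*} [MeasurableSpace X] {f : X → ℂ} (hf : Measurable f) : Measurable (msq f) := by
  unfold msq; fun_prop

lemma measurable_msq_osc (hg : Integrable g ν) (hφ : Measurable φ) : Measurable (msq (osc ν φ g)) :=
  measurable_msq (continuous_osc hg hφ).measurable

lemma msq_lt_top {X : Type*} (f : X → ℂ) (x : X) : msq f x < ⊤ := by unfold msq; finiteness

lemma osc_zero (x : ι → ℝ) : osc ν φ 0 x = 0 := by simp [osc]

lemma osc_sum {Q : Type*} (s : Finset Q) (G : Q → Ξ → ℂ) (hG : ∀ q ∈ s, Integrable (G q) ν) (hφ : Measurable φ)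
    (x : ι → ℝ) : osc ν φ (fun ξ => ∑ q ∈ s, G q ξ) x = ∑ q ∈ s, osc ν φ (G q) x := by
  unfold osc
  simp_rw [Finset.sum_mul]
  exact integral_finsetSum _ fun q hq => integrable_osc (hG q hq) hφ x

lemma osc_mul_osc {Ξ' : Type*} [MeasurableSpace Ξ'] {ν' : Measure Ξ'} [SFinite ν] [SFinite ν']
    (φ' : Ξ' → ι → ℝ) (g' : Ξ' → ℂ) (x : ι → ℝ) :
    osc ν φ g x * osc ν' φ' g' x =
      osc (ν.prod ν') (fun p k => φ p.1 k + φ' p.2 k) (fun p => g p.1 * g' p.2) x := by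
  unfold osc
  rw [← integral_prod_mul]
  congr 1; ext p
  rw [show ∑ k, x k * (φ p.1 k + φ' p.2 k) = ∑ k, x k * φ p.1 k + ∑ k, x k * φ' p.2 k by
    rw [← Finset.sum_add_distrib]; congr 1; ext k; ring, cis_add]
  ring

lemma conj_osc (x : ι → ℝ) : starRingEnd ℂ (osc ν φ g x) = osc ν (fun ξ k => -φ ξ k) (fun ξ => starRingEnd ℂ (g ξ)) x := by
  unfold osc
  rw [← integral_conj]
  congr 1; ext ξ
  rw [map_mul, conj_cis, ← Finset.sum_neg_distrib]
  simp only [mul_neg]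

lemma osc_fubini [SFinite ν] {S : Type*} [MeasurableSpace S] {m : Measure S} [SFinite m]
    (hg : Integrable g ν) (hφ : Measurable φ) {X : S → ι → ℝ} (hX : Measurable X) {w : S → ℂ}
    (hw : Integrable w m) :
    ∫ s, osc ν φ g (X s) * w s ∂m = ∫ ξ, g ξ * (∫ s, cis (∑ k, X s k * φ ξ k) * w s ∂m) ∂ν := by
  unfold osc
  simp_rw [← integral_mul_const, ← integral_const_mul]
  rw [integral_integral_swap]
  · simp_rw [mul_assoc]
  · have hm : Measurable fun p : S × Ξ => cis (∑ k, X p.1 k * φ p.2 k) := by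
      refine continuous_cis.measurable.comp ?_
      have h1 : ∀ k, Measurable fun p : S × Ξ => φ p.2 k := fun k =>
        (measurable_pi_apply k).comp (hφ.comp measurable_snd)
      have h2 : ∀ k, Measurable fun p : S × Ξ => X p.1 k := fun k =>
        (measurable_pi_apply k).comp (hX.comp measurable_fst)
      fun_prop
    have := (hw.mul_prod hg).mul_bdd (c := 1) hm.aestronglyMeasurable
      (Eventually.of_forall fun _ => (norm_cis _).le)
    refine this.congr (Eventually.of_forall fun p => ?_)
    simp only [Function.uncurry]; ring

lemma enorm_integral_mul_sq_le {S : Type*} [MeasurableSpace S] {m : Measure S} {F w : S → ℂ}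
    (hF : AEMeasurable F m) (hw : AEMeasurable w m) :
    ‖∫ s, F s * w s ∂m‖ₑ ^ 2 ≤ (∫⁻ s, ‖w s‖ₑ ∂m) * ∫⁻ s, msq F s * ‖w s‖ₑ ∂m := by
  have h := ENNReal.lintegral_mul_norm_pow_le (μ := m) (f := fun s => msq F s * ‖w s‖ₑ) (g := fun s => ‖w s‖ₑ)
    (by unfold msq; fun_prop) (by fun_prop) (p := 1/2) (q := 1/2) (by norm_num) (by norm_num) (by norm_num)
  have h2 : ∀ s, (msq F s * ‖w s‖ₑ) ^ (1/2:ℝ) * ‖w s‖ₑ ^ (1/2:ℝ) = ‖F s * w s‖ₑ := by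
    intro s
    rw [← ENNReal.mul_rpow_of_nonneg _ _ (by norm_num), msq, enorm_mul,
      show ‖F s‖ₑ^2 * ‖w s‖ₑ * ‖w s‖ₑ = (‖F s‖ₑ * ‖w s‖ₑ)^(2:ℝ) by
        rw [ENNReal.rpow_two]; ring,
      ← ENNReal.rpow_mul]
    norm_num
  simp_rw [h2] at h
  calc ‖∫ s, F s * w s ∂m‖ₑ ^ 2 ≤ (∫⁻ s, ‖F s * w s‖ₑ ∂m) ^ 2 := by
        gcongr; exact enorm_integral_le_lintegral_enorm _
    _ ≤ ((∫⁻ s, msq F s * ‖w s‖ₑ ∂m) ^ (1/2:ℝ) * (∫⁻ s, ‖w s‖ₑ ∂m) ^ (1/2:ℝ)) ^ 2 := by gcongr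
    _ = _ := by
        rw [← ENNReal.mul_rpow_of_nonneg _ _ (by norm_num), ← ENNReal.rpow_natCast, ← ENNReal.rpow_mul]
        norm_num [mul_comm]

/-- If the kernel `w` along `X` reproduces all active frequencies at `x`, the value at `x` is
controlled by the weighted mean square. -/
lemma msq_osc_le_of_repro [SFinite ν] {S : Type*} [MeasurableSpace S] {m : Measure S} [SFinite m]
    (hg : Integrable g ν) (hφ : Measurable φ) {X : S → ι → ℝ} (hX : Measurable X) {w : S → ℂ}
    (hw : Integrable w m) (x : ι → ℝ)
    (h : ∀ ξ, g ξ ≠ 0 → ∫ s, cis (∑ k, X s k * φ ξ k) * w s ∂m = cis (∑ k, x k * φ ξ k)) :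
    msq (osc ν φ g) x ≤ (∫⁻ s, ‖w s‖ₑ ∂m) * ∫⁻ s, msq (osc ν φ g) (X s) * ‖w s‖ₑ ∂m := by
  have h1 : osc ν φ g x = ∫ s, osc ν φ g (X s) * w s ∂m := by
    rw [osc_fubini hg hφ hX hw, osc]
    congr 1; ext ξ
    by_cases h0 : g ξ = 0
    · simp [h0]
    · rw [h ξ h0]
  have h2 := enorm_integral_mul_sq_le (m := m) (F := fun s => osc ν φ g (X s)) (w := w)
    ((continuous_osc hg hφ).measurable.comp hX).aemeasurable hw.1.aemeasurable
  rw [← h1] at h2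
  exact h2

end Basic

section Weights

variable {ι : Type*} [Fintype ι]

lemma wt_ofReal (N : ℕ) (s : ι → ℝ) : wt N s = ENNReal.ofReal (∏ k, cw (s k) ^ N) := by
  unfold wt; rw [ENNReal.ofReal_prod_of_nonneg fun k _ => pow_nonneg (cw_pos _).le _]

lemma measurable_wt (N : ℕ) : Measurable (wt (ι := ι) N) := by
  unfold wt
  have := continuous_cw.measurable
  fun_prop

lemma lintegral_prod_ofReal (f : ι → ℝ → ℝ) (h0 : ∀ k s, 0 ≤ f k s) (hf : ∀ k, Integrable (f k)) :
    ∫⁻ s : ι → ℝ, ∏ k, ENNReal.ofReal (f k (s k)) = ∏ k, ENNReal.ofReal (∫ s, f k s) := by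
  rw [← ENNReal.ofReal_prod_of_nonneg fun k _ => integral_nonneg (h0 k),
    ← integral_fintype_prod_volume_eq_prod (𝕜 := ℝ) f, volume_pi, ofReal_integral_eq_lintegral_ofReal
      (Integrable.fintype_prod_dep (𝕜 := ℝ) hf) (Eventually.of_forall fun s => Finset.prod_nonneg fun k _ => h0 k _)]
  congr 1; ext s
  rw [ENNReal.ofReal_prod_of_nonneg fun k _ => h0 k _]

lemma integrable_cw_pow {N : ℕ} (hN : 1 ≤ N) : Integrable (fun s => cw s ^ N) :=
  integrable_of_le_cw (C := 1) (continuous_cw.pow N).aestronglyMeasurable fun s => by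
    rw [Real.norm_of_nonneg (pow_nonneg (cw_pos s).le _), one_mul]; exact cw_pow_le_cw s hN

lemma lintegral_wt_lt_top {N : ℕ} (hN : 1 ≤ N) : ∫⁻ s, wt (ι := ι) N s < ⊤ := by
  unfold wt
  rw [lintegral_prod_ofReal (fun _ s => cw s ^ N) (fun _ s => pow_nonneg (cw_pos s).le _)
    fun _ => integrable_cw_pow hN]
  exact ENNReal.prod_lt_top fun _ _ => ENNReal.ofReal_lt_top

lemma wt_le_one (N : ℕ) (s : ι → ℝ) : wt N s ≤ 1 := by
  rw [wt_ofReal]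
  exact ENNReal.ofReal_le_one.2 (Finset.prod_le_one (fun k _ => pow_nonneg (cw_pos _).le _)
    fun k _ => pow_le_one₀ (cw_pos _).le (cw_le_one _))

lemma measurable_avg {N : ℕ} {T : ℝ} {G : (ι → ℝ) → ℝ≥0∞} (hG : Measurable G) : Measurable (avg N T G) := by
  unfold avg
  have := measurable_wt (ι := ι) N
  refine Measurable.lintegral_prod_right (f := fun (x : ι → ℝ) (s : ι → ℝ) => G (x + T • s) * wt N s) ?_
  fun_prop

lemma lintegral_avg {N : ℕ} {T : ℝ} {G : (ι → ℝ) → ℝ≥0∞} (hG : Measurable G) :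
    ∫⁻ x, avg N T G x = (∫⁻ s, wt (ι := ι) N s) * ∫⁻ x, G x := by
  have := measurable_wt (ι := ι) N
  unfold avg
  rw [lintegral_lintegral_swap (by fun_prop)]
  have : ∀ s, ∫⁻ x, G (x + T • s) * wt N s = wt N s * ∫⁻ x, G x := fun s => by
    rw [lintegral_mul_const _ (by fun_prop), lintegral_add_right_eq_self, mul_comm]
  simp_rw [this]
  rw [lintegral_mul_const _ (measurable_wt N)]

lemma avg_sum {J : Type*} (t : Finset J) {N : ℕ} {T : ℝ} {G : J → (ι → ℝ) → ℝ≥0∞} (hG : ∀ j, Measurable (G j)) (x : ι → ℝ) :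
    avg N T (fun y => ∑ j ∈ t, G j y) x = ∑ j ∈ t, avg N T (G j) x := by
  have := measurable_wt (ι := ι) N
  unfold avg; rw [← lintegral_finsetSum _ (fun j _ => by have := hG j; fun_prop)]; simp_rw [Finset.sum_mul]

lemma lintegral_comp_add_smul {T : ℝ} (hT : 0 < T) {G : (ι → ℝ) → ℝ≥0∞} (hG : Measurable G) (x : ι → ℝ) :
    ∫⁻ s, G (x + T • s) = ENNReal.ofReal ((T ^ Fintype.card ι)⁻¹) * ∫⁻ y, G y := by
  rw [← lintegral_add_left_eq_self G x]
  have h := Measure.map_addHaar_smul (volume : Measure (ι → ℝ)) hT.ne'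
  have h2 := lintegral_map (μ := (volume : Measure (ι → ℝ))) (f := fun s => G (x + s)) (by fun_prop)
    (measurable_const_smul T)
  rw [h, lintegral_smul_measure, Module.finrank_pi, abs_of_pos (by positivity)] at h2
  exact h2.symm

end Weights

section Weights2

variable {ι : Type*} [Fintype ι]

lemma avg_le_lintegral {N : ℕ} {T : ℝ} (hT : 0 < T) {G : (ι → ℝ) → ℝ≥0∞} (hG : Measurable G) (x : ι → ℝ) :
    avg N T G x ≤ ENNReal.ofReal ((T ^ Fintype.card ι)⁻¹) * ∫⁻ y, G y := by
  rw [← lintegral_comp_add_smul hT hG x]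
  unfold avg
  gcongr with s
  exact mul_le_of_le_one_right (by positivity) (wt_le_one N s)

lemma wt_mul_wt_le (N : ℕ) (v s : ι → ℝ) :
    wt N (s - v) * wt N v ≤ ENNReal.ofReal ((2 ^ N) ^ Fintype.card ι) * wt N s := by
  rw [wt_ofReal, wt_ofReal, wt_ofReal, ← ENNReal.ofReal_mul (Finset.prod_nonneg fun k _ => pow_nonneg (cw_pos _).le _),
    ← ENNReal.ofReal_mul (by positivity), ← Finset.prod_mul_distrib, ← Finset.card_univ, ← Finset.prod_const,
    ← Finset.prod_mul_distrib]
  refine ENNReal.ofReal_le_ofReal (Finset.prod_le_prod (fun k _ => mul_nonneg (pow_nonneg (cw_pos _).le _) (pow_nonneg (cw_pos _).le _)) fun k _ => ?_)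
  rw [← mul_pow, ← mul_pow]
  refine pow_le_pow_left₀ (mul_nonneg (cw_pos _).le (cw_pos _).le) ?_ N
  rw [mul_comm]
  exact cw_mul_cw_le (v k) (s k)

lemma avg_mul_wt_le {N : ℕ} {T : ℝ} {G : (ι → ℝ) → ℝ≥0∞} (hG : Measurable G) (y v : ι → ℝ) :
    avg N T G (y + T • v) * wt N v ≤ ENNReal.ofReal ((2 ^ N) ^ Fintype.card ι) * avg N T G y := by
  have hw := measurable_wt (ι := ι) N
  unfold avg
  rw [← lintegral_mul_const _ (by fun_prop), ← lintegral_const_mul _ (by fun_prop),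
    ← lintegral_sub_right_eq_self _ v]
  refine lintegral_mono fun s => ?_
  simp only
  rw [show y + T • v + T • (s - v) = y + T • s by rw [add_assoc, ← smul_add]; simp]
  calc _ = G (y + T • s) * (wt N (s - v) * wt N v) := by ring
    _ ≤ G (y + T • s) * (ENNReal.ofReal ((2 ^ N) ^ Fintype.card ι) * wt N s) := by
        exact mul_le_mul' le_rfl (wt_mul_wt_le N v s)
    _ = _ := by ring

lemma half_le_cw {s : ℝ} (h : |s| ≤ 1) : 1 / 2 ≤ cw s := by
  unfold cw
  rw [one_div]
  have : s ^ 2 ≤ 1 := by rw [← sq_abs]; exact pow_le_one₀ (abs_nonneg _) h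
  apply inv_anti₀ (by positivity); linarith

lemma one_le_wt {N : ℕ} {v : ι → ℝ} (h : ∀ k, |v k| ≤ 1) :
    1 ≤ ENNReal.ofReal ((2 ^ N) ^ Fintype.card ι) * wt N v := by
  rw [wt_ofReal, ← ENNReal.ofReal_mul (by positivity), ← Finset.card_univ, ← Finset.prod_const,
    ← Finset.prod_mul_distrib, ENNReal.one_le_ofReal]
  calc (1:ℝ) = ∏ _k : ι, 1 := by simp
    _ ≤ _ := Finset.prod_le_prod (fun _ _ => zero_le_one) fun k _ => by
      rw [← mul_pow]
      exact one_le_pow₀ (by linarith [half_le_cw (h k)])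

lemma avg_local {N : ℕ} {T : ℝ} (hT : 0 < T) {G : (ι → ℝ) → ℝ≥0∞} (hG : Measurable G) {x y : ι → ℝ}
    (h : ∀ k, |x k - y k| ≤ T) :
    avg N T G x ≤ ENNReal.ofReal ((4 ^ N) ^ Fintype.card ι) * avg N T G y := by
  set v : ι → ℝ := T⁻¹ • (x - y)
  have hx : x = y + T • v := by simp only [v]; rw [smul_inv_smul₀ hT.ne']; simp
  have hv : ∀ k, |v k| ≤ 1 := fun k => by
    simp only [v, Pi.smul_apply, Pi.sub_apply, smul_eq_mul, abs_mul, abs_of_pos (inv_pos.2 hT)]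
    rw [inv_mul_le_iff₀ hT, mul_one]; exact h k
  have h1 := avg_mul_wt_le (N := N) (T := T) hG y v
  rw [← hx] at h1
  calc avg N T G x ≤ avg N T G x * (ENNReal.ofReal ((2 ^ N) ^ Fintype.card ι) * wt N v) :=
        le_mul_of_one_le_right (by positivity) (one_le_wt hv)
    _ = ENNReal.ofReal ((2 ^ N) ^ Fintype.card ι) * (avg N T G x * wt N v) := by ring
    _ ≤ ENNReal.ofReal ((2 ^ N) ^ Fintype.card ι) * (ENNReal.ofReal ((2 ^ N) ^ Fintype.card ι) * avg N T G y) := by gcongr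
    _ = _ := by
        rw [← mul_assoc, ← ENNReal.ofReal_mul (by positivity), ← mul_pow, ← mul_pow]; norm_num

lemma integral_cw_conv_le {l : ℝ} (h0 : 0 < l) (h1 : l ≤ 1) (t : ℝ) :
    ∫ s, cw s * cw (t - l * s) ≤ 4 * Real.pi * cw t := by
  have hpi : ∫ s, cw s = Real.pi := integral_univ_inv_one_add_sq
  have hb : Integrable (fun s => cw (t - l * s)) :=
    (integrable_cw.comp_sub_left t).comp_mul_left' h0.ne'
  have hb2 : ∫ s, cw (t - l * s) = l⁻¹ * Real.pi := by
    have := Measure.integral_comp_mul_left (fun s => cw (t - s)) l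
    rw [this, integral_sub_left_eq_self (fun s => cw s) volume t, hpi, abs_of_pos (by positivity), smul_eq_mul]
  have hpt : ∀ s, cw s * cw (t - l * s) ≤ 2 * cw t * (cw s + l * cw (t - l * s)) := by
    intro s
    unfold cw
    have e1 : (0:ℝ) < 1 + s^2 := by positivity
    have e2 : (0:ℝ) < 1 + (t - l * s)^2 := by positivity
    have e3 : (0:ℝ) < 1 + t^2 := by positivity
    rw [← mul_inv, inv_le_iff_one_le_mul₀ (by positivity)]
    have : 2 * (1 + t ^ 2)⁻¹ * ((1 + s ^ 2)⁻¹ + l * (1 + (t - l * s) ^ 2)⁻¹) * ((1 + s ^ 2) * (1 + (t - l * s) ^ 2))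
       = 2 * ((1 + (t - l*s)^2) + l * (1 + s^2)) / (1 + t^2) := by field_simp
    rw [this, le_div_iff₀ e3]
    have : l^2 * s^2 ≤ l * s^2 := by
      have : l^2 ≤ l := by nlinarith
      gcongr
    nlinarith [sq_nonneg (t - 2 * (l * s))]
  calc _ ≤ ∫ s, 2 * cw t * (cw s + l * cw (t - l * s)) := by
        refine integral_mono_of_nonneg (Eventually.of_forall fun s => mul_nonneg (cw_pos _).le (cw_pos _).le)
          ((integrable_cw.add (hb.const_mul l)).const_mul _) (Eventually.of_forall hpt)
    _ = 4 * Real.pi * cw t := by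
        rw [integral_const_mul, integral_add integrable_cw (hb.const_mul l), integral_const_mul, hb2, hpi]
        field_simp; ring

lemma avg_avg_le {ρ T : ℝ} (hρ : 0 < ρ) (hT : ρ ≤ T) {G : (ι → ℝ) → ℝ≥0∞} (hG : Measurable G) (x : ι → ℝ) :
    avg 1 T (avg 1 ρ G) x ≤ ENNReal.ofReal ((4 * Real.pi) ^ Fintype.card ι) * avg 1 T G x := by
  have hw := measurable_wt (ι := ι) 1
  have hT0 : 0 < T := hρ.trans_le hT
  set l := ρ / T with hl
  have hl0 : 0 < l := by positivity
  have hl1 : l ≤ 1 := (div_le_one hT0).2 hT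
  have e1 : avg 1 T (avg 1 ρ G) x = ∫⁻ s, ∫⁻ t, G (x + T • t) * (wt 1 (t - l • s) * wt 1 s) := by
    unfold avg
    have e0 : ∀ t : ι → ℝ, (∫⁻ s, G (x + T • t + ρ • s) * wt 1 s) * wt 1 t =
        ∫⁻ s, G (x + T • t + ρ • s) * wt 1 s * wt 1 t := fun t =>
      (lintegral_mul_const _ (by fun_prop)).symm
    rw [lintegral_congr e0, lintegral_lintegral_swap (by fun_prop)]
    congr 1; ext s
    rw [← lintegral_sub_right_eq_self _ (l • s)]
    congr 1; ext t
    have : x + T • (t - l • s) + ρ • s = x + T • t := by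
      rw [smul_sub, smul_smul, hl, mul_div_cancel₀ _ hT0.ne']; abel
    rw [this]; ring
  rw [e1, lintegral_lintegral_swap (by fun_prop), avg, ← lintegral_const_mul _ (by fun_prop)]
  refine lintegral_mono fun t => ?_
  simp only
  rw [lintegral_const_mul _ (by fun_prop)]
  have e2 : ∫⁻ s, wt 1 (t - l • s) * wt 1 s ≤ ENNReal.ofReal ((4 * Real.pi) ^ Fintype.card ι) * wt 1 t := by
    have : ∀ s : ι → ℝ, wt 1 (t - l • s) * wt 1 s = ∏ k, ENNReal.ofReal (cw (s k) * cw (t k - l * s k)) := by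
      intro s
      unfold wt
      rw [← Finset.prod_mul_distrib]
      congr 1; ext k
      rw [← ENNReal.ofReal_mul (pow_nonneg (cw_pos _).le _)]
      simp [mul_comm]
    simp_rw [this]
    rw [lintegral_prod_ofReal (fun k s => cw s * cw (t k - l * s)) (fun k s => mul_nonneg (cw_pos _).le (cw_pos _).le)
      (fun k => integrable_cw.mul_bdd (c := 1) (by have := continuous_cw; fun_prop)
        (Eventually.of_forall fun s => by rw [Real.norm_of_nonneg (cw_pos _).le]; exact cw_le_one _))]
    unfold wt
    rw [ENNReal.ofReal_pow (by positivity), ← Finset.card_univ, ← Finset.prod_const, ← Finset.prod_mul_distrib]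
    refine Finset.prod_le_prod' fun k _ => ?_
    rw [← ENNReal.ofReal_mul (by positivity), pow_one]
    exact ENNReal.ofReal_le_ofReal (integral_cw_conv_le hl0 hl1 (t k))
  calc _ ≤ G (x + T • t) * (ENNReal.ofReal ((4 * Real.pi) ^ Fintype.card ι) * wt 1 t) := by gcongr
    _ = _ := by ring

end Weights2

section Repro

lemma integral_prod_kernel {ι : Type*} [Fintype ι] (k : ℝ → ℂ) (u : ι → ℝ) :
    ∫ s : ι → ℝ, cis (∑ i, s i * u i) * ∏ i, k (s i) = ∏ i, ∫ s, k s * cis (s * u i) := by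
  rw [← integral_fintype_prod_volume_eq_prod (𝕜 := ℂ) (fun i s => k s * cis (s * u i))]
  congr 1; ext s
  rw [cis_sum, Finset.prod_mul_distrib, mul_comm]

lemma enorm_le_wt {ι : Type*} [Fintype ι] {k : ℝ → ℂ} {C : ℝ} {N : ℕ} (hC : 0 < C) (hk : ∀ s, ‖k s‖ ≤ C * cw s ^ N) (s : ι → ℝ) :
    ‖∏ i, k (s i)‖ₑ ≤ ENNReal.ofReal (C ^ Fintype.card ι) * wt N s := by
  rw [wt_ofReal, ← ENNReal.ofReal_mul (by positivity), ← Finset.card_univ, ← Finset.prod_const, ← Finset.prod_mul_distrib,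
    ← ofReal_norm, norm_prod]
  exact ENNReal.ofReal_le_ofReal (Finset.prod_le_prod (fun _ _ => norm_nonneg _) fun i _ => hk _)

lemma integrable_kernel {k : ℝ → ℂ} (hc : Continuous k) {C : ℝ} {N : ℕ} (hN : 1 ≤ N)
    (hC : 0 < C) (hk : ∀ s, ‖k s‖ ≤ C * cw s ^ N) : Integrable k :=
  integrable_of_le_cw hc.aestronglyMeasurable (C := C) fun s => (hk s).trans (by gcongr; exact cw_pow_le_cw s hN)

lemma exists_repro (ι : Type*) [Fintype ι] (N : ℕ) (hN : 1 ≤ N) : ∃ C : ℝ≥0∞, C ≠ ⊤ ∧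
    ∀ (Ξ : Type) [MeasurableSpace Ξ] (ν : Measure Ξ) [SFinite ν] (φ : Ξ → ι → ℝ) (g : Ξ → ℂ),
      Integrable g ν → Measurable φ → ∀ (T : ℝ) (η : ι → ℝ), (∀ ξ, g ξ ≠ 0 → ∀ k, |T * (φ ξ k - η k)| ≤ 2) →
      ∀ x, msq (osc ν φ g) x ≤ C * avg N T (msq (osc ν φ g)) x := by
  obtain ⟨k, hk, hd, hr⟩ := exists_repro_kernel
  obtain ⟨C, hC, hkC⟩ := hd N
  set A := ENNReal.ofReal (C ^ Fintype.card ι)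
  refine ⟨A * (∫⁻ s, wt (ι := ι) N s) * A, ENNReal.mul_ne_top (ENNReal.mul_ne_top ENNReal.ofReal_ne_top (lintegral_wt_lt_top hN).ne) ENNReal.ofReal_ne_top, ?_⟩
  intro Ξ _ ν _ φ g hg hφ T η hη x
  have hw := measurable_wt (ι := ι) N
  have hm := measurable_msq_osc hg hφ
  set w : (ι → ℝ) → ℂ := fun s => cis (-∑ i, s i * (T * η i)) * ∏ i, k (s i) with hwdef
  have hki : Integrable (fun s : ι → ℝ => ∏ i, k (s i)) :=
    Integrable.fintype_prod fun i => integrable_kernel hk hN hC hkC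
  have hwi : Integrable w := by
    refine hki.bdd_mul (c := 1) ?_ (Eventually.of_forall fun _ => (norm_cis _).le)
    exact (continuous_cis.comp (by fun_prop)).aestronglyMeasurable
  have hwn : ∀ s, ‖w s‖ₑ ≤ A * wt N s := fun s => by
    rw [hwdef]
    simp only [enorm_mul]
    rw [← ofReal_norm (cis _), norm_cis, ENNReal.ofReal_one, one_mul]
    exact enorm_le_wt hC hkC s
  have key := msq_osc_le_of_repro (m := volume) hg hφ (X := fun s : ι → ℝ => x + T • s) (by fun_prop) hwi x ?_
  · refine key.trans ?_
    rw [mul_assoc]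
    refine mul_le_mul' ?_ ?_
    · rw [← lintegral_const_mul _ hw]; exact lintegral_mono hwn
    · rw [avg, ← lintegral_const_mul _ (by fun_prop)]
      refine lintegral_mono fun s => ?_
      calc _ ≤ msq (osc ν φ g) (x + T • s) * (A * wt N s) := by gcongr; exact hwn s
        _ = _ := by ring
  · intro ξ hξ
    have : ∀ s : ι → ℝ, cis (∑ i, (x + T • s) i * φ ξ i) * w s =
        cis (∑ i, x i * φ ξ i) * (cis (∑ i, s i * (T * (φ ξ i - η i))) * ∏ i, k (s i)) := by
      intro s
      rw [hwdef]
      simp only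
      rw [← mul_assoc, ← mul_assoc, ← cis_add, ← cis_add]
      congr 2
      rw [← sub_eq_add_neg, ← Finset.sum_sub_distrib, ← Finset.sum_add_distrib]
      congr 1; ext i; simp; ring
    simp_rw [this]
    rw [integral_const_mul, integral_prod_kernel, Finset.prod_eq_one, mul_one]
    exact fun i _ => hr _ (hη ξ hξ i)

lemma sum_add_single {ι : Type*} [Fintype ι] [DecidableEq ι] (x η : ι → ℝ) (i : ι) (a : ℝ) :
    ∑ j, (x + Pi.single i a : ι → ℝ) j * η j = ∑ j, x j * η j + a * η i := by
  simp [add_mul, Finset.sum_add_distrib, Pi.single_apply]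

lemma exists_repro_one (N : ℕ) (hN : 1 ≤ N) : ∃ C : ℝ≥0∞, C ≠ ⊤ ∧
    ∀ (ι : Type) [Fintype ι] [DecidableEq ι] (Ξ : Type) [MeasurableSpace Ξ] (ν : Measure Ξ) [SFinite ν] (φ : Ξ → ι → ℝ) (g : Ξ → ℂ),
      Integrable g ν → Measurable φ → ∀ (T : ℝ) (i : ι) (η : ℝ), (∀ ξ, g ξ ≠ 0 → |T * (φ ξ i - η)| ≤ 2) →
      ∀ x, msq (osc ν φ g) x ≤ C * ∫⁻ s : ℝ, msq (osc ν φ g) (x + Pi.single i (T * s)) * ENNReal.ofReal (cw s ^ N) := by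
  obtain ⟨k, hk, hd, hr⟩ := exists_repro_kernel
  obtain ⟨C, hC, hkC⟩ := hd N
  set A := ENNReal.ofReal C
  refine ⟨A * (∫⁻ s, ENNReal.ofReal (cw s ^ N)) * A, ENNReal.mul_ne_top (ENNReal.mul_ne_top ENNReal.ofReal_ne_top ?_) ENNReal.ofReal_ne_top, ?_⟩
  · have := (integrable_cw_pow hN).lintegral_lt_top
    exact this.ne
  intro ι _ _ Ξ _ ν _ φ g hg hφ T i η hη x
  have hw : Measurable fun s => ENNReal.ofReal (cw s ^ N) := by
    have := continuous_cw.measurable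
    fun_prop
  have hX : Measurable fun s : ℝ => x + Pi.single i (T * s) := by
    have : Continuous fun s : ℝ => x + (Pi.single i (T * s) : ι → ℝ) :=
      continuous_const.add ((continuous_single (A := fun _ => ℝ) i).comp (by fun_prop))
    exact this.measurable
  have hm := measurable_msq_osc hg hφ
  set w : ℝ → ℂ := fun s => cis (-(s * (T * η))) * k s with hwdef
  have hki : Integrable k := integrable_kernel hk hN hC hkC
  have hwi : Integrable w := by
    refine hki.bdd_mul (c := 1) ?_ (Eventually.of_forall fun _ => (norm_cis _).le)
    exact (continuous_cis.comp (by fun_prop)).aestronglyMeasurable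
  have hwn : ∀ s, ‖w s‖ₑ ≤ A * ENNReal.ofReal (cw s ^ N) := fun s => by
    rw [hwdef]
    simp only [enorm_mul]
    rw [← ofReal_norm (cis _), norm_cis, ENNReal.ofReal_one, one_mul, ← ENNReal.ofReal_mul hC.le, ← ofReal_norm]
    exact ENNReal.ofReal_le_ofReal (hkC s)
  have key := msq_osc_le_of_repro (m := volume) hg hφ hX hwi x ?_
  · refine key.trans ?_
    rw [mul_assoc]
    refine mul_le_mul' ?_ ?_
    · rw [← lintegral_const_mul _ hw]; exact lintegral_mono hwn
    · have hmX : Measurable fun s : ℝ => msq (osc ν φ g) (x + Pi.single i (T * s)) := hm.comp hX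
      rw [← lintegral_const_mul A (by fun_prop)]
      refine lintegral_mono fun s => ?_
      calc _ ≤ msq (osc ν φ g) (x + Pi.single i (T * s)) * (A * ENNReal.ofReal (cw s ^ N)) := by gcongr; exact hwn s
        _ = _ := by ring
  · intro ξ hξ
    have : ∀ s : ℝ, cis (∑ j, (x + Pi.single i (T * s) : ι → ℝ) j * φ ξ j) * w s =
        cis (∑ j, x j * φ ξ j) * (k s * cis (s * (T * (φ ξ i - η)))) := by
      intro s
      rw [hwdef, sum_add_single, cis_add, show s * (T * (φ ξ i - η)) = T * s * φ ξ i + -(s * (T * η)) by ring, cis_add]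
      ring
    simp_rw [this]
    rw [integral_const_mul, hr _ (hη ξ hξ), mul_one]

end Repro

lemma lintegral_msq_eq {S : Type*} [MeasurableSpace S] {m : Measure S} [IsFiniteMeasure m] {f : S → ℂ}
    (hf : Measurable f) {C : ℝ} (hC : ∀ s, ‖f s‖ ≤ C) :
    ∫⁻ s, msq f s ∂m = ENNReal.ofReal (∫ s, ‖f s‖ ^ 2 ∂m) := by
  rw [ofReal_integral_eq_lintegral_ofReal _ (Eventually.of_forall fun s => sq_nonneg _)]
  · congr 1; ext s
    rw [msq, ENNReal.ofReal_pow (norm_nonneg _), ofReal_norm]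
  · refine Integrable.of_bound (by fun_prop) (C ^ 2) (Eventually.of_forall fun s => ?_)
    rw [norm_pow, norm_norm]
    exact pow_le_pow_left₀ (norm_nonneg _) (hC s) 2

lemma almost_orth {S : Type*} [MeasurableSpace S] {m : Measure S} [IsFiniteMeasure m] {Q : Type*} (s : Finset Q)
    (F : Q → S → ℂ) (hF : ∀ q, Measurable (F q)) (hb : ∀ q, ∃ C, ∀ x, ‖F q x‖ ≤ C)
    (near : Q → Q → Prop) [DecidableRel near] (hsymm : ∀ q q', near q q' → near q' q) (M : ℕ)
    (hM : ∀ q ∈ s, (s.filter (near q)).card ≤ M)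
    (h0 : ∀ q ∈ s, ∀ q' ∈ s, ¬ near q q' → ∫ x, F q x * starRingEnd ℂ (F q' x) ∂m = 0) :
    ∫⁻ x, msq (fun x => ∑ q ∈ s, F q x) x ∂m ≤ M * ∑ q ∈ s, ∫⁻ x, msq (F q) x ∂m := by
  choose C hC using hb
  have hbsum : ∀ x, ‖∑ q ∈ s, F q x‖ ≤ ∑ q ∈ s, C q := fun x =>
    (norm_sum_le _ _).trans (Finset.sum_le_sum fun q _ => hC q x)
  have hint : ∀ q, Integrable (fun x => ‖F q x‖ ^ 2) m := fun q => by
    have := hF q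
    refine Integrable.of_bound (by fun_prop) (C q ^ 2) (Eventually.of_forall fun x => ?_)
    rw [norm_pow, norm_norm]
    exact pow_le_pow_left₀ (norm_nonneg _) (hC q x) 2
  have hint2 : ∀ q q', Integrable (fun x => F q x * starRingEnd ℂ (F q' x)) m := fun q q' => by
    have h1 := hF q
    have h2 := hF q'
    have h3 : Measurable fun x => starRingEnd ℂ (F q' x) := Complex.continuous_conj.measurable.comp h2
    refine Integrable.of_bound (by fun_prop) (C q * C q') (Eventually.of_forall fun x => ?_)
    rw [norm_mul, RCLike.norm_conj]
    exact mul_le_mul (hC q x) (hC q' x) (norm_nonneg _) ((norm_nonneg _).trans (hC q x))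
  set E : Q → ℝ := fun q => ∫ x, ‖F q x‖ ^ 2 ∂m
  have hE0 : ∀ q, 0 ≤ E q := fun q => integral_nonneg fun x => sq_nonneg _
  have hpair : ∀ q q', (∫ x, F q x * starRingEnd ℂ (F q' x) ∂m).re ≤ (E q + E q') / 2 := fun q q' => by
    refine (Complex.re_le_norm _).trans ((norm_integral_le_integral_norm _).trans ?_)
    have : (E q + E q') / 2 = ∫ x, (‖F q x‖ ^ 2 + ‖F q' x‖ ^ 2) / 2 ∂m := by
      rw [integral_div, integral_add (hint q) (hint q')]
    rw [this]
    refine integral_mono (hint2 q q').norm (((hint q).add (hint q')).div_const _) fun x => ?_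
    simp only [norm_mul, RCLike.norm_conj]
    nlinarith [sq_nonneg (‖F q x‖ - ‖F q' x‖)]
  have key : ∫ x, ‖∑ q ∈ s, F q x‖ ^ 2 ∂m ≤ M * ∑ q ∈ s, E q := by
    have e1 : ((∫ x, ‖∑ q ∈ s, F q x‖ ^ 2 ∂m : ℝ) : ℂ) =
        ∑ q ∈ s, ∑ q' ∈ s, ∫ x, F q x * starRingEnd ℂ (F q' x) ∂m := by
      rw [← integral_complex_ofReal]
      have : ∀ x, ((‖∑ q ∈ s, F q x‖ ^ 2 : ℝ) : ℂ) = ∑ q ∈ s, ∑ q' ∈ s, F q x * starRingEnd ℂ (F q' x) := fun x => by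
        rw [← Finset.sum_mul_sum, ← map_sum, Complex.mul_conj, Complex.normSq_eq_norm_sq]
      simp_rw [this]
      rw [integral_finsetSum _ fun q _ => integrable_finsetSum _ fun q' _ => hint2 q q']
      congr 1; ext q
      rw [integral_finsetSum _ fun q' _ => hint2 q q']
    have e2 := congrArg Complex.re e1
    rw [Complex.ofReal_re, Complex.re_sum] at e2
    rw [e2]
    have e3 : ∀ q ∈ s, (∑ q' ∈ s, ∫ x, F q x * starRingEnd ℂ (F q' x) ∂m).re ≤
        ∑ q' ∈ s, if near q q' then (E q + E q') / 2 else 0 := fun q hq => by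
      rw [Complex.re_sum]
      refine Finset.sum_le_sum fun q' hq' => ?_
      split_ifs with h
      · exact hpair q q'
      · rw [h0 q hq q' hq' h]; simp
    refine (Finset.sum_le_sum e3).trans ?_
    have e4 : ∑ q ∈ s, ∑ q' ∈ s, (if near q q' then E q / 2 else 0) ≤ M * ∑ q ∈ s, E q / 2 := by
      rw [Finset.mul_sum]
      refine Finset.sum_le_sum fun q hq => ?_
      rw [← Finset.sum_filter, Finset.sum_const, nsmul_eq_mul]
      have := hM q hq
      have := hE0 q
      gcongr
    have e5 : ∑ q ∈ s, ∑ q' ∈ s, (if near q q' then E q' / 2 else 0) ≤ M * ∑ q ∈ s, E q / 2 := by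
      rw [Finset.sum_comm]
      refine le_trans (le_of_eq ?_) e4
      congr 1; ext q; congr 1; ext q'
      congr 1
      exact propext ⟨hsymm _ _, hsymm _ _⟩
    calc _ = ∑ q ∈ s, ∑ q' ∈ s, (if near q q' then E q / 2 else 0) +
          ∑ q ∈ s, ∑ q' ∈ s, (if near q q' then E q' / 2 else 0) := by
          rw [← Finset.sum_add_distrib]
          congr 1; ext q
          rw [← Finset.sum_add_distrib]
          congr 1; ext q'
          split_ifs
          · ring
          · ring
      _ ≤ _ := add_le_add e4 e5
      _ = _ := by rw [← mul_add, ← Finset.sum_add_distrib]; congr 2; ext q; ring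
  rw [lintegral_msq_eq (by fun_prop) hbsum]
  have : ∀ q, ∫⁻ x, msq (F q) x ∂m = ENNReal.ofReal (E q) := fun q => lintegral_msq_eq (hF q) (hC q)
  simp_rw [this]
  rw [← ENNReal.ofReal_sum_of_nonneg fun q _ => hE0 q, ← ENNReal.ofReal_natCast, ← ENNReal.ofReal_mul (by positivity)]
  exact ENNReal.ofReal_le_ofReal key

/-- A finite product measure comparable to `wt 1` whose Fourier transform vanishes outside the unit cube. -/
lemma exists_thetaMeasure (ι : Type*) [Fintype ι] : ∃ m : Measure (ι → ℝ), IsFiniteMeasure m ∧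
    (∃ A B : ℝ≥0∞, A ≠ ⊤ ∧ B ≠ ⊤ ∧ (∀ G : (ι → ℝ) → ℝ≥0∞, Measurable G → ∫⁻ s, G s * wt 1 s ≤ A * ∫⁻ s, G s ∂m ∧
      ∫⁻ s, G s ∂m ≤ B * ∫⁻ s, G s * wt 1 s)) ∧
    ∀ u : ι → ℝ, (∃ k, 1 ≤ |u k|) → ∫ s, cis (∑ k, s k * u k) ∂m = 0 := by
  obtain ⟨θ, hθ, ⟨c, C, hc, hC, hcC⟩, hz⟩ := exists_theta
  have hθ0 : ∀ s, 0 ≤ θ s := fun s => (mul_nonneg hc.le (cw_pos s).le).trans (hcC s).1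
  have hθi : Integrable θ := integrable_of_le_cw hθ.aestronglyMeasurable (C := C) fun s => by
    rw [Real.norm_of_nonneg (hθ0 s)]; exact (hcC s).2
  have hw := measurable_wt (ι := ι) 1
  set Θ : (ι → ℝ) → ℝ≥0∞ := fun s => ∏ k, ENNReal.ofReal (θ (s k)) with hΘ
  have hΘm : Measurable Θ := by fun_prop
  have h1 : ∀ s, Θ s ≤ ENNReal.ofReal (C ^ Fintype.card ι) * wt 1 s := fun s => by
    rw [hΘ, wt, ENNReal.ofReal_pow hC.le, ← Finset.card_univ, ← Finset.prod_const, ← Finset.prod_mul_distrib]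
    refine Finset.prod_le_prod' fun k _ => ?_
    rw [← ENNReal.ofReal_mul hC.le, pow_one]
    exact ENNReal.ofReal_le_ofReal (hcC _).2
  have h2 : ∀ s, wt 1 s ≤ ENNReal.ofReal ((c⁻¹) ^ Fintype.card ι) * Θ s := fun s => by
    rw [hΘ, wt, ENNReal.ofReal_pow (inv_pos.2 hc).le, ← Finset.card_univ, ← Finset.prod_const, ← Finset.prod_mul_distrib]
    refine Finset.prod_le_prod' fun k _ => ?_
    rw [← ENNReal.ofReal_mul (inv_pos.2 hc).le, pow_one]
    refine ENNReal.ofReal_le_ofReal ?_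
    rw [le_inv_mul_iff₀ hc]; exact (hcC _).1
  have hfin : ∫⁻ s, Θ s ≠ ⊤ := by
    rw [hΘ, lintegral_prod_ofReal (fun _ => θ) (fun _ => hθ0) fun _ => hθi]
    exact (ENNReal.prod_lt_top fun _ _ => ENNReal.ofReal_lt_top).ne
  refine ⟨volume.withDensity Θ, isFiniteMeasure_withDensity hfin, ⟨ENNReal.ofReal ((c⁻¹) ^ Fintype.card ι),
    ENNReal.ofReal (C ^ Fintype.card ι), ENNReal.ofReal_ne_top, ENNReal.ofReal_ne_top, fun G hG => ?_⟩, ?_⟩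
  · rw [lintegral_withDensity_eq_lintegral_mul _ hΘm hG]
    constructor
    · rw [← lintegral_const_mul _ (by fun_prop)]
      refine lintegral_mono fun s => ?_
      calc _ ≤ G s * (ENNReal.ofReal ((c⁻¹) ^ Fintype.card ι) * Θ s) := mul_le_mul' le_rfl (h2 s)
        _ = _ := by simp only [Pi.mul_apply]; ring
    · rw [← lintegral_const_mul _ (by fun_prop)]
      refine lintegral_mono fun s => ?_
      calc _ ≤ (ENNReal.ofReal (C ^ Fintype.card ι) * wt 1 s) * G s := mul_le_mul' (h1 s) le_rfl
        _ = _ := by ring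
  · rintro u ⟨k, hk⟩
    rw [integral_withDensity_eq_integral_toReal_smul hΘm
      (Eventually.of_forall fun s => ENNReal.prod_lt_top fun _ _ => ENNReal.ofReal_lt_top)]
    have : ∀ s : ι → ℝ, (Θ s).toReal • cis (∑ k, s k * u k) = cis (∑ k, s k * u k) * ∏ k, (θ (s k) : ℂ) := fun s => by
      rw [hΘ]
      simp only [ENNReal.toReal_prod, ENNReal.toReal_ofReal (hθ0 _)]
      rw [Complex.real_smul, mul_comm]; push_cast; rfl
    simp_rw [this]
    rw [integral_prod_kernel (fun s => (θ s : ℂ)) u]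
    exact Finset.prod_eq_zero (Finset.mem_univ k) (hz _ hk)

lemma card_near_le {ι : Type*} [Fintype ι] [DecidableEq ι] (Q : Finset (ι → ℤ)) (q : ι → ℤ) (n : ℕ) :
    (Q.filter fun q' => ∀ k, |q k - q' k| ≤ n).card ≤ (2 * n + 1) ^ Fintype.card ι := by
  calc _ ≤ (Fintype.piFinset fun k => Finset.Icc (q k - n) (q k + n)).card := by
        refine Finset.card_le_card fun q' h => ?_
        rw [Finset.mem_filter] at h
        rw [Fintype.mem_piFinset]
        intro k
        have := abs_le.1 (h.2 k)
        rw [Finset.mem_Icc]; constructor <;> linarith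
    _ = _ := by
        rw [Fintype.card_piFinset]
        simp only [Int.card_Icc]
        rw [← Finset.card_univ, ← Finset.prod_const]
        congr 1; ext k; omega

lemma exists_orth (ι : Type) [Fintype ι] : ∃ C : ℝ≥0∞, C ≠ ⊤ ∧
    ∀ (Ξ : Type) [MeasurableSpace Ξ] (ν : Measure Ξ) [SFinite ν] (φ : Ξ → ι → ℝ), Measurable φ →
      ∀ (T : ℝ) (Q : Finset (ι → ℤ)) (g : (ι → ℤ) → Ξ → ℂ), (∀ q, Integrable (g q) ν) →
        (∀ q ξ, g q ξ ≠ 0 → ∀ k, |2 * T * φ ξ k - q k| < 1) →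
        ∀ x, avg 1 T (msq (osc ν φ (fun ξ => ∑ q ∈ Q, g q ξ))) x ≤ C * ∑ q ∈ Q, avg 1 T (msq (osc ν φ (g q))) x := by
  classical
  obtain ⟨m, hm, ⟨A, B, hA, hB, hAB⟩, hz⟩ := exists_thetaMeasure ι
  refine ⟨A * ((2 * 3 + 1) ^ Fintype.card ι : ℕ) * B, by finiteness, ?_⟩
  intro Ξ _ ν _ φ hφ T Q g hg hsupp x
  set F : (ι → ℤ) → (ι → ℝ) → ℂ := fun q s => osc ν φ (g q) (x + T • s) with hF
  have hFm : ∀ q, Measurable (F q) := fun q => (continuous_osc (hg q) hφ).measurable.comp (by fun_prop)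
  have hsum : ∀ s, osc ν φ (fun ξ => ∑ q ∈ Q, g q ξ) (x + T • s) = ∑ q ∈ Q, F q s := fun s =>
    osc_sum Q g (fun q _ => hg q) hφ _
  have key := almost_orth (m := m) Q F hFm (fun q => ⟨_, fun s => norm_osc_le _⟩)
    (fun q q' => ∀ k, |q k - q' k| ≤ (3 : ℕ)) (fun q q' h k => by rw [abs_sub_comm]; exact h k)
    ((2 * 3 + 1) ^ Fintype.card ι) (fun q _ => card_near_le Q q 3) ?_
  · have hms : Measurable (msq fun s => ∑ q ∈ Q, F q s) := measurable_msq (by fun_prop)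
    calc avg 1 T (msq (osc ν φ (fun ξ => ∑ q ∈ Q, g q ξ))) x
        = ∫⁻ s, msq (fun s => ∑ q ∈ Q, F q s) s * wt 1 s := by
          unfold avg; congr 1; ext s; rw [msq, msq, hsum]
      _ ≤ A * ∫⁻ s, msq (fun s => ∑ q ∈ Q, F q s) s ∂m := (hAB _ hms).1
      _ ≤ A * (((2 * 3 + 1) ^ Fintype.card ι : ℕ) * ∑ q ∈ Q, (B * avg 1 T (msq (osc ν φ (g q))) x)) := by
          refine mul_le_mul' le_rfl (key.trans (mul_le_mul' le_rfl (Finset.sum_le_sum fun q _ => ?_)))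
          exact (hAB _ (measurable_msq (hFm q))).2
      _ = _ := by rw [← Finset.mul_sum]; ring
  · intro q _ q' _ hnear
    push Not at hnear
    obtain ⟨k, hk⟩ := hnear
    have e1 : ∀ s, F q s * starRingEnd ℂ (F q' s) =
        osc (ν.prod ν) (fun p k => φ p.1 k + -φ p.2 k) (fun p => g q p.1 * starRingEnd ℂ (g q' p.2)) (x + T • s) * 1 := fun s => by
      simp only [hF]
      rw [conj_osc, osc_mul_osc, mul_one]
    simp_rw [e1]
    have hφ' : Measurable fun (p : Ξ × Ξ) (k : ι) => φ p.1 k + -φ p.2 k := by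
      have : ∀ k, Measurable fun ξ => φ ξ k := fun k => (measurable_pi_apply k).comp hφ
      fun_prop
    have hgi : Integrable (fun p : Ξ × Ξ => g q p.1 * starRingEnd ℂ (g q' p.2)) (ν.prod ν) :=
      (hg q).mul_prod (Complex.conjCLE.toContinuousLinearMap.integrable_comp (hg q'))
    rw [osc_fubini (X := fun s : ι → ℝ => x + T • s) hgi hφ' (by fun_prop) (integrable_const 1)]
    refine integral_eq_zero_of_ae (Eventually.of_forall fun p => ?_)
    by_cases h1 : g q p.1 = 0
    · simp [h1]
    by_cases h2 : g q' p.2 = 0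
    · simp [h2]
    simp only [mul_one, Pi.zero_apply]
    have e2 : ∀ s : ι → ℝ, cis (∑ k, (x + T • s) k * (φ p.1 k + -φ p.2 k)) =
        cis (∑ k, x k * (φ p.1 k + -φ p.2 k)) * cis (∑ k, s k * (T * (φ p.1 k + -φ p.2 k))) := fun s => by
      rw [← cis_add, ← Finset.sum_add_distrib]
      congr 2; ext k; simp; ring
    simp_rw [e2]
    rw [integral_const_mul, hz _ ⟨k, ?_⟩, mul_zero, mul_zero]
    have a1 := hsupp q _ h1 k
    have a2 := hsupp q' _ h2 k
    have a3 : (4:ℝ) ≤ |(q k : ℝ) - q' k| := by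
      rw [← Int.cast_sub, ← Int.cast_abs]; exact_mod_cast hk
    rw [abs_lt] at a1 a2
    rcases le_abs.1 a3 with h | h
    · exact le_abs.2 (Or.inl (by linarith))
    · exact le_abs.2 (Or.inr (by linarith))

/-- The piece of `g` with frequency near `q / (2T)`. -/
noncomputable def cap {Ξ ι : Type*} [Fintype ι] (T : ℝ) (φ : Ξ → ι → ℝ) (g : Ξ → ℂ) (q : ι → ℤ) (ξ : Ξ) : ℂ :=
  g ξ * ∏ k, (kap (2 * T * φ ξ k - q k) : ℂ)

section Cap

variable {Ξ ι : Type*} [Fintype ι] {φ : Ξ → ι → ℝ} {g : Ξ → ℂ}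

lemma cap_supp {T : ℝ} {q : ι → ℤ} {ξ : Ξ} (h : cap T φ g q ξ ≠ 0) :
    g ξ ≠ 0 ∧ ∀ k, |2 * T * φ ξ k - q k| < 1 := by
  refine ⟨left_ne_zero_of_mul h, fun k => ?_⟩
  by_contra hk
  refine h (mul_eq_zero_of_right _ (Finset.prod_eq_zero (Finset.mem_univ k) ?_))
  rw [kap_eq_zero (not_lt.1 hk), Complex.ofReal_zero]

lemma measurable_capFactor [MeasurableSpace Ξ] (hφ : Measurable φ) (T : ℝ) (q : ι → ℤ) :
    Measurable fun ξ => ∏ k, (kap (2 * T * φ ξ k - q k) : ℂ) := by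
  have h1 : ∀ k, Measurable fun ξ => φ ξ k := fun k => (measurable_pi_apply k).comp hφ
  have h2 := continuous_kap.measurable
  fun_prop

lemma norm_capFactor_le (T : ℝ) (q : ι → ℤ) (ξ : Ξ) : ‖∏ k, (kap (2 * T * φ ξ k - q k) : ℂ)‖ ≤ 1 := by
  rw [norm_prod]
  refine Finset.prod_le_one (fun _ _ => norm_nonneg _) fun k _ => ?_
  rw [Complex.norm_real, Real.norm_of_nonneg (kap_nonneg _)]
  exact kap_le_one _

lemma integrable_cap [MeasurableSpace Ξ] {ν : Measure Ξ} (hg : Integrable g ν) (hφ : Measurable φ) (T : ℝ) (q : ι → ℤ) : Integrable (cap T φ g q) ν :=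
  hg.mul_bdd (c := 1) (measurable_capFactor hφ T q).aestronglyMeasurable
    (Eventually.of_forall fun ξ => norm_capFactor_le T q ξ)

lemma sum_cap [DecidableEq ι] {T : ℝ} {m : ℕ} (h : ∀ ξ, g ξ ≠ 0 → ∀ k, |2 * T * φ ξ k| ≤ m) (ξ : Ξ) :
    ∑ q ∈ Fintype.piFinset (fun _ : ι => Finset.Icc (-(m : ℤ)) m), cap T φ g q ξ = g ξ := by
  by_cases h0 : g ξ = 0
  · simp [cap, h0]
  unfold cap
  rw [← Finset.mul_sum, ← Finset.prod_univ_sum (fun _ => Finset.Icc (-(m : ℤ)) m)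
    (fun k q => (kap (2 * T * φ ξ k - (q : ℤ)) : ℂ)), Finset.prod_eq_one, mul_one]
  intro k _
  have := sum_kap m _ (h ξ h0 k)
  exact_mod_cast congrArg (fun r : ℝ => (r : ℂ)) this

end Cap

lemma osc_cap_eq {ι : Type*} [Fintype ι] {k : ℝ → ℂ} (hki : Integrable k)
    (hr : ∀ u, ∫ s, k s * cis (s * u) = (kap u : ℂ))
    {Ξ : Type*} [MeasurableSpace Ξ] {ν : Measure Ξ} [SFinite ν] {φ : Ξ → ι → ℝ} {g : Ξ → ℂ}
    (hg : Integrable g ν) (hφ : Measurable φ) (T : ℝ) (q : ι → ℤ) (x : ι → ℝ) :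
    osc ν φ (cap T φ g q) x =
      ∫ s, osc ν φ g (x + (2 * T) • s) * (cis (∑ i, s i * (-(q i : ℝ))) * ∏ i, k (s i)) := by
  have hwi : Integrable (fun s : ι → ℝ => cis (∑ i, s i * (-(q i : ℝ))) * ∏ i, k (s i)) := by
    refine (Integrable.fintype_prod fun i => hki).bdd_mul (c := 1) ?_ (Eventually.of_forall fun _ => (norm_cis _).le)
    exact (continuous_cis.comp (by fun_prop)).aestronglyMeasurable
  rw [osc_fubini (X := fun s : ι → ℝ => x + (2 * T) • s) hg hφ (by fun_prop) hwi, osc]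
  congr 1; ext ξ
  have : ∀ s : ι → ℝ, cis (∑ i, (x + (2 * T) • s) i * φ ξ i) * (cis (∑ i, s i * (-(q i : ℝ))) * ∏ i, k (s i)) =
      cis (∑ i, x i * φ ξ i) * (cis (∑ i, s i * (2 * T * φ ξ i - q i)) * ∏ i, k (s i)) := fun s => by
    rw [← mul_assoc, ← mul_assoc, ← cis_add, ← cis_add]
    congr 2
    rw [← Finset.sum_add_distrib, ← Finset.sum_add_distrib]
    congr 1; ext i; simp; ring
  simp_rw [this]
  rw [integral_const_mul, integral_prod_kernel]
  simp_rw [hr]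
  unfold cap
  ring

lemma exists_bessel (ι : Type) [Fintype ι] : ∃ C : ℝ≥0∞, C ≠ ⊤ ∧
    ∀ (Ξ : Type) [MeasurableSpace Ξ] (ν : Measure Ξ) [SFinite ν] (φ : Ξ → ι → ℝ) (g : Ξ → ℂ), Integrable g ν →
      Measurable φ → ∀ (T : ℝ) (Q : Finset (ι → ℤ)) (x : ι → ℝ),
        ∑ q ∈ Q, msq (osc ν φ (cap T φ g q)) x ≤ C * avg 1 (2 * T) (msq (osc ν φ g)) x := by
  classical
  obtain ⟨m, hm, ⟨A, B, hA, hB, hAB⟩, hz⟩ := exists_thetaMeasure ι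
  obtain ⟨k, hk, hd, hr⟩ : ∃ k : ℝ → ℂ, Continuous k ∧ (∀ m : ℕ, ∃ C : ℝ, 0 < C ∧ ∀ s, ‖k s‖ ≤ C * cw s ^ m) ∧
      ∀ u, ∫ s, k s * cis (s * u) = (kap u : ℂ) := by
    obtain ⟨k, h1, h2, -, h3⟩ := exists_kap_kernel 1 one_pos
    exact ⟨k, h1, h2, fun u => by rw [h3, one_mul]⟩
  obtain ⟨C, hC, hkC⟩ := hd 1
  have hw := measurable_wt (ι := ι) 1
  have hki := integrable_kernel hk le_rfl hC hkC
  set C1 := ENNReal.ofReal (C ^ Fintype.card ι)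
  set P : ℝ≥0∞ := A * m univ
  refine ⟨C1 ^ 2 * P, by simp only [P, C1]; finiteness, ?_⟩
  intro Ξ _ ν _ φ g hg hφ T Q x
  set c : (ι → ℤ) → ℂ := fun q => osc ν φ (cap T φ g q) x with hc
  set F : (ι → ℤ) → (ι → ℝ) → ℂ := fun q s => starRingEnd ℂ (c q) * cis (∑ i, s i * (-(q i : ℝ))) with hF
  have hFm : ∀ q, Measurable (F q) := fun q => (continuous_const.mul (continuous_phase _)).measurable
  have hFn : ∀ q s, ‖F q s‖ = ‖c q‖ := fun q s => by
    simp only [hF]; rw [norm_mul, norm_cis, RCLike.norm_conj, mul_one]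
  set t : (ι → ℝ) → ℂ := fun s => ∑ q ∈ Q, F q s with ht
  have htm : Measurable t := by fun_prop
  set S : ℝ≥0∞ := ∑ q ∈ Q, msq (osc ν φ (cap T φ g q)) x with hS
  have hSfin : S ≠ ⊤ := ENNReal.sum_ne_top.2 fun q _ => (msq_lt_top _ _).ne
  have horth : ∫⁻ s, msq t s ∂m ≤ m univ * S := by
    have := almost_orth (m := m) Q F hFm (fun q => ⟨‖c q‖, fun s => (hFn q s).le⟩) (fun q q' => q = q')
      (fun _ _ h => h.symm) 1 (fun q _ => by
        refine (Finset.card_le_card (t := {q}) fun q' h => ?_).trans (by simp)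
        rw [Finset.mem_filter] at h; simp [h.2]) ?_
    · refine this.trans (le_of_eq ?_)
      rw [Nat.cast_one, one_mul, hS, Finset.mul_sum]
      congr 1; ext q
      have : ∀ s, msq (F q) s = ‖c q‖ₑ ^ 2 := fun s => by
        rw [msq, ← ofReal_norm, hFn, ofReal_norm]
      simp_rw [this]
      rw [lintegral_const, mul_comm]; rfl
    · intro q _ q' _ hqq
      obtain ⟨i, hi⟩ := Function.ne_iff.1 hqq
      have e : ∀ s, F q s * starRingEnd ℂ (F q' s) = (starRingEnd ℂ (c q) * c q') * cis (∑ i, s i * ((q' i : ℝ) - q i)) := fun s => by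
        simp only [hF]
        rw [map_mul, conj_cis, Complex.conj_conj]
        have : cis (∑ i, s i * ((q' i : ℝ) - q i)) = cis (∑ i, s i * (-(q i : ℝ))) * cis (-∑ i, s i * (-(q' i : ℝ))) := by
          rw [← cis_add, ← sub_eq_add_neg, ← Finset.sum_sub_distrib]
          congr 2; ext i; ring
        rw [this]; ring
      simp_rw [e]
      rw [integral_const_mul, hz _ ⟨i, ?_⟩, mul_zero]
      rw [← Int.cast_sub, ← Int.cast_abs]
      exact_mod_cast Int.one_le_abs (sub_ne_zero.2 (Ne.symm hi))
  set f : (ι → ℝ) → ℂ := fun s => osc ν φ g (x + (2 * T) • s) with hf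
  have hfm : Measurable f := (continuous_osc hg hφ).measurable.comp (by fun_prop)
  have hrep : ((∑ q ∈ Q, ‖c q‖ ^ 2 : ℝ) : ℂ) = ∫ s, (f s * t s) * ∏ i, k (s i) := by
    have hkI : Integrable (fun s : ι → ℝ => ∏ i, k (s i)) := Integrable.fintype_prod fun i => hki
    have e1 : ∀ q, starRingEnd ℂ (c q) * c q = ∫ s, f s * F q s * ∏ i, k (s i) := fun q => by
      conv_lhs => rw [hc]
      simp only
      conv_lhs => arg 2; rw [osc_cap_eq hki hr hg hφ]
      rw [← integral_const_mul]
      congr 1; ext s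
      simp only [hf, hF]; ring
    have e2 : ∀ s, (f s * t s) * ∏ i, k (s i) = ∑ q ∈ Q, f s * F q s * ∏ i, k (s i) := fun s => by
      rw [ht, Finset.mul_sum, Finset.sum_mul]
    simp_rw [e2]
    rw [integral_finsetSum]
    · simp_rw [← e1]
      push_cast
      congr 1; ext q
      rw [mul_comm, Complex.mul_conj, Complex.normSq_eq_norm_sq]; push_cast; rfl
    · intro q _
      refine hkI.bdd_mul (c := (∫ ξ, ‖g ξ‖ ∂ν) * ‖c q‖) (hfm.mul (hFm q)).aestronglyMeasurable
        (Eventually.of_forall fun s => ?_)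
      rw [norm_mul, hFn]
      gcongr
      exact norm_osc_le _
  have hS2 : S = ‖((∑ q ∈ Q, ‖c q‖ ^ 2 : ℝ) : ℂ)‖ₑ := by
    rw [← ofReal_norm, Complex.norm_real, Real.norm_of_nonneg (Finset.sum_nonneg fun _ _ => sq_nonneg _),
      ENNReal.ofReal_sum_of_nonneg fun _ _ => sq_nonneg _, hS]
    congr 1; ext q
    rw [msq, ENNReal.ofReal_pow (norm_nonneg _), ofReal_norm]
  have hcs : S ^ 2 ≤ (C1 * avg 1 (2 * T) (msq (osc ν φ g)) x) * (C1 * (P * S)) := by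
    have h1 : S ≤ ∫⁻ s, (‖f s‖ₑ * ‖t s‖ₑ) * (C1 * wt 1 s) := by
      rw [hS2, hrep]
      refine (enorm_integral_le_lintegral_enorm _).trans (lintegral_mono fun s => ?_)
      rw [enorm_mul, enorm_mul]
      exact mul_le_mul' le_rfl (enorm_le_wt hC hkC s)
    have h2 := ENNReal.lintegral_mul_norm_pow_le (μ := (volume : Measure (ι → ℝ))) (f := fun s => msq f s * (C1 * wt 1 s))
      (g := fun s => msq t s * (C1 * wt 1 s))
      (by unfold msq; fun_prop) (by unfold msq; fun_prop) (p := 1/2) (q := 1/2) (by norm_num) (by norm_num) (by norm_num)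
    have h3 : ∀ s, (msq f s * (C1 * wt 1 s)) ^ (1/2:ℝ) * (msq t s * (C1 * wt 1 s)) ^ (1/2:ℝ) =
        (‖f s‖ₑ * ‖t s‖ₑ) * (C1 * wt 1 s) := fun s => by
      rw [← ENNReal.mul_rpow_of_nonneg _ _ (by norm_num), msq, msq,
        show ‖f s‖ₑ ^ 2 * (C1 * wt 1 s) * (‖t s‖ₑ ^ 2 * (C1 * wt 1 s)) = ((‖f s‖ₑ * ‖t s‖ₑ) * (C1 * wt 1 s)) ^ (2:ℝ) by
          rw [ENNReal.rpow_two]; ring, ← ENNReal.rpow_mul]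
      norm_num
    simp_rw [h3] at h2
    have h4 : ∫⁻ s, msq f s * (C1 * wt 1 s) = C1 * avg 1 (2 * T) (msq (osc ν φ g)) x := by
      have := measurable_msq hfm
      rw [avg, ← lintegral_const_mul _ (by exact this.mul hw)]
      congr 1; ext s
      simp only [hf, msq]; ring
    have h5 : ∫⁻ s, msq t s * (C1 * wt 1 s) ≤ C1 * (P * S) := by
      have := measurable_msq htm
      have e : ∀ s, msq t s * (C1 * wt 1 s) = C1 * (msq t s * wt 1 s) := fun s => by ring
      simp_rw [e]
      rw [lintegral_const_mul _ (by fun_prop)]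
      refine mul_le_mul' le_rfl ((hAB _ this).1.trans ?_)
      calc _ ≤ A * (m univ * S) := mul_le_mul' le_rfl horth
        _ = _ := by simp only [P]; ring
    rw [h4] at h2
    have h6 := (h1.trans h2).trans (mul_le_mul' le_rfl (ENNReal.rpow_le_rpow h5 (by norm_num)))
    calc S ^ 2 ≤ _ := pow_le_pow_left' h6 2
      _ = _ := by
        rw [← ENNReal.mul_rpow_of_nonneg _ _ (by norm_num), ← ENNReal.rpow_natCast, ← ENNReal.rpow_mul]
        norm_num
  rcases eq_or_ne S 0 with h0 | h0
  · rw [h0]; exact zero_le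
  · have : S * S ≤ S * (C1 ^ 2 * P * avg 1 (2 * T) (msq (osc ν φ g)) x) := by
      calc S * S = S ^ 2 := by ring
        _ ≤ _ := hcs
        _ = _ := by ring
    exact (ENNReal.mul_le_mul_iff_right h0 hSfin).1 this

lemma exists_bessel_lintegral (ι : Type) [Fintype ι] : ∃ C : ℝ≥0∞, C ≠ ⊤ ∧
    ∀ (Ξ : Type) [MeasurableSpace Ξ] (ν : Measure Ξ) [SFinite ν] (φ : Ξ → ι → ℝ) (g : Ξ → ℂ), Integrable g ν →
      Measurable φ → ∀ (T : ℝ) (Q : Finset (ι → ℤ)),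
        ∑ q ∈ Q, ∫⁻ x, msq (osc ν φ (cap T φ g q)) x ≤ C * ∫⁻ x, msq (osc ν φ g) x := by
  obtain ⟨C, hC, h⟩ := exists_bessel ι
  refine ⟨C * ∫⁻ s, wt (ι := ι) 1 s, ENNReal.mul_ne_top hC (lintegral_wt_lt_top le_rfl).ne, ?_⟩
  intro Ξ _ ν _ φ g hg hφ T Q
  rw [← lintegral_finsetSum _ fun q _ => measurable_msq_osc (integrable_cap hg hφ T q) hφ, mul_assoc,
    ← lintegral_avg (T := 2 * T) (measurable_msq_osc hg hφ),
    ← lintegral_const_mul _ (measurable_avg (measurable_msq_osc hg hφ))]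
  exact lintegral_mono fun x => h Ξ ν φ g hg hφ T Q x

lemma loomis_whitney (ι : Type*) [Fintype ι] [DecidableEq ι] (hd : 2 ≤ Fintype.card ι) :
    ∃ C : ℝ≥0∞, C ≠ ⊤ ∧ ∀ a : ι → (ι → ℝ) → ℝ≥0∞, (∀ i, Measurable (a i)) → (∀ i, ∫⁻ u, a i u ≠ ⊤) →
      ∫⁻ u, (∏ i, ∫⁻ s, a i (Function.update u i s)) ^ (1 / ((Fintype.card ι : ℝ) - 1)) ≤
        C * (∏ i, ∫⁻ u, a i u) ^ (1 / ((Fintype.card ι : ℝ) - 1)) := by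
  set d : ℝ := (Fintype.card ι : ℝ) with hdd
  have hd2 : (2:ℝ) ≤ d := by rw [hdd]; exact_mod_cast hd
  set r := 1 / (d - 1) with hr
  have hr0 : 0 ≤ r := by rw [hr]; apply div_nonneg <;> linarith
  have hp : d.HolderConjugate (d / (d - 1)) := Real.HolderConjugate.conjExponent (by linarith)
  have hp0 : 0 ≤ d / (d - 1) := by apply div_nonneg <;> linarith
  have hCt : ENNReal.ofReal d ^ (d / (d - 1)) ≠ ⊤ := ENNReal.rpow_ne_top_of_nonneg hp0 ENNReal.ofReal_ne_top
  refine ⟨ENNReal.ofReal d ^ (d / (d - 1)), hCt, ?_⟩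
  intro a ha hfin
  set A : ι → NNReal := fun i => (∫⁻ u, a i u).toNNReal with hA
  have hAe : ∀ i, ∫⁻ u, a i u = A i := fun i => (ENNReal.coe_toNNReal (hfin i)).symm
  have main : ∀ ε : NNReal, 0 < ε → ∫⁻ u, (∏ i, ∫⁻ s, a i (Function.update u i s)) ^ r ≤
      ENNReal.ofReal d ^ (d / (d - 1)) * (((∏ i, (A i + ε) : NNReal) : ℝ≥0∞)) ^ r := by
    intro ε hε
    have hB0 : ∀ i, ((A i + ε : NNReal) : ℝ≥0∞) ≠ 0 := fun i => by
      rw [Ne, ENNReal.coe_eq_zero]; positivity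
    set f : (ι → ℝ) → ℝ≥0∞ := fun u => ∑ i, ((A i + ε : NNReal) : ℝ≥0∞)⁻¹ * a i u with hf
    have hfm : Measurable f := by fun_prop
    have h1 := lintegral_prod_lintegral_pow_le (fun _ : ι => (volume : Measure ℝ)) hp hfm
    rw [← volume_pi] at h1
    have h2 : ∫⁻ u, f u ≤ ENNReal.ofReal d := by
      rw [hf, lintegral_finsetSum _ fun i _ => by fun_prop]
      calc _ ≤ ∑ i : ι, (1 : ℝ≥0∞) := by
            refine Finset.sum_le_sum fun i _ => ?_
            rw [lintegral_const_mul _ (ha i), hAe, ENNReal.inv_mul_le_iff (hB0 i) ENNReal.coe_ne_top, mul_one]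
            exact_mod_cast le_self_add
        _ = _ := by simp [hdd]
    have h3 : ∀ u, (∏ i, ((A i + ε : NNReal) : ℝ≥0∞)⁻¹) ^ r * (∏ i, ∫⁻ s, a i (Function.update u i s)) ^ r ≤
        ∏ i, (∫⁻ s, f (Function.update u i s)) ^ r := fun u => by
      rw [← ENNReal.mul_rpow_of_nonneg _ _ hr0, ← Finset.prod_mul_distrib, ENNReal.prod_rpow_of_nonneg hr0]
      refine ENNReal.rpow_le_rpow (Finset.prod_le_prod' fun i _ => ?_) hr0
      have hm : Measurable fun s => a i (Function.update u i s) := (ha i).comp (measurable_update u)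
      rw [← lintegral_const_mul _ hm]
      refine lintegral_mono fun s => ?_
      exact Finset.single_le_sum (f := fun j => ((A j + ε : NNReal) : ℝ≥0∞)⁻¹ * a j (Function.update u i s))
        (fun _ _ => zero_le) (Finset.mem_univ i)
    have h4 : (∏ i, ((A i + ε : NNReal) : ℝ≥0∞)⁻¹) ^ r = ((((∏ i, (A i + ε) : NNReal) : ℝ≥0∞)) ^ r)⁻¹ := by
      rw [← ENNReal.inv_rpow, ENNReal.ofNNReal_finsetProd, ENNReal.prod_inv_distrib]
      intro i _ j _ _
      exact Or.inr ENNReal.coe_ne_top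
    have h5 : (((∏ i, (A i + ε) : NNReal) : ℝ≥0∞)) ^ r ≠ 0 := by
      rw [Ne, ENNReal.rpow_eq_zero_iff]
      rintro (⟨h, -⟩ | ⟨h, -⟩)
      · rw [ENNReal.coe_eq_zero, Finset.prod_eq_zero_iff] at h
        obtain ⟨i, -, hi⟩ := h
        exact hB0 i (by rw [hi]; rfl)
      · exact ENNReal.coe_ne_top h
    have h6 : (((∏ i, (A i + ε) : NNReal) : ℝ≥0∞)) ^ r ≠ ⊤ := ENNReal.rpow_ne_top_of_nonneg hr0 ENNReal.coe_ne_top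
    rw [mul_comm, ← ENNReal.inv_mul_le_iff h5 h6, ← h4]
    calc _ ≤ ∫⁻ u, (∏ i, ((A i + ε : NNReal) : ℝ≥0∞)⁻¹) ^ r * (∏ i, ∫⁻ s, a i (Function.update u i s)) ^ r :=
          lintegral_const_mul_le _ _
      _ ≤ _ := lintegral_mono h3
      _ ≤ _ := h1
      _ ≤ _ := ENNReal.rpow_le_rpow h2 hp0
  simp_rw [hAe]
  rw [← ENNReal.ofNNReal_finsetProd]
  have hcont : Continuous fun ε : NNReal => ENNReal.ofReal d ^ (d / (d - 1)) * (((∏ i, (A i + ε) : NNReal) : ℝ≥0∞)) ^ r :=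
    (ENNReal.continuous_const_mul hCt).comp
      (ENNReal.continuous_rpow_const.comp (ENNReal.continuous_coe.comp (by fun_prop)))
  have ht := (hcont.tendsto 0).mono_left (nhdsWithin_le_nhds (s := Ioi 0))
  simp only [add_zero] at ht
  exact ge_of_tendsto ht (eventually_nhdsWithin_of_forall fun ε hε => main ε hε)

/-- Local form of Loomis–Whitney for functions with a one-dimensional reproducing property. -/
lemma local_loomis_whitney (ι : Type) [Fintype ι] [DecidableEq ι] (hd : 2 ≤ Fintype.card ι) (C₁ : ℝ≥0∞) (hC₁ : C₁ ≠ ⊤) :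
    ∃ C : ℝ≥0∞, C ≠ ⊤ ∧ ∀ (S : ι → (ι → ℝ) → ℝ≥0∞) (T : ℝ), (∀ i, Measurable (S i)) →
      (∀ i z, avg 1 T (S i) z ≠ ⊤) →
      (∀ i x, S i x ≤ C₁ * ∫⁻ s : ℝ, S i (x + Pi.single i (T * s)) * ENNReal.ofReal (cw s ^ 1)) →
      ∫⁻ z, (∏ i, S i z) ^ (1 / ((Fintype.card ι : ℝ) - 1)) ≤
        C * ∫⁻ z, (∏ i, avg 1 T (S i) z) ^ (1 / ((Fintype.card ι : ℝ) - 1)) := by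
  obtain ⟨C₂, hC₂, hLW⟩ := loomis_whitney ι hd
  have hd2 : (2:ℝ) ≤ Fintype.card ι := by exact_mod_cast hd
  set r := 1 / ((Fintype.card ι : ℝ) - 1) with hr
  have hr0 : 0 ≤ r := by rw [hr]; apply div_nonneg <;> linarith
  have hw := measurable_wt (ι := ι) 1
  have hcw := continuous_cw.measurable
  set K : ℝ≥0∞ := C₁ * ENNReal.ofReal (4 * 2 ^ Fintype.card ι) with hK
  have hKt : K ≠ ⊤ := by rw [hK]; finiteness
  refine ⟨(∏ _i : ι, K) ^ r * C₂, ENNReal.mul_ne_top (ENNReal.rpow_ne_top_of_nonneg hr0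
    (ENNReal.prod_ne_top fun _ _ => hKt)) hC₂, ?_⟩
  intro S T hS hfin hrep
  have hcube : ∀ u : ι → ℝ, (∀ k, u k ∈ Icc (0:ℝ) 1) → ∀ i v,
      cw (v - u i) ≤ 4 * 2 ^ Fintype.card ι * ∏ k, cw (Function.update u i v k) := by
    intro u hu i v
    have h1 : ∀ k, 1 / 2 ≤ cw (u k) := fun k => half_le_cw (by rw [abs_of_nonneg (hu k).1]; exact (hu k).2)
    have h2 : cw (v - u i) ≤ 4 * cw v := by
      have := cw_mul_cw_le (u i) v
      nlinarith [h1 i, cw_pos (v - u i)]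
    have h3 : cw v ≤ 2 ^ Fintype.card ι * ∏ k, cw (Function.update u i v k) := by
      rw [← Finset.card_univ, ← Finset.prod_const, ← Finset.prod_mul_distrib,
        ← Finset.mul_prod_erase _ _ (Finset.mem_univ i), Function.update_self]
      have : 1 ≤ ∏ k ∈ Finset.univ.erase i, 2 * cw (Function.update u i v k) := by
        calc (1:ℝ) = ∏ k ∈ Finset.univ.erase i, 1 := by simp
          _ ≤ _ := Finset.prod_le_prod (fun _ _ => zero_le_one) fun k hk => by
            rw [Function.update_of_ne (Finset.ne_of_mem_erase hk)]; linarith [h1 k]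
      nlinarith [cw_pos v]
    nlinarith
  have hloc : ∀ z, ∫⁻ u in Set.pi univ fun _ : ι => Icc (0:ℝ) 1, (∏ i, S i (z + T • u)) ^ r ≤
      (∏ _i : ι, K) ^ r * (C₂ * (∏ i, avg 1 T (S i) z) ^ r) := by
    intro z
    have h1 := hLW (fun i u => S i (z + T • u) * wt 1 u) (fun i => by have := hS i; fun_prop) (fun i => hfin i z)
    change _ ≤ C₂ * (∏ i, avg 1 T (S i) z) ^ r at h1
    have hmeas : Measurable fun u : ι → ℝ => (∏ i, ∫⁻ s, S i (z + T • Function.update u i s) * wt 1 (Function.update u i s)) ^ r := by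
      refine Measurable.pow_const (Finset.measurable_prod _ fun i _ => ?_) _
      refine Measurable.lintegral_prod_right (f := fun (u : ι → ℝ) (s : ℝ) => S i (z + T • Function.update u i s) * wt 1 (Function.update u i s)) ?_
      have hup : Measurable fun p : (ι → ℝ) × ℝ => Function.update p.1 i p.2 := by
        rw [measurable_pi_iff]
        intro k
        by_cases h : k = i
        · subst h; simp only [Function.update_self]; fun_prop
        · simp only [Function.update_of_ne h]; fun_prop
      have := hS i
      exact (this.comp ((hup.const_smul T).const_add z)).mul (hw.comp hup)
    refine le_trans ?_ (mul_le_mul' le_rfl h1)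
    rw [← lintegral_const_mul _ hmeas]
    refine (setLIntegral_mono' (MeasurableSet.univ_pi fun _ => measurableSet_Icc) fun u hu => ?_).trans (setLIntegral_le_lintegral _ _)
    rw [← ENNReal.mul_rpow_of_nonneg _ _ hr0, ← Finset.prod_mul_distrib]
    refine ENNReal.rpow_le_rpow (Finset.prod_le_prod' fun i _ => ?_) hr0
    refine (hrep i _).trans ?_
    rw [hK, mul_assoc]
    refine mul_le_mul' le_rfl ?_
    have hmi : Measurable fun s : ℝ => S i (z + T • Function.update u i s) * wt 1 (Function.update u i s) := by
      have := hS i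
      have hup : Measurable fun s : ℝ => Function.update u i s := measurable_update u
      exact (this.comp ((hup.const_smul T).const_add z)).mul (hw.comp hup)
    rw [← lintegral_const_mul _ hmi, ← lintegral_sub_right_eq_self _ (u i)]
    refine lintegral_mono fun v => ?_
    have e1 : z + T • u + Pi.single i (T * (v - u i)) = z + T • Function.update u i v := by
      rw [add_assoc]
      congr 1
      ext k
      by_cases h : k = i
      · subst h; simp; ring
      · simp [h]
    rw [e1, mul_left_comm]
    refine mul_le_mul' le_rfl ?_
    rw [pow_one, wt_ofReal, ← ENNReal.ofReal_mul (by positivity)]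
    simp only [pow_one]
    exact ENNReal.ofReal_le_ofReal (hcube u (fun k => hu k (mem_univ k)) i v)
  have hm1 : Measurable fun z => (∏ i, S i z) ^ r := by fun_prop
  have hm2 : Measurable fun z => (∏ i, avg 1 T (S i) z) ^ r := by
    have := fun i => measurable_avg (N := 1) (T := T) (hS i)
    fun_prop
  have hvol : volume (Set.pi univ fun _ : ι => Icc (0:ℝ) 1) = 1 := by
    rw [volume_pi_pi]; simp
  calc ∫⁻ z, (∏ i, S i z) ^ r = ∫⁻ u in Set.pi univ fun _ : ι => Icc (0:ℝ) 1, ∫⁻ z, (∏ i, S i (z + T • u)) ^ r := by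
        have : ∀ u : ι → ℝ, ∫⁻ z, (∏ i, S i (z + T • u)) ^ r = ∫⁻ z, (∏ i, S i z) ^ r := fun u =>
          lintegral_add_right_eq_self (fun z => (∏ i, S i z) ^ r) (T • u)
        simp_rw [this]
        rw [lintegral_const, Measure.restrict_apply_univ, hvol, mul_one]
    _ = ∫⁻ z, ∫⁻ u in Set.pi univ fun _ : ι => Icc (0:ℝ) 1, (∏ i, S i (z + T • u)) ^ r := by
        rw [lintegral_lintegral_swap]
        exact Measurable.aemeasurable (by fun_prop)
    _ ≤ ∫⁻ z, (∏ _i : ι, K) ^ r * (C₂ * (∏ i, avg 1 T (S i) z) ^ r) := lintegral_mono hloc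
    _ = _ := by
        rw [lintegral_const_mul _ (by fun_prop), lintegral_const_mul _ hm2, mul_assoc]

lemma avg_le_of_le_shift {ι : Type} [Fintype ι] {C : ℝ≥0∞} {G : (ι → ℝ) → ℝ≥0∞} (hG : Measurable G)
    {ρ : ℝ} {S : ℝ → ι → ℝ} (hs : Measurable S) {v : ℝ → ℝ≥0∞} (hv : Measurable v)
    (h : ∀ x, G x ≤ C * ∫⁻ s : ℝ, G (x + S s) * v s) (x : ι → ℝ) :
    avg 1 ρ G x ≤ C * ∫⁻ t : ℝ, avg 1 ρ G (x + S t) * v t := by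
  have hw := measurable_wt (ι := ι) 1
  have hp : Measurable fun p : (ι → ℝ) × ℝ => G (x + ρ • p.1 + S p.2) :=
    hG.comp ((by fun_prop : Measurable fun p : (ι → ℝ) × ℝ => x + ρ • p.1).add (hs.comp measurable_snd))
  have hpw : Measurable fun p : (ι → ℝ) × ℝ => G (x + ρ • p.1 + S p.2) * v p.2 * wt 1 p.1 :=
    (hp.mul (hv.comp measurable_snd)).mul (hw.comp measurable_fst)
  calc avg 1 ρ G x ≤ ∫⁻ u, (C * ∫⁻ t : ℝ, G (x + ρ • u + S t) * v t) * wt 1 u :=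
        lintegral_mono fun u => mul_le_mul' (h _) le_rfl
    _ = C * ∫⁻ u, ∫⁻ t : ℝ, G (x + ρ • u + S t) * v t * wt 1 u := by
        rw [← lintegral_const_mul _ hpw.lintegral_prod_right']
        congr 1; ext u
        have hm : Measurable fun t => G (x + ρ • u + S t) * v t := (hp.comp (measurable_prodMk_left (x := u))).mul hv
        dsimp only
        rw [lintegral_mul_const _ hm, mul_assoc]
    _ = C * ∫⁻ t : ℝ, ∫⁻ u, G (x + ρ • u + S t) * v t * wt 1 u := by
        rw [lintegral_lintegral_swap hpw.aemeasurable]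
    _ = _ := by
        congr 2; ext t
        unfold avg
        have hm : Measurable fun u => G (x + S t + ρ • u) * wt 1 u := (hG.comp (by fun_prop)).mul hw
        rw [← lintegral_mul_const _ hm]
        congr 1; ext u
        rw [show x + ρ • u + S t = x + S t + ρ • u by abel]
        ring

lemma sum_avg_one_le {ι : Type} [Fintype ι] [DecidableEq ι] {C : ℝ≥0∞} {J : Type} (s : Finset J)
    {G : J → (ι → ℝ) → ℝ≥0∞} (hG : ∀ j, Measurable (G j)) {ρ T : ℝ} (i : ι)
    (h : ∀ j x, G j x ≤ C * ∫⁻ s : ℝ, G j (x + Pi.single i (T * s)) * ENNReal.ofReal (cw s ^ 1)) (x : ι → ℝ) :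
    (∑ j ∈ s, avg 1 ρ (G j) x) ≤
      C * ∫⁻ t : ℝ, (∑ j ∈ s, avg 1 ρ (G j) (x + Pi.single i (T * t))) * ENNReal.ofReal (cw t ^ 1) := by
  have hcw : Measurable fun t => ENNReal.ofReal (cw t ^ 1) := (continuous_cw.measurable.pow_const 1).ennreal_ofReal
  have hs : Measurable fun t : ℝ => (Pi.single i (T * t) : ι → ℝ) :=
    ((continuous_single (A := fun _ => ℝ) i).comp (by fun_prop : Continuous fun t : ℝ => T * t)).measurable
  have hsj : ∀ j, Measurable fun t : ℝ => avg 1 ρ (G j) (x + Pi.single i (T * t)) * ENNReal.ofReal (cw t ^ 1) := fun j =>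
    ((measurable_avg (hG j)).comp (hs.const_add x)).mul hcw
  simp_rw [Finset.sum_mul]
  rw [lintegral_finsetSum _ fun j _ => hsj j, Finset.mul_sum]
  exact Finset.sum_le_sum fun j _ => avg_le_of_le_shift (hG j) hs hcw (h j) x

/-- Multilinear restriction, by induction on scales. -/
lemma exists_multilinear (ι : Type) [Fintype ι] [DecidableEq ι] (hd : 2 ≤ Fintype.card ι) (n : ℕ) :
    ∃ C : ℝ≥0∞, C ≠ ⊤ ∧ ∀ (Ξ : Type) [MeasurableSpace Ξ] (ν : Measure Ξ) [SFinite ν] (φ : Ξ → ι → ℝ), Measurable φ →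
      ∀ (B : ℝ) (J : Type) (s : Finset J) (g : ι → J → Ξ → ℂ) (ρ L : ℝ),
      (∀ i j ξ k, g i j ξ ≠ 0 → |φ ξ k| ≤ B) →
      (∀ i j, Integrable (g i j) ν) → 0 < ρ → 1 ≤ L →
      (∀ i j ξ ξ', g i j ξ ≠ 0 → g i j ξ' ≠ 0 → (∀ k, |φ ξ k - φ ξ' k| ≤ ρ⁻¹) ∧
        |φ ξ i - φ ξ' i| ≤ L⁻¹ * ‖φ ξ - φ ξ'‖ + (ρ * L ^ n)⁻¹) →
      (∀ i j, ∫⁻ x, msq (osc ν φ (g i j)) x ≠ ⊤) →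
      ∫⁻ x, (∏ i, ∑ j ∈ s, avg 1 ρ (msq (osc ν φ (g i j))) x) ^ (1 / ((Fintype.card ι : ℝ) - 1)) ≤
        C * (∏ i, (ENNReal.ofReal (ρ * L ^ n)⁻¹ * ∑ j ∈ s, ∫⁻ x, msq (osc ν φ (g i j)) x)) ^
          (1 / ((Fintype.card ι : ℝ) - 1)) := by
  set d : ℝ := (Fintype.card ι : ℝ) with hdd
  have hd2 : (2:ℝ) ≤ d := by rw [hdd]; exact_mod_cast hd
  set r := 1 / (d - 1) with hr
  have hr0 : 0 ≤ r := by rw [hr]; apply div_nonneg <;> linarith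
  induction n with
  | zero =>
    set W := ∫⁻ s, wt (ι := ι) 1 s with hW
    have hWt : W ≠ ⊤ := (lintegral_wt_lt_top le_rfl).ne
    refine ⟨(W ^ (1 / d)) ^ Fintype.card ι, ENNReal.pow_ne_top (ENNReal.rpow_ne_top_of_nonneg (by positivity) hWt), ?_⟩
    intro Ξ _ ν _ φ hφ B J s g ρ L hB hg hρ hL hsupp hfin
    rw [pow_zero, mul_one]
    set S : ι → (ι → ℝ) → ℝ≥0∞ := fun i x => ∑ j ∈ s, avg 1 ρ (msq (osc ν φ (g i j))) x with hS
    set E : ι → ℝ≥0∞ := fun i => ∑ j ∈ s, ∫⁻ x, msq (osc ν φ (g i j)) x with hE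
    have hm := fun i j => measurable_msq_osc (hg i j) hφ
    have hSm : ∀ i, Measurable (S i) := fun i => by
      have := fun j => measurable_avg (N := 1) (T := ρ) (hm i j)
      fun_prop
    have hSE : ∀ i, ∫⁻ x, S i x = W * E i := fun i => by
      rw [hS, lintegral_finsetSum _ fun j _ => measurable_avg (hm i j), hE, Finset.mul_sum]
      congr 1; ext j
      rw [lintegral_avg (hm i j)]
    have hSb : ∀ i x, S i x ≤ ENNReal.ofReal ((ρ ^ Fintype.card ι)⁻¹) * E i := fun i x => by
      simp only [hS, hE]
      rw [Finset.mul_sum]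
      exact Finset.sum_le_sum fun j _ => avg_le_lintegral hρ (hm i j) x
    have hH := ENNReal.lintegral_prod_norm_pow_le (μ := (volume : Measure (ι → ℝ))) Finset.univ (f := S)
      (fun i _ => (hSm i).aemeasurable) (p := fun _ => 1 / d)
      (by rw [Finset.sum_const, Finset.card_univ, nsmul_eq_mul, ← hdd]; field_simp) (fun _ _ => by positivity)
    have hrd : r = 1 / d + (r - 1 / d) := by ring
    have hrd0 : 0 ≤ r - 1 / d := by
      rw [hr, sub_nonneg]; exact one_div_le_one_div_of_le (by linarith) (by linarith)
    have hd0 : 0 ≤ 1 / d := by positivity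
    calc ∫⁻ x, (∏ i, S i x) ^ r ≤ ∫⁻ x, (∏ i, S i x ^ (1 / d)) * (∏ i, (ENNReal.ofReal ((ρ ^ Fintype.card ι)⁻¹) * E i)) ^ (r - 1 / d) := by
          refine lintegral_mono fun x => ?_
          conv_lhs => rw [hrd, ENNReal.rpow_add_of_nonneg _ _ hd0 hrd0]
          rw [ENNReal.prod_rpow_of_nonneg hd0]
          exact mul_le_mul' le_rfl (ENNReal.rpow_le_rpow (Finset.prod_le_prod' fun i _ => hSb i x) hrd0)
      _ ≤ (∏ i, (W * E i) ^ (1 / d)) * (∏ i, (ENNReal.ofReal ((ρ ^ Fintype.card ι)⁻¹) * E i)) ^ (r - 1 / d) := by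
          rw [lintegral_mul_const _ (Finset.measurable_prod _ fun i _ => (hSm i).pow_const _)]
          simp_rw [hSE] at hH
          exact mul_le_mul' hH le_rfl
      _ = (W ^ (1 / d)) ^ Fintype.card ι * (((∏ i, E i) ^ (1 / d) * (∏ i, E i) ^ (r - 1 / d)) *
            ((ENNReal.ofReal ((ρ ^ Fintype.card ι)⁻¹)) ^ (Fintype.card ι)) ^ (r - 1 / d)) := by
          simp_rw [ENNReal.mul_rpow_of_nonneg _ _ hd0]
          rw [Finset.prod_mul_distrib, Finset.prod_mul_distrib, Finset.prod_const, Finset.prod_const,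
            Finset.card_univ, ENNReal.mul_rpow_of_nonneg _ _ hrd0, ENNReal.prod_rpow_of_nonneg hd0]
          ring
      _ = _ := by
          rw [← ENNReal.rpow_add_of_nonneg _ _ hd0 hrd0, ← hrd, Finset.prod_mul_distrib, Finset.prod_const, Finset.card_univ,
            ENNReal.mul_rpow_of_nonneg _ _ hr0]
          have : (ENNReal.ofReal ((ρ ^ Fintype.card ι)⁻¹) ^ Fintype.card ι) ^ (r - 1 / d) = (ENNReal.ofReal ρ⁻¹ ^ Fintype.card ι) ^ r := by
            rw [← inv_pow, ENNReal.ofReal_pow (by positivity), ← pow_mul, ← ENNReal.rpow_natCast, ← ENNReal.rpow_natCast,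
              ← ENNReal.rpow_mul, ← ENNReal.rpow_mul]
            congr 1
            push_cast
            rw [← hdd, hr]
            have : d - 1 ≠ 0 := by linarith
            field_simp
            ring
          rw [this]
          ring
  | succ n ih =>
    obtain ⟨C₀, hC₀, hIH⟩ := ih
    obtain ⟨C₁, hC₁, hrep⟩ := exists_repro_one 1 le_rfl
    obtain ⟨C₂, hC₂, hLW⟩ := local_loomis_whitney ι hd C₁ hC₁
    obtain ⟨C₃, hC₃, horth⟩ := exists_orth ι
    obtain ⟨C₄, hC₄, hbes⟩ := exists_bessel_lintegral ι
    set K := ENNReal.ofReal ((4 * Real.pi) ^ Fintype.card ι) * C₃ with hK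
    have hKt : K ≠ ⊤ := ENNReal.mul_ne_top ENNReal.ofReal_ne_top hC₃
    refine ⟨C₂ * ((K ^ Fintype.card ι) ^ r * (C₀ * (C₄ ^ Fintype.card ι) ^ r)), ?_, ?_⟩
    · exact ENNReal.mul_ne_top hC₂ (ENNReal.mul_ne_top (ENNReal.rpow_ne_top_of_nonneg hr0 (ENNReal.pow_ne_top hKt))
        (ENNReal.mul_ne_top hC₀ (ENNReal.rpow_ne_top_of_nonneg hr0 (ENNReal.pow_ne_top hC₄))))
    intro Ξ _ ν _ φ hφ B J s g ρ L hB hg hρ hL hsupp hfin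
    have hL0 : 0 < L := by linarith
    set T := ρ * L with hT
    have hT0 : 0 < T := by positivity
    have hρT : ρ ≤ T := le_mul_of_one_le_right hρ.le hL
    have hm := fun i j => measurable_msq_osc (hg i j) hφ
    set S : ι → (ι → ℝ) → ℝ≥0∞ := fun i x => ∑ j ∈ s, avg 1 ρ (msq (osc ν φ (g i j))) x with hS
    have hSm : ∀ i, Measurable (S i) := fun i => by
      have := fun j => measurable_avg (N := 1) (T := ρ) (hm i j)
      fun_prop
    set m : ℕ := ⌈2 * T * B⌉₊ with hmdef
    set Q := Fintype.piFinset (fun _ : ι => Finset.Icc (-(m : ℤ)) m) with hQ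
    have hphm : ∀ i j ξ, g i j ξ ≠ 0 → ∀ k, |2 * T * φ ξ k| ≤ m := fun i j ξ h k => by
      rw [abs_mul, abs_of_pos (by positivity)]
      exact (mul_le_mul_of_nonneg_left (hB i j ξ k h) (by positivity)).trans (Nat.le_ceil _)
    have hsmall : ∀ i j ξ ξ', g i j ξ ≠ 0 → g i j ξ' ≠ 0 → |T * (φ ξ i - φ ξ' i)| ≤ 2 := by
      intro i j ξ ξ' h h'
      obtain ⟨h1, h2⟩ := hsupp i j ξ ξ' h h'
      have h3 : ‖φ ξ - φ ξ'‖ ≤ ρ⁻¹ := (pi_norm_le_iff_of_nonneg (by positivity)).2 h1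
      have h4 : (ρ * L ^ (n + 1))⁻¹ ≤ T⁻¹ := by
        apply inv_anti₀ hT0
        rw [hT, pow_succ]
        have : 1 ≤ L ^ n := one_le_pow₀ hL
        have := mul_le_mul_of_nonneg_left this (mul_pos hρ hL0).le
        nlinarith
      have h5 : L⁻¹ * ‖φ ξ - φ ξ'‖ ≤ T⁻¹ := by
        rw [hT, mul_inv, mul_comm ρ⁻¹]; gcongr
      rw [abs_mul, abs_of_pos hT0]
      calc _ ≤ T * (T⁻¹ + T⁻¹) := by gcongr; linarith
        _ = 2 := by field_simp; norm_num
    have hone : ∀ i j x, msq (osc ν φ (g i j)) x ≤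
        C₁ * ∫⁻ s : ℝ, msq (osc ν φ (g i j)) (x + Pi.single i (T * s)) * ENNReal.ofReal (cw s ^ 1) := by
      intro i j x
      by_cases h : ∃ ξ₀, g i j ξ₀ ≠ 0
      · obtain ⟨ξ₀, h0⟩ := h
        exact hrep ι Ξ ν φ (g i j) (hg i j) hφ T i (φ ξ₀ i) (fun ξ hξ => hsmall i j ξ ξ₀ hξ h0) x
      · push Not at h
        have : g i j = 0 := funext h
        rw [this, msq, osc_zero]
        simp
    have havg : ∀ i z, avg 1 T (S i) z ≤ K * ∑ p ∈ s ×ˢ Q, avg 1 T (msq (osc ν φ (cap T φ (g i p.1) p.2))) z := by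
      intro i z
      rw [Finset.sum_product, hS, avg_sum _ (fun j => measurable_avg (hm i j)), Finset.mul_sum]
      refine Finset.sum_le_sum fun j _ => ?_
      refine (avg_avg_le hρ hρT (hm i j) z).trans ?_
      rw [hK, mul_assoc]
      refine mul_le_mul' le_rfl ?_
      have := horth Ξ ν φ hφ T Q (cap T φ (g i j)) (fun q => integrable_cap (hg i j) hφ T q)
        (fun q ξ h => (cap_supp h).2) z
      have e : (fun ξ => ∑ q ∈ Q, cap T φ (g i j) q ξ) = g i j := funext fun ξ => sum_cap (hphm i j) ξ
      rwa [e] at this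
    have hfin' : ∀ i (p : J × (ι → ℤ)), ∫⁻ x, msq (osc ν φ (cap T φ (g i p.1) p.2)) x ≠ ⊤ := fun i p => by
      have := hbes Ξ ν φ (g i p.1) (hg i p.1) hφ T {p.2}
      rw [Finset.sum_singleton] at this
      exact ne_top_of_le_ne_top (ENNReal.mul_ne_top hC₄ (hfin i p.1)) this
    have hSfin : ∀ i z, avg 1 T (S i) z ≠ ⊤ := fun i z => by
      refine ne_top_of_le_ne_top (ENNReal.mul_ne_top hKt (ENNReal.sum_ne_top.2 fun p _ => ?_)) (havg i z)
      exact ne_top_of_le_ne_top (ENNReal.mul_ne_top ENNReal.ofReal_ne_top (hfin' i p))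
        (avg_le_lintegral hT0 (measurable_msq_osc (integrable_cap (hg i p.1) hφ T p.2) hφ) z)
    have h1 := hLW S T hSm hSfin (fun i x => sum_avg_one_le s (hm i) i (hone i) x)
    refine h1.trans ?_
    rw [mul_assoc]
    refine mul_le_mul' le_rfl ?_
    have h2 := hIH Ξ ν φ hφ B (J × (ι → ℤ)) (s ×ˢ Q) (fun i p => cap T φ (g i p.1) p.2) T L
      (fun i p ξ k h => hB i p.1 ξ k (cap_supp h).1)
      (fun i p => integrable_cap (hg i p.1) hφ T p.2) hT0 hL ?_ hfin'
    · calc _ ≤ ∫⁻ z, (K ^ Fintype.card ι) ^ r * (∏ i, ∑ p ∈ s ×ˢ Q, avg 1 T (msq (osc ν φ (cap T φ (g i p.1) p.2))) z) ^ r := by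
            refine lintegral_mono fun z => ?_
            rw [← ENNReal.mul_rpow_of_nonneg _ _ hr0, ← Finset.card_univ, ← Finset.prod_const, ← Finset.prod_mul_distrib]
            exact ENNReal.rpow_le_rpow (Finset.prod_le_prod' fun i _ => havg i z) hr0
        _ ≤ (K ^ Fintype.card ι) ^ r * (C₀ * (∏ i, (ENNReal.ofReal (T * L ^ n)⁻¹ *
              ∑ p ∈ s ×ˢ Q, ∫⁻ x, msq (osc ν φ (cap T φ (g i p.1) p.2)) x)) ^ r) := by
            rw [lintegral_const_mul']
            · exact mul_le_mul' le_rfl h2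
            · exact ENNReal.rpow_ne_top_of_nonneg hr0 (ENNReal.pow_ne_top hKt)
        _ ≤ (K ^ Fintype.card ι) ^ r * (C₀ * (∏ i, (C₄ * (ENNReal.ofReal (ρ * L ^ (n + 1))⁻¹ *
              ∑ j ∈ s, ∫⁻ x, msq (osc ν φ (g i j)) x))) ^ r) := by
            refine mul_le_mul' le_rfl (mul_le_mul' le_rfl (ENNReal.rpow_le_rpow (Finset.prod_le_prod' fun i _ => ?_) hr0))
            rw [show T * L ^ n = ρ * L ^ (n + 1) by rw [hT]; ring, mul_left_comm C₄, Finset.sum_product]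
            refine mul_le_mul' le_rfl ?_
            rw [Finset.mul_sum]
            exact (Finset.sum_le_sum fun j _ => hbes Ξ ν φ (g i j) (hg i j) hφ T Q)
        _ = _ := by
            rw [Finset.prod_mul_distrib, Finset.prod_const, Finset.card_univ, ENNReal.mul_rpow_of_nonneg _ _ hr0]
            ring
    · intro i p ξ ξ' h h'
      obtain ⟨a1, a2⟩ := cap_supp h
      obtain ⟨b1, b2⟩ := cap_supp h'
      refine ⟨fun k => ?_, ?_⟩
      · have x1 := abs_lt.1 (a2 k)
        have x2 := abs_lt.1 (b2 k)
        rw [← one_div, le_div_iff₀ hT0]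
        rcases abs_cases (φ ξ k - φ ξ' k) with ⟨e, -⟩ | ⟨e, -⟩ <;> rw [e] <;> nlinarith
      · have := (hsupp i p.1 ξ ξ' a1 b1).2
        rwa [show T * L ^ n = ρ * L ^ (n + 1) by rw [hT]; ring]

lemma exists_window : ∃ b : ℝ → ℂ, Integrable b ∧ (∀ v, b v ≠ 0 → |v| ≤ 1) ∧ Continuous (fun s => ∫ v, b v * cis (-(s * v))) ∧
    (∃ C : ℝ, 0 < C ∧ ∀ s, ‖∫ v, b v * cis (-(s * v))‖ ≤ C * cw s ^ 1) ∧
    ∀ s, |s| ≤ 1 → 1 ≤ ‖∫ v, b v * cis (-(s * v))‖ := by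
  obtain ⟨k, hk, hd, hf, -⟩ := exists_kap_kernel 1 one_pos
  obtain ⟨C, hC, hCk⟩ := hd 1
  simp only [one_mul] at hf
  have hcomp : HasCompactSupport kap := by
    have := hasCompactSupport_kapScale 1 one_pos
    refine HasCompactSupport.intro (isCompact_Icc (a := (-1:ℝ)) (b := 1)) fun x hx => kap_eq_zero ?_
    by_contra! h
    exact hx ⟨(abs_lt.1 h).1.le, (abs_lt.1 h).2.le⟩
  have hint : Integrable kap := continuous_kap.integrable_of_hasCompactSupport hcomp
  have hpos : 0 < ∫ v, kap v :=
    continuous_kap.integral_pos_of_hasCompactSupport_nonneg_nonzero hcomp kap_nonneg (x := 0) (by rw [kap_zero]; norm_num)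
  set c := Real.cos 1 * ∫ v, kap v with hc
  have hc0 : 0 < c := mul_pos Real.cos_one_pos hpos
  have hkey : ∀ s, ∫ v, ((c⁻¹ : ℝ) * kap v : ℂ) * cis (-(s * v)) = ((2 * Real.pi * c⁻¹ : ℝ) : ℂ) * k s := fun s => by
    rw [hf, ← mul_assoc, ← Complex.ofReal_mul, show 2 * Real.pi * c⁻¹ * (2 * Real.pi)⁻¹ = c⁻¹ by field_simp,
      ← integral_const_mul]
    simp only [mul_assoc]
  refine ⟨fun v => (c⁻¹ : ℝ) * kap v, hint.ofReal.const_mul _, fun v hv => ?_, ?_, ⟨2 * Real.pi * c⁻¹ * C, by positivity, fun s => ?_⟩, fun s hs => ?_⟩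
  · by_contra! h
    exact hv (by simp [kap_eq_zero h.le])
  · simp_rw [hkey]; fun_prop
  · rw [hkey, norm_mul, Complex.norm_real, Real.norm_of_nonneg (by positivity), mul_assoc _ C]
    exact mul_le_mul_of_nonneg_left (hCk s) (by positivity)
  · have hm : ∀ v, (((c⁻¹ : ℝ) * kap v : ℂ) * cis (-(s * v))).re = c⁻¹ * kap v * Real.cos (s * v) := fun v => by
      rw [← Complex.ofReal_mul, Complex.re_ofReal_mul, cis, mul_comm Complex.I, Complex.exp_ofReal_mul_I_re, Real.cos_neg]
    have hi : Integrable fun v => ((c⁻¹ : ℝ) * kap v : ℂ) * cis (-(s * v)) :=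
      (hint.ofReal.const_mul _).mul_bdd (c := 1) (continuous_cis.comp (by fun_prop)).aestronglyMeasurable
        (Eventually.of_forall fun v => (norm_cis _).le)
    calc 1 = ∫ v, c⁻¹ * kap v * Real.cos 1 := by
          rw [integral_mul_const, integral_const_mul]
          field_simp
          rw [hc]; ring
      _ ≤ ∫ v, (((c⁻¹ : ℝ) * kap v : ℂ) * cis (-(s * v))).re := by
          refine integral_mono ((hint.const_mul _).mul_const _) hi.re fun v => ?_
          dsimp only
          rw [hm]
          by_cases hv : |v| ≤ 1
          · refine mul_le_mul_of_nonneg_left ?_ (mul_nonneg (by positivity) (kap_nonneg v))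
            rw [← Real.cos_abs (s * v), abs_mul]
            exact Real.cos_le_cos_of_nonneg_of_le_pi (by positivity) (by linarith [Real.pi_gt_three])
              (mul_le_one₀ hs (abs_nonneg v) hv)
          · rw [kap_eq_zero (not_le.1 hv).le]; simp
      _ = (∫ v, ((c⁻¹ : ℝ) * kap v : ℂ) * cis (-(s * v))).re := integral_re hi
      _ ≤ _ := Complex.re_le_norm _

/-- Localization of an oscillatory integral to a cube, at the cost of a small frequency blur. -/
lemma exists_localize (ι : Type) [Fintype ι] : ∃ C : ℝ≥0∞, C ≠ ⊤ ∧
    ∀ (Ξ : Type) [MeasurableSpace Ξ] (ν : Measure Ξ) [SFinite ν] (φ : Ξ → ι → ℝ) (g : Ξ → ℂ),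
      Integrable g ν → Measurable φ → ∀ (T : ℝ) (z : ι → ℝ), 0 < T →
      ∃ (φ' : Ξ × (ι → ℝ) → ι → ℝ) (g' : Ξ × (ι → ℝ) → ℂ), Integrable g' (ν.prod volume) ∧ Measurable φ' ∧
        (∀ p, g' p ≠ 0 → g p.1 ≠ 0 ∧ ∀ k, |φ' p k - φ p.1 k| ≤ T⁻¹) ∧
        (∀ x, (∀ k, |x k - z k| ≤ T) → msq (osc ν φ g) x ≤ msq (osc (ν.prod volume) φ' g') x) ∧
        ∫⁻ x, msq (osc (ν.prod volume) φ' g') x ≤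
          C * (ENNReal.ofReal (T ^ Fintype.card ι) * avg 1 T (msq (osc ν φ g)) z) := by
  obtain ⟨b, hb, hbs, hbc, ⟨C, hC, hCb⟩, hb1⟩ := exists_window
  refine ⟨ENNReal.ofReal (C ^ Fintype.card ι) ^ 2, ENNReal.pow_ne_top ENNReal.ofReal_ne_top, ?_⟩
  intro Ξ _ ν _ φ g hg hφ T z hT
  set ω : ℝ → ℂ := fun s => ∫ v, b v * cis (-(s * v)) with hω
  set g₂ : (ι → ℝ) → ℂ := fun η => (∏ k, b (η k)) * cis (∑ k, z k * (T⁻¹ * η k)) with hg₂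
  set φ₂ : (ι → ℝ) → ι → ℝ := fun η k => -(T⁻¹ * η k) with hφ₂
  have hb' : Integrable fun η : ι → ℝ => ∏ k, b (η k) := Integrable.fintype_prod fun _ => hb
  have hg₂i : Integrable g₂ := hb'.mul_bdd (c := 1)
    (continuous_cis.comp (by fun_prop)).aestronglyMeasurable (Eventually.of_forall fun _ => (norm_cis _).le)
  have hosc : ∀ x, osc volume φ₂ g₂ x = ∏ k, ω (T⁻¹ * (x k - z k)) := fun x => by
    rw [hω, ← integral_fintype_prod_volume_eq_prod (𝕜 := ℂ) (fun k v => b v * cis (-(T⁻¹ * (x k - z k) * v)))]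
    unfold osc
    congr 1; ext η
    rw [hg₂, mul_assoc, ← cis_add, Finset.prod_mul_distrib, ← cis_sum, ← Finset.sum_add_distrib]
    congr 3; ext k
    rw [hφ₂]; ring
  have hmul : ∀ x, msq (osc (ν.prod volume) (fun p k => φ p.1 k + φ₂ p.2 k) (fun p => g p.1 * g₂ p.2)) x =
      msq (osc ν φ g) x * ‖∏ k, ω (T⁻¹ * (x k - z k))‖ₑ ^ 2 := fun x => by
    rw [msq, ← osc_mul_osc, enorm_mul, mul_pow, hosc]; rfl
  refine ⟨fun p k => φ p.1 k + φ₂ p.2 k, fun p => g p.1 * g₂ p.2, hg.mul_prod hg₂i, ?_, ?_, ?_, ?_⟩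
  · have : Measurable φ₂ := by fun_prop
    fun_prop
  · intro p hp
    refine ⟨left_ne_zero_of_mul hp, fun k => ?_⟩
    have h2 : ∏ k, b (p.2 k) ≠ 0 := left_ne_zero_of_mul (right_ne_zero_of_mul hp)
    have h3 := hbs _ (Finset.prod_ne_zero_iff.1 h2 k (Finset.mem_univ k))
    rw [add_sub_cancel_left, hφ₂, abs_neg, abs_mul, abs_of_pos (inv_pos.2 hT)]
    exact mul_le_of_le_one_right (inv_pos.2 hT).le h3
  · intro x hx
    rw [hmul]
    refine le_mul_of_one_le_right' (one_le_pow_of_one_le' ?_ 2)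
    rw [← ofReal_norm, ENNReal.one_le_ofReal, norm_prod]
    refine Finset.one_le_prod fun k _ => hb1 _ ?_
    rw [abs_mul, abs_of_pos (inv_pos.2 hT), inv_mul_le_iff₀ hT, mul_one]
    exact hx k
  · simp_rw [hmul]
    have hF := measurable_msq_osc hg hφ
    set F := msq (osc ν φ g)
    have h1 : ∀ x : ι → ℝ, ‖∏ k, ω (T⁻¹ * (x k - z k))‖ₑ ^ 2 ≤
        ENNReal.ofReal (C ^ Fintype.card ι) ^ 2 * wt 1 (T⁻¹ • (x - z)) := fun x => by
      have := enorm_le_wt hC hCb (T⁻¹ • (x - z))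
      refine (pow_le_pow_left' this 2).trans ?_
      rw [mul_pow, pow_two (wt 1 _)]
      exact mul_le_mul' le_rfl (mul_le_of_le_one_left' (wt_le_one _ _))
    have hw : Measurable fun x : ι → ℝ => wt 1 (T⁻¹ • (x - z)) := (measurable_wt 1).comp (by fun_prop)
    have hFw : Measurable fun x => F x * wt 1 (T⁻¹ • (x - z)) := hF.mul hw
    have h2 := lintegral_comp_add_smul hT (G := fun x => F x * wt 1 (T⁻¹ • (x - z))) hFw z
    have h3 : avg 1 T F z = ∫⁻ s, (fun x => F x * wt 1 (T⁻¹ • (x - z))) (z + T • s) := by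
      unfold avg
      congr 1; ext s
      simp [smul_smul, inv_mul_cancel₀ hT.ne']
    rw [h3, h2, ← mul_assoc (ENNReal.ofReal _), ← ENNReal.ofReal_mul (by positivity), mul_inv_cancel₀ (by positivity),
      ENNReal.ofReal_one, one_mul, ← lintegral_const_mul _ hFw]
    refine lintegral_mono fun x => ?_
    calc _ ≤ F x * (ENNReal.ofReal (C ^ Fintype.card ι) ^ 2 * wt 1 (T⁻¹ • (x - z))) := mul_le_mul' le_rfl (h1 x)
      _ = _ := by ring

lemma lintegral_le_of_local {E : Type*} [PseudoMetricSpace E] [SecondCountableTopology E] [MeasurableSpace E] [BorelSpace E]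
    (κ μ : Measure E) [SFinite κ] [SFinite μ] {G : E → ℝ≥0∞} (hG : Measurable G) {r : ℝ} {v A : ℝ≥0∞}
    (hv : ∀ x, v ≤ κ (closedBall x r)) (h : ∀ x y, dist x y ≤ r → G x ≤ A * G y) :
    v * ∫⁻ x, G x ∂μ ≤ A * ∫⁻ y, G y * μ (closedBall y r) ∂κ := by
  have hS : MeasurableSet {p : E × E | dist p.1 p.2 ≤ r} :=
    (isClosed_le continuous_dist continuous_const).measurableSet
  set k : E → E → ℝ≥0∞ := fun x y => {p : E × E | dist p.1 p.2 ≤ r}.indicator 1 (x, y) with hk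
  have hkm : Measurable (Function.uncurry k) := measurable_one.indicator hS
  have hk1 : ∀ x, ∫⁻ y, k x y ∂κ = κ (closedBall x r) := fun x => by
    rw [← lintegral_indicator_one isClosed_closedBall.measurableSet]
    congr 1; ext y
    simp [hk, indicator, mem_closedBall, dist_comm y x]
  have hk2 : ∀ y, ∫⁻ x, k x y ∂μ = μ (closedBall y r) := fun y => by
    rw [← lintegral_indicator_one isClosed_closedBall.measurableSet]
    congr 1
  have hm : Measurable (Function.uncurry fun x y => A * (k x y * G y)) :=
    (hkm.mul (hG.comp measurable_snd)).const_mul A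
  rw [← lintegral_const_mul _ hG]
  calc ∫⁻ x, v * G x ∂μ ≤ ∫⁻ x, ∫⁻ y, A * (k x y * G y) ∂κ ∂μ := by
        refine lintegral_mono fun x => ?_
        calc v * G x ≤ (∫⁻ y, k x y ∂κ) * G x := by rw [hk1]; exact mul_le_mul' (hv x) le_rfl
          _ = ∫⁻ y, k x y * G x ∂κ := (lintegral_mul_const _ (hkm.comp measurable_prodMk_left)).symm
          _ ≤ _ := by
            refine lintegral_mono fun y => ?_
            by_cases hxy : dist x y ≤ r
            · rw [mul_left_comm]; exact mul_le_mul' le_rfl (h x y hxy)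
            · simp [hk, hxy]
    _ = ∫⁻ y, ∫⁻ x, A * (k x y * G y) ∂μ ∂κ := lintegral_lintegral_swap hm.aemeasurable
    _ = ∫⁻ y, A * (G y * μ (closedBall y r)) ∂κ := by
        congr 1; ext y
        have h1 : Measurable fun x => k x y := hkm.comp measurable_prodMk_right
        rw [lintegral_const_mul _ (h1.mul_const _), lintegral_mul_const _ h1, hk2, mul_comm (G y)]
    _ = _ := by
        refine lintegral_const_mul _ (hG.mul ?_)
        simp_rw [← hk2]
        exact hkm.lintegral_prod_left

/-- Half-open cubes of side `T` with corners in the lattice `T ℤ^ι`. -/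
def cube {ι : Type*} (T : ℝ) (b : ι → ℤ) : Set (ι → ℝ) := Set.pi univ fun k => Ico (T * b k) (T * (b k + 1))

section Cube
variable {ι : Type*} {T : ℝ}

lemma measurableSet_cube [Finite ι] (b : ι → ℤ) : MeasurableSet (cube T b) :=
  have := Finite.to_countable (α := ι)
  MeasurableSet.univ_pi fun _ => measurableSet_Ico

lemma mem_cube (hT : 0 < T) {b : ι → ℤ} {x : ι → ℝ} : x ∈ cube T b ↔ ∀ k, ⌊x k / T⌋ = b k := by
  simp only [cube, mem_univ_pi, mem_Ico, Int.floor_eq_iff, le_div_iff₀ hT, div_lt_iff₀ hT, mul_comm T]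

lemma iUnion_cube (hT : 0 < T) : ⋃ b : ι → ℤ, cube T b = univ :=
  eq_univ_of_forall fun x => mem_iUnion.2 ⟨fun k => ⌊x k / T⌋, (mem_cube hT).2 fun _ => rfl⟩

lemma disjoint_cube (hT : 0 < T) : Pairwise (Function.onFun Disjoint (cube (ι := ι) T)) := by
  intro b b' h
  refine Set.disjoint_left.2 fun x h1 h2 => h (funext fun k => ?_)
  rw [← (mem_cube hT).1 h1 k, (mem_cube hT).1 h2 k]

lemma abs_sub_le_of_mem_cube {b : ι → ℤ} {x : ι → ℝ} (h : x ∈ cube T b) (k : ι) : |x k - T * b k| ≤ T := by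
  have := h k (mem_univ k)
  rw [abs_le]; constructor <;> nlinarith [this.1, this.2]

lemma volume_cube [Fintype ι] (hT : 0 < T) (b : ι → ℤ) : volume (cube T b) = ENNReal.ofReal (T ^ Fintype.card ι) := by
  rw [cube, volume_pi_pi]
  simp only [Real.volume_Ico]
  rw [ENNReal.ofReal_pow hT.le, ← Finset.card_univ, ← Finset.prod_const]
  congr 1; ext k; congr 1; ring

lemma lintegral_cube [Fintype ι] (hT : 0 < T) (μ : Measure (ι → ℝ)) (F : (ι → ℝ) → ℝ≥0∞) :
    ∫⁻ x, F x ∂μ = ∑' b, ∫⁻ x in cube T b, F x ∂μ := by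
  rw [← lintegral_iUnion measurableSet_cube (disjoint_cube hT), iUnion_cube hT, Measure.restrict_univ]

lemma tsum_avg_le [Fintype ι] (hT : 0 < T) {F : (ι → ℝ) → ℝ≥0∞} (hF : Measurable F) :
    ∑' b : ι → ℤ, ENNReal.ofReal (T ^ Fintype.card ι) * avg 1 T F (fun k => T * b k) ≤
      ENNReal.ofReal ((4 ^ 1) ^ Fintype.card ι) * (∫⁻ s, wt (ι := ι) 1 s) * ∫⁻ x, F x := by
  rw [mul_assoc, ← lintegral_avg hF, lintegral_cube hT, ← ENNReal.tsum_mul_left]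
  refine ENNReal.tsum_le_tsum fun b => ?_
  rw [← lintegral_const_mul _ (measurable_avg hF), ← volume_cube hT b, mul_comm, ← setLIntegral_const]
  refine setLIntegral_mono' (measurableSet_cube b) fun x hx => avg_local hT hF fun k => ?_
  rw [abs_sub_comm]; exact abs_sub_le_of_mem_cube hx k

end Cube

/-- Fractal energy estimate for thin neighbourhoods of the unit sphere in dimension `n + 1`. -/
def KakeyaEnergy (n : ℕ) : Prop :=
  ∀ A : ℝ, 0 < A → ∃ (c : ℝ) (C : ℝ≥0∞), 0 < c ∧ c ≤ 1 ∧ C ≠ ⊤ ∧ ∀ R : ℝ, 1 ≤ R →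
    ∀ (Ξ : Type) [MeasurableSpace Ξ] (ν : Measure Ξ) [SFinite ν] (φ : Ξ → Fin (n + 1) → ℝ) (g : Ξ → ℂ),
      Integrable g ν → Measurable φ → (∀ ξ, g ξ ≠ 0 → |∑ k, φ ξ k ^ 2 - 1| ≤ A / R) →
      ∀ (μ : Measure (Fin (n + 1) → ℝ)) [IsFiniteMeasure μ] (H : ℝ≥0∞),
        (∀ x r, 1 ≤ r → r ≤ R → μ (closedBall x r) ≤ H * ENNReal.ofReal (r ^ n)) →
        μ univ ≤ H * ENNReal.ofReal (R ^ n) →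
        ∫⁻ x, msq (osc ν φ g) x ∂μ ≤ C * H * ENNReal.ofReal (R ^ (-c)) * ∫⁻ x, msq (osc ν φ g) x

/-- The same estimate without the bound on the total mass. -/
def KakeyaEnergyLoc (n : ℕ) : Prop :=
  ∀ A : ℝ, 0 < A → ∃ (c : ℝ) (C : ℝ≥0∞), 0 < c ∧ c ≤ 1 ∧ C ≠ ⊤ ∧ ∀ R : ℝ, 1 ≤ R →
    ∀ (Ξ : Type) [MeasurableSpace Ξ] (ν : Measure Ξ) [SFinite ν] (φ : Ξ → Fin (n + 1) → ℝ) (g : Ξ → ℂ),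
      Integrable g ν → Measurable φ → (∀ ξ, g ξ ≠ 0 → |∑ k, φ ξ k ^ 2 - 1| ≤ A / R) →
      ∀ (μ : Measure (Fin (n + 1) → ℝ)) [IsFiniteMeasure μ] (H : ℝ≥0∞),
        (∀ x r, 1 ≤ r → r ≤ R → μ (closedBall x r) ≤ H * ENNReal.ofReal (r ^ n)) →
        ∫⁻ x, msq (osc ν φ g) x ∂μ ≤ C * H * ENNReal.ofReal (R ^ (-c)) * ∫⁻ x, msq (osc ν φ g) x

lemma abs_le_of_sum_sq {ι : Type*} [Fintype ι] {x : ι → ℝ} {A : ℝ} (hA : 0 ≤ A) (h : |∑ k, x k ^ 2 - 1| ≤ A) (k : ι) :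
    |x k| ≤ 1 + A := by
  have h1 := Finset.single_le_sum (f := fun k => x k ^ 2) (fun k _ => sq_nonneg (x k)) (Finset.mem_univ k)
  have h2 := (abs_le.1 h).2
  apply abs_le_of_sq_le_sq _ (by linarith)
  nlinarith

lemma sum_sq_perturb {ι : Type*} [Fintype ι] {x y : ι → ℝ} {A δ : ℝ} (hA : 0 ≤ A) (hδ : δ ≤ 1)
    (h : |∑ k, x k ^ 2 - 1| ≤ A * δ) (hxy : ∀ k, |y k - x k| ≤ δ) :
    |∑ k, y k ^ 2 - 1| ≤ (A + Fintype.card ι * (2 * A + 3)) * δ := by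
  by_cases hι : IsEmpty ι
  · simp only [Finset.univ_eq_empty, Finset.sum_empty] at h ⊢
    simpa using h
  · rw [not_isEmpty_iff] at hι
    have hδ0 : 0 ≤ δ := (abs_nonneg _).trans (hxy hι.some)
    have hx := abs_le_of_sum_sq hA (h.trans (mul_le_of_le_one_right hA hδ))
    have h1 : |∑ k, y k ^ 2 - ∑ k, x k ^ 2| ≤ Fintype.card ι * ((2 * A + 3) * δ) := by
      rw [← Finset.sum_sub_distrib, ← nsmul_eq_mul, ← Finset.card_univ, ← Finset.sum_const]
      refine (Finset.abs_sum_le_sum_abs _ _).trans (Finset.sum_le_sum fun k _ => ?_)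
      rw [show y k ^ 2 - x k ^ 2 = (y k - x k + 2 * x k) * (y k - x k) by ring, abs_mul]
      refine mul_le_mul ?_ (hxy k) (abs_nonneg _) (by linarith)
      refine (abs_add_le _ _).trans ?_
      rw [abs_mul, abs_two]
      linarith [hx k, hxy k]
    calc _ = |(∑ k, y k ^ 2 - ∑ k, x k ^ 2) + (∑ k, x k ^ 2 - 1)| := by congr 1; ring
      _ ≤ _ := (abs_add_le _ _).trans (by linarith)

lemma KakeyaEnergy.loc {n : ℕ} (h : KakeyaEnergy n) : KakeyaEnergyLoc n := by
  intro A hA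
  obtain ⟨c, C, hc, hc1, hC, hK⟩ := h (A + Fintype.card (Fin (n + 1)) * (2 * A + 3)) (by positivity)
  obtain ⟨C₁, hC₁, hloc⟩ := exists_localize (Fin (n + 1))
  set W := ENNReal.ofReal ((4 ^ 1) ^ Fintype.card (Fin (n + 1))) * (∫⁻ s, wt (ι := Fin (n + 1)) 1 s) with hW
  refine ⟨c, C * C₁ * W, hc, hc1, ENNReal.mul_ne_top (ENNReal.mul_ne_top hC hC₁)
    (ENNReal.mul_ne_top ENNReal.ofReal_ne_top (lintegral_wt_lt_top le_rfl).ne), ?_⟩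
  intro R hR Ξ _ ν _ φ g hg hφ hs μ _ H hH
  have hR0 : 0 < R := by linarith
  rw [lintegral_cube hR0]
  have key : ∀ b : Fin (n + 1) → ℤ, ∫⁻ x in cube R b, msq (osc ν φ g) x ∂μ ≤
      C * C₁ * H * ENNReal.ofReal (R ^ (-c)) * (ENNReal.ofReal (R ^ Fintype.card (Fin (n + 1))) *
        avg 1 R (msq (osc ν φ g)) (fun k => R * b k)) := by
    intro b
    obtain ⟨φ', g', hg', hφ', hs', hle, hint⟩ := hloc Ξ ν φ g hg hφ R (fun k => R * b k) hR0
    have hsub : cube R b ⊆ closedBall (fun k => R * b k) R := fun x hx => by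
      rw [mem_closedBall, dist_pi_le_iff hR0.le]
      exact fun k => abs_sub_le_of_mem_cube hx k
    calc ∫⁻ x in cube R b, msq (osc ν φ g) x ∂μ ≤ ∫⁻ x in cube R b, msq (osc (ν.prod volume) φ' g') x ∂μ :=
          setLIntegral_mono' (measurableSet_cube b) fun x hx => hle x fun k => abs_sub_le_of_mem_cube hx k
      _ ≤ C * H * ENNReal.ofReal (R ^ (-c)) * ∫⁻ x, msq (osc (ν.prod volume) φ' g') x := by
          refine hK R hR (Ξ × (Fin (n + 1) → ℝ)) (ν.prod volume) φ' g' hg' hφ' ?_ (μ.restrict (cube R b)) H ?_ ?_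
          · intro p hp
            obtain ⟨h1, h2⟩ := hs' p hp
            rw [div_eq_mul_inv]
            exact sum_sq_perturb hA.le (inv_le_one_of_one_le₀ hR) (by rw [← div_eq_mul_inv]; exact hs _ h1) h2
          · exact fun x r h1 h2 => (Measure.restrict_apply_le _ _).trans (hH x r h1 h2)
          · rw [Measure.restrict_apply_univ]
            exact (measure_mono hsub).trans (hH _ R hR le_rfl)
      _ ≤ C * H * ENNReal.ofReal (R ^ (-c)) * (C₁ * (ENNReal.ofReal (R ^ Fintype.card (Fin (n + 1))) *
            avg 1 R (msq (osc ν φ g)) (fun k => R * b k))) := mul_le_mul' le_rfl hint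
      _ = _ := by ring
  refine (ENNReal.tsum_le_tsum key).trans ?_
  rw [ENNReal.tsum_mul_left]
  refine (mul_le_mul' le_rfl (tsum_avg_le hR0 (measurable_msq_osc hg hφ))).trans (le_of_eq ?_)
  rw [← hW]; ring

lemma lintegral_avg_le {ι : Type*} [Fintype ι] {N : ℕ} {T : ℝ} (hT : 1 ≤ T) {G : (ι → ℝ) → ℝ≥0∞} (hG : Measurable G)
    {μ : Measure (ι → ℝ)} [SFinite μ] {H : ℝ≥0∞} (hμ : ∀ x, μ (closedBall x 1) ≤ H) :
    ∫⁻ x, avg N T G x ∂μ ≤ ENNReal.ofReal ((4 ^ N) ^ Fintype.card ι) * (∫⁻ s, wt (ι := ι) N s) * H * ∫⁻ x, G x := by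
  have h1 := lintegral_le_of_local volume μ (measurable_avg (N := N) (T := T) hG) (r := 1) (v := 1)
    (A := ENNReal.ofReal ((4 ^ N) ^ Fintype.card ι))
    (fun x => by
      rw [Real.volume_pi_closedBall _ zero_le_one, ENNReal.one_le_ofReal]
      exact one_le_pow₀ (by norm_num))
    (fun x y h => avg_local (by linarith) hG fun k =>
      ((Real.dist_eq _ _).symm.le.trans (dist_le_pi_dist x y k)).trans (h.trans hT))
  rw [one_mul] at h1
  refine h1.trans ?_
  calc _ ≤ ENNReal.ofReal ((4 ^ N) ^ Fintype.card ι) * ∫⁻ y, avg N T G y * H :=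
        mul_le_mul' le_rfl (lintegral_mono fun y => mul_le_mul' le_rfl (hμ y))
    _ = _ := by rw [lintegral_mul_const _ (measurable_avg hG), lintegral_avg hG]; ring

lemma msq_sum_le {X Q : Type*} (s : Finset Q) (f : Q → X → ℂ) (x : X) :
    msq (fun x => ∑ q ∈ s, f q x) x ≤ s.card * ∑ q ∈ s, msq (f q) x := by
  have h : ∀ z : ℂ, ‖z‖ₑ ^ 2 = ENNReal.ofReal (‖z‖ ^ 2) := fun z => by
    rw [← ofReal_norm, ENNReal.ofReal_pow (norm_nonneg _)]
  simp only [msq, h]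
  rw [← ENNReal.ofReal_sum_of_nonneg fun _ _ => sq_nonneg _, ← ENNReal.ofReal_natCast,
    ← ENNReal.ofReal_mul (by positivity)]
  refine ENNReal.ofReal_le_ofReal ?_
  exact (pow_le_pow_left₀ (norm_nonneg _) (norm_sum_le _ _) 2).trans sq_sum_le_card_mul_sum_sq

lemma msq_add_le {X : Type*} (f f' : X → ℂ) (x : X) :
    msq (fun x => f x + f' x) x ≤ 2 * (msq f x + msq f' x) := by
  have := msq_sum_le Finset.univ (fun b : Bool => if b then f else f') x
  simpa using this

lemma card_le_of_near {ι : Type*} [Fintype ι] [DecidableEq ι] {P : Finset (ι → ℤ)} {q : ι → ℤ} {n : ℕ}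
    (h : ∀ q' ∈ P, ∀ k, |(q k : ℝ) - q' k| ≤ n) : P.card ≤ (2 * n + 1) ^ Fintype.card ι := by
  refine le_trans (Finset.card_le_card fun q' hq' => ?_) (card_near_le P q n)
  exact Finset.mem_filter.2 ⟨hq', fun k => by exact_mod_cast h q' hq' k⟩

lemma kakeyaEnergy_zero : KakeyaEnergy 0 := by
  intro A hA
  obtain ⟨C₁, hC₁, hrep⟩ := exists_repro (Fin 1) 1 le_rfl
  obtain ⟨C₂, hC₂, hbes⟩ := exists_bessel_lintegral (Fin 1)
  set n₀ : ℕ := ⌈2 * A + 2⌉₊ with hn₀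
  have hn : 2 * A + 2 ≤ n₀ := Nat.le_ceil _
  set M : ℕ := 2 * (2 * n₀ + 1) with hM
  refine ⟨1, M * C₁ * C₂, one_pos, le_rfl,
    ENNReal.mul_ne_top (ENNReal.mul_ne_top (ENNReal.natCast_ne_top _) hC₁) hC₂, ?_⟩
  intro R hR Ξ _ ν _ φ g hg hφ hs μ _ H _ hH
  have hR0 : 0 < R := by linarith
  set T := R / 2 with hT
  have hTR : 2 * T = R := by rw [hT]; ring
  have hsupp : ∀ ξ, g ξ ≠ 0 → |R * |φ ξ 0| - R| ≤ A := fun ξ h => by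
    have h1 := hs ξ h
    rw [Fin.sum_univ_one, le_div_iff₀ hR0] at h1
    have h2 : φ ξ 0 ^ 2 - 1 = (|φ ξ 0| - 1) * (|φ ξ 0| + 1) := by rw [← sq_abs]; ring
    rw [h2, abs_mul, abs_of_nonneg (by positivity : 0 ≤ |φ ξ 0| + 1)] at h1
    rw [show R * |φ ξ 0| - R = R * (|φ ξ 0| - 1) by ring, abs_mul, abs_of_pos hR0]
    nlinarith [abs_nonneg (|φ ξ 0| - 1), abs_nonneg (φ ξ 0), mul_nonneg (mul_nonneg (abs_nonneg (|φ ξ 0| - 1)) (abs_nonneg (φ ξ 0))) hR0.le]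
  set m : ℕ := ⌈R + A⌉₊ with hm
  set Q := Fintype.piFinset (fun _ : Fin 1 => Finset.Icc (-(m : ℤ)) m) with hQ
  classical
  set Q' := Q.filter fun q => ∃ ξ, cap T φ g q ξ ≠ 0 with hQ'
  have hsum : ∀ ξ, ∑ q ∈ Q', cap T φ g q ξ = g ξ := fun ξ => by
    rw [hQ', Finset.sum_filter_of_ne fun q _ h => ⟨ξ, h⟩]
    refine sum_cap (fun ξ h k => ?_) ξ
    rw [Subsingleton.elim k 0, hTR, abs_mul, abs_of_pos hR0]
    linarith [(abs_le.1 (hsupp ξ h)).2, Nat.le_ceil (R + A)]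
  have hq : ∀ q ∈ Q', |(|(q 0 : ℝ)|) - R| ≤ A + 1 := fun q h => by
    obtain ⟨ξ, h1⟩ := (Finset.mem_filter.1 h).2
    obtain ⟨h2, h3⟩ := cap_supp h1
    have h4 := hsupp ξ h2
    have h5 := h3 0
    rw [hTR] at h5
    have h6 := (abs_abs_sub_abs_le (R * φ ξ 0) (q 0)).trans h5.le
    rw [abs_mul, abs_of_pos hR0] at h6
    rw [abs_le] at h4 h6 ⊢
    constructor <;> linarith [h4.1, h4.2, h6.1, h6.2]
  have hhalf : ∀ P : Finset (Fin 1 → ℤ), P ⊆ Q' → (∀ q ∈ P, ∀ q' ∈ P, |(q 0 : ℝ) - q' 0| = |(|(q 0 : ℝ)|) - (|(q' 0 : ℝ)|)|) →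
      P.card ≤ 2 * n₀ + 1 := by
    intro P hP hPs
    rcases P.eq_empty_or_nonempty with rfl | ⟨q, hqP⟩
    · simp
    have h1 : P.card ≤ (2 * n₀ + 1) ^ Fintype.card (Fin 1) := card_le_of_near (q := q) fun q' hq' k => ?_
    · rwa [Fintype.card_fin, pow_one] at h1
    rw [Subsingleton.elim k 0]
    have h2 := hq q (hP hqP)
    have h3 := hq q' (hP hq')
    rw [hPs q hqP q' hq', abs_le]
    rw [abs_le] at h2 h3
    constructor <;> linarith [h2.1, h2.2, h3.1, h3.2]
  have hcard : Q'.card ≤ M := by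
    rw [← Finset.card_filter_add_card_filter_not (s := Q') (fun q => 0 ≤ q 0), hM, two_mul (2 * n₀ + 1)]
    refine add_le_add (hhalf _ (Finset.filter_subset _ _) ?_) (hhalf _ (Finset.filter_subset _ _) ?_)
    · intro q h q' h'
      have h1 : (0:ℝ) ≤ q 0 := by exact_mod_cast (Finset.mem_filter.1 h).2
      have h2 : (0:ℝ) ≤ q' 0 := by exact_mod_cast (Finset.mem_filter.1 h').2
      rw [abs_of_nonneg h1, abs_of_nonneg h2]
    · intro q h q' h'
      have h1 : (q 0 : ℝ) < 0 := by exact_mod_cast not_le.1 (Finset.mem_filter.1 h).2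
      have h2 : (q' 0 : ℝ) < 0 := by exact_mod_cast not_le.1 (Finset.mem_filter.1 h').2
      rw [abs_of_neg h1, abs_of_neg h2, abs_sub_comm]
      congr 1; ring
  have hpt : ∀ x, msq (osc ν φ g) x ≤ M * C₁ * C₂ * ENNReal.ofReal (R ^ (-1:ℝ)) * ∫⁻ x, msq (osc ν φ g) x := by
    intro x
    have e : osc ν φ g = fun x => ∑ q ∈ Q', osc ν φ (cap T φ g q) x := by
      ext x
      rw [← osc_sum _ _ (fun q _ => integrable_cap hg hφ T q) hφ]
      congr 1; ext ξ; exact (hsum ξ).symm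
    calc msq (osc ν φ g) x ≤ M * ∑ q ∈ Q', C₁ * (ENNReal.ofReal ((R ^ Fintype.card (Fin 1))⁻¹) * ∫⁻ x, msq (osc ν φ (cap T φ g q)) x) := by
          conv_lhs => rw [e]
          refine (msq_sum_le _ _ _).trans (mul_le_mul' (by exact_mod_cast hcard) (Finset.sum_le_sum fun q _ => ?_))
          have hi := integrable_cap hg hφ T q
          refine (hrep Ξ ν φ _ hi hφ R (fun k => q k / R) (fun ξ h k => ?_) x).trans
            (mul_le_mul' le_rfl (avg_le_lintegral hR0 (measurable_msq_osc hi hφ) x))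
          have := (cap_supp h).2 k
          rw [hTR] at this
          rw [mul_sub, mul_div_cancel₀ _ hR0.ne']
          linarith
      _ = M * C₁ * ENNReal.ofReal (R ^ (-1:ℝ)) * ∑ q ∈ Q', ∫⁻ x, msq (osc ν φ (cap T φ g q)) x := by
          rw [Fintype.card_fin, pow_one, Real.rpow_neg_one, ← Finset.mul_sum, ← Finset.mul_sum]
          ring
      _ ≤ M * C₁ * ENNReal.ofReal (R ^ (-1:ℝ)) * (C₂ * ∫⁻ x, msq (osc ν φ g) x) :=
          mul_le_mul' le_rfl (hbes Ξ ν φ g hg hφ T Q')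
      _ = _ := by ring
  calc _ ≤ ∫⁻ _, (M * C₁ * C₂ * ENNReal.ofReal (R ^ (-1:ℝ)) * ∫⁻ x, msq (osc ν φ g) x) ∂μ := lintegral_mono hpt
    _ = (M * C₁ * C₂ * ENNReal.ofReal (R ^ (-1:ℝ)) * ∫⁻ x, msq (osc ν φ g) x) * μ univ := lintegral_const _
    _ ≤ (M * C₁ * C₂ * ENNReal.ofReal (R ^ (-1:ℝ)) * ∫⁻ x, msq (osc ν φ g) x) * (H * ENNReal.ofReal (R ^ 0)) :=
        mul_le_mul' le_rfl hH
    _ = _ := by rw [pow_zero, ENNReal.ofReal_one]; ring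

lemma measure_closedBall_le {ι : Type*} [Fintype ι] {μ : Measure (ι → ℝ)} {r : ℝ} (hr : 0 < r) {H : ℝ≥0∞}
    (hμ : ∀ x, μ (closedBall x r) ≤ H) (m : ℕ) (z : ι → ℝ) :
    μ (closedBall z (m * r)) ≤ ((2 * m + 1) ^ Fintype.card ι : ℕ) * H := by
  classical
  set S := Fintype.piFinset fun _ : ι => Finset.Icc (-(m : ℤ)) m with hS
  have hcov : closedBall z (m * r) ⊆ ⋃ k ∈ S, closedBall (fun i => z i + r * k i) r := by
    intro x hx
    rw [mem_closedBall, dist_pi_le_iff (by positivity)] at hx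
    refine mem_iUnion₂.2 ⟨fun i => round ((x i - z i) / r), ?_, ?_⟩
    · refine Fintype.mem_piFinset.2 fun i => ?_
      have h1 := abs_sub_round ((x i - z i) / r)
      have h2 : |(x i - z i) / r| ≤ m := by
        rw [abs_div, abs_of_pos hr, div_le_iff₀ hr]; exact hx i
      rw [abs_le] at h1 h2
      refine Finset.mem_Icc.2 ⟨Int.lt_add_one_iff.1 ?_, Int.lt_add_one_iff.1 ?_⟩
      · have : ((-(m : ℤ) : ℤ) : ℝ) < ((round ((x i - z i) / r) + 1 : ℤ) : ℝ) := by push_cast; linarith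
        exact_mod_cast this
      · have : (round ((x i - z i) / r) : ℝ) < ((m + 1 : ℤ) : ℝ) := by push_cast; linarith
        exact_mod_cast this
    · rw [mem_closedBall, dist_pi_le_iff hr.le]
      intro i
      have h1 := abs_sub_round ((x i - z i) / r)
      rw [Real.dist_eq]
      have h3 : x i - (z i + r * round ((x i - z i) / r)) = r * ((x i - z i) / r - round ((x i - z i) / r)) := by
        field_simp; ring
      rw [h3, abs_mul, abs_of_pos hr]
      nlinarith
  have hcard : S.card = (2 * m + 1) ^ Fintype.card ι := by
    rw [hS, Fintype.card_piFinset, Finset.prod_const, Finset.card_univ, Int.card_Icc]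
    congr 1; lia
  calc _ ≤ μ (⋃ k ∈ S, closedBall (fun i => z i + r * k i) r) := measure_mono hcov
    _ ≤ ∑ k ∈ S, μ (closedBall (fun i => z i + r * k i) r) := measure_biUnion_finset_le _ _
    _ ≤ S.card • H := Finset.sum_le_card_nsmul _ _ _ fun k _ => hμ _
    _ = _ := by rw [hcard, nsmul_eq_mul]

lemma lintegral_comp_mulVec {ι : Type*} [Fintype ι] [DecidableEq ι] {W : Matrix ι ι ℝ} (hW : W.det ≠ 0)
    {F : (ι → ℝ) → ℝ≥0∞} (hF : Measurable F) :
    ∫⁻ x, F (W.mulVec x) = ENNReal.ofReal |W.det⁻¹| * ∫⁻ y, F y := by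
  have h := Real.map_matrix_volume_pi_eq_smul_volume_pi hW
  have hm : Measurable (Matrix.toLin' W) := (Matrix.toLin' W).continuous_of_finiteDimensional.measurable
  have h2 := lintegral_map (μ := volume) hF hm
  rw [h, lintegral_smul_measure] at h2
  exact h2.symm

lemma exists_orthogonal_matrix {n : ℕ} (e : Fin (n + 1) → ℝ) (he : ∑ k, e k ^ 2 = 1) :
    ∃ U : Matrix (Fin (n + 1)) (Fin (n + 1)) ℝ, U * U.transpose = 1 ∧ U 0 = e := by
  set v : Fin (n + 1) → EuclideanSpace ℝ (Fin (n + 1)) := fun _ => WithLp.toLp 2 e with hv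
  have hn : ‖WithLp.toLp 2 e‖ = 1 := by
    rw [EuclideanSpace.norm_eq, Real.sqrt_eq_one]
    simpa using he
  obtain ⟨b, hb⟩ := Orthonormal.exists_orthonormalBasis_extension_of_card_eq (𝕜 := ℝ)
    (ι := Fin (n + 1)) (E := EuclideanSpace ℝ (Fin (n + 1))) (by simp) (v := v) (s := {0}) (by
      constructor
      · intro i; exact hn
      · intro i j hij
        exact absurd (Subtype.ext (i.2.trans j.2.symm)) hij)
  refine ⟨Matrix.of fun i k => b i k, ?_, ?_⟩
  · ext i j
    rw [Matrix.mul_apply, Matrix.one_apply]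
    have := orthonormal_iff_ite.1 b.orthonormal i j
    rw [← this, PiLp.inner_apply]
    simp [Matrix.transpose_apply, mul_comm]
  · ext k
    change b 0 k = e k
    rw [hb 0 rfl]

lemma cw_div_le {K u s t : ℝ} (hK : 0 < K) (h : |t - s| ≤ K) : cw ((u - t) / K) ≤ 4 * cw ((u - s) / K) := by
  have h1 := cw_mul_le ((s - t) / K) ((u - t) / K)
  have h2 : 1 / 2 ≤ cw ((s - t) / K) := half_le_cw (by
    rw [abs_div, abs_of_pos hK, div_le_one hK, abs_sub_comm]; exact h)
  rw [show (u - t) / K - (s - t) / K = (u - s) / K by ring] at h1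
  nlinarith [cw_pos ((u - t) / K)]

lemma lintegral_cw_div {K : ℝ} (hK : 0 < K) (G : ℝ → ℝ≥0∞) (hG : Measurable G) (a : ℝ) :
    ∫⁻ s, G (a + K * s) * ENNReal.ofReal (cw s) =
      ENNReal.ofReal K⁻¹ * ∫⁻ u, G u * ENNReal.ofReal (cw ((u - a) / K)) := by
  have hc := continuous_cw.measurable
  set F : ℝ → ℝ≥0∞ := fun t => G (a + t) * ENNReal.ofReal (cw (t / K)) with hF
  have h := lintegral_map (μ := (volume : Measure ℝ)) (f := F) (by fun_prop) (measurable_const_mul K)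
  rw [Real.map_volume_mul_left hK.ne', lintegral_smul_measure, abs_of_pos (inv_pos.2 hK)] at h
  have h3 := lintegral_add_left_eq_self (μ := volume) (fun u => G u * ENNReal.ofReal (cw ((u - a) / K))) a
  simp only [add_sub_cancel_left] at h3
  rw [← h3]
  refine Eq.trans ?_ h.symm
  congr 1; ext s
  rw [hF]; dsimp only
  rw [mul_div_cancel_left₀ _ hK.ne']

/-- Fractal energy estimate near an equatorial slab of the sphere in dimension `n + 2`. -/
lemma KakeyaEnergyLoc.slab {n : ℕ} (h : KakeyaEnergyLoc n) (A : ℝ) (hA : 0 < A) :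
    ∃ (c : ℝ) (C : ℝ≥0∞), 0 < c ∧ c ≤ 1 ∧ C ≠ ⊤ ∧ ∀ K : ℝ, 1 ≤ K →
    ∀ (Ξ : Type) [MeasurableSpace Ξ] (ν : Measure Ξ) [SFinite ν] (φ : Ξ → Fin (n + 2) → ℝ) (g : Ξ → ℂ),
      Integrable g ν → Measurable φ → (∀ ξ, g ξ ≠ 0 → |φ ξ 0| ≤ 2 / K ∧ |∑ k, φ ξ k ^ 2 - 1| ≤ A / K) →
      ∀ (μ : Measure (Fin (n + 2) → ℝ)) [IsFiniteMeasure μ] (H : ℝ≥0∞),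
        (∀ x r, 1 ≤ r → r ≤ K → μ (closedBall x r) ≤ H * ENNReal.ofReal (r ^ (n + 1))) →
        ∫⁻ x, msq (osc ν φ g) x ∂μ ≤ C * H * ENNReal.ofReal (K ^ (-c)) * ∫⁻ x, msq (osc ν φ g) x := by
  obtain ⟨c, C, hc, hc1, hC, hK⟩ := h (A + 4) (by positivity)
  obtain ⟨C₁, hC₁, hrep⟩ := exists_repro_one 1 le_rfl
  set I := ∫⁻ s, ENNReal.ofReal (cw s) with hI
  have hIt : I ≠ ⊤ := integrable_cw.lintegral_lt_top.ne
  refine ⟨c, C₁ * C * (2 * I), hc, hc1, ENNReal.mul_ne_top (ENNReal.mul_ne_top hC₁ hC) (ENNReal.mul_ne_top (by simp) hIt), ?_⟩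
  intro K hK1 Ξ _ ν _ φ g hg hφ hs μ _ H hH
  have hK0 : 0 < K := by linarith
  have hcw : Measurable fun s => ENNReal.ofReal (cw s) := continuous_cw.measurable.ennreal_ofReal
  have hcons : Measurable fun p : ℝ × (Fin (n + 1) → ℝ) => (Fin.cons p.1 p.2 : Fin (n + 2) → ℝ) :=
    measurable_pi_lambda _ fun i => Fin.cases (by simpa using measurable_fst)
      (fun j => by simp only [Fin.cons_succ]; exact (measurable_pi_apply j).comp measurable_snd) i
  have htail : Measurable fun x : Fin (n + 2) → ℝ => Fin.tail x := measurable_pi_lambda _ fun _ => measurable_pi_apply _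
  have hf := measurable_msq_osc hg hφ
  -- the slice at height `u`
  set g' : ℝ → Ξ → ℂ := fun u ξ => g ξ * cis (u * φ ξ 0) with hg'
  have hφ0 : Measurable fun ξ => φ ξ 0 := (measurable_pi_apply _).comp hφ
  have hgi : ∀ u, Integrable (g' u) ν := fun u =>
    hg.mul_bdd (c := 1) (continuous_cis.measurable.comp (hφ0.const_mul u)).aestronglyMeasurable
      (Eventually.of_forall fun _ => (norm_cis _).le)
  have hslice : ∀ u y, osc ν φ g (Fin.cons u y : Fin (n + 2) → ℝ) = osc ν (fun ξ => Fin.tail (φ ξ)) (g' u) y := fun u y => by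
    unfold osc
    congr 1; ext ξ
    rw [Fin.sum_univ_succ, cis_add, hg', mul_assoc]
    simp [Fin.tail]
  -- the sliced measures
  set D : ℝ → Measure (Fin (n + 2) → ℝ) := fun u => μ.withDensity fun x => ENNReal.ofReal (cw ((u - x 0) / K)) with hD
  have hdm : ∀ u, Measurable fun x : Fin (n + 2) → ℝ => ENNReal.ofReal (cw ((u - x 0) / K)) := fun u =>
    hcw.comp ((measurable_const.sub (measurable_pi_apply _)).div_const _)
  have hDf : ∀ u, IsFiniteMeasure (D u) := fun u => isFiniteMeasure_withDensity (by
    refine ((lintegral_mono fun x => ENNReal.ofReal_le_one.2 (cw_le_one _)).trans_lt ?_).ne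
    rw [lintegral_one]; exact measure_lt_top μ univ)
  have hGm : ∀ u, Measurable fun t => ENNReal.ofReal (cw ((u - t) / K)) := fun u =>
    hcw.comp ((measurable_const.sub measurable_id).div_const _)
  have hball : ∀ u y r, 1 ≤ r → r ≤ K → (D u).map Fin.tail (closedBall y r) ≤ (2 * I * ENNReal.ofReal K * H) * ENNReal.ofReal (r ^ n) := by
    intro u y r hr hrK
    have hr0 : 0 < r := by linarith
    set S : Set (Fin (n + 2) → ℝ) := Fin.tail ⁻¹' closedBall y r with hS
    have hSm : MeasurableSet S := htail isClosed_closedBall.measurableSet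
    rw [Measure.map_apply htail isClosed_closedBall.measurableSet, hD, withDensity_apply _ hSm]
    have h1 := lintegral_le_of_local volume ((μ.restrict S).map fun x => x 0) (r := r) (v := ENNReal.ofReal (2 * r)) (A := 4)
      (G := fun t => ENNReal.ofReal (cw ((u - t) / K))) (hGm u) (fun x => by rw [Real.volume_closedBall])
      (fun s t hst => by
        rw [show (4 : ℝ≥0∞) = ENNReal.ofReal 4 by simp, ← ENNReal.ofReal_mul (by norm_num)]
        exact ENNReal.ofReal_le_ofReal (cw_div_le hK0 ((Real.dist_eq s t).symm.le.trans (hst.trans hrK))))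
    rw [lintegral_map (hGm u) (measurable_pi_apply _)] at h1
    have h2 : ∀ t, (μ.restrict S).map (fun x => x 0) (closedBall t r) ≤ H * ENNReal.ofReal (r ^ (n + 1)) := fun t => by
      rw [Measure.map_apply (measurable_pi_apply _) isClosed_closedBall.measurableSet,
        Measure.restrict_apply (measurable_pi_apply _ isClosed_closedBall.measurableSet)]
      refine (measure_mono fun x hx => ?_).trans (hH (Fin.cons t y) r hr hrK)
      rw [mem_closedBall, dist_pi_le_iff hr0.le]
      refine Fin.cases ?_ fun j => ?_
      · simpa using hx.1
      · have := hx.2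
        rw [hS, mem_preimage, mem_closedBall, dist_pi_le_iff hr0.le] at this
        simpa [Fin.tail] using this j
    have h3 : ∫⁻ t, ENNReal.ofReal (cw ((u - t) / K)) = ENNReal.ofReal K * I := by
      have h4 := lintegral_cw_div hK0 (fun _ => 1) measurable_const u
      simp only [one_mul] at h4
      rw [hI, h4, ← mul_assoc, ← ENNReal.ofReal_mul hK0.le, mul_inv_cancel₀ hK0.ne', ENNReal.ofReal_one, one_mul]
      congr 1; ext t
      rw [show (u - t) / K = -((t - u) / K) by ring, cw_neg]
    have h5 : ENNReal.ofReal (2 * r) * ∫⁻ x in S, ENNReal.ofReal (cw ((u - x 0) / K)) ∂μ ≤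
        ENNReal.ofReal (2 * r) * ((2 * I * ENNReal.ofReal K * H) * ENNReal.ofReal (r ^ n)) := by
      refine h1.trans ?_
      calc _ ≤ 4 * ∫⁻ t, ENNReal.ofReal (cw ((u - t) / K)) * (H * ENNReal.ofReal (r ^ (n + 1))) :=
            mul_le_mul' le_rfl (lintegral_mono fun t => mul_le_mul' le_rfl (h2 t))
        _ = _ := by
          rw [lintegral_mul_const _ (hGm u), h3, pow_succ, ENNReal.ofReal_mul (by positivity),
            ENNReal.ofReal_mul (by norm_num : (0:ℝ) ≤ 2), ENNReal.ofReal_ofNat]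
          ring
    exact (ENNReal.mul_le_mul_iff_right (by simpa using hr0) ENNReal.ofReal_ne_top).1 h5
  have hslab : ∀ u, ∫⁻ x, msq (osc ν φ g) (Fin.cons u (Fin.tail x) : Fin (n + 2) → ℝ) * ENNReal.ofReal (cw ((u - x 0) / K)) ∂μ ≤
      C * (2 * I * ENNReal.ofReal K * H) * ENNReal.ofReal (K ^ (-c)) * ∫⁻ y, msq (osc ν φ g) (Fin.cons u y : Fin (n + 2) → ℝ) := by
    intro u
    have hsm : Measurable fun y => msq (osc ν φ g) (Fin.cons u y : Fin (n + 2) → ℝ) :=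
      hf.comp (hcons.comp measurable_prodMk_left)
    have h1 := hK K hK1 Ξ ν (fun ξ => Fin.tail (φ ξ)) (g' u) (hgi u) (htail.comp hφ) (fun ξ h => by
      obtain ⟨h0, h2⟩ := hs ξ (left_ne_zero_of_mul h)
      rw [Fin.sum_univ_succ] at h2
      have h3 : φ ξ 0 ^ 2 ≤ 4 / K := by
        rw [← sq_abs]
        calc _ ≤ (2 / K) ^ 2 := pow_le_pow_left₀ (abs_nonneg _) h0 2
          _ = 4 / K * (1 / K) := by ring
          _ ≤ 4 / K * 1 := mul_le_mul_of_nonneg_left ((div_le_one hK0).2 hK1) (by positivity)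
          _ = _ := mul_one _
      have h4 := sq_nonneg (φ ξ 0)
      rw [add_div]
      rw [abs_le] at h2 ⊢
      simp only [Fin.tail]
      have : 0 ≤ 4 / K := by positivity
      constructor <;> linarith [h2.1, h2.2]) ((D u).map Fin.tail) _ (hball u)
    have hm' : Measurable (msq (osc ν (fun ξ => Fin.tail (φ ξ)) (g' u))) := measurable_msq_osc (hgi u) (htail.comp hφ)
    have hmt : Measurable fun x : Fin (n + 2) → ℝ => msq (osc ν (fun ξ => Fin.tail (φ ξ)) (g' u)) (Fin.tail x) := hm'.comp htail
    rw [lintegral_map hm' htail, lintegral_withDensity_eq_lintegral_mul _ (hdm u) hmt] at h1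
    have h2 : ∀ y, msq (osc ν (fun ξ => Fin.tail (φ ξ)) (g' u)) y = msq (osc ν φ g) (Fin.cons u y : Fin (n + 2) → ℝ) := fun y => by
      simp only [msq, hslice]
    simp only [Pi.mul_apply, h2] at h1
    simpa only [mul_comm (ENNReal.ofReal (cw _))] using h1
  have hvol : ∫⁻ u, ∫⁻ y, msq (osc ν φ g) (Fin.cons u y : Fin (n + 2) → ℝ) = ∫⁻ x, msq (osc ν φ g) x := by
    have h1 := (volume_preserving_piFinSuccAbove (fun _ : Fin (n + 2) => ℝ) 0).symm.lintegral_comp hf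
    rw [← h1, Measure.volume_eq_prod, lintegral_prod _ (by
      exact (hf.comp (MeasurableEquiv.piFinSuccAbove (fun _ : Fin (n + 2) => ℝ) 0).symm.measurable).aemeasurable)]
    congr 1; ext u; congr 1; ext y
    congr 1
    exact (Fin.insertNth_zero _ _).symm
  have hpt : ∀ x : Fin (n + 2) → ℝ, msq (osc ν φ g) x ≤ C₁ * (ENNReal.ofReal K⁻¹ *
      ∫⁻ u, msq (osc ν φ g) (Fin.cons u (Fin.tail x) : Fin (n + 2) → ℝ) * ENNReal.ofReal (cw ((u - x 0) / K))) := fun x => by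
    have h1 := hrep (Fin (n + 2)) Ξ ν φ g hg hφ K 0 0 (fun ξ h => by
      rw [sub_zero, abs_mul, abs_of_pos hK0, mul_comm, ← le_div_iff₀ hK0]; exact (hs ξ h).1) x
    refine h1.trans (mul_le_mul' le_rfl ?_)
    rw [← lintegral_cw_div hK0 (fun u => msq (osc ν φ g) (Fin.cons u (Fin.tail x) : Fin (n + 2) → ℝ))
      (hf.comp (hcons.comp (measurable_id.prodMk measurable_const))) (x 0)]
    refine lintegral_mono fun s => ?_
    rw [pow_one]
    refine mul_le_mul' (le_of_eq ?_) le_rfl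
    congr 1
    ext i
    refine Fin.cases ?_ (fun j => ?_) i
    · simp
    · simp [Fin.tail, Fin.succ_ne_zero]
  have hm : Measurable (Function.uncurry fun (x : Fin (n + 2) → ℝ) (u : ℝ) =>
      msq (osc ν φ g) (Fin.cons u (Fin.tail x) : Fin (n + 2) → ℝ) * ENNReal.ofReal (cw ((u - x 0) / K))) :=
    (hf.comp (hcons.comp (measurable_snd.prodMk (htail.comp measurable_fst)))).mul
      (hcw.comp ((measurable_snd.sub ((measurable_pi_apply _).comp measurable_fst)).div_const _))
  calc _ ≤ ∫⁻ x, C₁ * (ENNReal.ofReal K⁻¹ *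
      ∫⁻ u, msq (osc ν φ g) (Fin.cons u (Fin.tail x) : Fin (n + 2) → ℝ) * ENNReal.ofReal (cw ((u - x 0) / K))) ∂μ :=
        lintegral_mono hpt
    _ = C₁ * ENNReal.ofReal K⁻¹ * ∫⁻ u, ∫⁻ x, msq (osc ν φ g) (Fin.cons u (Fin.tail x) : Fin (n + 2) → ℝ) * ENNReal.ofReal (cw ((u - x 0) / K)) ∂μ := by
        have h1 := hm.lintegral_prod_right' (ν := volume)
        simp only [Function.uncurry] at h1
        rw [lintegral_const_mul _ (h1.const_mul _), lintegral_const_mul _ h1, lintegral_lintegral_swap hm.aemeasurable, mul_assoc]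
    _ ≤ C₁ * ENNReal.ofReal K⁻¹ * ∫⁻ u, C * (2 * I * ENNReal.ofReal K * H) * ENNReal.ofReal (K ^ (-c)) *
          ∫⁻ y, msq (osc ν φ g) (Fin.cons u y : Fin (n + 2) → ℝ) :=
        mul_le_mul' le_rfl (lintegral_mono hslab)
    _ = C₁ * ENNReal.ofReal K⁻¹ * (C * (2 * I * ENNReal.ofReal K * H) * ENNReal.ofReal (K ^ (-c)) * ∫⁻ x, msq (osc ν φ g) x) := by
        rw [lintegral_const_mul, hvol]
        exact (hf.comp hcons).lintegral_prod_right'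
    _ = (ENNReal.ofReal K⁻¹ * ENNReal.ofReal K) * (C₁ * C * (2 * I) * H * ENNReal.ofReal (K ^ (-c)) * ∫⁻ x, msq (osc ν φ g) x) := by ring
    _ = _ := by rw [← ENNReal.ofReal_mul (by positivity), inv_mul_cancel₀ hK0.ne', ENNReal.ofReal_one, one_mul]

lemma sum_mulVec_transpose_mul {ι : Type*} [Fintype ι] (U : Matrix ι ι ℝ) (y z : ι → ℝ) :
    ∑ k, U.transpose.mulVec y k * z k = ∑ i, y i * U.mulVec z i := by
  have := Matrix.dotProduct_mulVec y U z
  rw [← Matrix.mulVec_transpose] at this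
  exact this.symm

lemma measurable_mulVec {ι : Type*} [Fintype ι] (U : Matrix ι ι ℝ) : Measurable U.mulVec := by
  classical
  exact (Matrix.toLin' U).continuous_of_finiteDimensional.measurable

/-- Fractal energy estimate near an equatorial slab with arbitrary normal. -/
lemma KakeyaEnergyLoc.narrow {n : ℕ} (h : KakeyaEnergyLoc n) (A : ℝ) (hA : 0 < A) :
    ∃ (c : ℝ) (C : ℝ≥0∞), 0 < c ∧ c ≤ 1 ∧ C ≠ ⊤ ∧ ∀ K : ℝ, 1 ≤ K →
    ∀ (Ξ : Type) [MeasurableSpace Ξ] (ν : Measure Ξ) [SFinite ν] (φ : Ξ → Fin (n + 2) → ℝ) (g : Ξ → ℂ),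
      Integrable g ν → Measurable φ → ∀ e : Fin (n + 2) → ℝ, ∑ k, e k ^ 2 = 1 →
      (∀ ξ, g ξ ≠ 0 → |∑ k, e k * φ ξ k| ≤ 2 / K ∧ |∑ k, φ ξ k ^ 2 - 1| ≤ A / K) →
      ∀ (μ : Measure (Fin (n + 2) → ℝ)) [IsFiniteMeasure μ] (H : ℝ≥0∞),
        (∀ x r, 1 ≤ r → r ≤ K → μ (closedBall x r) ≤ H * ENNReal.ofReal (r ^ (n + 1))) →
        ∫⁻ x, msq (osc ν φ g) x ∂μ ≤ C * H * ENNReal.ofReal (K ^ (-c)) * ∫⁻ x, msq (osc ν φ g) x := by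
  obtain ⟨c, C, hc, hc1, hC, hK⟩ := h.slab A hA
  set m := (2 * (n + 2) + 1) ^ Fintype.card (Fin (n + 2)) with hm
  refine ⟨c, C * m, hc, hc1, ENNReal.mul_ne_top hC (ENNReal.natCast_ne_top _), ?_⟩
  intro K hK1 Ξ _ ν _ φ g hg hφ e he hs μ _ H hH
  obtain ⟨U, hU, hU0⟩ := exists_orthogonal_matrix e he
  have hU' : U.transpose * U = 1 := mul_eq_one_comm.1 hU
  have hdet : |U.det| = 1 := by
    have := congrArg Matrix.det hU
    rw [Matrix.det_mul, Matrix.det_transpose, Matrix.det_one, ← abs_mul_abs_self] at this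
    nlinarith [abs_nonneg U.det]
  have hfeq : ∀ x, osc ν φ g x = osc ν (fun ξ => U.mulVec (φ ξ)) g (U.mulVec x) := fun x => by
    unfold osc
    congr 1; ext ξ
    rw [← sum_mulVec_transpose_mul, Matrix.mulVec_mulVec, hU', Matrix.one_mulVec]
  have hφ' : Measurable fun ξ => U.mulVec (φ ξ) := (measurable_mulVec U).comp hφ
  have hmf := measurable_msq_osc hg hφ'
  have hfm : ∀ x, msq (osc ν φ g) x = msq (osc ν (fun ξ => U.mulVec (φ ξ)) g) (U.mulVec x) := fun x => by
    simp only [msq, hfeq]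
  have hball : ∀ x r, 1 ≤ r → r ≤ K → μ.map U.mulVec (closedBall x r) ≤ m * H * ENNReal.ofReal (r ^ (n + 1)) := by
    intro x r hr hrK
    rw [Measure.map_apply (measurable_mulVec U) isClosed_closedBall.measurableSet, mul_assoc]
    refine (measure_mono fun y hy => ?_).trans
      (measure_closedBall_le (by linarith) (fun z => hH z r hr hrK) (n + 2) (U.transpose.mulVec x))
    rw [mem_preimage, mem_closedBall, dist_pi_le_iff (by linarith)] at hy
    rw [mem_closedBall, dist_pi_le_iff (by positivity)]
    intro k
    have h1 : y k - U.transpose.mulVec x k = ∑ i, U i k * (U.mulVec y i - x i) := by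
      have h2 : y = U.transpose.mulVec (U.mulVec y) := by rw [Matrix.mulVec_mulVec, hU', Matrix.one_mulVec]
      conv_lhs => rw [h2]
      simp only [Matrix.mulVec, dotProduct, Matrix.transpose_apply, ← Finset.sum_sub_distrib, mul_sub]
    have hent : ∀ i, |U i k| ≤ 1 := fun i => by
      have h3 := congrFun (congrFun hU' k) k
      rw [Matrix.mul_apply, Matrix.one_apply_eq] at h3
      have h4 := Finset.single_le_sum (f := fun i => U.transpose k i * U i k) (fun i _ => mul_self_nonneg (U i k)) (Finset.mem_univ i)
      rw [h3] at h4
      exact abs_le_one_iff_mul_self_le_one.2 h4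
    rw [Real.dist_eq, h1]
    refine (Finset.abs_sum_le_sum_abs _ _).trans ((Finset.sum_le_card_nsmul _ _ r fun i _ => ?_).trans (le_of_eq (by simp; left; ring)))
    rw [abs_mul]
    have := hy i
    rw [Real.dist_eq] at this
    nlinarith [abs_nonneg (U i k), abs_nonneg (U.mulVec y i - x i), hent i]
  have h1 := hK K hK1 Ξ ν (fun ξ => U.mulVec (φ ξ)) g hg hφ' (fun ξ h => by
    obtain ⟨h2, h3⟩ := hs ξ h
    refine ⟨?_, ?_⟩
    · simpa only [Matrix.mulVec, hU0, dotProduct] using h2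
    · have h4 := sum_mulVec_transpose_mul U (U.mulVec (φ ξ)) (φ ξ)
      rw [Matrix.mulVec_mulVec, hU', Matrix.one_mulVec] at h4
      simp only [sq] at h3 ⊢
      rwa [← h4]) (μ.map U.mulVec) _ hball
  rw [lintegral_map hmf (measurable_mulVec U)] at h1
  have h5 := lintegral_comp_mulVec (W := U) (fun h => by rw [h] at hdet; simp at hdet) hmf
  rw [abs_inv, hdet, inv_one, ENNReal.ofReal_one, one_mul] at h5
  simp only [hfm]
  rw [h5]
  refine h1.trans (le_of_eq ?_)
  ring

lemma exists_transversal {m : ℕ} (S : Finset (Fin m → ℝ)) {K : ℝ} (hK : 0 < K)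
    (h : ∀ e : Fin m → ℝ, ∑ k, e k ^ 2 = 1 → ∃ ω ∈ S, 1 / K < |∑ k, e k * ω k|) :
    ∃ w : Matrix (Fin m) (Fin m) ℝ, (∀ i, w i ∈ S) ∧ w.det ≠ 0 ∧ ∀ (y : Fin m → ℝ) (M : ℝ),
      (∀ i, |w.mulVec y i| ≤ M) → ∀ k, |y k| ≤ K * m * M := by
  have h' : ∀ y : Fin m → ℝ, y ≠ 0 → ∃ ω ∈ S, √(∑ k, y k ^ 2) < K * |∑ k, y k * ω k| := by
    intro y hy
    have hpos : 0 < ∑ k, y k ^ 2 := by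
      obtain ⟨k, hk⟩ := Function.ne_iff.1 hy
      exact Finset.sum_pos' (fun _ _ => sq_nonneg _) ⟨k, Finset.mem_univ _, sq_pos_of_ne_zero hk⟩
    set s := √(∑ k, y k ^ 2) with hs
    have hs0 : 0 < s := Real.sqrt_pos.2 hpos
    obtain ⟨ω, hω, h1⟩ := h (fun k => y k / s) (by
      simp only [div_pow, ← Finset.sum_div]
      rw [hs, Real.sq_sqrt hpos.le, div_self hpos.ne'])
    refine ⟨ω, hω, ?_⟩
    have h2 : ∑ k, y k / s * ω k = (∑ k, y k * ω k) / s := by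
      rw [Finset.sum_div]; congr 1; ext k; ring
    rw [h2, abs_div, abs_of_pos hs0, div_lt_div_iff₀ hK hs0] at h1
    linarith
  have hspan : Submodule.span ℝ (S : Set (Fin m → ℝ)) = ⊤ := by
    by_contra hne
    obtain ⟨f, hf, hle⟩ := Submodule.exists_le_ker_of_lt_top _ (lt_top_iff_ne_top.2 hne)
    have hfe : ∀ v, f v = ∑ k, f (fun j => if k = j then 1 else 0) * v k := fun v => by
      rw [LinearMap.pi_apply_eq_sum_univ f v]
      simp only [smul_eq_mul, mul_comm]
    have hy : (fun k => f (fun j => if k = j then 1 else 0)) ≠ 0 := fun h0 => hf (LinearMap.ext fun v => by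
      rw [hfe]
      exact Finset.sum_eq_zero fun k _ => by rw [show f (fun j => if k = j then 1 else 0) = 0 from congrFun h0 k, zero_mul])
    obtain ⟨ω, hω, h1⟩ := h' _ hy
    rw [← hfe, LinearMap.mem_ker.1 (hle (Submodule.subset_span hω)), abs_zero, mul_zero] at h1
    exact absurd h1 (Real.sqrt_nonneg _).not_gt
  obtain ⟨w₀, hw₀, hdet₀⟩ : ∃ w : Matrix (Fin m) (Fin m) ℝ, (∀ i, w i ∈ S) ∧ w.det ≠ 0 := by
    obtain ⟨b, hb, hbs, hli⟩ := exists_linearIndependent ℝ (S : Set (Fin m → ℝ))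
    rw [hspan] at hbs
    set B := Module.Basis.mk hli (by rw [Subtype.range_coe_subtype]; exact hbs.ge) with hB
    have : Finite b := Set.Finite.subset S.finite_toSet hb
    have : Fintype b := Fintype.ofFinite b
    have hc : Fintype.card b = Fintype.card (Fin m) := by
      rw [← Module.finrank_eq_card_basis B]; simp
    set σ := Fintype.equivOfCardEq hc
    refine ⟨Matrix.of fun i => (σ.symm i : Fin m → ℝ), fun i => hb (σ.symm i).2, ?_⟩
    have hli' : LinearIndependent ℝ (fun i => (σ.symm i : Fin m → ℝ)) := hli.comp _ σ.symm.injective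
    exact ((Matrix.isUnit_iff_isUnit_det _).1 (Matrix.linearIndependent_rows_iff_isUnit.1 hli')).ne_zero
  obtain ⟨w, hw, hmax⟩ := Finset.exists_max_image (Fintype.piFinset fun _ : Fin m => S)
    (fun w => |(Matrix.of w).det|) ⟨w₀, Fintype.mem_piFinset.2 hw₀⟩
  rw [Fintype.mem_piFinset] at hw
  have hdet : 0 < |(Matrix.of w).det| := (abs_pos.2 hdet₀).trans_le (hmax w₀ (Fintype.mem_piFinset.2 hw₀))
  refine ⟨Matrix.of w, hw, abs_pos.1 hdet, fun y M hM k => ?_⟩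
  by_cases hy : y = 0
  · have : 0 ≤ M := (abs_nonneg _).trans (hM k)
    rw [hy]; simp; positivity
  obtain ⟨ω, hω, h1⟩ := h' y hy
  have hc := Matrix.mulVec_cramer (Matrix.of w).transpose ω
  have hcr : ∀ i, |(Matrix.of w).transpose.cramer ω i| ≤ |(Matrix.of w).det| := fun i => by
    rw [Matrix.cramer_transpose_apply]
    refine hmax (Function.update w i ω) (Fintype.mem_piFinset.2 fun j => ?_)
    rcases eq_or_ne j i with rfl | hj
    · simpa using hω
    · simpa [hj] using hw j
  have h2 : (Matrix.of w).det * ∑ k, y k * ω k = ∑ i, (Matrix.of w).transpose.cramer ω i * (Matrix.of w).mulVec y i := by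
    rw [← sum_mulVec_transpose_mul, hc, Matrix.det_transpose, Finset.mul_sum]
    refine Finset.sum_congr rfl fun k _ => ?_
    simp; ring
  have h3 : |(Matrix.of w).det| * |∑ k, y k * ω k| ≤ |(Matrix.of w).det| * (m * M) := by
    rw [← abs_mul, h2]
    refine (Finset.abs_sum_le_sum_abs _ _).trans ((Finset.sum_le_card_nsmul _ _ (|(Matrix.of w).det| * M) fun i _ => ?_).trans (le_of_eq ?_))
    · rw [abs_mul]
      exact mul_le_mul (hcr i) (hM i) (abs_nonneg _) hdet.le
    · simp; ring
  have h4 := le_of_mul_le_mul_left h3 hdet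
  calc |y k| ≤ √(∑ k, y k ^ 2) := Real.abs_le_sqrt (Finset.single_le_sum (f := fun k => y k ^ 2) (fun _ _ => sq_nonneg _) (Finset.mem_univ k))
    _ ≤ K * |∑ k, y k * ω k| := h1.le
    _ ≤ K * (m * M) := mul_le_mul_of_nonneg_left h4 hK.le
    _ = _ := by ring

section Matrix
variable {Ξ ι : Type} [MeasurableSpace Ξ] [Fintype ι] [DecidableEq ι] {ν : Measure Ξ} {φ : Ξ → ι → ℝ} {g : Ξ → ℂ}

lemma osc_mulVec (W : Matrix ι ι ℝ) (y : ι → ℝ) :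
    osc ν (fun ξ => W.mulVec (φ ξ)) g y = osc ν φ g (W.transpose.mulVec y) := by
  unfold osc
  congr 1; ext ξ
  rw [← sum_mulVec_transpose_mul]

lemma lintegral_eq_mulVec {W : Matrix ι ι ℝ} (hW : W.det ≠ 0) {F : (ι → ℝ) → ℝ≥0∞} (hF : Measurable F) :
    ∫⁻ x, F x = ENNReal.ofReal |W.det| * ∫⁻ y, F (W.transpose.mulVec y) := by
  have hW' : W.transpose.det ≠ 0 := by rwa [Matrix.det_transpose]
  rw [lintegral_comp_mulVec hW' hF, Matrix.det_transpose, ← mul_assoc, ← ENNReal.ofReal_mul (abs_nonneg _),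
    ← abs_mul, mul_inv_cancel₀ hW, abs_one, ENNReal.ofReal_one, one_mul]

lemma wt_card_mulVec_le {V : Matrix ι ι ℝ} {β : ℝ} (hβ : 1 ≤ β)
    (hV : ∀ (u : ι → ℝ) (M : ℝ), (∀ k, |V.mulVec u k| ≤ M) → ∀ j, |u j| ≤ β * M) (u : ι → ℝ) :
    wt (Fintype.card ι) (V.mulVec u) ≤ ENNReal.ofReal ((β ^ 2) ^ Fintype.card ι) * wt 1 u := by
  rw [wt_ofReal, wt_ofReal, ← ENNReal.ofReal_mul (by positivity)]
  refine ENNReal.ofReal_le_ofReal ?_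
  have hP : ∀ j, ∏ k, cw (V.mulVec u k) ≤ β ^ 2 * cw (u j) := by
    intro j
    have : Nonempty ι := ⟨j⟩
    obtain ⟨k, -, hk⟩ := Finset.exists_max_image Finset.univ (fun k => |V.mulVec u k|) Finset.univ_nonempty
    have h1 := hV u _ (fun i => hk i (Finset.mem_univ i)) j
    have h2 : ∏ k, cw (V.mulVec u k) ≤ cw (V.mulVec u k) := by
      classical
      rw [← Finset.mul_prod_erase _ _ (Finset.mem_univ k)]
      exact mul_le_of_le_one_right (cw_pos _).le (Finset.prod_le_one (fun _ _ => (cw_pos _).le) fun _ _ => cw_le_one _)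
    refine h2.trans ?_
    unfold cw
    rw [inv_eq_one_div, ← div_eq_mul_inv, div_le_div_iff₀ (by positivity) (by positivity)]
    have h3 := pow_le_pow_left₀ (abs_nonneg _) h1 2
    rw [sq_abs, mul_pow, sq_abs] at h3
    nlinarith [sq_nonneg (V.mulVec u k), pow_le_pow_left₀ zero_le_one hβ 2]
  calc ∏ k, cw (V.mulVec u k) ^ Fintype.card ι = ∏ _j : ι, ∏ k, cw (V.mulVec u k) := by
        rw [Finset.prod_pow, Finset.prod_const, Finset.card_univ]
    _ ≤ ∏ j, β ^ 2 * cw (u j) := Finset.prod_le_prod (fun _ _ => Finset.prod_nonneg fun _ _ => (cw_pos _).le) fun j _ => hP j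
    _ = _ := by rw [Finset.prod_mul_distrib, Finset.prod_const, Finset.card_univ]; simp

lemma avg_mulVec_le {W : Matrix ι ι ℝ} (hW : W.det ≠ 0) {β : ℝ} (hβ : 1 ≤ β)
    (hV : ∀ (u : ι → ℝ) (M : ℝ), (∀ k, |W.transpose.mulVec u k| ≤ M) → ∀ j, |u j| ≤ β * M)
    (L : ℝ) {F : (ι → ℝ) → ℝ≥0∞} (hF : Measurable F) (y : ι → ℝ) :
    avg (Fintype.card ι) L F (W.transpose.mulVec y) ≤
      ENNReal.ofReal |W.det| * (ENNReal.ofReal ((β ^ 2) ^ Fintype.card ι) * avg 1 L (fun y => F (W.transpose.mulVec y)) y) := by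
  have hF' := hF.comp (measurable_mulVec W.transpose)
  have hm : Measurable fun s => F (W.transpose.mulVec y + L • s) * wt (Fintype.card ι) s :=
    (hF.comp (measurable_const.add (measurable_id.const_smul L))).mul (measurable_wt _)
  have hm2 : Measurable fun u => F (W.transpose.mulVec (y + L • u)) * wt 1 u :=
    (hF'.comp (measurable_const.add (measurable_id.const_smul L))).mul (measurable_wt _)
  unfold avg
  rw [lintegral_eq_mulVec hW hm, ← lintegral_const_mul _ hm2]
  refine mul_le_mul' le_rfl (lintegral_mono fun u => ?_)
  dsimp only
  rw [← Matrix.mulVec_smul, ← Matrix.mulVec_add, mul_left_comm]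
  exact mul_le_mul' le_rfl (wt_card_mulVec_le hβ hV u)

/-- A lower bound for a matrix passes to its transpose. -/
lemma transpose_bound [DecidableEq ι] {W : Matrix ι ι ℝ} (hW : W.det ≠ 0) {β : ℝ}
    (h : ∀ (y : ι → ℝ) (M : ℝ), (∀ i, |W.mulVec y i| ≤ M) → ∀ k, |y k| ≤ β * M)
    (u : ι → ℝ) (M : ℝ) (hu : ∀ k, |W.transpose.mulVec u k| ≤ M) (j : ι) : |u j| ≤ Fintype.card ι * β * M := by
  set z := W⁻¹.mulVec (Pi.single j 1) with hz
  have hWz : W.mulVec z = Pi.single j 1 := by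
    rw [hz, Matrix.mulVec_mulVec, Matrix.mul_nonsing_inv _ (isUnit_iff_ne_zero.2 hW), Matrix.one_mulVec]
  have hzb : ∀ k, |z k| ≤ β * 1 := h z 1 fun i => by
    rw [hWz, Pi.single_apply]; split_ifs <;> simp
  have h1 := sum_mulVec_transpose_mul W u z
  rw [hWz] at h1
  simp only [Pi.single_apply, mul_ite, mul_one, mul_zero, Finset.sum_ite_eq', Finset.mem_univ, if_true] at h1
  have hM : 0 ≤ M := (abs_nonneg _).trans (hu j)
  rw [← h1]
  refine (Finset.abs_sum_le_sum_abs _ _).trans ((Finset.sum_le_card_nsmul _ _ (M * β) fun k _ => ?_).trans (le_of_eq ?_))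
  · rw [abs_mul]
    exact mul_le_mul (hu k) (by simpa using hzb k) (abs_nonneg _) hM
  · rw [nsmul_eq_mul, Finset.card_univ]; ring

lemma exists_multilinear_matrix (ι : Type) [Fintype ι] [DecidableEq ι] (hd : 2 ≤ Fintype.card ι) (n : ℕ) :
    ∃ C : ℝ≥0∞, C ≠ ⊤ ∧ ∀ (Ξ : Type) [MeasurableSpace Ξ] (ν : Measure Ξ) [SFinite ν] (φ : Ξ → ι → ℝ), Measurable φ →
      ∀ (W : Matrix ι ι ℝ) (B β : ℝ) (g : ι → Ξ → ℂ) (ρ L : ℝ), W.det ≠ 0 → 1 ≤ β →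
      (∀ (u : ι → ℝ) (M : ℝ), (∀ k, |W.transpose.mulVec u k| ≤ M) → ∀ j, |u j| ≤ β * M) →
      (∀ i ξ k, g i ξ ≠ 0 → |W.mulVec (φ ξ) k| ≤ B) →
      (∀ i, Integrable (g i) ν) → 0 < ρ → 1 ≤ L →
      (∀ i ξ ξ', g i ξ ≠ 0 → g i ξ' ≠ 0 → (∀ k, |W.mulVec (φ ξ) k - W.mulVec (φ ξ') k| ≤ ρ⁻¹) ∧
        |W.mulVec (φ ξ) i - W.mulVec (φ ξ') i| ≤ L⁻¹ * ‖W.mulVec (φ ξ) - W.mulVec (φ ξ')‖ + (ρ * L ^ n)⁻¹) →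
      (∀ i, ∫⁻ x, msq (osc ν φ (g i)) x ≠ ⊤) →
      ∫⁻ x, (∏ i, avg (Fintype.card ι) ρ (msq (osc ν φ (g i))) x) ^ (1 / ((Fintype.card ι : ℝ) - 1)) ≤
        C * ENNReal.ofReal |W.det| * (∏ i, (ENNReal.ofReal ((β ^ 2) ^ Fintype.card ι) *
          (ENNReal.ofReal (ρ * L ^ n)⁻¹ * ∫⁻ x, msq (osc ν φ (g i)) x))) ^ (1 / ((Fintype.card ι : ℝ) - 1)) := by
  obtain ⟨C, hC, h⟩ := exists_multilinear ι hd n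
  refine ⟨C, hC, ?_⟩
  intro Ξ _ ν _ φ hφ W B β g ρ L hW hβ hV hB hg hρ hL hsep hfin
  have hd2 : (2:ℝ) ≤ Fintype.card ι := by exact_mod_cast hd
  set r := 1 / ((Fintype.card ι : ℝ) - 1) with hr
  have hr0 : 0 ≤ r := by rw [hr]; apply div_nonneg <;> linarith
  set δ := ENNReal.ofReal |W.det| with hδ
  have hδ0 : δ ≠ 0 := by simpa [hδ] using hW
  have hδt : δ ≠ ⊤ := ENNReal.ofReal_ne_top
  set b := ENNReal.ofReal ((β ^ 2) ^ Fintype.card ι) with hb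
  have hm := fun i => measurable_msq_osc (hg i) hφ
  have hft : ∀ i, msq (osc ν (fun ξ => W.mulVec (φ ξ)) (g i)) = fun y => msq (osc ν φ (g i)) (W.transpose.mulVec y) := fun i => by
    ext y; simp only [msq, osc_mulVec]
  have hint : ∀ i, ∫⁻ x, msq (osc ν φ (g i)) x = δ * ∫⁻ y, msq (osc ν (fun ξ => W.mulVec (φ ξ)) (g i)) y := fun i => by
    rw [lintegral_eq_mulVec hW (hm i), hft i]
  have h1 := h Ξ ν (fun ξ => W.mulVec (φ ξ)) ((measurable_mulVec W).comp hφ) B Unit {()} (fun i _ => g i) ρ L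
    (fun i _ => hB i) (fun i _ => hg i) hρ hL (fun i _ => hsep i) (fun i _ ht => hfin i (by
      rw [hint i, ht, ENNReal.mul_top hδ0]) |>.elim)
  simp only [Finset.sum_singleton] at h1
  have hma : Measurable fun x => (∏ i, avg (Fintype.card ι) ρ (msq (osc ν φ (g i))) x) ^ r :=
    (Finset.measurable_prod _ fun i _ => measurable_avg (hm i)).pow_const r
  have hmb : Measurable fun y => (∏ i, avg 1 ρ (msq (osc ν (fun ξ => W.mulVec (φ ξ)) (g i))) y) ^ r :=
    (Finset.measurable_prod _ fun i _ => measurable_avg (measurable_msq_osc (hg i) ((measurable_mulVec W).comp hφ))).pow_const r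
  calc _ = δ * ∫⁻ y, (∏ i, avg (Fintype.card ι) ρ (msq (osc ν φ (g i))) (W.transpose.mulVec y)) ^ r :=
        lintegral_eq_mulVec hW hma
    _ ≤ δ * ∫⁻ y, (∏ _i : ι, (δ * b)) ^ r * (∏ i, avg 1 ρ (msq (osc ν (fun ξ => W.mulVec (φ ξ)) (g i))) y) ^ r := by
        refine mul_le_mul' le_rfl (lintegral_mono fun y => ?_)
        dsimp only
        rw [← ENNReal.mul_rpow_of_nonneg _ _ hr0, ← Finset.prod_mul_distrib]
        refine ENNReal.rpow_le_rpow (Finset.prod_le_prod' fun i _ => ?_) hr0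
        rw [hft i, mul_assoc]
        exact avg_mulVec_le hW hβ hV ρ (hm i) y
    _ ≤ δ * ((∏ _i : ι, (δ * b)) ^ r * (C * (∏ i, (ENNReal.ofReal (ρ * L ^ n)⁻¹ * ∫⁻ x, msq (osc ν (fun ξ => W.mulVec (φ ξ)) (g i)) x)) ^ r)) := by
        rw [lintegral_const_mul _ hmb]
        exact mul_le_mul' le_rfl (mul_le_mul' le_rfl h1)
    _ = C * δ * ((∏ _i : ι, (δ * b)) ^ r * (∏ i, (ENNReal.ofReal (ρ * L ^ n)⁻¹ * ∫⁻ x, msq (osc ν (fun ξ => W.mulVec (φ ξ)) (g i)) x)) ^ r) := by ring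
    _ = _ := by
        rw [← ENNReal.mul_rpow_of_nonneg _ _ hr0, ← Finset.prod_mul_distrib]
        congr 3; ext i
        rw [hint i]; ring

end Matrix

section Broad
variable {ι : Type} [Fintype ι]

lemma abs_sum_mul_le {u v : ι → ℝ} {a b : ℝ} (ha : 0 ≤ a) (hu : ∀ k, |u k| ≤ a) (hv : ∀ k, |v k| ≤ b) :
    |∑ k, u k * v k| ≤ Fintype.card ι * (a * b) := by
  refine (Finset.abs_sum_le_sum_abs _ _).trans ?_
  rw [← nsmul_eq_mul, ← Finset.card_univ, ← Finset.sum_const]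
  refine Finset.sum_le_sum fun k _ => ?_
  rw [abs_mul]
  exact mul_le_mul (hu k) (hv k) (abs_nonneg _) ha

lemma abs_normal_le {x y q : ι → ℝ} {a l m : ℝ} (hl : 0 ≤ l)
    (hx : |∑ k, x k ^ 2 - 1| ≤ a) (hy : |∑ k, y k ^ 2 - 1| ≤ a)
    (hqx : ∀ k, |x k - q k| ≤ l) (hqy : ∀ k, |y k - q k| ≤ l) (hm : ∀ k, |x k - y k| ≤ m) :
    |∑ k, q k * (x k - y k)| ≤ a + Fintype.card ι * (l * m) := by
  have h1 : ∑ k, q k * (x k - y k) = ((∑ k, x k ^ 2 - 1) - (∑ k, y k ^ 2 - 1)) / 2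
      - ∑ k, (((x k - q k) + (y k - q k)) / 2) * (x k - y k) := by
    rw [sub_sub_sub_cancel_right, ← Finset.sum_sub_distrib, Finset.sum_div, ← Finset.sum_sub_distrib]
    exact Finset.sum_congr rfl fun k _ => by ring
  rw [h1]
  have h2 : |∑ k, (((x k - q k) + (y k - q k)) / 2) * (x k - y k)| ≤ Fintype.card ι * (l * m) := by
    refine abs_sum_mul_le hl (fun k => ?_) hm
    have := abs_le.1 (hqx k); have := abs_le.1 (hqy k)
    rw [abs_le]; constructor <;> linarith
  have := abs_le.1 hx; have := abs_le.1 hy; have := abs_le.1 h2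
  rw [abs_le]; constructor <;> linarith

lemma exists_multilinear_cap (ι : Type) [Fintype ι] [DecidableEq ι] (hd : 2 ≤ Fintype.card ι) (N : ℕ) (A : ℝ) (hA : 0 < A) :
    ∃ C : ℝ≥0∞, C ≠ ⊤ ∧ ∀ (Ξ : Type) [MeasurableSpace Ξ] (ν : Measure Ξ) [SFinite ν] (φ : Ξ → ι → ℝ) (g : Ξ → ℂ),
      Integrable g ν → Measurable φ → ∀ K L : ℝ, 1 ≤ K → (Fintype.card ι : ℝ) ^ 2 * K ≤ L →
      (∀ ξ, g ξ ≠ 0 → |∑ k, φ ξ k ^ 2 - 1| ≤ A / L ^ (N + 1)) →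
      ∀ w : ι → ι → ℤ, (Matrix.of fun i k => (w i k : ℝ) / L).det ≠ 0 →
      (∀ (y : ι → ℝ) (M : ℝ), (∀ i, |(Matrix.of fun i k => (w i k : ℝ) / L).mulVec y i| ≤ M) →
        ∀ k, |y k| ≤ K * Fintype.card ι * M) →
      ∀ Y : ℝ≥0∞, Y ≠ ⊤ → (∀ i, ∫⁻ x, msq (osc ν φ (cap (L / 2) φ g (w i))) x ≤ Y) →
      ∫⁻ x, (∏ i, avg (Fintype.card ι) L (msq (osc ν φ (cap (L / 2) φ g (w i)))) x) ^ (1 / ((Fintype.card ι : ℝ) - 1)) ≤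
        C * ((C * (ENNReal.ofReal (K ^ (2 * Fintype.card ι + N) / L ^ (N + 1)) * Y)) ^ Fintype.card ι)
          ^ (1 / ((Fintype.card ι : ℝ) - 1)) := by
  obtain ⟨C, hC, h⟩ := exists_multilinear_matrix ι hd N
  set d := Fintype.card ι with hdef
  have hd2 : (2:ℝ) ≤ d := by exact_mod_cast hd
  set C1 : ℝ := 2 * d * (2 + A) with hC1
  have hC1' : 1 ≤ C1 := by rw [hC1]; nlinarith
  have hC0 : 0 < C1 := by linarith
  set C2 : ℝ := ((d ^ 2 * C1) ^ 2) ^ d * (d ^ 2) ^ N with hC2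
  set C3 : ℝ≥0∞ := C * ENNReal.ofReal (d.factorial : ℝ) with hC3
  refine ⟨C3 + ENNReal.ofReal C2, by finiteness, ?_⟩
  intro Ξ _ ν _ φ g hg hφ K L hK hKL hsph w hdet htr Y hY hw
  have hK0 : 0 < K := by linarith
  have hL4 : 4 ≤ L := by nlinarith
  have hL0 : 0 < L := by linarith
  have hr0 : 0 ≤ 1 / ((d : ℝ) - 1) := by apply div_nonneg <;> linarith
  have hR1 : 1 ≤ L ^ (N + 1) := one_le_pow₀ (by linarith)
  have hAR : A / L ^ (N + 1) ≤ A := div_le_self hA.le hR1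
  set f : ι → Ξ → ℂ := fun i => cap (L / 2) φ g (w i) with hf
  have hsupp : ∀ i ξ, f i ξ ≠ 0 → g ξ ≠ 0 ∧ ∀ k, |φ ξ k - (w i k : ℝ) / L| ≤ 1 / L := by
    intro i ξ hne
    obtain ⟨h1, h2⟩ := cap_supp hne
    refine ⟨h1, fun k => ?_⟩
    have h3 := h2 k
    rw [show 2 * (L / 2) * φ ξ k - w i k = L * (φ ξ k - w i k / L) by field_simp, abs_mul, abs_of_pos hL0] at h3
    rw [le_div_iff₀ hL0]; linarith
  by_cases hz : ∃ i, ∀ ξ, f i ξ = 0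
  · obtain ⟨i, hi⟩ := hz
    have h1 : avg d L (msq (osc ν φ (f i))) = 0 := by
      have : f i = 0 := funext hi
      ext x
      rw [this]; simp [avg, msq, osc_zero]
    have h2 : ∀ x, (∏ i, avg d L (msq (osc ν φ (f i))) x) ^ (1 / ((d : ℝ) - 1)) = 0 := by
      intro x
      rw [Finset.prod_eq_zero (Finset.mem_univ i) (by rw [h1]; rfl), ENNReal.zero_rpow_of_pos]
      apply div_pos <;> linarith
    rw [lintegral_congr h2]; simp
  push Not at hz
  have hwb : ∀ i k, |(w i k : ℝ) / L| ≤ 2 + A := by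
    intro i k
    obtain ⟨ξ, hξ⟩ := hz i
    obtain ⟨h1, h2⟩ := hsupp i ξ hξ
    have h3 := abs_le.1 (abs_le_of_sum_sq hA.le ((hsph ξ h1).trans hAR) k)
    have h4 := abs_le.1 (h2 k)
    have h5 : 1 / L ≤ 1 := by rw [div_le_one hL0]; linarith
    rw [abs_le]; constructor <;> linarith
  set V : Matrix ι ι ℝ := Matrix.of fun i k => (w i k : ℝ) / L with hV
  set W : Matrix ι ι ℝ := C1⁻¹ • V with hW
  have hWV : ∀ y i, W.mulVec y i = C1⁻¹ * V.mulVec y i := by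
    intro y i; rw [hW, Matrix.smul_mulVec, Pi.smul_apply, smul_eq_mul]
  have hWdet : W.det ≠ 0 := by
    rw [hW, Matrix.det_smul]; exact mul_ne_zero (pow_ne_zero _ (inv_ne_zero hC0.ne')) hdet
  have hWe : ∀ i k, |W i k| ≤ 1 / (2 * d) := by
    intro i k
    have : W i k = C1⁻¹ * ((w i k : ℝ) / L) := rfl
    rw [this, abs_mul, abs_of_pos (inv_pos.2 hC0), hC1]
    calc _ ≤ (2 * d * (2 + A))⁻¹ * (2 + A) := mul_le_mul_of_nonneg_left (hwb i k) (by positivity)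
      _ = _ := by field_simp
  have hWtr : ∀ (y : ι → ℝ) (M : ℝ), (∀ i, |W.mulVec y i| ≤ M) → ∀ k, |y k| ≤ (K * d * C1) * M := by
    intro y M hM k
    refine (htr y (C1 * M) (fun i => ?_) k).trans (le_of_eq (by ring))
    have := hM i
    rw [hWV, abs_mul, abs_of_pos (inv_pos.2 hC0), inv_mul_le_iff₀ hC0] at this
    exact this
  have hWdet' : ENNReal.ofReal |W.det| ≤ ENNReal.ofReal (d.factorial : ℝ) := by
    refine ENNReal.ofReal_le_ofReal ?_
    have h1 := Matrix.det_le (A := W) (abv := AbsoluteValue.abs) (x := 1) (fun i k => (hWe i k).trans (by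
      rw [div_le_one (by positivity)]; linarith))
    simpa [nsmul_eq_mul] using h1
  have hdiff : ∀ i ξ ξ', f i ξ ≠ 0 → f i ξ' ≠ 0 → (∀ k, |W.mulVec (φ ξ) k - W.mulVec (φ ξ') k| ≤ L⁻¹) ∧
        |W.mulVec (φ ξ) i - W.mulVec (φ ξ') i| ≤
          (L / (d ^ 2 * K))⁻¹ * ‖W.mulVec (φ ξ) - W.mulVec (φ ξ')‖ + (L * (L / (d ^ 2 * K)) ^ N)⁻¹ := by
    intro i ξ ξ' hξ hξ'
    obtain ⟨a1, a2⟩ := hsupp i ξ hξ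
    obtain ⟨b1, b2⟩ := hsupp i ξ' hξ'
    constructor
    · intro k
      rw [← Pi.sub_apply, ← Matrix.mulVec_sub]
      have h1 : |∑ j, W k j * (φ ξ - φ ξ') j| ≤ d * (1 / (2 * d) * (2 / L)) := by
        refine abs_sum_mul_le (by positivity) (hWe k) fun j => ?_
        rw [Pi.sub_apply, show (2:ℝ) / L = 1 / L + 1 / L by ring]
        have := abs_le.1 (a2 j); have := abs_le.1 (b2 j)
        rw [abs_le]; constructor <;> linarith
      refine h1.trans (le_of_eq ?_)
      field_simp
    · rw [← Pi.sub_apply, ← Matrix.mulVec_sub]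
      have h0 : ∀ k, |φ ξ k - φ ξ' k| ≤ (K * d * C1) * ‖W.mulVec (φ ξ - φ ξ')‖ := by
        intro k
        exact hWtr (φ ξ - φ ξ') _ (fun j => norm_le_pi_norm (W.mulVec (φ ξ - φ ξ')) j) k
      have h1 := abs_normal_le (by positivity) (hsph ξ a1) (hsph ξ' b1) a2 b2 h0
      have h2 : V.mulVec (φ ξ - φ ξ') i = ∑ k, (w i k : ℝ) / L * (φ ξ k - φ ξ' k) := rfl
      rw [hWV, abs_mul, abs_of_pos (inv_pos.2 hC0), h2, inv_mul_le_iff₀ hC0]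
      refine h1.trans ?_
      rw [mul_add, add_comm]
      refine add_le_add (le_of_eq ?_) ?_
      · rw [← hdef]; field_simp
      · have e1 : A ≤ C1 := by rw [hC1]; nlinarith
        rw [div_eq_mul_inv]
        refine mul_le_mul e1 ?_ (by positivity) hC0.le
        rw [inv_le_inv₀ (by positivity) (by positivity), pow_succ' L]
        refine mul_le_mul_of_nonneg_left (pow_le_pow_left₀ (by positivity) (div_le_self hL0.le ?_) N) hL0.le
        nlinarith
  have hL1 : 1 ≤ L / (d ^ 2 * K) := by rw [one_le_div (by positivity)]; exact hKL
  have hβ : 1 ≤ d * (K * d * C1) := by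
    have h1 : 1 ≤ K * d := by nlinarith
    have h2 : 1 ≤ K * d * C1 := by nlinarith
    nlinarith
  have key := h Ξ ν φ hφ W (d * (1 / (2 * d) * (1 + A))) (d * (K * d * C1)) f L (L / (d ^ 2 * K)) hWdet hβ
    (transpose_bound hWdet hWtr)
    (fun i ξ k hne => abs_sum_mul_le (by positivity) (hWe k)
      fun j => abs_le_of_sum_sq hA.le ((hsph ξ (hsupp i ξ hne).1).trans hAR) j)
    (fun i => integrable_cap hg hφ _ _) hL0 hL1 hdiff (fun i => ne_top_of_le_ne_top hY (hw i))
  refine key.trans (mul_le_mul' ((mul_le_mul' le_rfl hWdet').trans le_self_add) ?_)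
  refine ENNReal.rpow_le_rpow ?_ hr0
  refine (Finset.prod_le_prod (fun _ _ => zero_le) fun i _ => ?_).trans (le_of_eq (Finset.prod_const _))
  rw [← mul_assoc, ← mul_assoc (C3 + _)]
  refine mul_le_mul' ?_ (hw i)
  refine le_trans ?_ (mul_le_mul' (le_add_self : ENNReal.ofReal C2 ≤ C3 + ENNReal.ofReal C2) le_rfl)
  rw [← ENNReal.ofReal_mul (by positivity), ← ENNReal.ofReal_mul (by positivity)]
  refine ENNReal.ofReal_le_ofReal (le_of_eq ?_)
  rw [hC2, show (d * (K * d * C1) : ℝ) ^ 2 = (d ^ 2 * C1) ^ 2 * K ^ 2 by ring, mul_pow (_ ^ 2) (K ^ 2), ← pow_mul K,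
    pow_add K, pow_succ' L, div_pow, mul_pow _ K]
  field_simp

end Broad

section Hoelder
variable {ι : Type} [Fintype ι]

lemma measurable_measure_closedBall (μ : Measure (ι → ℝ)) [SFinite μ] (r : ℝ) :
    Measurable fun y => μ (closedBall y r) := by
  have hS : MeasurableSet {p : (ι → ℝ) × (ι → ℝ) | dist p.2 p.1 ≤ r} :=
    (isClosed_le (continuous_snd.dist continuous_fst) continuous_const).measurableSet
  exact measurable_measure_prodMk_left hS

lemma lintegral_measure_closedBall (μ : Measure (ι → ℝ)) [SFinite μ] {r : ℝ} (hr : 0 ≤ r) :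
    ∫⁻ y, μ (closedBall y r) = ENNReal.ofReal ((2 * r) ^ Fintype.card ι) * μ univ := by
  have hS : MeasurableSet {p : (ι → ℝ) × (ι → ℝ) | dist p.2 p.1 ≤ r} :=
    (isClosed_le (continuous_snd.dist continuous_fst) continuous_const).measurableSet
  have h1 := Measure.prod_apply (μ := volume) (ν := μ) hS
  rw [Measure.prod_apply_symm hS] at h1
  have h2 : ∀ y : ι → ℝ, (fun x => (x, y)) ⁻¹' {p : (ι → ℝ) × (ι → ℝ) | dist p.2 p.1 ≤ r} = closedBall y r := by
    intro y; ext x; simp [dist_comm]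
  simp only [h2, Real.volume_pi_closedBall _ hr, lintegral_const] at h1
  exact h1.symm

lemma lintegral_prod_rpow_le {m : ℕ} (hm : 1 ≤ m) (hd : Fintype.card ι = m + 1) {R : ℝ} (hR : 0 < R)
    (μ : Measure (ι → ℝ)) [IsFiniteMeasure μ] (H : ℝ≥0∞) (hμ : ∀ x, μ (closedBall x 1) ≤ H)
    (hμ' : μ univ ≤ H * ENNReal.ofReal (R ^ m)) {a : ι → (ι → ℝ) → ℝ≥0∞} (ha : ∀ i, Measurable (a i))
    {c B Z : ℝ≥0∞} (hloc : ∀ i x y, dist x y ≤ 1 → a i x ≤ c * a i y)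
    (hB : ∫⁻ x, (∏ i, a i x) ^ (1 / (m : ℝ)) ≤ B * (Z ^ (m + 1)) ^ (1 / (m : ℝ))) :
    ∫⁻ x, ∏ i, a i x ^ (1 / ((m : ℝ) + 1)) ∂μ ≤
      (c * B ^ (m / ((m : ℝ) + 1)) * 2) * (Z * (H * ENNReal.ofReal (R ^ (m / ((m : ℝ) + 1))))) := by
  have hm0 : (0:ℝ) < m := by exact_mod_cast hm
  have hm1 : (0:ℝ) < (m:ℝ) + 1 := by positivity
  set s : ℝ := 1 / ((m : ℝ) + 1) with hs
  have hs0 : 0 ≤ s := by positivity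
  have hGm : Measurable fun x => ∏ i, a i x ^ s := Finset.measurable_prod _ fun i _ => (ha i).pow_const s
  have hhm := measurable_measure_closedBall μ 1
  have h1 := lintegral_le_of_local volume μ hGm (r := 1) (v := 1) (A := c) (fun x => by
    rw [Real.volume_pi_closedBall _ zero_le_one, ENNReal.one_le_ofReal]; exact one_le_pow₀ (by norm_num)) (by
    intro x y hxy
    calc _ ≤ ∏ i, (c * a i y) ^ s := Finset.prod_le_prod (fun _ _ => zero_le) fun i _ => ENNReal.rpow_le_rpow (hloc i x y hxy) hs0
      _ = (c ^ s) ^ (m + 1) * ∏ i, a i y ^ s := by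
        simp only [ENNReal.mul_rpow_of_nonneg _ _ hs0]
        rw [Finset.prod_mul_distrib, Finset.prod_const, Finset.card_univ, hd]
      _ = _ := by
        rw [← ENNReal.rpow_natCast, ← ENNReal.rpow_mul, hs]
        push_cast
        rw [one_div_mul_cancel hm1.ne', ENNReal.rpow_one])
  rw [one_mul] at h1
  refine h1.trans ?_
  have hpq : (((m:ℝ) + 1) / m).HolderConjugate ((m:ℝ) + 1) := by
    rw [Real.holderConjugate_iff]
    refine ⟨by rw [lt_div_iff₀ hm0]; linarith, by field_simp⟩
  have h2 := ENNReal.lintegral_mul_le_Lp_mul_Lq volume hpq hGm.aemeasurable hhm.aemeasurable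
  simp only [Pi.mul_apply] at h2
  have h3 : (∫⁻ y, (∏ i, a i y ^ s) ^ (((m:ℝ) + 1) / m)) ^ (1 / (((m:ℝ) + 1) / m)) ≤ B ^ (m / ((m : ℝ) + 1)) * Z := by
    have e1 : ∀ y, (∏ i, a i y ^ s) ^ (((m:ℝ) + 1) / m) = (∏ i, a i y) ^ (1 / (m:ℝ)) := by
      intro y
      rw [ENNReal.prod_rpow_of_nonneg hs0, ← ENNReal.rpow_mul, hs]
      congr 1; field_simp
    rw [lintegral_congr e1]
    refine (ENNReal.rpow_le_rpow hB (by positivity)).trans (le_of_eq ?_)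
    rw [one_div_div, ENNReal.mul_rpow_of_nonneg _ _ (by positivity), ← ENNReal.rpow_mul, ← ENNReal.rpow_natCast, ← ENNReal.rpow_mul]
    congr 1
    push_cast
    rw [show ((m:ℝ) + 1) * (1 / m * (m / (m + 1))) = 1 by field_simp, ENNReal.rpow_one]
  have h4 : (∫⁻ y, μ (closedBall y 1) ^ ((m:ℝ) + 1)) ^ (1 / ((m:ℝ) + 1)) ≤ 2 * (H * ENNReal.ofReal (R ^ (m / ((m : ℝ) + 1)))) := by
    have e1 : ∀ y : ι → ℝ, μ (closedBall y 1) ^ ((m:ℝ) + 1) ≤ H ^ m * μ (closedBall y 1) := by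
      intro y
      have : (m:ℝ) + 1 = ((m + 1 : ℕ) : ℝ) := by push_cast; rfl
      rw [this, ENNReal.rpow_natCast, pow_succ]
      exact mul_le_mul' (pow_le_pow_left' (hμ y) m) le_rfl
    have e2 : ∫⁻ y, μ (closedBall y 1) ^ ((m:ℝ) + 1) ≤ (2 * H) ^ (m + 1) * ENNReal.ofReal (R ^ m) := by
      refine (lintegral_mono e1).trans ?_
      rw [lintegral_const_mul _ hhm, lintegral_measure_closedBall μ zero_le_one, hd]
      calc _ ≤ H ^ m * (ENNReal.ofReal ((2 * 1) ^ (m + 1)) * (H * ENNReal.ofReal (R ^ m))) := by gcongr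
        _ = _ := by
          rw [mul_one, ENNReal.ofReal_pow (by norm_num), mul_pow, pow_succ H]
          rw [ENNReal.ofReal_ofNat]; ring
    refine (ENNReal.rpow_le_rpow e2 (by positivity)).trans (le_of_eq ?_)
    rw [ENNReal.mul_rpow_of_nonneg _ _ (by positivity), ← ENNReal.rpow_natCast, ← ENNReal.rpow_mul,
      ENNReal.ofReal_rpow_of_pos (by positivity), ← Real.rpow_natCast, ← Real.rpow_mul hR.le]
    push_cast
    rw [mul_one_div_cancel hm1.ne', ENNReal.rpow_one, mul_assoc, mul_one_div]
  calc c * ∫⁻ y, (∏ i, a i y ^ s) * μ (closedBall y 1) ≤ c * ((B ^ (m / ((m : ℝ) + 1)) * Z) * (2 * (H * ENNReal.ofReal (R ^ (m / ((m : ℝ) + 1)))))) :=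
        mul_le_mul' le_rfl (h2.trans (mul_le_mul' h3 h4))
    _ = _ := by ring

lemma exists_broad [DecidableEq ι] {m : ℕ} (hm : 1 ≤ m) (hd : Fintype.card ι = m + 1) (N : ℕ) (A : ℝ) (hA : 0 < A) :
    ∃ C : ℝ≥0∞, C ≠ ⊤ ∧ ∀ (Ξ : Type) [MeasurableSpace Ξ] (ν : Measure Ξ) [SFinite ν] (φ : Ξ → ι → ℝ) (g : Ξ → ℂ),
      Integrable g ν → Measurable φ → ∀ K L : ℝ, 1 ≤ K → (Fintype.card ι : ℝ) ^ 2 * K ≤ L →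
      (∀ ξ, g ξ ≠ 0 → |∑ k, φ ξ k ^ 2 - 1| ≤ A / L ^ (N + 1)) →
      ∀ (μ : Measure (ι → ℝ)) [IsFiniteMeasure μ] (H : ℝ≥0∞), (∀ x, μ (closedBall x 1) ≤ H) →
      μ univ ≤ H * ENNReal.ofReal ((L ^ (N + 1)) ^ m) →
      ∀ w : ι → ι → ℤ, (Matrix.of fun i k => (w i k : ℝ) / L).det ≠ 0 →
      (∀ (y : ι → ℝ) (M : ℝ), (∀ i, |(Matrix.of fun i k => (w i k : ℝ) / L).mulVec y i| ≤ M) →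
        ∀ k, |y k| ≤ K * Fintype.card ι * M) →
      ∀ Y : ℝ≥0∞, Y ≠ ⊤ → (∀ i, ∫⁻ x, msq (osc ν φ (cap (L / 2) φ g (w i))) x ≤ Y) →
      ∫⁻ x, ∏ i, avg (Fintype.card ι) L (msq (osc ν φ (cap (L / 2) φ g (w i)))) x ^ (1 / ((m : ℝ) + 1)) ∂μ ≤
        C * H * ENNReal.ofReal (K ^ (2 * (m + 1) + N) * (L ^ (N + 1)) ^ (-(1 / ((m : ℝ) + 1)))) * Y := by
  obtain ⟨C, hC, h⟩ := exists_multilinear_cap ι (by omega) N A hA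
  rw [hd] at h ⊢
  refine ⟨(ENNReal.ofReal ((4 ^ (m + 1)) ^ (m + 1)) * C ^ (m / ((m : ℝ) + 1)) * 2) * C, ?_, ?_⟩
  · have : C ^ (m / ((m : ℝ) + 1)) ≠ ⊤ := ENNReal.rpow_ne_top_of_nonneg (by positivity) hC
    finiteness
  intro Ξ _ ν _ φ g hg hφ K L hK hKL hsph μ _ H hμ hμ' w hdet htr Y hY hw
  have hL1 : 1 ≤ L := by
    refine le_trans ?_ hKL
    push_cast; nlinarith [(Nat.cast_nonneg m : (0:ℝ) ≤ m)]
  have hR : 0 < L ^ (N + 1) := by positivity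
  have h1 := h Ξ ν φ g hg hφ K L hK hKL hsph w hdet htr Y hY hw
  have hm2 := fun i => measurable_msq_osc (integrable_cap hg hφ (L / 2) (w i)) hφ
  rw [show ((m + 1 : ℕ) : ℝ) - 1 = m by push_cast; ring] at h1
  refine (lintegral_prod_rpow_le hm hd hR μ H hμ hμ' (fun i => measurable_avg (hm2 i)) (c := ENNReal.ofReal ((4 ^ (m + 1)) ^ (m + 1)))
    (fun i x y hxy => ?_) h1).trans (le_of_eq ?_)
  · rw [← hd]
    refine avg_local (by linarith) (hm2 i) fun k => ?_
    rw [← Real.dist_eq]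
    exact ((dist_le_pi_dist x y k).trans hxy).trans hL1
  · have e : ENNReal.ofReal (K ^ (2 * (m + 1) + N) * (L ^ (N + 1)) ^ (-(1 / ((m : ℝ) + 1)))) =
        ENNReal.ofReal (K ^ (2 * (m + 1) + N) / L ^ (N + 1)) * ENNReal.ofReal ((L ^ (N + 1)) ^ (m / ((m : ℝ) + 1))) := by
      rw [← ENNReal.ofReal_mul (by positivity), div_mul_eq_mul_div, mul_div_assoc, ← Real.rpow_sub_one hR.ne']
      congr 3; field_simp; ring
    rw [e]; ring

end Hoelder

lemma KakeyaEnergy.narrow_cube {n : ℕ} (h : KakeyaEnergy n) (A : ℝ) (hA : 0 < A) :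
    ∃ (c : ℝ) (C : ℝ≥0∞), 0 < c ∧ c ≤ 1 ∧ C ≠ ⊤ ∧
    ∀ (Ξ : Type) [MeasurableSpace Ξ] (ν : Measure Ξ) [SFinite ν] (φ : Ξ → Fin (n + 2) → ℝ) (g : Ξ → ℂ),
      Integrable g ν → Measurable φ → ∀ K T : ℝ, 1 ≤ K → 3 * (n + 2) * K ≤ 2 * T →
      (∀ ξ, g ξ ≠ 0 → |∑ k, φ ξ k ^ 2 - 1| ≤ A / T) →
      ∀ e : Fin (n + 2) → ℝ, ∑ k, e k ^ 2 = 1 → ∀ S : Finset (Fin (n + 2) → ℤ),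
      (∀ q ∈ S, |∑ k, e k * (q k / (2 * T))| ≤ 1 / K) →
      ∀ (μ : Measure (Fin (n + 2) → ℝ)) [IsFiniteMeasure μ] (H : ℝ≥0∞),
        (∀ x r, 1 ≤ r → r ≤ K → μ (closedBall x r) ≤ H * ENNReal.ofReal (r ^ (n + 1))) → ∀ b : Fin (n + 2) → ℤ,
        ∫⁻ x in cube T b, msq (osc ν φ (fun ξ => ∑ q ∈ S, cap T φ g q ξ)) x ∂μ ≤
          C * H * ENNReal.ofReal (K ^ (-c)) * ∑ q ∈ S, ENNReal.ofReal (T ^ Fintype.card (Fin (n + 2))) *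
            avg 1 T (msq (osc ν φ (cap T φ g q))) (fun k => T * b k) := by
  obtain ⟨c, C, hc, hc1, hC, hN⟩ := h.loc.narrow (A + Fintype.card (Fin (n + 2)) * (2 * A + 3)) (by positivity)
  obtain ⟨C₁, hC₁, hloc⟩ := exists_localize (Fin (n + 2))
  obtain ⟨C₂, hC₂, horth⟩ := exists_orth (Fin (n + 2))
  refine ⟨c, C * C₁ * C₂, hc, hc1, by finiteness, ?_⟩
  intro Ξ _ ν _ φ g hg hφ K T hK hKT hsph e he S hS μ _ H hH b
  have hn0 : (0:ℝ) ≤ n := Nat.cast_nonneg n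
  have hTK : K ≤ T := by nlinarith
  have hT1 : 1 ≤ T := hK.trans hTK
  have hT0 : 0 < T := by linarith
  have hgi : Integrable (fun ξ => ∑ q ∈ S, cap T φ g q ξ) ν := integrable_finsetSum _ fun q _ => integrable_cap hg hφ T q
  obtain ⟨φ', g', hg', hφ', hs', hle, hint⟩ := hloc Ξ ν φ _ hgi hφ T (fun k => T * b k) hT0
  have hsupp : ∀ p, g' p ≠ 0 → |∑ k, e k * φ' p k| ≤ 2 / K ∧
      |∑ k, φ' p k ^ 2 - 1| ≤ (A + Fintype.card (Fin (n + 2)) * (2 * A + 3)) / K := by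
    intro p hp
    obtain ⟨h1, h2⟩ := hs' p hp
    obtain ⟨q, hq, hq'⟩ := Finset.exists_ne_zero_of_sum_ne_zero h1
    obtain ⟨h3, h4⟩ := cap_supp hq'
    constructor
    · have h5 : |∑ k, e k * (φ' p k - q k / (2 * T))| ≤ Fintype.card (Fin (n + 2)) * (1 * (3 / (2 * T))) := by
        refine abs_sum_mul_le zero_le_one (fun k => ?_) fun k => ?_
        · have : e k ^ 2 ≤ 1 := he ▸ Finset.single_le_sum (f := fun k => e k ^ 2) (fun k _ => sq_nonneg (e k)) (Finset.mem_univ k)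
          rwa [sq_le_one_iff_abs_le_one] at this
        · have h6 := h4 k
          rw [show 2 * T * φ p.1 k - q k = 2 * T * (φ p.1 k - q k / (2 * T)) by field_simp, abs_mul, abs_of_pos (by positivity),
            ← lt_div_iff₀' (by positivity)] at h6
          have h7 := h2 k
          rw [show (3:ℝ) / (2 * T) = T⁻¹ + 1 / (2 * T) by field_simp; norm_num]
          calc _ = |(φ' p k - φ p.1 k) + (φ p.1 k - q k / (2 * T))| := by congr 1; ring
            _ ≤ _ := (abs_add_le _ _).trans (add_le_add h7 h6.le)
      have h8 : (Fintype.card (Fin (n + 2)) : ℝ) * (1 * (3 / (2 * T))) ≤ 1 / K := by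
        rw [Fintype.card_fin, one_mul, mul_div_assoc', div_le_div_iff₀ (by positivity) (by positivity)]
        push_cast; linarith
      calc |∑ k, e k * φ' p k| = |∑ k, e k * (φ' p k - q k / (2 * T)) + ∑ k, e k * (q k / (2 * T))| := by
            rw [← Finset.sum_add_distrib]; congr 1
            exact Finset.sum_congr rfl fun k _ => by ring
        _ ≤ 1 / K + 1 / K := (abs_add_le _ _).trans (add_le_add (h5.trans h8) (hS q hq))
        _ = _ := by ring
    · refine (sum_sq_perturb hA.le (inv_le_one_of_one_le₀ hT1) ?_ h2).trans ?_
      · rw [← div_eq_mul_inv]; exact hsph _ h3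
      · rw [div_eq_mul_inv]
        refine mul_le_mul_of_nonneg_left ?_ (by positivity)
        rwa [inv_le_inv₀ hT0 (by linarith)]
  have h1 := hN K hK (Ξ × (Fin (n + 2) → ℝ)) (ν.prod volume) φ' g' hg' hφ' e he hsupp μ H hH
  have h2 := horth Ξ ν φ hφ T S (fun q => cap T φ g q) (fun q => integrable_cap hg hφ T q) (fun q ξ hq => (cap_supp hq).2)
    (fun k => T * b k)
  calc _ ≤ ∫⁻ x in cube T b, msq (osc (ν.prod volume) φ' g') x ∂μ :=
        setLIntegral_mono' (measurableSet_cube b) fun x hx => hle x fun k => abs_sub_le_of_mem_cube hx k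
    _ ≤ ∫⁻ x, msq (osc (ν.prod volume) φ' g') x ∂μ := setLIntegral_le_lintegral _ _
    _ ≤ C * H * ENNReal.ofReal (K ^ (-c)) * (C₁ * (ENNReal.ofReal (T ^ Fintype.card (Fin (n + 2))) *
          (C₂ * ∑ q ∈ S, avg 1 T (msq (osc ν φ (cap T φ g q))) (fun k => T * b k)))) :=
        h1.trans (mul_le_mul' le_rfl (hint.trans (mul_le_mul' le_rfl (mul_le_mul' le_rfl h2))))
    _ = _ := by rw [← Finset.mul_sum]; ring

lemma prod_const_mul_rpow {ι : Type*} [Fintype ι] [Nonempty ι] (c : ℝ≥0∞) (a : ι → ℝ≥0∞) :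
    ∏ i, (c * a i) ^ (1 / (Fintype.card ι : ℝ)) = c * ∏ i, a i ^ (1 / (Fintype.card ι : ℝ)) := by
  have h : (Fintype.card ι : ℝ) ≠ 0 := by exact_mod_cast Fintype.card_ne_zero
  simp only [ENNReal.mul_rpow_of_nonneg _ _ (by positivity : 0 ≤ 1 / (Fintype.card ι : ℝ))]
  rw [Finset.prod_mul_distrib, Finset.prod_const, Finset.card_univ, ← ENNReal.rpow_natCast, ← ENNReal.rpow_mul,
    one_div_mul_cancel h, ENNReal.rpow_one]

lemma prod_rpow_self {ι : Type*} [Fintype ι] [Nonempty ι] (c : ℝ≥0∞) :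
    ∏ _i : ι, c ^ (1 / (Fintype.card ι : ℝ)) = c := by
  simpa using prod_const_mul_rpow (ι := ι) c (fun _ => 1)

/-- Tuples of lattice points whose rescalings are quantitatively linearly independent. -/
def Transversal {ι : Type*} [Fintype ι] [DecidableEq ι] (K L : ℝ) (w : ι → ι → ℤ) : Prop :=
  (Matrix.of fun i k => (w i k : ℝ) / L).det ≠ 0 ∧
    ∀ (y : ι → ℝ) (M : ℝ), (∀ i, |(Matrix.of fun i k => (w i k : ℝ) / L).mulVec y i| ≤ M) →
      ∀ k, |y k| ≤ K * Fintype.card ι * M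

lemma exists_transversal_or_narrow {D : ℕ} {K L : ℝ} (hK : 0 < K) (S : Finset (Fin D → ℤ)) :
    (∃ e : Fin D → ℝ, ∑ k, e k ^ 2 = 1 ∧ ∀ q ∈ S, |∑ k, e k * (q k / L)| ≤ 1 / K) ∨
      ∃ w : Fin D → Fin D → ℤ, (∀ i, w i ∈ S) ∧ Transversal K L w := by
  classical
  by_cases h : ∃ e : Fin D → ℝ, ∑ k, e k ^ 2 = 1 ∧ ∀ q ∈ S, |∑ k, e k * (q k / L)| ≤ 1 / K
  · exact Or.inl h
  right
  push Not at h
  obtain ⟨w, hw, hdet, htr⟩ := exists_transversal (S.image fun q k => (q k : ℝ) / L) hK fun e he => by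
    obtain ⟨q, hq, hq'⟩ := h e he
    exact ⟨_, Finset.mem_image_of_mem _ hq, hq'⟩
  choose v hv hvw using fun i => Finset.mem_image.1 (hw i)
  have e : w = Matrix.of fun i k => (v i k : ℝ) / L := by
    ext i k; exact (congrFun (hvw i) k).symm
  rw [e] at hdet htr
  exact ⟨v, hv, hdet, by simpa only [Fintype.card_fin] using htr⟩

lemma exists_broad_narrow (n : ℕ) (A : ℝ) (hA : 0 < A) :
    ∃ C : ℝ≥0∞, C ≠ ⊤ ∧
    ∀ (Ξ : Type) [MeasurableSpace Ξ] (ν : Measure Ξ) [SFinite ν] (φ : Ξ → Fin (n + 2) → ℝ) (g : Ξ → ℂ),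
      Integrable g ν → Measurable φ → ∀ K L : ℝ, 0 < K → 1 ≤ L →
      (∀ ξ, g ξ ≠ 0 → |∑ k, φ ξ k ^ 2 - 1| ≤ A) →
      ∃ Q : Finset (Fin (n + 2) → ℤ), (Q.card : ℝ≥0∞) ≤ C * ENNReal.ofReal L ^ (n + 2) ∧ ∀ b : Fin (n + 2) → ℤ,
      ∃ S ⊆ Q, ∃ e : Fin (n + 2) → ℝ, ∑ k, e k ^ 2 = 1 ∧ (∀ q ∈ S, |∑ k, e k * (q k / L)| ≤ 1 / K) ∧
      ∀ x ∈ cube (L / 2) b, msq (osc ν φ g) x ≤ 2 * msq (osc ν φ (fun ξ => ∑ q ∈ S, cap (L / 2) φ g q ξ)) x +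
        C * ((ENNReal.ofReal L)⁻¹ * ∑ q ∈ Q, avg (n + 2) L (msq (osc ν φ (cap (L / 2) φ g q))) x +
          ENNReal.ofReal L ^ (4 * (n + 2) + 1) * ∑' w : {w : Fin (n + 2) → Fin (n + 2) → ℤ // (∀ i, w i ∈ Q) ∧ Transversal K L w},
            ∏ i, avg (n + 2) L (msq (osc ν φ (cap (L / 2) φ g (w.1 i)))) x ^ (1 / ((n + 2 : ℕ) : ℝ))) := by
  classical
  obtain ⟨C₁, hC₁, hrep⟩ := exists_repro (Fin (n + 2)) (n + 2) (by omega)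
  set C₀ : ℝ≥0∞ := ENNReal.ofReal (2 * (1 + A) + 3) ^ (n + 2) with hC₀
  set c₄ : ℝ≥0∞ := ENNReal.ofReal ((4 ^ (n + 2)) ^ Fintype.card (Fin (n + 2))) with hc₄
  set C : ℝ≥0∞ := 2 * C₀ ^ 2 * C₁ * c₄ ^ 2 with hC
  refine ⟨C₀ + C, by finiteness, ?_⟩
  intro Ξ _ ν _ φ g hg hφ K L hK hL hsph
  have hL0 : 0 < L := by linarith
  set l := ENNReal.ofReal L with hl
  have hl0 : l ≠ 0 := by simpa [hl] using hL0
  have hlt : l ≠ ⊤ := ENNReal.ofReal_ne_top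
  set m := ⌈L * (1 + A)⌉₊ with hm
  set Q := Fintype.piFinset (fun _ : Fin (n + 2) => Finset.Icc (-(m : ℤ)) m) with hQ
  have hcard : (Q.card : ℝ≥0∞) ≤ C₀ * l ^ (n + 2) := by
    rw [hQ, Fintype.card_piFinset, Finset.prod_const, Finset.card_univ, Fintype.card_fin, Int.card_Icc, hC₀, ← mul_pow,
      Nat.cast_pow]
    refine pow_le_pow_left' ?_ _
    rw [hl, ← ENNReal.ofReal_mul (by positivity), ← ENNReal.ofReal_natCast]
    refine ENNReal.ofReal_le_ofReal ?_
    have h1 : (m : ℝ) < L * (1 + A) + 1 := Nat.ceil_lt_add_one (by positivity)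
    have h2 : (((m : ℤ) + 1 - -(m : ℤ)).toNat : ℝ) = 2 * m + 1 := by
      rw [show (m : ℤ) + 1 - -(m : ℤ) = ((2 * m + 1 : ℕ) : ℤ) by push_cast; ring, Int.toNat_natCast]
      push_cast; ring
    rw [h2]; nlinarith
  refine ⟨Q, hcard.trans (mul_le_mul' le_self_add le_rfl), fun b => ?_⟩
  have hTT : 2 * (L / 2) = L := by ring
  have hsum : ∀ ξ, ∑ q ∈ Q, cap (L / 2) φ g q ξ = g ξ := fun ξ => by
    refine sum_cap (fun ξ hξ k => ?_) ξ
    rw [hTT, abs_mul, abs_of_pos hL0]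
    exact (mul_le_mul_of_nonneg_left (abs_le_of_sum_sq hA.le (hsph ξ hξ) k) hL0.le).trans (Nat.le_ceil _)
  have hci := fun q => integrable_cap hg hφ (L / 2) q
  set a : (Fin (n + 2) → ℤ) → (Fin (n + 2) → ℝ) → ℝ≥0∞ := fun q => avg (n + 2) L (msq (osc ν φ (cap (L / 2) φ g q))) with ha
  set z : Fin (n + 2) → ℝ := fun k => L / 2 * b k with hz
  have hrepq : ∀ q x, msq (osc ν φ (cap (L / 2) φ g q)) x ≤ C₁ * a q x := fun q x =>
    hrep Ξ ν φ _ (hci q) hφ L (fun k => q k / L) (fun ξ h k => by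
      have := (cap_supp h).2 k
      rw [hTT] at this
      rw [mul_sub, mul_div_cancel₀ _ hL0.ne']
      linarith) x
  have hnear : ∀ x ∈ cube (L / 2) b, ∀ k, |x k - z k| ≤ L := fun x hx k =>
    (abs_sub_le_of_mem_cube hx k).trans (by linarith)
  have hloc : ∀ q, ∀ x ∈ cube (L / 2) b, a q x ≤ c₄ * a q z := fun q x hx =>
    avg_local hL0 (measurable_msq_osc (hci q) hφ) (hnear x hx)
  have hloc' : ∀ q, ∀ x ∈ cube (L / 2) b, a q z ≤ c₄ * a q x := fun q x hx =>
    avg_local hL0 (measurable_msq_osc (hci q) hφ) fun k => by rw [abs_sub_comm]; exact hnear x hx k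
  set M := Q.sup (fun q => a q z) with hM
  have hMle : ∀ q ∈ Q, a q z ≤ M := fun q hq => Finset.le_sup (f := fun q => a q z) hq
  set σ := 2 * (n + 2) + 1 with hσ
  set P := Q.filter fun q => M ≤ l ^ σ * a q z with hP
  have hsplit : ∀ x, msq (osc ν φ g) x ≤ 2 * (msq (osc ν φ (fun ξ => ∑ q ∈ P, cap (L / 2) φ g q ξ)) x +
      msq (osc ν φ (fun ξ => ∑ q ∈ Q.filter (fun q => ¬ M ≤ l ^ σ * a q z), cap (L / 2) φ g q ξ)) x) := by
    intro x
    refine le_trans (le_of_eq ?_) (msq_add_le _ _ x)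
    unfold msq
    dsimp only
    rw [osc_sum _ _ (fun q _ => hci q) hφ, osc_sum _ _ (fun q _ => hci q) hφ, hP, Finset.sum_filter_add_sum_filter_not,
      ← osc_sum _ _ (fun q _ => hci q) hφ]
    congr 3; ext ξ; exact (hsum ξ).symm
  have hpart : ∀ P' ⊆ Q, ∀ x ∈ cube (L / 2) b, ∀ Z, (∀ q ∈ P', a q z ≤ Z) →
      msq (osc ν φ (fun ξ => ∑ q ∈ P', cap (L / 2) φ g q ξ)) x ≤ (C₀ * l ^ (n + 2)) ^ 2 * (C₁ * (c₄ * Z)) := by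
    intro P' hP' x hx Z hZ
    have hcard' : (P'.card : ℝ≥0∞) ≤ C₀ * l ^ (n + 2) := le_trans (by exact_mod_cast Finset.card_le_card hP') hcard
    rw [show osc ν φ (fun ξ => ∑ q ∈ P', cap (L / 2) φ g q ξ) = fun x => ∑ q ∈ P', osc ν φ (cap (L / 2) φ g q) x from
      funext fun x => osc_sum _ _ (fun q _ => hci q) hφ x]
    refine (msq_sum_le _ _ _).trans ?_
    rw [pow_two, mul_assoc]
    refine mul_le_mul' hcard' ?_
    refine (Finset.sum_le_card_nsmul _ _ (C₁ * (c₄ * Z)) fun q hq => ?_).trans ?_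
    · exact (hrepq q x).trans (mul_le_mul' le_rfl ((hloc q x hx).trans (mul_le_mul' le_rfl (hZ q hq))))
    · rw [nsmul_eq_mul]; exact mul_le_mul' hcard' le_rfl
  have hinsig : ∀ x ∈ cube (L / 2) b,
      2 * msq (osc ν φ (fun ξ => ∑ q ∈ Q.filter (fun q => ¬ M ≤ l ^ σ * a q z), cap (L / 2) φ g q ξ)) x ≤
        C * (l⁻¹ * ∑ q ∈ Q, a q x) := by
    intro x hx
    have h1 : M ≤ c₄ * ∑ q ∈ Q, a q x := by
      refine Finset.sup_le fun q hq => (hloc' q x hx).trans (mul_le_mul' le_rfl ?_)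
      exact Finset.single_le_sum (f := fun q => a q x) (fun _ _ => zero_le) hq
    have h2 := hpart _ (Finset.filter_subset (fun q => ¬ M ≤ l ^ σ * a q z) Q) x hx ((l ^ σ)⁻¹ * (c₄ * ∑ q ∈ Q, a q x)) fun q hq => by
      rw [← ENNReal.div_eq_inv_mul, ENNReal.le_div_iff_mul_le (Or.inl (pow_ne_zero _ hl0)) (Or.inl (ENNReal.pow_ne_top hlt)), mul_comm]
      exact (not_le.1 (Finset.mem_filter.1 hq).2).le.trans h1
    refine (mul_le_mul' le_rfl h2).trans (le_of_eq ?_)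
    have h3 : (l ^ (n + 2)) ^ 2 * (l ^ σ)⁻¹ = l⁻¹ := by
      rw [← pow_mul, mul_comm (n + 2) 2, hσ, pow_succ l (2 * (n + 2)), ENNReal.mul_inv (Or.inl (pow_ne_zero _ hl0)) (Or.inl (ENNReal.pow_ne_top hlt)),
        ← mul_assoc, ENNReal.mul_inv_cancel (pow_ne_zero _ hl0) (ENNReal.pow_ne_top hlt), one_mul]
    rw [← h3, hC]; ring
  rcases exists_transversal_or_narrow (L := L) hK P with ⟨e, he, heP⟩ | ⟨w, hwP, hw⟩
  · refine ⟨P, Finset.filter_subset _ _, e, he, heP, fun x hx => (hsplit x).trans ?_⟩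
    rw [mul_add]
    refine add_le_add le_rfl ((hinsig x hx).trans ?_)
    exact mul_le_mul' le_add_self le_self_add
  · refine ⟨∅, Finset.empty_subset _, Pi.single 0 1, ?_, by simp, fun x hx => (hsplit x).trans ?_⟩
    · rw [Finset.sum_eq_single 0] <;> simp +contextual
    refine le_trans ?_ le_add_self
    rw [mul_add, add_comm]
    refine le_trans ?_ (mul_le_mul' (le_add_self : C ≤ C₀ + C) le_rfl)
    rw [mul_add C]
    refine add_le_add (hinsig x hx) ?_
    have h1 : M ≤ (l ^ σ * c₄) * ∏ i, a (w i) x ^ (1 / ((n + 2 : ℕ) : ℝ)) := by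
      have h2 := prod_rpow_self (ι := Fin (n + 2)) M
      have h3 := prod_const_mul_rpow (l ^ σ * c₄) fun i => a (w i) x
      rw [Fintype.card_fin] at h2 h3
      rw [← h2, ← h3]
      refine Finset.prod_le_prod (fun _ _ => zero_le) fun i _ => ENNReal.rpow_le_rpow ?_ (by positivity)
      rw [mul_assoc]
      exact (Finset.mem_filter.1 (hwP i)).2.trans (mul_le_mul' le_rfl (hloc' _ x hx))
    have h4 := hpart P (Finset.filter_subset _ _) x hx _ fun q hq => (hMle q (Finset.mem_filter.1 hq).1).trans h1
    refine (mul_le_mul' le_rfl h4).trans ?_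
    have h5 : ∏ i, a (w i) x ^ (1 / ((n + 2 : ℕ) : ℝ)) ≤
        ∑' w : {w : Fin (n + 2) → Fin (n + 2) → ℤ // (∀ i, w i ∈ Q) ∧ Transversal K L w}, ∏ i, a (w.1 i) x ^ (1 / ((n + 2 : ℕ) : ℝ)) :=
      ENNReal.le_tsum (f := fun w : {w : Fin (n + 2) → Fin (n + 2) → ℤ // (∀ i, w i ∈ Q) ∧ Transversal K L w} =>
        ∏ i, a (w.1 i) x ^ (1 / ((n + 2 : ℕ) : ℝ))) ⟨w, fun i => (Finset.mem_filter.1 (hwP i)).1, hw⟩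
    calc _ = C * (l ^ (4 * (n + 2) + 1) * ∏ i, a (w i) x ^ (1 / ((n + 2 : ℕ) : ℝ))) := by
          rw [hC, hσ, show 4 * (n + 2) + 1 = (n + 2) * 2 + (2 * (n + 2) + 1) by ring, pow_add l ((n + 2) * 2), pow_mul l]; ring
      _ ≤ _ := mul_le_mul' le_rfl (mul_le_mul' le_rfl h5)

lemma tsum_tuples_le {ι X : Type*} [Fintype ι] [DecidableEq ι] (Q : Finset X) (p : (ι → X) → Prop) (c : ℝ≥0∞) :
    ∑' _w : {w : ι → X // (∀ i, w i ∈ Q) ∧ p w}, c ≤ (Q.card : ℝ≥0∞) ^ Fintype.card ι * c := by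
  have h1 := ENNReal.tsum_mono_subtype (fun _ : ι → X => c) (s := {w | (∀ i, w i ∈ Q) ∧ p w})
    (t := (Fintype.piFinset fun _ : ι => Q : Finset (ι → X))) fun w hw => by
      simpa using hw.1
  refine h1.trans (le_of_eq ?_)
  rw [Finset.tsum_subtype' (Fintype.piFinset fun _ : ι => Q) (fun _ => c), Finset.sum_const, Fintype.card_piFinset, Finset.prod_const, Finset.card_univ,
    nsmul_eq_mul, Nat.cast_pow]

lemma KakeyaEnergy.step_bound {n : ℕ} (h : KakeyaEnergy n) (N : ℕ) (A : ℝ) (hA : 0 < A) :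
    ∃ (c : ℝ) (C : ℝ≥0∞), 0 < c ∧ c ≤ 1 ∧ C ≠ ⊤ ∧ ∀ K L : ℝ, 1 ≤ K → 3 * ((n + 2 : ℕ) : ℝ) ^ 2 * K ≤ L →
    ∀ (Ξ : Type) [MeasurableSpace Ξ] (ν : Measure Ξ) [SFinite ν] (φ : Ξ → Fin (n + 2) → ℝ) (g : Ξ → ℂ),
      Integrable g ν → Measurable φ → (∀ ξ, g ξ ≠ 0 → |∑ k, φ ξ k ^ 2 - 1| ≤ A / L ^ (N + 1)) →
      ∀ (μ : Measure (Fin (n + 2) → ℝ)) [IsFiniteMeasure μ] (H : ℝ≥0∞),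
        (∀ x r, 1 ≤ r → r ≤ L ^ (N + 1) → μ (closedBall x r) ≤ H * ENNReal.ofReal (r ^ (n + 1))) →
        μ univ ≤ H * ENNReal.ofReal ((L ^ (N + 1)) ^ (n + 1)) → ∫⁻ x, msq (osc ν φ g) x ≠ ⊤ →
        ∫⁻ x, msq (osc ν φ g) x ∂μ ≤ C * H * (ENNReal.ofReal (K ^ (-c)) + (ENNReal.ofReal L)⁻¹ +
          ENNReal.ofReal L ^ (4 * (n + 2) + 1 + (n + 2) * (n + 2)) *
            ENNReal.ofReal (K ^ (2 * (n + 2) + N) * (L ^ (N + 1)) ^ (-(1 / ((n + 2 : ℕ) : ℝ))))) * ∫⁻ x, msq (osc ν φ g) x := by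
  classical
  obtain ⟨c, C₁, hc, hc1, hC₁, hnar⟩ := h.narrow_cube A hA
  obtain ⟨C₂, hC₂, hbn⟩ := exists_broad_narrow n A hA
  obtain ⟨C₃, hC₃, hbro⟩ := exists_broad (ι := Fin (n + 2)) (m := n + 1) (by omega) (Fintype.card_fin _) N A hA
  obtain ⟨C₄, hC₄, hbes⟩ := exists_bessel_lintegral (Fin (n + 2))
  set C₅ : ℝ≥0∞ := ENNReal.ofReal ((4 ^ 1) ^ Fintype.card (Fin (n + 2))) * (∫⁻ s, wt (ι := Fin (n + 2)) 1 s) with hC₅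
  have hC₅' : C₅ ≠ ⊤ := ENNReal.mul_ne_top ENNReal.ofReal_ne_top (lintegral_wt_lt_top le_rfl).ne
  set C₆ : ℝ≥0∞ := ENNReal.ofReal ((4 ^ (n + 2)) ^ Fintype.card (Fin (n + 2))) * (∫⁻ s, wt (ι := Fin (n + 2)) (n + 2) s) with hC₆
  have hC₆' : C₆ ≠ ⊤ := ENNReal.mul_ne_top ENNReal.ofReal_ne_top (lintegral_wt_lt_top (by omega)).ne
  set Ca : ℝ≥0∞ := 2 * C₁ * (C₅ * C₄) with hCa
  set Cb : ℝ≥0∞ := C₂ * (C₆ * C₄) with hCb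
  set Cc : ℝ≥0∞ := C₂ * C₂ ^ (n + 2) * (C₃ * C₄) with hCc
  refine ⟨c, Ca + Cb + Cc, hc, hc1, by finiteness, ?_⟩
  intro K L hK hKL Ξ _ ν _ φ g hg hφ hsph μ _ H hH hH' hfin
  have hn0 : (0:ℝ) ≤ n := Nat.cast_nonneg n
  have hKL' : K ≤ L := by
    push_cast at hKL
    exact (le_mul_of_one_le_left (by linarith) (by nlinarith)).trans hKL
  have hL1 : 1 ≤ L := hK.trans hKL'
  have hL0 : 0 < L := by linarith
  have hLR : L ≤ L ^ (N + 1) := le_self_pow₀ hL1 (by omega)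
  have hTT : 2 * (L / 2) = L := by ring
  set l := ENNReal.ofReal L with hl
  set Y := ∫⁻ x, msq (osc ν φ g) x with hY
  have hH1 : ∀ x, μ (closedBall x 1) ≤ H := fun x => by simpa using hH x 1 le_rfl (hL1.trans hLR)
  have hsphA : ∀ ξ, g ξ ≠ 0 → |∑ k, φ ξ k ^ 2 - 1| ≤ A := fun ξ hξ =>
    (hsph ξ hξ).trans (div_le_self hA.le (hL1.trans hLR))
  obtain ⟨Q, hQ, hb⟩ := hbn Ξ ν φ g hg hφ K L (by linarith) hL1 hsphA
  choose S hS e he heS hpt using hb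
  have hm := fun q => measurable_msq_osc (integrable_cap hg hφ (L / 2) q) hφ
  set a : (Fin (n + 2) → ℤ) → (Fin (n + 2) → ℝ) → ℝ≥0∞ := fun q => avg (n + 2) L (msq (osc ν φ (cap (L / 2) φ g q))) with ha
  have ham : ∀ q, Measurable (a q) := fun q => measurable_avg (hm q)
  set G : {w : Fin (n + 2) → Fin (n + 2) → ℤ // (∀ i, w i ∈ Q) ∧ Transversal K L w} → (Fin (n + 2) → ℝ) → ℝ≥0∞ :=
    fun w x => ∏ i, a (w.1 i) x ^ (1 / ((n + 2 : ℕ) : ℝ)) with hG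
  have hGm : ∀ w, Measurable (G w) := fun w => Finset.measurable_prod _ fun i _ => (ham _).pow_const _
  set ρ : (Fin (n + 2) → ℝ) → ℝ≥0∞ := fun x => l⁻¹ * ∑ q ∈ Q, a q x + l ^ (4 * (n + 2) + 1) * ∑' w, G w x with hρ
  have hSm : Measurable fun x => ∑ q ∈ Q, a q x := Finset.measurable_sum _ fun q _ => ham q
  have hTm : Measurable fun x => ∑' w, G w x := Measurable.tsum hGm
  have hρm : Measurable ρ := (hSm.const_mul _).add (hTm.const_mul _)
  have hbesQ := hbes Ξ ν φ g hg hφ (L / 2) Q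
  have hqY : ∀ q, ∫⁻ x, msq (osc ν φ (cap (L / 2) φ g q)) x ≤ C₄ * Y := fun q => by
    simpa using hbes Ξ ν φ g hg hφ (L / 2) {q}
  have hnarrow : ∀ b, ∫⁻ x in cube (L / 2) b, msq (osc ν φ (fun ξ => ∑ q ∈ S b, cap (L / 2) φ g q ξ)) x ∂μ ≤
      C₁ * H * ENNReal.ofReal (K ^ (-c)) * ∑ q ∈ Q, ENNReal.ofReal ((L / 2) ^ Fintype.card (Fin (n + 2))) *
            avg 1 (L / 2) (msq (osc ν φ (cap (L / 2) φ g q))) (fun k => L / 2 * b k) := fun b => by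
    refine (hnar Ξ ν φ g hg hφ K (L / 2) hK ?_ (fun ξ hξ => (hsph ξ hξ).trans ?_) (e b) (he b) (S b) ?_ μ H ?_ b).trans ?_
    · rw [hTT]; push_cast at hKL; nlinarith
    · exact div_le_div_of_nonneg_left hA.le (by linarith) (by linarith)
    · rw [hTT]; exact heS b
    · exact fun x r h1 h2 => hH x r h1 (h2.trans (hKL'.trans hLR))
    · exact mul_le_mul' le_rfl (Finset.sum_le_sum_of_subset (hS b))
  have hnarrow_sum : ∑' b, ∫⁻ x in cube (L / 2) b, msq (osc ν φ (fun ξ => ∑ q ∈ S b, cap (L / 2) φ g q ξ)) x ∂μ ≤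
      C₁ * H * ENNReal.ofReal (K ^ (-c)) * (C₅ * (C₄ * Y)) := by
    refine (ENNReal.tsum_le_tsum hnarrow).trans ?_
    rw [ENNReal.tsum_mul_left, Summable.tsum_finsetSum fun _ _ => ENNReal.summable]
    refine mul_le_mul' le_rfl ?_
    refine (Finset.sum_le_sum fun q _ => tsum_avg_le (by linarith) (hm q)).trans ?_
    rw [← Finset.mul_sum]
    exact mul_le_mul' le_rfl hbesQ
  have hbroad : ∀ w, ∫⁻ x, G w x ∂μ ≤
      C₃ * H * ENNReal.ofReal (K ^ (2 * (n + 2) + N) * (L ^ (N + 1)) ^ (-(1 / ((n + 2 : ℕ) : ℝ)))) * (C₄ * Y) := fun w => by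
    have h1 := hbro Ξ ν φ g hg hφ K L hK (by rw [Fintype.card_fin]; nlinarith) hsph μ H hH1 hH' w.1 w.2.2.1 w.2.2.2
      (C₄ * Y) (by finiteness) (fun i => hqY _)
    have h2 : (((n + 1 : ℕ) : ℝ) + 1) = ((n + 2 : ℕ) : ℝ) := by push_cast; ring
    rw [h2, Fintype.card_fin] at h1
    exact h1
  have hρint : ∫⁻ x, ρ x ∂μ ≤ l⁻¹ * (C₆ * H * (C₄ * Y)) + l ^ (4 * (n + 2) + 1) * ((C₂ * l ^ (n + 2)) ^ (n + 2) *
      (C₃ * H * ENNReal.ofReal (K ^ (2 * (n + 2) + N) * (L ^ (N + 1)) ^ (-(1 / ((n + 2 : ℕ) : ℝ)))) * (C₄ * Y))) := by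
    rw [hρ, lintegral_add_left (hSm.const_mul _), lintegral_const_mul _ hSm, lintegral_const_mul _ hTm,
      lintegral_finsetSum _ fun q _ => ham q, lintegral_tsum fun w => (hGm w).aemeasurable]
    refine add_le_add (mul_le_mul' le_rfl ?_) (mul_le_mul' le_rfl ?_)
    · refine (Finset.sum_le_sum fun q _ => lintegral_avg_le hL1 (hm q) hH1).trans ?_
      rw [← Finset.mul_sum]
      exact mul_le_mul' le_rfl hbesQ
    · refine (ENNReal.tsum_le_tsum hbroad).trans ((tsum_tuples_le Q (Transversal K L) _).trans ?_)
      rw [Fintype.card_fin]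
      exact mul_le_mul' (pow_le_pow_left' hQ _) le_rfl
  have hmain : ∫⁻ x, msq (osc ν φ g) x ∂μ ≤ 2 * (C₁ * H * ENNReal.ofReal (K ^ (-c)) * (C₅ * (C₄ * Y))) + C₂ * ∫⁻ x, ρ x ∂μ := by
    have hT0 : 0 < L / 2 := by linarith
    rw [lintegral_cube hT0 μ (msq (osc ν φ g)), lintegral_cube hT0 μ ρ]
    refine le_trans ?_ (add_le_add (mul_le_mul' le_rfl hnarrow_sum) le_rfl)
    rw [← ENNReal.tsum_mul_left, ← ENNReal.tsum_mul_left, ← ENNReal.tsum_add]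
    refine ENNReal.tsum_le_tsum fun b => ?_
    have hfm := measurable_msq_osc (integrable_finsetSum (S b) fun q _ => integrable_cap hg hφ (L / 2) q) hφ
    rw [← lintegral_const_mul _ hfm, ← lintegral_const_mul _ hρm, ← lintegral_add_left (hfm.const_mul _)]
    exact setLIntegral_mono' (measurableSet_cube b) (hpt b)
  refine hmain.trans ((add_le_add le_rfl (mul_le_mul' le_rfl hρint)).trans ?_)
  set u := ENNReal.ofReal (K ^ (-c))
  set v := ENNReal.ofReal (K ^ (2 * (n + 2) + N) * (L ^ (N + 1)) ^ (-(1 / ((n + 2 : ℕ) : ℝ))))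
  calc _ = (Ca * u + Cb * l⁻¹ + Cc * (l ^ (4 * (n + 2) + 1 + (n + 2) * (n + 2)) * v)) * (H * Y) := by
        rw [hCa, hCb, hCc, pow_add l, pow_mul l, mul_pow]; ring
    _ ≤ ((Ca + Cb + Cc) * u + (Ca + Cb + Cc) * l⁻¹ + (Ca + Cb + Cc) * (l ^ (4 * (n + 2) + 1 + (n + 2) * (n + 2)) * v)) * (H * Y) := by
        refine mul_le_mul' (add_le_add (add_le_add (mul_le_mul' ?_ le_rfl) (mul_le_mul' ?_ le_rfl)) (mul_le_mul' ?_ le_rfl)) le_rfl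
        · rw [add_assoc]; exact le_self_add
        · rw [add_right_comm]; exact le_add_self
        · exact le_add_self
    _ = _ := by ring

lemma avg_le_avg_one {ι : Type*} [Fintype ι] {N : ℕ} {T : ℝ} (hT : 0 < T) (hT1 : T ≤ 1) {G : (ι → ℝ) → ℝ≥0∞}
    (hG : Measurable G) (x : ι → ℝ) :
    avg N T G x ≤ ENNReal.ofReal ((T ^ Fintype.card ι)⁻¹) * avg N 1 G x := by
  have hw : ∀ s : ι → ℝ, wt N s ≤ wt N (T • s) := fun s => by
    refine Finset.prod_le_prod' fun k _ => ENNReal.ofReal_le_ofReal (pow_le_pow_left₀ (cw_pos _).le ?_ N)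
    simp only [Pi.smul_apply, smul_eq_mul, cw]
    refine inv_anti₀ (by positivity) ?_
    rw [mul_pow]
    nlinarith [mul_le_mul_of_nonneg_right (pow_le_one₀ hT.le hT1 : T ^ 2 ≤ 1) (sq_nonneg (s k))]
  have hG' : Measurable fun y => G y * wt N (y - x) := hG.mul ((measurable_wt N).comp (by fun_prop))
  have h1 := lintegral_comp_add_smul hT hG' x
  have h2 := lintegral_comp_add_smul one_pos hG' x
  simp only [add_sub_cancel_left, one_pow, inv_one, ENNReal.ofReal_one, one_mul, one_smul] at h1 h2
  unfold avg
  simp only [one_smul]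
  rw [h2, ← h1]
  exact lintegral_mono fun s => mul_le_mul' le_rfl (hw s)

lemma exists_energy_bound (n : ℕ) (A : ℝ) (hA : 0 < A) : ∃ C : ℝ≥0∞, C ≠ ⊤ ∧
    ∀ (Ξ : Type) [MeasurableSpace Ξ] (ν : Measure Ξ) [SFinite ν] (φ : Ξ → Fin n → ℝ) (g : Ξ → ℂ),
      Integrable g ν → Measurable φ → (∀ ξ, g ξ ≠ 0 → |∑ k, φ ξ k ^ 2 - 1| ≤ A) →
      ∀ (μ : Measure (Fin n → ℝ)) [IsFiniteMeasure μ] (H : ℝ≥0∞), (∀ x, μ (closedBall x 1) ≤ H) →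
        ∫⁻ x, msq (osc ν φ g) x ∂μ ≤ C * H * ∫⁻ x, msq (osc ν φ g) x := by
  obtain ⟨C, hC, hrep⟩ := exists_repro (Fin n) 1 le_rfl
  set T : ℝ := (1 + A)⁻¹ with hT
  have hT0 : 0 < T := by positivity
  have hT1 : T ≤ 1 := inv_le_one_of_one_le₀ (by linarith)
  set W : ℝ≥0∞ := ENNReal.ofReal ((4 ^ 1) ^ Fintype.card (Fin n)) * (∫⁻ s, wt (ι := Fin n) 1 s) with hW
  have hW' : W ≠ ⊤ := ENNReal.mul_ne_top ENNReal.ofReal_ne_top (lintegral_wt_lt_top le_rfl).ne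
  refine ⟨C * ENNReal.ofReal ((T ^ Fintype.card (Fin n))⁻¹) * W, by finiteness, ?_⟩
  intro Ξ _ ν _ φ g hg hφ hsph μ _ H hH
  have hm := measurable_msq_osc hg hφ
  have h1 := hrep Ξ ν φ g hg hφ T 0 fun ξ hξ k => by
    rw [Pi.zero_apply, sub_zero, abs_mul, abs_of_pos hT0, hT]
    have := mul_le_mul_of_nonneg_left (abs_le_of_sum_sq hA.le (hsph ξ hξ) k) hT0.le
    rw [hT, inv_mul_cancel₀ (by positivity)] at this
    linarith
  calc _ ≤ ∫⁻ x, C * ENNReal.ofReal ((T ^ Fintype.card (Fin n))⁻¹) * avg 1 1 (msq (osc ν φ g)) x ∂μ :=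
        lintegral_mono fun x => (h1 x).trans (by
          rw [mul_assoc]; exact mul_le_mul' le_rfl (avg_le_avg_one hT0 hT1 hm x))
    _ = C * ENNReal.ofReal ((T ^ Fintype.card (Fin n))⁻¹) * ∫⁻ x, avg 1 1 (msq (osc ν φ g)) x ∂μ :=
        lintegral_const_mul _ (measurable_avg hm)
    _ ≤ C * ENNReal.ofReal ((T ^ Fintype.card (Fin n))⁻¹) * (W * H * ∫⁻ x, msq (osc ν φ g) x) :=
        mul_le_mul' le_rfl (lintegral_avg_le le_rfl hm hH)
    _ = _ := by ring

lemma KakeyaEnergy.succ {n : ℕ} (h : KakeyaEnergy n) : KakeyaEnergy (n + 1) := by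
  intro A hA
  set D := n + 2 with hD
  set q := D * D + 4 * D + 1 with hq
  set N := 2 * D * q + 2 * D with hN
  set p := 4 * D * (N + 1) with hp
  obtain ⟨c, C, hc, hc1, hC, hstep⟩ := h.step_bound N A hA
  obtain ⟨C₁, hC₁, htriv⟩ := exists_energy_bound (n + 2) A hA
  have hD2 : (2:ℝ) ≤ D := by rw [hD]; push_cast; linarith [(Nat.cast_nonneg n : (0:ℝ) ≤ n)]
  have hp1 : (1:ℝ) ≤ p := by
    have : 1 ≤ p := by rw [hp]; nlinarith
    exact_mod_cast this
  have hp0 : (0:ℝ) < p := by linarith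
  set K₀ : ℝ := 3 * D ^ 2 with hK₀
  have hK₀0 : 0 < K₀ := by positivity
  refine ⟨c / p, 3 * C + C₁ * ENNReal.ofReal (K₀ ^ c), by positivity, (div_le_one hp0).2 (by linarith), by finiteness, ?_⟩
  intro R hR Ξ _ ν _ φ g hg hφ hsph μ _ H hH hH'
  have hR0 : 0 < R := by linarith
  set K : ℝ := R ^ (1 / (p:ℝ)) with hK
  have hK1 : 1 ≤ K := Real.one_le_rpow hR (by positivity)
  have hK0 : 0 < K := by linarith
  have hKp : K ^ p = R := by
    rw [hK, ← Real.rpow_natCast, ← Real.rpow_mul hR0.le, one_div_mul_cancel hp0.ne', Real.rpow_one]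
  have hKc : K ^ (-c) = R ^ (-(c / p)) := by
    rw [hK, ← Real.rpow_mul hR0.le]; congr 1; ring
  rw [← hKc]
  set Y := ∫⁻ x, msq (osc ν φ g) x with hY
  by_cases hcase : K < K₀ ∨ Y = ⊤
  · have h1 := htriv Ξ ν φ g hg hφ (fun ξ hξ => (hsph ξ hξ).trans (div_le_self hA.le hR)) μ H
      fun x => by simpa using hH x 1 le_rfl hR
    rcases hcase with hcase | hcase
    · refine h1.trans (mul_le_mul' ?_ le_rfl)
      have h2 : 1 ≤ ENNReal.ofReal (K₀ ^ c) * ENNReal.ofReal (K ^ (-c)) := by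
        rw [← ENNReal.ofReal_mul (by positivity), ← ENNReal.ofReal_one]
        refine ENNReal.ofReal_le_ofReal ?_
        rw [Real.rpow_neg hK0.le, ← div_eq_mul_inv, one_le_div (by positivity)]
        exact Real.rpow_le_rpow hK0.le hcase.le hc.le
      calc C₁ * H = C₁ * H * 1 := (mul_one _).symm
        _ ≤ C₁ * H * (ENNReal.ofReal (K₀ ^ c) * ENNReal.ofReal (K ^ (-c))) := mul_le_mul' le_rfl h2
        _ = (C₁ * ENNReal.ofReal (K₀ ^ c)) * H * ENNReal.ofReal (K ^ (-c)) := by ring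
        _ ≤ _ := mul_le_mul' (mul_le_mul' le_add_self le_rfl) le_rfl
    · rw [← hY, hcase] at *
      refine h1.trans ?_
      by_cases hC₁H : C₁ * H = 0
      · simp [hC₁H]
      · have hKc0 : ENNReal.ofReal (K ^ (-c)) ≠ 0 := by
          rw [ENNReal.ofReal_ne_zero_iff]; positivity
        have hK₀c0 : ENNReal.ofReal (K₀ ^ c) ≠ 0 := by
          rw [ENNReal.ofReal_ne_zero_iff]; positivity
        have : (3 * C + C₁ * ENNReal.ofReal (K₀ ^ c)) * H * ENNReal.ofReal (K ^ (-c)) ≠ 0 := by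
          simp only [ne_eq, mul_eq_zero, not_or, add_eq_zero] at hC₁H ⊢
          tauto
        rw [ENNReal.mul_top this]
        exact le_top
  · push Not at hcase
    obtain ⟨hKK, hYt⟩ := hcase
    set L : ℝ := K ^ (4 * D) with hL
    have hLR : L ^ (N + 1) = R := by rw [hL, ← pow_mul, ← hp, hKp]
    have hKL : 3 * ((n + 2 : ℕ) : ℝ) ^ 2 * K ≤ L := by
      calc 3 * ((n + 2 : ℕ) : ℝ) ^ 2 * K ≤ K * K := mul_le_mul_of_nonneg_right hKK hK0.le
        _ = K ^ 2 := by ring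
        _ ≤ L := pow_le_pow_right₀ hK1 (by omega)
    have h1 := hstep K L hK1 hKL Ξ ν φ g hg hφ (by rwa [hLR]) μ H (by rwa [hLR]) (by rwa [hLR]) hYt
    refine h1.trans (mul_le_mul' ?_ le_rfl)
    have e0 : ∀ a : ℝ, a ≤ -1 → ENNReal.ofReal (K ^ a) ≤ ENNReal.ofReal (K ^ (-c)) := fun a ha =>
      ENNReal.ofReal_le_ofReal (Real.rpow_le_rpow_of_exponent_le hK1 (by linarith))
    have e1 : (ENNReal.ofReal L)⁻¹ ≤ ENNReal.ofReal (K ^ (-c)) := by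
      rw [← ENNReal.ofReal_inv_of_pos (by positivity), hL, ← Real.rpow_natCast, ← Real.rpow_neg hK0.le]
      refine e0 _ ?_
      push_cast; linarith
    have e2 : ENNReal.ofReal L ^ (4 * (n + 2) + 1 + (n + 2) * (n + 2)) *
            ENNReal.ofReal (K ^ (2 * (n + 2) + N) * (L ^ (N + 1)) ^ (-(1 / ((n + 2 : ℕ) : ℝ)))) ≤ ENNReal.ofReal (K ^ (-c)) := by
      have hDn : ((n + 2 : ℕ) : ℝ) = D := by rw [hD]
      have h3 : (L ^ (N + 1)) ^ (-(1 / ((n + 2 : ℕ) : ℝ))) = K ^ (-(4 * ((N:ℝ) + 1))) := by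
        rw [hDn, hL, ← pow_mul, ← Real.rpow_natCast, ← Real.rpow_mul hK0.le]
        congr 1
        push_cast
        field_simp
      rw [h3, ← ENNReal.ofReal_pow (by positivity), ← ENNReal.ofReal_mul (by positivity), hL, ← pow_mul, ← mul_assoc, ← pow_add,
        ← Real.rpow_natCast, ← Real.rpow_add hK0]
      refine e0 _ ?_
      have hNr : (N:ℝ) = 2 * D * (D * D + 4 * D + 1) + 2 * D := by rw [hN, hq]; push_cast; ring
      push_cast
      have hnD : (n:ℝ) + 2 = D := by rw [hD]; push_cast; ring
      rw [hnD, hNr]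
      nlinarith [mul_pos (show (0:ℝ) < D by linarith) (show (0:ℝ) < D by linarith), mul_pos (mul_pos (show (0:ℝ) < D by linarith) (show (0:ℝ) < D by linarith)) (show (0:ℝ) < D by linarith)]
    calc _ ≤ C * H * (ENNReal.ofReal (K ^ (-c)) + ENNReal.ofReal (K ^ (-c)) + ENNReal.ofReal (K ^ (-c))) :=
          mul_le_mul' le_rfl (add_le_add (add_le_add le_rfl e1) e2)
      _ = (3 * C) * H * ENNReal.ofReal (K ^ (-c)) := by ring
      _ ≤ _ := mul_le_mul' (mul_le_mul' le_self_add le_rfl) le_rfl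

theorem kakeyaEnergy : ∀ n, KakeyaEnergy n
  | 0 => kakeyaEnergy_zero
  | n + 1 => (kakeyaEnergy n).succ

/-- Plancherel's inequality for oscillatory integrals over Ahlfors-regular frequency measures. -/
lemma exists_plancherel (ι : Type*) [Fintype ι] : ∃ C : ℝ≥0∞, C ≠ ⊤ ∧
    ∀ (Ξ : Type) [MeasurableSpace Ξ] (ν : Measure Ξ) [SFinite ν] (φ : Ξ → ι → ℝ) (g : Ξ → ℂ),
      Integrable g ν → Measurable g → Measurable φ → ∀ V : ℝ≥0∞,
      (∀ ξ r, 0 < r → ν {η | ∀ k, |φ ξ k - φ η k| < r} ≤ V * ENNReal.ofReal (r ^ Fintype.card ι)) →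
      ∫⁻ x, msq (osc ν φ g) x ≤ C * V * ∫⁻ ξ, ‖g ξ‖ₑ ^ 2 ∂ν := by
  obtain ⟨m, hm, ⟨A, B, hA, hB, hAB⟩, hz⟩ := exists_thetaMeasure ι
  set K : ℝ≥0∞ := ENNReal.ofReal ((2 ^ 1) ^ Fintype.card ι) with hK
  refine ⟨K * A * (m univ * 2), by finiteness, ?_⟩
  intro Ξ _ ν _ φ g hg hgm hφ V hV
  set Y := ∫⁻ ξ, ‖g ξ‖ₑ ^ 2 ∂ν with hY
  have hφk : ∀ k, Measurable fun ξ => φ ξ k := fun k => (measurable_pi_apply k).comp hφ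
  have key : ∀ T : ℝ, 0 < T → ∫⁻ s, msq (osc ν φ g) (T • s) ∂m ≤
      m univ * 2 * (V * ENNReal.ofReal ((T ^ Fintype.card ι)⁻¹)) * Y := by
    intro T hT
    set near : Set (Ξ × Ξ) := {p | ∀ k, |φ p.1 k - φ p.2 k| < T⁻¹} with hnear
    have hnm : MeasurableSet near := by
      rw [hnear, ofPred_forall]
      refine MeasurableSet.iInter fun k => measurableSet_lt ?_ measurable_const
      exact (((hφk k).comp measurable_fst).sub ((hφk k).comp measurable_snd)).norm
    have hcont : Continuous fun s : ι → ℝ => osc ν φ g (T • s) := (continuous_osc hg hφ).comp (by fun_prop)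
    have hpm : Measurable fun p : Ξ × Ξ => fun k => φ p.1 k + -φ p.2 k := by
      refine measurable_pi_iff.2 fun k => ((hφk k).comp measurable_fst).add ((hφk k).comp measurable_snd).neg
    have hconj : Integrable (fun ξ => starRingEnd ℂ (g ξ)) ν := by
      simpa using (Complex.conjLIE.toContinuousLinearEquiv.toContinuousLinearMap.integrable_comp hg)
    have h1 : ((∫ s, ‖osc ν φ g (T • s)‖ ^ 2 ∂m : ℝ) : ℂ) = ∫ p, (g p.1 * starRingEnd ℂ (g p.2)) *
        (∫ s, cis (∑ k, (T • s) k * (φ p.1 k + -φ p.2 k)) * 1 ∂m) ∂(ν.prod ν) := by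
      rw [← osc_fubini (g := fun p : Ξ × Ξ => g p.1 * starRingEnd ℂ (g p.2)) (X := fun s => T • s) (hg.mul_prod hconj) hpm (by fun_prop) (integrable_const (1:ℂ)), ← integral_complex_ofReal]
      congr 1; ext s
      rw [mul_one, ← osc_mul_osc (fun ξ k => -φ ξ k) (fun ξ => starRingEnd ℂ (g ξ)), ← conj_osc, Complex.mul_conj,
        Complex.normSq_eq_norm_sq]
    have h2 : ∀ p : Ξ × Ξ, ‖∫ s, cis (∑ k, (T • s) k * (φ p.1 k + -φ p.2 k)) * 1 ∂m‖ₑ ≤ near.indicator (fun _ => m univ) p := by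
      intro p
      by_cases hp : p ∈ near
      · rw [indicator_of_mem hp]
        refine (enorm_integral_le_lintegral_enorm _).trans ?_
        simp [← ofReal_norm, norm_cis]
      · have : ∃ k, 1 ≤ |T * (φ p.1 k - φ p.2 k)| := by
          simp only [hnear, mem_ofPred_eq, not_forall, not_lt] at hp
          obtain ⟨k, hk⟩ := hp
          refine ⟨k, ?_⟩
          rw [abs_mul, abs_of_pos hT]
          calc (1:ℝ) = T * T⁻¹ := (mul_inv_cancel₀ hT.ne').symm
            _ ≤ _ := by gcongr
        have h3 := hz (fun k => T * (φ p.1 k - φ p.2 k)) this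
        have h4 : ∀ s : ι → ℝ, cis (∑ k, (T • s) k * (φ p.1 k + -φ p.2 k)) * 1 = cis (∑ k, s k * (T * (φ p.1 k - φ p.2 k))) := fun s => by
          rw [mul_one]; congr 1
          refine Finset.sum_congr rfl fun k _ => ?_
          rw [Pi.smul_apply, smul_eq_mul]; ring
        simp_rw [h4, h3]
        simp
    have hind : ∀ f : Ξ → ℝ≥0∞, Measurable f → ∫⁻ p, near.indicator (fun p => f p.1) p ∂(ν.prod ν) ≤
        (V * ENNReal.ofReal ((T ^ Fintype.card ι)⁻¹)) * ∫⁻ ξ, f ξ ∂ν := fun f hf => by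
      have hm1 : Measurable fun p : Ξ × Ξ => near.indicator (fun p => f p.1) p := (hf.comp measurable_fst).indicator hnm
      rw [lintegral_prod _ hm1.aemeasurable, ← lintegral_const_mul _ hf]
      refine lintegral_mono fun ξ => ?_
      have h5 : ∀ η, near.indicator (fun p => f p.1) (ξ, η) = {η | ∀ k, |φ ξ k - φ η k| < T⁻¹}.indicator (fun _ => f ξ) η := fun η => by
        simp [Set.indicator, hnear]
      have h6 : MeasurableSet {η | ∀ k, |φ ξ k - φ η k| < T⁻¹} := measurable_prodMk_left hnm
      simp_rw [h5]
      rw [lintegral_indicator_const h6, mul_comm (f ξ), ← inv_pow]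
      exact mul_le_mul' (hV ξ T⁻¹ (by positivity)) le_rfl
    have hsymm : ∀ f : Ξ → ℝ≥0∞, Measurable f → ∫⁻ p, near.indicator (fun p => f p.2) p ∂(ν.prod ν) =
        ∫⁻ p, near.indicator (fun p => f p.1) p ∂(ν.prod ν) := fun f hf => by
      rw [← lintegral_prod_swap]
      congr 1; ext p
      simp [Set.indicator, hnear, abs_sub_comm]
    have he : Measurable fun ξ => ‖g ξ‖ₑ ^ 2 := by fun_prop
    have h0 := lintegral_msq_eq (m := m) (f := fun s => osc ν φ g (T • s)) hcont.measurable fun s => norm_osc_le _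
    change ∫⁻ s, msq (fun s => osc ν φ g (T • s)) s ∂m ≤ _
    rw [h0]
    calc ENNReal.ofReal (∫ s, ‖osc ν φ g (T • s)‖ ^ 2 ∂m) ≤ ‖((∫ s, ‖osc ν φ g (T • s)‖ ^ 2 ∂m : ℝ) : ℂ)‖ₑ := by
          rw [← ofReal_norm, Complex.norm_real]
          exact ENNReal.ofReal_le_ofReal (le_abs_self _)
      _ ≤ ∫⁻ p, m univ * (near.indicator (fun p => ‖g p.1‖ₑ ^ 2) p + near.indicator (fun p => ‖g p.2‖ₑ ^ 2) p) ∂(ν.prod ν) := by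
          rw [h1]
          refine (enorm_integral_le_lintegral_enorm _).trans (lintegral_mono fun p => ?_)
          rw [enorm_mul]
          refine (mul_le_mul' le_rfl (h2 p)).trans ?_
          by_cases hp : p ∈ near
          · rw [indicator_of_mem hp, indicator_of_mem hp, indicator_of_mem hp, enorm_mul, mul_comm]
            refine mul_le_mul' le_rfl ?_
            have h7 : ‖starRingEnd ℂ (g p.2)‖ₑ = ‖g p.2‖ₑ := by rw [← ofReal_norm, RCLike.norm_conj, ofReal_norm]
            rw [h7]
            rcases le_total (‖g p.1‖ₑ) (‖g p.2‖ₑ) with h | h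
            · calc _ ≤ ‖g p.2‖ₑ * ‖g p.2‖ₑ := mul_le_mul' h le_rfl
                _ ≤ _ := by rw [← sq]; exact le_add_self
            · calc _ ≤ ‖g p.1‖ₑ * ‖g p.1‖ₑ := mul_le_mul' le_rfl h
                _ ≤ _ := by rw [← sq]; exact le_self_add
          · rw [indicator_of_notMem hp, mul_zero]; exact zero_le
      _ ≤ m univ * ((V * ENNReal.ofReal ((T ^ Fintype.card ι)⁻¹)) * Y + (V * ENNReal.ofReal ((T ^ Fintype.card ι)⁻¹)) * Y) := by
          have hm1 : Measurable fun p : Ξ × Ξ => near.indicator (fun p => ‖g p.1‖ₑ ^ 2) p := (he.comp measurable_fst).indicator hnm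
          have hm2 : Measurable fun p : Ξ × Ξ => near.indicator (fun p => ‖g p.2‖ₑ ^ 2) p := (he.comp measurable_snd).indicator hnm
          have hm3 : Measurable fun p : Ξ × Ξ => near.indicator (fun p => ‖g p.1‖ₑ ^ 2) p + near.indicator (fun p => ‖g p.2‖ₑ ^ 2) p := hm1.add hm2
          rw [lintegral_const_mul _ hm3, lintegral_add_left hm1]
          refine mul_le_mul' le_rfl (add_le_add (hind _ he) ?_)
          rw [hsymm _ he]; exact hind _ he
      _ = _ := by ring
  have hball : ∀ T : ℝ, 0 < T → ∫⁻ x in closedBall 0 T, msq (osc ν φ g) x ≤ K * A * (m univ * 2) * V * Y := by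
    intro T hT
    have hmm := measurable_msq_osc hg hφ
    have hTm : Measurable fun s : ι → ℝ => msq (osc ν φ g) (T • s) := hmm.comp (by fun_prop)
    set G := (closedBall (0 : ι → ℝ) T).indicator (msq (osc ν φ g)) with hG
    have hGm : Measurable G := hmm.indicator measurableSet_closedBall
    have h1 := lintegral_comp_add_smul hT hGm 0
    have hTT : ENNReal.ofReal (T ^ Fintype.card ι) * ENNReal.ofReal ((T ^ Fintype.card ι)⁻¹) = 1 := by
      rw [← ENNReal.ofReal_mul (by positivity), mul_inv_cancel₀ (by positivity), ENNReal.ofReal_one]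
    have h2 : ∀ s, G (0 + T • s) ≤ K * (msq (osc ν φ g) (T • s) * wt 1 s) := fun s => by
      rw [zero_add, hG]
      by_cases hs : T • s ∈ closedBall (0 : ι → ℝ) T
      · rw [indicator_of_mem hs]
        have h3 : ∀ k, |s k| ≤ 1 := fun k => by
          rw [mem_closedBall_zero_iff, norm_smul, Real.norm_of_nonneg hT.le] at hs
          have := norm_le_pi_norm s k
          rw [Real.norm_eq_abs] at this
          refine this.trans (le_of_mul_le_mul_left (by rwa [mul_one]) hT)
        calc _ = msq (osc ν φ g) (T • s) * 1 := (mul_one _).symm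
          _ ≤ msq (osc ν φ g) (T • s) * (K * wt 1 s) := mul_le_mul' le_rfl (one_le_wt h3)
          _ = _ := by ring
      · rw [indicator_of_notMem hs]; exact zero_le
    have h4 : ∫⁻ s, G (0 + T • s) ≤ K * (A * (m univ * 2 * (V * ENNReal.ofReal ((T ^ Fintype.card ι)⁻¹)) * Y)) := by
      refine (lintegral_mono h2).trans ?_
      have hTw : Measurable fun s : ι → ℝ => msq (osc ν φ g) (T • s) * wt 1 s := hTm.mul (measurable_wt 1)
      rw [lintegral_const_mul _ hTw]
      exact mul_le_mul' le_rfl ((hAB _ hTm).1.trans (mul_le_mul' le_rfl (key T hT)))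
    rw [h1] at h4
    rw [← lintegral_indicator measurableSet_closedBall]
    calc ∫⁻ x, G x = ENNReal.ofReal (T ^ Fintype.card ι) * (ENNReal.ofReal ((T ^ Fintype.card ι)⁻¹) * ∫⁻ x, G x) := by
          rw [← mul_assoc, hTT, one_mul]
      _ ≤ ENNReal.ofReal (T ^ Fintype.card ι) * (K * (A * (m univ * 2 * (V * ENNReal.ofReal ((T ^ Fintype.card ι)⁻¹)) * Y))) := mul_le_mul' le_rfl h4
      _ = (ENNReal.ofReal (T ^ Fintype.card ι) * ENNReal.ofReal ((T ^ Fintype.card ι)⁻¹)) * (K * A * (m univ * 2) * V * Y) := by ring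
      _ = _ := by rw [hTT, one_mul]
  refine le_of_tendsto ((aecover_closedBall (x := (0 : ι → ℝ)) tendsto_id).lintegral_tendsto_of_countably_generated (measurable_msq_osc hg hφ).aemeasurable) ?_
  filter_upwards [eventually_gt_atTop 0] with T hT using hball T hT

lemma measurable_coord (n : ℕ) : Measurable fun (ξ : EuclideanSpace ℝ (Fin n)) k => ξ k :=
  (PiLp.volume_preserving_ofLp (Fin n)).measurable

lemma volume_coord_le (n : ℕ) (ξ : EuclideanSpace ℝ (Fin n)) (r : ℝ) (hr : 0 < r) :
    volume {η : EuclideanSpace ℝ (Fin n) | ∀ k, |ξ k - η k| < r} ≤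
      ENNReal.ofReal (2 ^ Fintype.card (Fin n)) * ENNReal.ofReal (r ^ Fintype.card (Fin n)) := by
  have h1 : {η : EuclideanSpace ℝ (Fin n) | ∀ k, |ξ k - η k| < r} =
      (WithLp.ofLp : EuclideanSpace ℝ (Fin n) → Fin n → ℝ) ⁻¹' ball (WithLp.ofLp ξ) r := by
    ext η
    simp only [mem_ofPred_eq, mem_preimage, mem_ball, dist_pi_lt_iff hr, Real.dist_eq, abs_sub_comm]
  rw [h1, (PiLp.volume_preserving_ofLp (Fin n)).measure_preimage measurableSet_ball.nullMeasurableSet, Real.volume_pi_ball _ hr, mul_pow,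
    ENNReal.ofReal_mul (by positivity)]

lemma lintegral_comp_smul {ι : Type*} [Fintype ι] {T : ℝ} (hT : 0 < T) {G : (ι → ℝ) → ℝ≥0∞} (hG : Measurable G) :
    ∫⁻ y, G (T⁻¹ • y) = ENNReal.ofReal (T ^ Fintype.card ι) * ∫⁻ x, G x := by
  have := lintegral_comp_add_smul (inv_pos.2 hT) hG 0
  simpa using this

/-- Energy estimate on unit-width annuli against fractal measures. -/
lemma exists_annulus_energy (n : ℕ) : ∃ (c : ℝ) (C : ℝ≥0∞), 0 < c ∧ c ≤ 1 ∧ C ≠ ⊤ ∧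
    ∀ j : ℝ, 1 ≤ j → ∀ g : EuclideanSpace ℝ (Fin (n + 1)) → ℂ, Integrable g → Measurable g →
      (∀ ξ, g ξ ≠ 0 → j ≤ ‖ξ‖ ∧ ‖ξ‖ ≤ j + 1) → ∀ α : ℝ, α ≤ n →
      ∀ (μ : Measure (Fin (n + 1) → ℝ)) [IsFiniteMeasure μ] (κ : ℝ≥0∞),
        (∀ x r, j⁻¹ ≤ r → r ≤ 1 → μ (closedBall x r) ≤ κ * ENNReal.ofReal (r ^ α)) →
        ∫⁻ x, msq (osc volume (fun ξ k => ξ k) g) x ∂μ ≤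
          C * κ * ENNReal.ofReal (j ^ ((n:ℝ) + 1 - α - c)) * ∫⁻ ξ, ‖g ξ‖ₑ ^ 2 := by
  obtain ⟨c, C, hc, hc1, hC, hK⟩ := (kakeyaEnergy n).loc 3 (by norm_num)
  obtain ⟨C₂, hC₂, hP⟩ := exists_plancherel (Fin (n + 1))
  set V := ENNReal.ofReal (2 ^ Fintype.card (Fin (n + 1))) with hV
  refine ⟨c, C * C₂ * V, hc, hc1, by finiteness, ?_⟩
  intro j hj g hg hgm hsupp α hα μ _ κ hμ
  have hj0 : 0 < j := by linarith
  have hφ := measurable_coord (n + 1)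
  set f := osc volume (fun (ξ : EuclideanSpace ℝ (Fin (n + 1))) k => ξ k) g with hf
  have hfm : Measurable (msq f) := measurable_msq_osc hg hφ
  set φ : EuclideanSpace ℝ (Fin (n + 1)) → Fin (n + 1) → ℝ := fun ξ k => j⁻¹ * ξ k with hφdef
  have hφ' : Measurable φ := by
    refine measurable_pi_iff.2 fun k => ?_
    exact ((measurable_pi_apply k).comp hφ).const_mul _
  have hosc : ∀ y, osc volume φ g y = f (j⁻¹ • y) := fun y => by
    rw [hf]; unfold osc
    congr 1; ext ξ
    congr 2
    refine Finset.sum_congr rfl fun k _ => ?_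
    rw [hφdef, Pi.smul_apply, smul_eq_mul]; ring
  have hms : Measurable fun x : Fin (n + 1) → ℝ => j • x := by fun_prop
  have hoscm := measurable_msq_osc hg hφ' (φ := φ)
  have h1 := hK j hj (EuclideanSpace ℝ (Fin (n + 1))) volume φ g hg hφ' (fun ξ hξ => by
    obtain ⟨ha, hb⟩ := hsupp ξ hξ
    have : ∑ k, φ ξ k ^ 2 = ‖ξ‖ ^ 2 / j ^ 2 := by
      rw [EuclideanSpace.real_norm_sq_eq, Finset.sum_div]
      refine Finset.sum_congr rfl fun k _ => ?_
      rw [hφdef]; field_simp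
    rw [this, abs_of_nonneg (by rw [sub_nonneg, one_le_div (by positivity)]; gcongr), div_sub_one (by positivity),
      div_le_div_iff₀ (by positivity) hj0]
    nlinarith [mul_le_mul hb hb (norm_nonneg ξ) (by linarith), mul_pos hj0 hj0]) (μ.map fun x => j • x) (κ * ENNReal.ofReal (j ^ (-α)))
    fun x r hr hrj => by
      rw [Measure.map_apply hms measurableSet_closedBall]
      have h2 : (fun x : Fin (n + 1) → ℝ => j • x) ⁻¹' closedBall x r = closedBall (j⁻¹ • x) (r / j) := by
        ext y
        rw [mem_preimage, mem_closedBall, mem_closedBall, le_div_iff₀ hj0, dist_eq_norm, dist_eq_norm]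
        have : j • y - x = j • (y - j⁻¹ • x) := by rw [smul_sub, smul_inv_smul₀ hj0.ne']
        rw [this, norm_smul, Real.norm_of_nonneg hj0.le, mul_comm]
      rw [h2]
      refine (hμ _ _ (by rw [inv_eq_one_div]; gcongr) (by rwa [div_le_one hj0])).trans ?_
      rw [mul_assoc, ← ENNReal.ofReal_mul (by positivity)]
      refine mul_le_mul' le_rfl (ENNReal.ofReal_le_ofReal ?_)
      rw [div_eq_mul_inv, Real.mul_rpow (by linarith) (by positivity), Real.inv_rpow hj0.le, ← Real.rpow_neg hj0.le, mul_comm, ← Real.rpow_natCast r n]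
      exact mul_le_mul_of_nonneg_left (Real.rpow_le_rpow_of_exponent_le hr hα) (by positivity)
  rw [lintegral_map hoscm hms] at h1
  have e1 : ∀ y, msq (osc volume φ g) y = msq f (j⁻¹ • y) := fun y => by unfold msq; rw [hosc]
  simp_rw [e1, inv_smul_smul₀ hj0.ne'] at h1
  rw [lintegral_comp_smul hj0 hfm] at h1
  have h3 := hP _ volume (fun ξ k => ξ k) g hg hgm hφ V (volume_coord_le (n + 1))
  refine h1.trans ((mul_le_mul' le_rfl (mul_le_mul' le_rfl h3)).trans (le_of_eq ?_))
  have h4 : ENNReal.ofReal (j ^ ((n:ℝ) + 1 - α - c)) = ENNReal.ofReal (j ^ (-α)) * ENNReal.ofReal (j ^ (-c)) *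
      ENNReal.ofReal (j ^ Fintype.card (Fin (n + 1))) := by
    rw [← ENNReal.ofReal_mul (by positivity), ← ENNReal.ofReal_mul (by positivity), ← Real.rpow_natCast, ← Real.rpow_add hj0, ← Real.rpow_add hj0, Fintype.card_fin]
    congr 2; push_cast; ring
  rw [h4]; ring

/-- The part of `h` living outside the ball of radius `r`. -/
noncomputable def outer {n : ℕ} (r : ℝ) (h : EuclideanSpace ℝ (Fin n) → ℂ) : EuclideanSpace ℝ (Fin n) → ℂ :=
  {ξ | r < ‖ξ‖}.indicator h

/-- The inverse Fourier integral, in coordinates. -/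
noncomputable def fosc {n : ℕ} (h : EuclideanSpace ℝ (Fin n) → ℂ) : (Fin n → ℝ) → ℂ :=
  osc volume (fun (ξ : EuclideanSpace ℝ (Fin n)) k => ξ k) h

/-- Majorant for radial multipliers of bounded variation on a unit-width annulus. -/
noncomputable def radMax {n : ℕ} (j : ℝ) (h : EuclideanSpace ℝ (Fin n) → ℂ) (x : Fin n → ℝ) : ℝ≥0∞ :=
  ‖fosc h x‖ₑ + ∫⁻ s in Ioc (0:ℝ) 1, ‖fosc (outer (j + s) h) x‖ₑ

section
variable {n : ℕ} {h : EuclideanSpace ℝ (Fin n) → ℂ}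

lemma measurableSet_outer (r : ℝ) : MeasurableSet {ξ : EuclideanSpace ℝ (Fin n) | r < ‖ξ‖} :=
  measurableSet_lt measurable_const measurable_norm

lemma integrable_outer (hh : Integrable h) (r : ℝ) : Integrable (outer r h) :=
  hh.indicator (measurableSet_outer r)

lemma measurable_outer_uncurry (hm : Measurable h) (j : ℝ) :
    Measurable fun p : ℝ × EuclideanSpace ℝ (Fin n) => outer (j + p.1) h p.2 := by
  have h1 : MeasurableSet {p : ℝ × EuclideanSpace ℝ (Fin n) | j + p.1 < ‖p.2‖} :=
    measurableSet_lt (by fun_prop) (by fun_prop)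
  have h2 : (fun p : ℝ × EuclideanSpace ℝ (Fin n) => outer (j + p.1) h p.2) =
      {p : ℝ × EuclideanSpace ℝ (Fin n) | j + p.1 < ‖p.2‖}.indicator fun p => h p.2 := by
    ext p; simp [outer, Set.indicator]
  rw [h2]
  exact (hm.comp measurable_snd).indicator h1

lemma measurable_fosc_outer (hm : Measurable h) (j : ℝ) :
    Measurable fun p : ℝ × (Fin n → ℝ) => fosc (outer (j + p.1) h) p.2 := by
  have h1 : Measurable (Function.uncurry fun (p : ℝ × (Fin n → ℝ)) (ξ : EuclideanSpace ℝ (Fin n)) =>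
      outer (j + p.1) h ξ * cis (∑ k, p.2 k * ξ k)) := by
    refine ((measurable_outer_uncurry hm j).comp (f := fun q : (ℝ × (Fin n → ℝ)) × EuclideanSpace ℝ (Fin n) => (q.1.1, q.2)) (by fun_prop)).mul ?_
    refine continuous_cis.measurable.comp (Finset.measurable_sum _ fun k _ => ?_)
    exact ((measurable_pi_apply k).comp (measurable_snd.comp measurable_fst)).mul
      ((measurable_pi_apply k).comp ((measurable_coord n).comp measurable_snd))
  exact (h1.stronglyMeasurable.integral_prod_right (ν := volume)).measurable

lemma measurable_radMax (hh : Integrable h) (hm : Measurable h) (j : ℝ) : Measurable (radMax j h) := by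
  refine (continuous_osc hh (measurable_coord n)).measurable.enorm.add ?_
  exact ((measurable_fosc_outer hm j).enorm.comp measurable_swap).lintegral_prod_right'

lemma enorm_radial_le (hh : Integrable h) (hm : Measurable h) {j : ℝ} (hs : ∀ ξ, h ξ ≠ 0 → j ≤ ‖ξ‖ ∧ ‖ξ‖ ≤ j + 1)
    {a a' : ℝ → ℂ} (ha : ∀ ρ, HasDerivAt a (a' ρ) ρ) (ha' : Continuous a') {B : ℝ} (hB : ∀ ρ, ‖a ρ‖ ≤ B) (hB' : ∀ ρ, ‖a' ρ‖ ≤ B)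
    (x : Fin n → ℝ) :
    ‖fosc (fun ξ => a ‖ξ‖ * h ξ) x‖ₑ ≤ ENNReal.ofReal B * radMax j h x := by
  set ν := (volume : Measure ℝ).restrict (Ioc 0 1) with hν
  have hpt : ∀ ξ : EuclideanSpace ℝ (Fin n), a ‖ξ‖ * h ξ = a j * h ξ + ∫ s, a' (j + s) * outer (j + s) h ξ ∂ν := by
    intro ξ
    by_cases hξ : h ξ = 0
    · have : ∀ s, outer (j + s) h ξ = 0 := fun s => by simp [outer, Set.indicator, hξ]
      simp [hξ, this]
    · obtain ⟨h1, h2⟩ := hs ξ hξ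
      have h3 : ∀ s, a' (j + s) * outer (j + s) h ξ = (Iio (‖ξ‖ - j)).indicator (fun s => a' (j + s) * h ξ) s := fun s => by
        simp only [outer, Set.indicator, mem_ofPred_eq, mem_Iio, lt_sub_iff_add_lt']
        split_ifs <;> simp
      simp_rw [h3]
      rw [hν, integral_indicator measurableSet_Iio, Measure.restrict_restrict measurableSet_Iio]
      have h4 : Iio (‖ξ‖ - j) ∩ Ioc 0 1 = Ioo 0 (‖ξ‖ - j) := by
        ext s; simp only [mem_inter_iff, mem_Iio, mem_Ioc, mem_Ioo]
        constructor
        · rintro ⟨h5, h6, h7⟩; exact ⟨h6, h5⟩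
        · rintro ⟨h5, h6⟩; exact ⟨h6, h5, by linarith⟩
      rw [h4, ← integral_Ioc_eq_integral_Ioo, ← intervalIntegral.integral_of_le (by linarith), intervalIntegral.integral_mul_const,
        intervalIntegral.integral_comp_add_left (fun s => a' s) j, add_zero, add_sub_cancel,
        intervalIntegral.integral_eq_sub_of_hasDerivAt (fun ρ _ => ha ρ) (ha'.intervalIntegrable _ _)]
      ring
  have hcis : Measurable fun ξ : EuclideanSpace ℝ (Fin n) => cis (∑ k, x k * ξ k) :=
    measurable_phase (measurable_coord n) x
  have hint : Integrable (Function.uncurry fun (ξ : EuclideanSpace ℝ (Fin n)) (s : ℝ) =>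
      a' (j + s) * outer (j + s) h ξ * cis (∑ k, x k * ξ k)) (volume.prod ν) := by
    have h1 : Integrable (fun p : EuclideanSpace ℝ (Fin n) × ℝ => h p.1 * (B:ℂ)) (volume.prod ν) :=
      hh.mul_prod (integrable_const (μ := ν) (B:ℂ))
    refine h1.mono ?_ (Eventually.of_forall fun p => ?_)
    · refine Measurable.aestronglyMeasurable (Measurable.mul (Measurable.mul ?_ ?_) (hcis.comp measurable_fst))
      · exact ha'.measurable.comp (by fun_prop)
      · exact (measurable_outer_uncurry hm j).comp measurable_swap
    · have hB0 : 0 ≤ B := (norm_nonneg _).trans (hB 0)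
      simp only [Function.uncurry, norm_mul, norm_cis, mul_one, Complex.norm_real, Real.norm_of_nonneg hB0]
      rw [mul_comm]
      exact mul_le_mul (norm_indicator_le_norm_self _ _) (hB' _) (norm_nonneg _) (norm_nonneg _)
  have hsplit : fosc (fun ξ => a ‖ξ‖ * h ξ) x = a j * fosc h x + ∫ s, a' (j + s) * fosc (outer (j + s) h) x ∂ν := by
    have e1 : ∀ ξ : EuclideanSpace ℝ (Fin n), a ‖ξ‖ * h ξ * cis (∑ k, x k * ξ k) = a j * (h ξ * cis (∑ k, x k * ξ k)) +
        ∫ s, a' (j + s) * outer (j + s) h ξ * cis (∑ k, x k * ξ k) ∂ν := fun ξ => by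
      rw [integral_mul_const, hpt ξ]; ring
    have e2 : Integrable fun ξ : EuclideanSpace ℝ (Fin n) => ∫ s, a' (j + s) * outer (j + s) h ξ * cis (∑ k, x k * ξ k) ∂ν :=
      hint.integral_prod_left
    unfold fosc osc
    simp_rw [e1]
    rw [integral_add ((integrable_osc hh (measurable_coord n) x).const_mul _) e2, integral_const_mul,
      integral_integral_swap hint]
    congr 2
    ext s
    rw [← integral_const_mul]
    simp_rw [mul_assoc]
  have hBe : ∀ z : ℂ, ‖z‖ ≤ B → ‖z‖ₑ ≤ ENNReal.ofReal B := fun z hz => by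
    rw [← ofReal_norm]; exact ENNReal.ofReal_le_ofReal hz
  rw [hsplit, radMax, mul_add]
  refine (enorm_add_le _ _).trans (add_le_add ?_ ?_)
  · rw [enorm_mul]; exact mul_le_mul' (hBe _ (hB j)) le_rfl
  · refine (enorm_integral_le_lintegral_enorm _).trans ?_
    rw [← lintegral_const_mul' _ _ ENNReal.ofReal_ne_top]
    refine lintegral_mono fun s => ?_
    rw [enorm_mul]; exact mul_le_mul' (hBe _ (hB' _)) le_rfl

lemma lintegral_radMax_sq_le (hh : Integrable h) (hm : Measurable h) (j : ℝ) {μ : Measure (Fin n → ℝ)} [SFinite μ] {X : ℝ≥0∞}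
    (h0 : ∫⁻ x, msq (fosc h) x ∂μ ≤ X) (h1 : ∀ s ∈ Ioc (0:ℝ) 1, ∫⁻ x, msq (fosc (outer (j + s) h)) x ∂μ ≤ X) :
    ∫⁻ x, radMax j h x ^ 2 ∂μ ≤ 4 * X := by
  set ν := (volume : Measure ℝ).restrict (Ioc 0 1) with hν
  have hν1 : ν univ = 1 := by simp [hν]
  have hmm := measurable_fosc_outer hm j
  have hcs : ∀ x, (∫⁻ s, ‖fosc (outer (j + s) h) x‖ₑ ∂ν) ^ 2 ≤ ∫⁻ s, msq (fosc (outer (j + s) h)) x ∂ν := fun x => by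
    have hf : AEMeasurable (fun s => ‖fosc (outer (j + s) h) x‖ₑ) ν :=
      (hmm.comp (f := fun s : ℝ => (s, x)) (by fun_prop)).enorm.aemeasurable
    have := ENNReal.lintegral_mul_le_Lp_mul_Lq ν Real.HolderConjugate.two_two hf (aemeasurable_const (b := 1))
    simp only [Pi.mul_apply, mul_one, ENNReal.one_rpow, lintegral_one, hν1] at this
    calc _ ≤ ((∫⁻ s, ‖fosc (outer (j + s) h) x‖ₑ ^ (2:ℝ) ∂ν) ^ (1 / (2:ℝ))) ^ 2 := pow_le_pow_left' this 2
      _ = _ := by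
        rw [← ENNReal.rpow_natCast, ← ENNReal.rpow_mul]
        norm_num [msq]
  have hm0 : Measurable (msq (fosc h)) := measurable_msq_osc hh (measurable_coord n)
  have hm2 : Measurable fun p : (Fin n → ℝ) × ℝ => msq (fosc (outer (j + p.2) h)) p.1 :=
    ((hmm.comp measurable_swap).enorm.pow_const 2)
  have hm3 : Measurable fun x => ∫⁻ s, msq (fosc (outer (j + s) h)) x ∂ν := hm2.lintegral_prod_right'
  calc ∫⁻ x, radMax j h x ^ 2 ∂μ ≤ ∫⁻ x, (2 * msq (fosc h) x + 2 * ∫⁻ s, msq (fosc (outer (j + s) h)) x ∂ν) ∂μ := by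
        refine lintegral_mono fun x => ?_
        have h2 : ∀ a b : ℝ≥0∞, (a + b) ^ 2 ≤ 2 * a ^ 2 + 2 * b ^ 2 := fun a b => by
          have := ENNReal.rpow_add_le_mul_rpow_add_rpow a b (p := 2) one_le_two
          norm_num at this
          rwa [mul_add] at this
        exact (h2 _ _).trans (add_le_add le_rfl (mul_le_mul' le_rfl (hcs x)))
    _ = 2 * ∫⁻ x, msq (fosc h) x ∂μ + 2 * ∫⁻ s, ∫⁻ x, msq (fosc (outer (j + s) h)) x ∂μ ∂ν := by
        rw [lintegral_add_left (hm0.const_mul 2), lintegral_const_mul _ hm0, lintegral_const_mul _ hm3, lintegral_lintegral_swap hm2.aemeasurable]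
    _ ≤ 2 * X + 2 * X := by
        refine add_le_add (mul_le_mul' le_rfl h0) (mul_le_mul' le_rfl ?_)
        calc _ ≤ ∫⁻ _s, X ∂ν := setLIntegral_mono measurable_const h1
          _ = X := by rw [lintegral_const, hν1, mul_one]
    _ = 4 * X := by ring

end

/-- The unit-width annulus of inner radius `j`. -/
def annulus (n j : ℕ) : Set (EuclideanSpace ℝ (Fin n)) := {ξ | (j:ℝ) ≤ ‖ξ‖ ∧ ‖ξ‖ < j + 1}

/-- The part of `F` on a unit-width annulus. -/
noncomputable def shell {n : ℕ} (j : ℕ) (F : EuclideanSpace ℝ (Fin n) → ℂ) : EuclideanSpace ℝ (Fin n) → ℂ :=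
  (annulus n j).indicator F

/-- The maximal function of a dyadic block of annuli. -/
noncomputable def block {n : ℕ} (k : ℕ) (F : EuclideanSpace ℝ (Fin n) → ℂ) (x : Fin n → ℝ) : ℝ≥0∞ :=
  ∑ j ∈ Finset.Ico ((2:ℕ) ^ k) (2 ^ (k + 1)), radMax (j:ℝ) (shell (j:ℕ) F) x

/-- The square of the homogeneous Sobolev norm of order one, on the Fourier side. -/
noncomputable def energy {n : ℕ} (F : EuclideanSpace ℝ (Fin n) → ℂ) : ℝ≥0∞ := ∫⁻ ξ, ‖ξ‖ₑ ^ 2 * ‖F ξ‖ₑ ^ 2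

lemma measurableSet_annulus (n j : ℕ) : MeasurableSet (annulus n j) :=
  (measurableSet_le measurable_const measurable_norm).inter (measurableSet_lt measurable_norm measurable_const)

lemma annulus_pairwise_disjoint (n : ℕ) : Pairwise (Function.onFun Disjoint (annulus n)) := by
  intro i j hij
  rw [Function.onFun, Set.disjoint_left]
  rintro ξ ⟨h1, h2⟩ ⟨h3, h4⟩
  have h5 : (i:ℝ) < j + 1 := by linarith
  have h6 : (j:ℝ) < i + 1 := by linarith
  norm_cast at h5 h6
  omega

section
variable {n : ℕ} {F : EuclideanSpace ℝ (Fin n) → ℂ}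

lemma measurable_shell (hm : Measurable F) (j : ℕ) : Measurable (shell j F) :=
  hm.indicator (measurableSet_annulus n j)

lemma sum_shell_energy_le (s : Finset ℕ) :
    ∑ j ∈ s, ENNReal.ofReal ((j:ℝ) ^ 2) * ∫⁻ ξ, ‖shell j F ξ‖ₑ ^ 2 ≤ energy F := by
  have h1 : ∀ j : ℕ, ENNReal.ofReal ((j:ℝ) ^ 2) * ∫⁻ ξ, ‖shell j F ξ‖ₑ ^ 2 ≤
      ∫⁻ ξ in annulus n j, ‖ξ‖ₑ ^ 2 * ‖F ξ‖ₑ ^ 2 := fun j => by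
    rw [← lintegral_const_mul' _ _ ENNReal.ofReal_ne_top, ← lintegral_indicator (measurableSet_annulus n j)]
    refine lintegral_mono fun ξ => ?_
    by_cases hξ : ξ ∈ annulus n j
    · simp only [shell, indicator_of_mem hξ]
      refine mul_le_mul' ?_ le_rfl
      rw [← ofReal_norm, ← ENNReal.ofReal_pow (norm_nonneg _)]
      exact ENNReal.ofReal_le_ofReal (pow_le_pow_left₀ (by positivity) hξ.1 2)
    · simp [shell, indicator_of_notMem hξ]
  calc _ ≤ ∑ j ∈ s, ∫⁻ ξ in annulus n j, ‖ξ‖ₑ ^ 2 * ‖F ξ‖ₑ ^ 2 := Finset.sum_le_sum fun j _ => h1 j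
    _ = ∫⁻ ξ in ⋃ j ∈ s, annulus n j, ‖ξ‖ₑ ^ 2 * ‖F ξ‖ₑ ^ 2 :=
        (lintegral_biUnion_finset (fun i _ j _ hij => annulus_pairwise_disjoint n hij)
          (fun j _ => measurableSet_annulus n j) _).symm
    _ ≤ energy F := setLIntegral_le_lintegral _ _

lemma lintegral_shell_lt_top (hF : energy F ≠ ⊤) {j : ℕ} (hj : 1 ≤ j) :
    ∫⁻ ξ, ‖shell j F ξ‖ₑ ^ 2 < ⊤ := by
  have h1 := sum_shell_energy_le (F := F) {j}
  rw [Finset.sum_singleton] at h1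
  have hj' : (1:ℝ) ≤ j := by exact_mod_cast hj
  have h2 : (1:ℝ≥0∞) ≤ ENNReal.ofReal ((j:ℝ) ^ 2) := by
    rw [← ENNReal.ofReal_one]; exact ENNReal.ofReal_le_ofReal (one_le_pow₀ hj')
  calc _ = 1 * ∫⁻ ξ, ‖shell j F ξ‖ₑ ^ 2 := (one_mul _).symm
    _ ≤ _ := mul_le_mul' h2 le_rfl
    _ < ⊤ := h1.trans_lt hF.lt_top

lemma integrable_shell (hm : Measurable F) (hF : energy F ≠ ⊤) {j : ℕ} (hj : 1 ≤ j) : Integrable (shell j F) := by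
  refine ⟨(measurable_shell hm j).aestronglyMeasurable, ?_⟩
  have h1 : ∀ ξ, ‖shell j F ξ‖ₑ ≤ (annulus n j).indicator 1 ξ + ‖shell j F ξ‖ₑ ^ 2 := fun ξ => by
    by_cases hξ : ξ ∈ annulus n j
    · rw [indicator_of_mem hξ, Pi.one_apply]
      rcases le_total ‖shell j F ξ‖ₑ 1 with h | h
      · exact h.trans (le_add_right le_rfl)
      · exact (le_self_pow₀ h two_ne_zero).trans (le_add_left le_rfl)
    · simp [shell, indicator_of_notMem hξ]
  refine (lintegral_mono h1).trans_lt ?_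
  rw [lintegral_add_left (measurable_one.indicator (measurableSet_annulus n j)), lintegral_indicator_one (measurableSet_annulus n j)]
  refine ENNReal.add_lt_top.2 ⟨?_, lintegral_shell_lt_top hF hj⟩
  refine (measure_mono (t := closedBall 0 ((j:ℝ) + 1)) fun ξ hξ => ?_).trans_lt measure_closedBall_lt_top
  rw [mem_closedBall_zero_iff]; exact hξ.2.le

end

lemma exists_block_energy (n : ℕ) (hn : 1 ≤ n) : ∃ (α δ : ℝ) (C : ℝ≥0∞), 0 < α ∧ α < n ∧ 0 < δ ∧ C ≠ ⊤ ∧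
    ∀ F : EuclideanSpace ℝ (Fin (n + 1)) → ℂ, Measurable F → energy F ≠ ⊤ → ∀ k : ℕ,
      ∀ (μ : Measure (Fin (n + 1) → ℝ)) [IsFiniteMeasure μ] (κ : ℝ≥0∞),
        (∀ x r, ((2:ℝ) ^ (k + 1))⁻¹ ≤ r → r ≤ 1 → μ (closedBall x r) ≤ κ * ENNReal.ofReal (r ^ α)) →
        ∫⁻ x, block k F x ^ 2 ∂μ ≤ C * κ * ENNReal.ofReal (((2:ℝ) ^ k) ^ (-δ)) * energy F := by
  obtain ⟨c, C, hc, hc1, hC, hE⟩ := exists_annulus_energy n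
  have hn' : (1:ℝ) ≤ n := by exact_mod_cast hn
  refine ⟨n - c / 2, c / 2, 4 * C, by linarith, by linarith, by linarith, by finiteness, ?_⟩
  intro F hm hF k μ _ κ hμ
  set s := Finset.Ico (2 ^ k) (2 ^ (k + 1)) with hs
  have hj1 : ∀ j ∈ s, 1 ≤ j := fun j hj => Nat.one_le_two_pow.trans (Finset.mem_Ico.1 hj).1
  have hcard : s.card = 2 ^ k := by rw [hs, Nat.card_Ico, pow_succ]; omega
  have hone : ∀ j ∈ s, ∫⁻ x, radMax j (shell j F) x ^ 2 ∂μ ≤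
      4 * (C * κ * ENNReal.ofReal ((j:ℝ) ^ (1 - c / 2)) * ∫⁻ ξ, ‖shell j F ξ‖ₑ ^ 2) := by
    intro j hj
    have hjr : (1:ℝ) ≤ j := by exact_mod_cast hj1 j hj
    have hi := integrable_shell hm hF (hj1 j hj)
    have hmm := measurable_shell hm j
    have hsupp : ∀ ξ, shell j F ξ ≠ 0 → (j:ℝ) ≤ ‖ξ‖ ∧ ‖ξ‖ ≤ j + 1 := fun ξ hξ => by
      have : ξ ∈ annulus (n + 1) j := by
        by_contra h; exact hξ (indicator_of_notMem h _)
      exact ⟨this.1, this.2.le⟩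
    have hμj : ∀ x r, (j:ℝ)⁻¹ ≤ r → r ≤ 1 → μ (closedBall x r) ≤ κ * ENNReal.ofReal (r ^ ((n:ℝ) - c / 2)) := by
      intro x r h1 h2
      refine hμ x r (le_trans ?_ h1) h2
      refine inv_anti₀ (by linarith) ?_
      exact_mod_cast (Finset.mem_Ico.1 hj).2.le
    have hexp : (n:ℝ) + 1 - (n - c / 2) - c = 1 - c / 2 := by ring
    have key := fun g hg hgm hgs => hE j hjr g hg hgm hgs _ (by linarith) μ κ hμj
    rw [hexp] at key
    refine lintegral_radMax_sq_le hi hmm j (key _ hi hmm hsupp) fun t _ => ?_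
    have hle : ∀ ξ, ‖outer ((j:ℝ) + t) (shell j F) ξ‖ₑ ≤ ‖shell j F ξ‖ₑ := fun ξ => enorm_indicator_le_enorm_self _ _
    refine (key _ (integrable_outer hi _) (hmm.indicator (measurableSet_outer _)) fun ξ hξ => hsupp ξ fun h => hξ ?_).trans ?_
    · have := hle ξ
      rw [h] at this
      simpa using this
    · exact mul_le_mul' le_rfl (lintegral_mono fun ξ => pow_le_pow_left' (hle ξ) 2)
  have hcs : ∀ x, block k F x ^ 2 ≤ (2 ^ k : ℝ≥0∞) * ∑ j ∈ s, radMax j (shell j F) x ^ 2 := fun x => by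
    have := ENNReal.rpow_sum_le_const_mul_sum_rpow s (fun j => radMax j (shell j F) x) (one_le_two (α := ℝ))
    rw [hcard] at this
    norm_num at this
    exact_mod_cast this
  have hmr : ∀ j ∈ s, Measurable fun x => radMax j (shell j F) x ^ 2 := fun j hj =>
    (measurable_radMax (integrable_shell hm hF (hj1 j hj)) (measurable_shell hm _) _).pow_const 2
  calc ∫⁻ x, block k F x ^ 2 ∂μ ≤ ∫⁻ x, (2 ^ k : ℝ≥0∞) * ∑ j ∈ s, radMax j (shell j F) x ^ 2 ∂μ := lintegral_mono hcs
    _ = 2 ^ k * ∑ j ∈ s, ∫⁻ x, radMax j (shell j F) x ^ 2 ∂μ := by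
        rw [lintegral_const_mul' _ _ (by finiteness), lintegral_finsetSum _ hmr]
    _ ≤ 2 ^ k * ∑ j ∈ s, 4 * (C * κ * ENNReal.ofReal ((j:ℝ) ^ (1 - c / 2)) * ∫⁻ ξ, ‖shell j F ξ‖ₑ ^ 2) :=
        mul_le_mul' le_rfl (Finset.sum_le_sum hone)
    _ = 4 * C * κ * ∑ j ∈ s, (2 ^ k * ENNReal.ofReal ((j:ℝ) ^ (1 - c / 2))) * ∫⁻ ξ, ‖shell j F ξ‖ₑ ^ 2 := by
        rw [Finset.mul_sum, Finset.mul_sum]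
        exact Finset.sum_congr rfl fun j _ => by ring
    _ ≤ 4 * C * κ * ∑ j ∈ s, ENNReal.ofReal (((2:ℝ) ^ k) ^ (-(c / 2))) * (ENNReal.ofReal ((j:ℝ) ^ 2) * ∫⁻ ξ, ‖shell j F ξ‖ₑ ^ 2) := by
        refine mul_le_mul' le_rfl (Finset.sum_le_sum fun j hj => ?_)
        rw [← mul_assoc]
        refine mul_le_mul' ?_ le_rfl
        have hjk : (2:ℝ) ^ k ≤ j := by exact_mod_cast (Finset.mem_Ico.1 hj).1
        have h2k : (0:ℝ) < 2 ^ k := by positivity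
        have hj0 : (0:ℝ) < j := h2k.trans_le hjk
        have h2e : (2 ^ k : ℝ≥0∞) = ENNReal.ofReal ((2:ℝ) ^ k) := by
          rw [ENNReal.ofReal_pow (by norm_num)]; norm_num
        rw [h2e, ← ENNReal.ofReal_mul h2k.le, ← ENNReal.ofReal_mul (by positivity)]
        refine ENNReal.ofReal_le_ofReal ?_
        have e1 : ∀ y : ℝ, 0 < y → y = y ^ (-(c / 2)) * y ^ (1 + c / 2) := fun y hy => by
          rw [← Real.rpow_add hy]
          ring_nf
          rw [Real.rpow_one]
        have e2 : ((j:ℝ)) ^ 2 = (j:ℝ) ^ (1 + c / 2) * (j:ℝ) ^ (1 - c / 2) := by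
          rw [← Real.rpow_add hj0, ← Real.rpow_natCast]
          congr 1; push_cast; ring
        calc (2:ℝ) ^ k * (j:ℝ) ^ (1 - c / 2) = ((2:ℝ) ^ k) ^ (-(c / 2)) * (((2:ℝ) ^ k) ^ (1 + c / 2) * (j:ℝ) ^ (1 - c / 2)) := by
              conv_lhs => rw [e1 _ h2k]
              ring
          _ ≤ ((2:ℝ) ^ k) ^ (-(c / 2)) * ((j:ℝ) ^ (1 + c / 2) * (j:ℝ) ^ (1 - c / 2)) := by
              refine mul_le_mul_of_nonneg_left (mul_le_mul_of_nonneg_right ?_ (by positivity)) (by positivity)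
              exact Real.rpow_le_rpow h2k.le hjk (by linarith)
          _ = _ := by rw [e2]
    _ ≤ 4 * C * κ * (ENNReal.ofReal (((2:ℝ) ^ k) ^ (-(c / 2))) * energy F) := by
        rw [← Finset.mul_sum]
        exact mul_le_mul' le_rfl (mul_le_mul' le_rfl (sum_shell_energy_le s))
    _ = _ := by ring

/-- A maximal packing: nonnegative weights obeying all constraints, with every point in a tight constraint. -/
lemma exists_saturated {π ι : Type*} [Fintype π] [Fintype ι] (A : ι → Finset π) (b : ι → ℝ) (hb : ∀ i, 0 ≤ b i)
    (hA : ∀ p, ∃ i, p ∈ A i) :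
    ∃ c : π → ℝ, (∀ p, 0 ≤ c p) ∧ (∀ i, ∑ p ∈ A i, c p ≤ b i) ∧ ∀ p, ∃ i, p ∈ A i ∧ b i ≤ ∑ p ∈ A i, c p := by
  classical
  suffices h : ∀ P : Finset π, ∃ c : π → ℝ, (∀ p, 0 ≤ c p) ∧ (∀ i, ∑ p ∈ A i, c p ≤ b i) ∧
      ∀ p ∈ P, ∃ i, p ∈ A i ∧ b i ≤ ∑ p ∈ A i, c p by
    obtain ⟨c, h1, h2, h3⟩ := h Finset.univ
    exact ⟨c, h1, h2, fun p => h3 p (Finset.mem_univ p)⟩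
  intro P
  induction P using Finset.induction_on with
  | empty => exact ⟨0, fun _ => le_rfl, by simpa using hb, by simp⟩
  | insert p P _ ih =>
    obtain ⟨c, h1, h2, h3⟩ := ih
    obtain ⟨i₀, hi₀, hmin⟩ := Finset.exists_min_image (Finset.univ.filter fun i => p ∈ A i) (fun i => b i - ∑ q ∈ A i, c q)
      (by obtain ⟨i, hi⟩ := hA p; exact ⟨i, by simpa using hi⟩)
    have hi₀' : p ∈ A i₀ := by simpa using hi₀
    set e := b i₀ - ∑ q ∈ A i₀, c q with he
    have he0 : 0 ≤ e := sub_nonneg.2 (h2 i₀)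
    have hsum : ∀ i, ∑ q ∈ A i, (c q + if q = p then e else 0) = ∑ q ∈ A i, c q + if p ∈ A i then e else 0 := fun i => by
      rw [Finset.sum_add_distrib, Finset.sum_ite_eq']
    refine ⟨fun q => c q + if q = p then e else 0, fun q => ?_, fun i => ?_, fun q hq => ?_⟩
    · have := h1 q
      dsimp only
      split_ifs <;> linarith
    · rw [hsum]
      split_ifs with hi
      · have := hmin i (by simpa using hi)
        linarith
      · simpa using h2 i
    · simp_rw [hsum]
      rcases Finset.mem_insert.1 hq with rfl | hq
      · refine ⟨i₀, hi₀', ?_⟩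
        rw [if_pos hi₀', he]; linarith
      · obtain ⟨i, h4, h5⟩ := h3 q hq
        refine ⟨i, h4, h5.trans ?_⟩
        split_ifs <;> linarith

lemma exists_frostman_cover (d : ℕ) {α : ℝ} (hα : 0 < α) {E : Set (Fin d → ℝ)} (hE : Bornology.IsBounded E) (L : ℕ) :
    ∃ μ : Measure (Fin d → ℝ), IsFiniteMeasure μ ∧
      (∀ x r, ((2:ℝ) ^ L)⁻¹ ≤ r → r ≤ 1 → μ (closedBall x r) ≤ ENNReal.ofReal (4 ^ α) * ENNReal.ofReal (r ^ α)) ∧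
      (∀ (G : (Fin d → ℝ) → ℝ≥0∞) (lam : ℝ≥0∞), (∀ x ∈ E, lam ≤ G x) → lam * μ univ ≤ ∫⁻ x, G x ∂μ) ∧
      ∃ (ι : Type) (_ : Fintype ι) (t : ι → Set (Fin d → ℝ)), E ⊆ ⋃ i, t i ∧
        ∑ i, ediam (t i) ^ α ≤ ENNReal.ofReal (12 ^ α) * μ univ := by
  classical
  set δ : ℝ := ((2:ℝ) ^ L)⁻¹ with hδ
  have hδ0 : 0 < δ := by positivity
  obtain ⟨P₀, hP₀E, hP₀f, hP₀c⟩ := finite_approx_of_totallyBounded (hE.isCompact_closure.totallyBounded.subset subset_closure) δ hδ0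
  have : Fintype P₀ := hP₀f.fintype
  let ρ : P₀ × Fin (L + 3) → ℝ := fun i => 2 ^ (i.2 : ℕ) * δ
  have hρ : ∀ i, δ ≤ ρ i := fun i => le_mul_of_one_le_left hδ0.le (one_le_pow₀ one_le_two)
  have hρ0 : ∀ i, 0 < ρ i := fun i => hδ0.trans_le (hρ i)
  let A : P₀ × Fin (L + 3) → Finset P₀ := fun i => Finset.univ.filter fun p => (p : Fin d → ℝ) ∈ closedBall (i.1 : Fin d → ℝ) (ρ i)
  obtain ⟨c, hc0, hcb, hcs⟩ := exists_saturated A (fun i => ρ i ^ α) (fun i => (Real.rpow_nonneg (hρ0 i).le _))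
    fun p => ⟨(p, 0), by simp [A, (hρ0 _).le]⟩
  set μ : Measure (Fin d → ℝ) := ∑ p : P₀, ENNReal.ofReal (c p) • Measure.dirac (p : Fin d → ℝ) with hμ
  have hμap : ∀ S, MeasurableSet S → μ S = ∑ p : P₀, ENNReal.ofReal (c p) * S.indicator 1 (p : Fin d → ℝ) := fun S hS => by
    simp [hμ, Measure.finsetSum_apply, Measure.dirac_apply' _ hS]
  have hμA : ∀ i, μ (closedBall (i.1 : Fin d → ℝ) (ρ i)) = ENNReal.ofReal (∑ p ∈ A i, c p) := fun i => by
    rw [hμap _ isClosed_closedBall.measurableSet, ENNReal.ofReal_sum_of_nonneg fun p _ => hc0 p, Finset.sum_filter]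
    refine Finset.sum_congr rfl fun p _ => ?_
    simp only [indicator]
    split_ifs <;> simp
  have hμu : μ univ = ENNReal.ofReal (∑ p, c p) := by
    rw [hμap _ MeasurableSet.univ, ENNReal.ofReal_sum_of_nonneg fun p _ => hc0 p]
    simp
  refine ⟨μ, ⟨by rw [hμu]; exact ENNReal.ofReal_lt_top⟩, ?_, ?_, ?_⟩
  · intro x r hr hr1
    have hr0 : 0 < r := hδ0.trans_le hr
    by_cases hx : ∃ q : P₀, (q : Fin d → ℝ) ∈ closedBall x r
    · obtain ⟨q, hq⟩ := hx
      obtain ⟨l, hl1, hl2⟩ := exists_nat_pow_near (x := 2 * r / δ) (y := (2:ℝ)) (by rw [le_div_iff₀ hδ0]; linarith) one_lt_two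
      rw [le_div_iff₀ hδ0] at hl1
      rw [div_lt_iff₀ hδ0] at hl2
      have hlL : l < L + 2 := by
        have : (2:ℝ) ^ l < 2 ^ (L + 2) := by
          have : (2:ℝ) ^ l * δ < 2 ^ (L + 2) * δ := by
            rw [hδ, pow_add, mul_right_comm, mul_inv_cancel₀ (by positivity)]; linarith
          exact lt_of_mul_lt_mul_right this hδ0.le
        exact (pow_lt_pow_iff_right₀ one_lt_two).1 this
      set i : P₀ × Fin (L + 3) := (q, ⟨l + 1, by omega⟩) with hi
      have hρi : ρ i = 2 ^ (l + 1) * δ := rfl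
      have hρi4 : ρ i ≤ 4 * r := by rw [hρi, pow_succ]; linarith
      calc μ (closedBall x r) ≤ μ (closedBall (i.1 : Fin d → ℝ) (ρ i)) := by
            refine measure_mono (closedBall_subset_closedBall' ?_)
            have : dist x (q : Fin d → ℝ) ≤ r := by rw [dist_comm]; exact hq
            rw [hρi]; change r + dist x (q : Fin d → ℝ) ≤ _; linarith
        _ ≤ ENNReal.ofReal ((4 * r) ^ α) := by
            rw [hμA]
            exact ENNReal.ofReal_le_ofReal ((hcb i).trans (Real.rpow_le_rpow (hρ0 i).le hρi4 hα.le))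
        _ = _ := by rw [Real.mul_rpow (by norm_num) hr0.le, ENNReal.ofReal_mul (by positivity)]
    · push Not at hx
      rw [hμap _ isClosed_closedBall.measurableSet, Finset.sum_eq_zero fun p _ => by rw [indicator_of_notMem (hx p), mul_zero]]
      exact zero_le
  · intro G lam hG
    rw [hμ, lintegral_finsetSum_measure]
    simp only [lintegral_smul_measure, lintegral_dirac]
    rw [← hμ, hμu, ENNReal.ofReal_sum_of_nonneg fun p _ => hc0 p, Finset.mul_sum]
    refine Finset.sum_le_sum fun p _ => ?_
    rw [mul_comm]
    exact mul_le_mul' le_rfl (hG _ (hP₀E p.2))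
  · choose sat hsA hsb using hcs
    obtain ⟨u, hut, hud, huc⟩ := Vitali.exists_disjoint_subfamily_covering_enlargement_closedBall (range sat)
      (fun i => (i.1 : Fin d → ℝ)) ρ (2 ^ (L + 3) * δ) (fun i _ => mul_le_mul_of_nonneg_right
        (pow_le_pow_right₀ one_le_two i.2.2.le) hδ0.le) 5 (by norm_num)
    have husat : ∀ i ∈ u, ρ i ^ α ≤ ∑ p ∈ A i, c p := fun i hi => by
      obtain ⟨p, rfl⟩ := hut hi; exact hsb p
    let u' : Finset (P₀ × Fin (L + 3)) := Finset.univ.filter (· ∈ u)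
    have hmem : ∀ i, i ∈ u' ↔ i ∈ u := by simp [u']
    let e : Fin (Fintype.card u') ≃ u' := (Fintype.equivFin u').symm
    refine ⟨Fin (Fintype.card u'), inferInstance, fun i => closedBall ((e i).1.1 : Fin d → ℝ) (6 * ρ (e i)), ?_, ?_⟩
    · intro x hx
      obtain ⟨p, hp, hxp⟩ := mem_iUnion₂.1 (hP₀c hx)
      obtain ⟨i, hi, hsub⟩ := huc _ ⟨⟨p, hp⟩, rfl⟩
      have h1 : p ∈ closedBall ((sat ⟨p, hp⟩).1 : Fin d → ℝ) (ρ (sat ⟨p, hp⟩)) := by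
        simpa [A] using hsA ⟨p, hp⟩
      have h2 := mem_closedBall.1 (hsub h1)
      have h3 := mem_ball.1 hxp
      refine mem_iUnion.2 ⟨e.symm ⟨i, (hmem i).2 hi⟩, ?_⟩
      rw [Equiv.apply_symm_apply, mem_closedBall]
      have := dist_triangle x p (i.1 : Fin d → ℝ)
      have := hρ i
      linarith
    · rw [Equiv.sum_comp e fun i => ediam (closedBall (i.1.1 : Fin d → ℝ) (6 * ρ i)) ^ α, Finset.sum_coe_sort u' fun i => ediam (closedBall (i.1 : Fin d → ℝ) (6 * ρ i)) ^ α]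
      have hdisj : (u' : Set (P₀ × Fin (L + 3))).PairwiseDisjoint A := fun i hi j hj hij => by
        rw [Function.onFun, Finset.disjoint_left]
        intro p hpi hpj
        have := hud ((hmem i).1 hi) ((hmem j).1 hj) hij
        exact Set.disjoint_left.1 this (by simpa [A] using hpi) (by simpa [A] using hpj)
      calc ∑ i ∈ u', ediam (closedBall (i.1 : Fin d → ℝ) (6 * ρ i)) ^ α ≤ ∑ i ∈ u', ENNReal.ofReal (12 ^ α) * ENNReal.ofReal (∑ p ∈ A i, c p) := by
            refine Finset.sum_le_sum fun i hi => ?_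
            have h1 : ediam (closedBall (i.1 : Fin d → ℝ) (6 * ρ i)) ≤ ENNReal.ofReal (12 * ρ i) := by
              refine ediam_le_of_forall_dist_le fun x hx y hy => ?_
              have := dist_triangle_right x y (i.1 : Fin d → ℝ)
              have := mem_closedBall.1 hx
              have := mem_closedBall.1 hy
              linarith
            refine (ENNReal.rpow_le_rpow h1 hα.le).trans ?_
            rw [ENNReal.ofReal_rpow_of_pos (by have := hρ0 i; positivity), Real.mul_rpow (by norm_num) (hρ0 i).le, ENNReal.ofReal_mul (by positivity)]
            exact mul_le_mul' le_rfl (ENNReal.ofReal_le_ofReal (husat i ((hmem i).1 hi)))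
        _ = ENNReal.ofReal (12 ^ α) * ENNReal.ofReal (∑ p ∈ u'.biUnion A, c p) := by
            rw [← Finset.mul_sum, Finset.sum_biUnion hdisj, ENNReal.ofReal_sum_of_nonneg fun i _ => Finset.sum_nonneg fun p _ => hc0 p]
        _ ≤ _ := by
            rw [hμu]
            exact mul_le_mul' le_rfl (ENNReal.ofReal_le_ofReal
              (Finset.sum_le_sum_of_subset_of_nonneg (Finset.subset_univ _) fun p _ _ => hc0 p))

lemma tsum_pow_rpow_ne_top {δ : ℝ} (hδ : 0 < δ) (m : ℕ) : ∑' k : ℕ, ENNReal.ofReal (((2:ℝ) ^ (k + m)) ^ (-δ)) ≠ ⊤ := by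
  have h1 : ∀ k : ℕ, ENNReal.ofReal (((2:ℝ) ^ (k + m)) ^ (-δ)) = ENNReal.ofReal (((2:ℝ) ^ m) ^ (-δ)) * ENNReal.ofReal ((2:ℝ) ^ (-δ)) ^ k := fun k => by
    rw [← ENNReal.ofReal_pow (by positivity), ← ENNReal.ofReal_mul (by positivity), pow_add, Real.mul_rpow (by positivity) (by positivity),
      ← Real.rpow_natCast 2 k, ← Real.rpow_natCast _ k, ← Real.rpow_mul (by norm_num), ← Real.rpow_mul (by norm_num), mul_comm (k:ℝ), mul_comm]
  simp_rw [h1]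
  rw [ENNReal.tsum_mul_left, ENNReal.tsum_geometric]
  refine ENNReal.mul_ne_top ENNReal.ofReal_ne_top (ENNReal.inv_ne_top.2 (tsub_pos_of_lt ?_).ne')
  rw [← ENNReal.ofReal_one]
  exact (ENNReal.ofReal_lt_ofReal_iff one_pos).2 (Real.rpow_lt_one_of_one_lt_of_neg one_lt_two (by linarith))

/-- A limsup of sets with summable coverings has small dimension. -/
lemma hausdorffMeasure_limsup_eq_zero {X : Type*} [EMetricSpace X] [MeasurableSpace X] [BorelSpace X] {α : ℝ} (hα : 0 < α)
    {E : ℕ → Set X} {w : ℕ → ℝ≥0∞} (hw : ∑' k, w k ≠ ⊤)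
    (hE : ∀ k, ∃ (ι : Type) (_ : Fintype ι) (t : ι → Set X), E k ⊆ ⋃ i, t i ∧ ∑ i, ediam (t i) ^ α ≤ w k) :
    μH[α] {x | ∃ᶠ k in atTop, x ∈ E k} = 0 := by
  choose ι hι t ht hs using hE
  have hlim := ENNReal.tendsto_sum_nat_add w hw
  have hle : ∀ m, ∑' i : Σ k, ι (k + m), ediam (t (i.1 + m) i.2) ^ α ≤ ∑' k, w (k + m) := fun m => by
    rw [ENNReal.tsum_sigma' (fun i : Σ k, ι (k + m) => ediam (t (i.1 + m) i.2) ^ α)]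
    refine ENNReal.tsum_le_tsum fun k => ?_
    rw [tsum_fintype]
    exact hs _
  have key := Measure.hausdorffMeasure_le_liminf_tsum (X := X) (ι := fun m : ℕ => Σ k, ι (k + m)) α {x | ∃ᶠ k in atTop, x ∈ E k}
    (fun m => (∑' k, w (k + m)) ^ (1 / α))
    (by
      have := (ENNReal.continuous_rpow_const (y := 1 / α)).tendsto 0 |>.comp hlim
      rwa [ENNReal.zero_rpow_of_pos (by positivity)] at this)
    (fun m i => t (i.1 + m) i.2)
    (Eventually.of_forall fun m i => by
      have h1 : ediam (t (i.1 + m) i.2) ^ α ≤ ∑' k, w (k + m) := (ENNReal.le_tsum i).trans (hle m)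
      have h2 := ENNReal.rpow_le_rpow h1 (by positivity : 0 ≤ 1 / α)
      rwa [← ENNReal.rpow_mul, mul_one_div_cancel hα.ne', ENNReal.rpow_one] at h2)
    (Eventually.of_forall fun m x hx => by
      obtain ⟨k, hk, hxk⟩ := (frequently_atTop.1 hx) m
      obtain ⟨i, hi⟩ := mem_iUnion.1 (ht k hxk)
      obtain ⟨l, rfl⟩ := Nat.exists_eq_add_of_le' hk
      exact mem_iUnion.2 ⟨⟨l, i⟩, hi⟩)
  have h0 : Tendsto (fun m => ∑' i : Σ k, ι (k + m), ediam (t (i.1 + m) i.2) ^ α) atTop (𝓝 0) :=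
    tendsto_of_tendsto_of_tendsto_of_le_of_le tendsto_const_nhds hlim (fun _ => zero_le) hle
  rw [h0.liminf_eq] at key
  exact le_antisymm key zero_le

lemma radMax_lt_top {n : ℕ} {h : EuclideanSpace ℝ (Fin n) → ℂ} (hh : Integrable h) (j : ℝ) (x : Fin n → ℝ) :
    radMax j h x < ⊤ := by
  have h1 : ∀ g : EuclideanSpace ℝ (Fin n) → ℂ, (∀ ξ, ‖g ξ‖ₑ ≤ ‖h ξ‖ₑ) → ‖fosc g x‖ₑ ≤ ∫⁻ ξ, ‖h ξ‖ₑ := fun g hg => by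
    refine (enorm_integral_le_lintegral_enorm _).trans (lintegral_mono fun ξ => ?_)
    rw [enorm_mul, ← ofReal_norm (cis _), norm_cis, ENNReal.ofReal_one, mul_one]
    exact hg ξ
  refine ENNReal.add_lt_top.2 ⟨(h1 h fun _ => le_rfl).trans_lt hh.2, ?_⟩
  calc _ ≤ ∫⁻ _s in Ioc (0:ℝ) 1, ∫⁻ ξ, ‖h ξ‖ₑ := lintegral_mono fun s => h1 _ fun ξ => enorm_indicator_le_enorm_self _ _
    _ = ∫⁻ ξ, ‖h ξ‖ₑ := by simp
    _ < ⊤ := hh.2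

lemma tsum_radMax_le {n : ℕ} (F : EuclideanSpace ℝ (Fin n) → ℂ) (x : Fin n → ℝ) :
    ∑' j : ℕ, radMax ((j + 1 : ℕ) : ℝ) (shell (j + 1) F) x ≤ ∑' k, block k F x := by
  have h1 : ∀ K, ∑ j ∈ Finset.Ico (1:ℕ) (2 ^ K), radMax (j : ℝ) (shell (j:ℕ) F) x = ∑ k ∈ Finset.range K, block k F x := fun K => by
    induction K with
    | zero => simp
    | succ K ih =>
      rw [Finset.sum_range_succ, ← ih, block]
      exact (Finset.sum_Ico_consecutive _ Nat.one_le_two_pow (Nat.pow_le_pow_right (by norm_num) (Nat.le_succ K))).symm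
  rw [ENNReal.tsum_eq_iSup_nat]
  refine iSup_le fun N => ?_
  calc _ = ∑ j ∈ Finset.Ico (1:ℕ) (N + 1), radMax (j : ℝ) (shell (j:ℕ) F) x := by
        rw [Finset.sum_Ico_eq_sum_range]
        exact Finset.sum_congr rfl fun j _ => by rw [add_comm 1 j]
    _ ≤ ∑ j ∈ Finset.Ico (1:ℕ) (2 ^ (N + 1)), radMax (j : ℝ) (shell (j:ℕ) F) x :=
        Finset.sum_le_sum_of_subset (Finset.Ico_subset_Ico le_rfl Nat.lt_two_pow_self.le)
    _ ≤ _ := by rw [h1]; exact ENNReal.sum_le_tsum _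

/-- The maximal functions of the unit-width annuli are summable off a set of dimension less than `n`. -/
lemma exists_dimH_radMax (n : ℕ) (hn : 1 ≤ n) : ∃ α : ℝ, 0 < α ∧ α < n ∧
    ∀ F : EuclideanSpace ℝ (Fin (n + 1)) → ℂ, Measurable F → energy F ≠ ⊤ →
      dimH {x : Fin (n + 1) → ℝ | ∑' j : ℕ, radMax ((j + 1 : ℕ) : ℝ) (shell (j + 1) F) x = ⊤} ≤ ENNReal.ofReal α := by
  obtain ⟨α, δ, C, hα, hαn, hδ, hC, hB⟩ := exists_block_energy n hn
  refine ⟨α, hα, hαn, fun F hm hF => ?_⟩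
  set lam : ℕ → ℝ≥0∞ := fun k => ENNReal.ofReal (((2:ℝ) ^ k) ^ (-(δ / 4))) with hlam
  have hsub : {x : Fin (n + 1) → ℝ | ∑' j : ℕ, radMax ((j + 1 : ℕ) : ℝ) (shell (j + 1) F) x = ⊤} ⊆
      ⋃ M : ℕ, {x | ∃ᶠ k in atTop, x ∈ closedBall 0 (M:ℝ) ∩ {x | lam k ≤ block k F x}} := by
    intro x hx
    obtain ⟨M, hM⟩ := exists_nat_ge ‖x‖
    refine mem_iUnion.2 ⟨M, ?_⟩
    by_contra hcon
    have h1 : ∀ᶠ k in atTop, block k F x < lam k := by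
      have h2 : ∀ᶠ k in atTop, x ∉ closedBall 0 (M:ℝ) ∩ {x | lam k ≤ block k F x} := not_frequently.1 hcon
      filter_upwards [h2] with k hk
      by_contra h3
      exact hk ⟨by simpa using hM, not_lt.1 h3⟩
    obtain ⟨K, hK⟩ := eventually_atTop.1 h1
    have h3 : ∑' k, block k F x < ⊤ := by
      rw [← ENNReal.summable.sum_add_tsum_nat_add' (k := K)]
      refine ENNReal.add_lt_top.2 ⟨ENNReal.sum_lt_top.2 fun k _ => ENNReal.sum_lt_top.2 fun j hj => ?_, ?_⟩
      · exact radMax_lt_top (integrable_shell hm hF (Nat.one_le_two_pow.trans (Finset.mem_Ico.1 hj).1)) _ _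
      · exact (ENNReal.tsum_le_tsum fun k => (hK (k + K) (Nat.le_add_left _ _)).le).trans_lt
          (tsum_pow_rpow_ne_top (by linarith) K).lt_top
    exact ((tsum_radMax_le F x).trans_lt h3).ne hx
  refine (dimH_mono hsub).trans ?_
  rw [dimH_iUnion]
  refine iSup_le fun M => ?_
  have hα' : ((α.toNNReal : NNReal) : ℝ) = α := Real.coe_toNNReal _ hα.le
  refine dimH_le_of_hausdorffMeasure_ne_top (d := α.toNNReal) ?_
  rw [hα']
  set D := ENNReal.ofReal (12 ^ α) * (C * ENNReal.ofReal (4 ^ α) * energy F) with hD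
  rw [hausdorffMeasure_limsup_eq_zero hα (w := fun k => D * ENNReal.ofReal (((2:ℝ) ^ k) ^ (-(δ / 2))))]
  · exact ENNReal.zero_ne_top
  · rw [ENNReal.tsum_mul_left]
    exact ENNReal.mul_ne_top (by finiteness) (tsum_pow_rpow_ne_top (half_pos hδ) 0)
  · intro k
    obtain ⟨μ, hμf, hμ, hG, ι, hι, t, ht, hts⟩ := exists_frostman_cover (n + 1) hα
      (E := closedBall 0 (M:ℝ) ∩ {x | lam k ≤ block k F x}) (isBounded_closedBall.subset inter_subset_left) (k + 1)
    refine ⟨ι, hι, t, ht, hts.trans ?_⟩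
    rw [hD, mul_assoc]
    refine mul_le_mul' le_rfl ?_
    have h1 := (hG (fun x => block k F x ^ 2) (lam k ^ 2) fun x hx => pow_le_pow_left' hx.2 2).trans (hB F hm hF k μ _ hμ)
    set y : ℝ := (2:ℝ) ^ k with hy
    have hy0 : 0 < y := by positivity
    have h2 : ENNReal.ofReal (y ^ (δ / 2)) * lam k ^ 2 = 1 := by
      rw [hlam, ← ENNReal.ofReal_pow (by positivity), ← ENNReal.ofReal_mul (by positivity), ← Real.rpow_natCast, ← Real.rpow_mul hy0.le,
        ← Real.rpow_add hy0]
      norm_num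
      ring_nf
      simp
    have h3 : ENNReal.ofReal (y ^ (δ / 2)) * ENNReal.ofReal (y ^ (-δ)) = ENNReal.ofReal (y ^ (-(δ / 2))) := by
      rw [← ENNReal.ofReal_mul (by positivity), ← Real.rpow_add hy0]
      congr 2; ring
    calc μ univ = ENNReal.ofReal (y ^ (δ / 2)) * (lam k ^ 2 * μ univ) := by rw [← mul_assoc, h2, one_mul]
      _ ≤ ENNReal.ofReal (y ^ (δ / 2)) * (C * ENNReal.ofReal (4 ^ α) * ENNReal.ofReal (y ^ (-δ)) * energy F) := mul_le_mul' le_rfl h1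
      _ = C * ENNReal.ofReal (4 ^ α) * energy F * (ENNReal.ofReal (y ^ (δ / 2)) * ENNReal.ofReal (y ^ (-δ))) := by ring
      _ = _ := by rw [h3]

/-- The radial multiplier of the half-wave evolution at time `p.1` with frequency cutoff at scale `p.2⁻¹`. -/
noncomputable def waveMult (ψ : SchwartzMap ℝ ℝ) (p : ℝ × ℝ) (ρ : ℝ) : ℂ := ((ψ (p.2 * ρ) : ℝ) : ℂ) * cis (p.1 * ρ)

lemma hasDerivAt_cis_mul (t ρ : ℝ) : HasDerivAt (fun ρ => cis (t * ρ)) (Complex.I * t * cis (t * ρ)) ρ := by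
  have h1 : HasDerivAt (fun ρ : ℝ => Complex.I * ((t * ρ : ℝ) : ℂ)) (Complex.I * t) ρ := by
    have := ((hasDerivAt_id ρ).const_mul t).ofReal_comp.const_mul Complex.I
    simpa using this
  have := h1.cexp
  rw [mul_comm] at this
  exact this

lemma hasDerivAt_waveMult (ψ : SchwartzMap ℝ ℝ) (p : ℝ × ℝ) (ρ : ℝ) :
    HasDerivAt (waveMult ψ p) (((deriv ψ (p.2 * ρ) * p.2 : ℝ) : ℂ) * cis (p.1 * ρ) +
      ((ψ (p.2 * ρ) : ℝ) : ℂ) * (Complex.I * p.1 * cis (p.1 * ρ))) ρ := by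
  have h1 : HasDerivAt (fun ρ : ℝ => ψ (p.2 * ρ)) (deriv ψ (p.2 * ρ) * p.2) ρ := by
    have h2 : HasDerivAt (fun ρ : ℝ => p.2 * ρ) p.2 ρ := by simpa using (hasDerivAt_id ρ).const_mul p.2
    exact (ψ.hasDerivAt (p.2 * ρ)).comp ρ h2
  exact h1.ofReal_comp.mul (hasDerivAt_cis_mul p.1 ρ)

lemma exists_waveMult_bound (ψ : SchwartzMap ℝ ℝ) : ∃ B : ℝ, 0 ≤ B ∧ ∀ p ρ, ‖waveMult ψ p ρ‖ ≤ B := by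
  refine ⟨SchwartzMap.seminorm ℝ 0 0 ψ, apply_nonneg _ _, fun p ρ => ?_⟩
  rw [waveMult, norm_mul, norm_cis, mul_one, Complex.norm_real]
  exact SchwartzMap.norm_le_seminorm ℝ ψ _

lemma exists_waveMult_deriv_bound (ψ : SchwartzMap ℝ ℝ) : ∃ B : ℝ, 0 ≤ B ∧ ∀ p : ℝ × ℝ, p ∈ Icc (-1) 1 ×ˢ Icc 0 1 → ∃ a',
    (∀ ρ, HasDerivAt (waveMult ψ p) (a' ρ) ρ) ∧ Continuous a' ∧ (∀ ρ, ‖waveMult ψ p ρ‖ ≤ B) ∧ ∀ ρ, ‖a' ρ‖ ≤ B := by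
  set B₀ := SchwartzMap.seminorm ℝ 0 0 ψ with hB₀
  set B₁ := SchwartzMap.seminorm ℝ 0 0 (SchwartzMap.derivCLM ℝ ℝ ψ) with hB₁
  have h0 : 0 ≤ B₀ := apply_nonneg _ _
  have h1 : 0 ≤ B₁ := apply_nonneg _ _
  have hψ : ∀ y, ‖ψ y‖ ≤ B₀ := fun y => SchwartzMap.norm_le_seminorm ℝ ψ y
  have hψ' : ∀ y, ‖deriv ψ y‖ ≤ B₁ := fun y => by
    have := SchwartzMap.norm_le_seminorm ℝ (SchwartzMap.derivCLM ℝ ℝ ψ) y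
    rwa [SchwartzMap.derivCLM_apply] at this
  have hc : Continuous fun y => deriv ψ y := by
    have : (fun y => deriv ψ y) = SchwartzMap.derivCLM ℝ ℝ ψ := by
      ext y; rw [SchwartzMap.derivCLM_apply]
    rw [this]; exact SchwartzMap.continuous _
  refine ⟨B₁ + B₀, by positivity, fun p hp => ⟨_, hasDerivAt_waveMult ψ p, ?_, fun ρ => ?_, fun ρ => ?_⟩⟩
  · have h2 : Continuous fun ρ => deriv ψ (p.2 * ρ) := hc.comp (by fun_prop)
    have h3 : Continuous fun ρ => ψ (p.2 * ρ) := ψ.continuous.comp (by fun_prop)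
    have h4 : Continuous fun ρ => cis (p.1 * ρ) := continuous_cis.comp (by fun_prop)
    fun_prop
  · rw [waveMult, norm_mul, norm_cis, mul_one, Complex.norm_real]
    linarith [hψ (p.2 * ρ)]
  · obtain ⟨⟨h2, h3⟩, h4, h5⟩ := hp
    refine (norm_add_le _ _).trans (add_le_add ?_ ?_)
    · rw [norm_mul, norm_cis, mul_one, Complex.norm_real, norm_mul, ← mul_one B₁]
      exact mul_le_mul (hψ' _) (by rw [Real.norm_of_nonneg h4]; exact h5) (norm_nonneg _) h1
    · rw [norm_mul, norm_mul, norm_mul, norm_cis, mul_one, Complex.norm_I, one_mul, Complex.norm_real, Complex.norm_real, ← mul_one B₀]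
      exact mul_le_mul (hψ _) (abs_le.2 ⟨h2, h3⟩) (norm_nonneg _) h0

section
variable {n : ℕ} {f : EuclideanSpace ℝ (Fin n) → ℂ} (ψ : SchwartzMap ℝ ℝ)

lemma continuous_waveMult_left (ρ : ℝ) : Continuous fun p => waveMult ψ p ρ :=
  (Complex.continuous_ofReal.comp (ψ.continuous.comp (by fun_prop))).mul (continuous_cis.comp (by fun_prop))

lemma measurable_waveMult (p : ℝ × ℝ) : Measurable (waveMult ψ p) :=
  ((Complex.continuous_ofReal.comp (ψ.continuous.comp (by fun_prop))).mul (continuous_cis.comp (by fun_prop))).measurable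

lemma continuous_fosc_waveMult {h : EuclideanSpace ℝ (Fin n) → ℂ} (hh : Integrable h) (x : Fin n → ℝ) :
    Continuous fun p => fosc (fun ξ => waveMult ψ p ‖ξ‖ * h ξ) x := by
  obtain ⟨B, hB0, hB⟩ := exists_waveMult_bound ψ
  refine continuous_of_dominated (bound := fun ξ => B * ‖h ξ‖) (fun p => ?_) (fun p => Eventually.of_forall fun ξ => ?_)
    (hh.norm.const_mul B) (Eventually.of_forall fun ξ => ?_)
  · exact ((((measurable_waveMult ψ p).comp measurable_norm).aestronglyMeasurable).mul hh.1).mul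
      (measurable_phase (measurable_coord n) x).aestronglyMeasurable
  · rw [norm_mul, norm_cis, mul_one, norm_mul]
    exact mul_le_mul_of_nonneg_right (hB _ _) (norm_nonneg _)
  · exact ((continuous_waveMult_left ψ _).mul continuous_const).mul continuous_const

/-- The half-wave evolution, with a smooth frequency truncation. -/
noncomputable def halfWave (f : EuclideanSpace ℝ (Fin n) → ℂ) (x : Fin n → ℝ) (p : ℝ × ℝ) : ℂ :=
  fosc (fun ξ => waveMult ψ p ‖ξ‖ * f ξ) x

/-- The half-wave evolution, as a sum over annuli. -/
noncomputable def halfWaveSum (f : EuclideanSpace ℝ (Fin n) → ℂ) (x : Fin n → ℝ) (p : ℝ × ℝ) : ℂ :=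
  fosc (fun ξ => waveMult ψ p ‖ξ‖ * shell 0 f ξ) x +
    ∑' j : ℕ, fosc (fun ξ => waveMult ψ p ‖ξ‖ * shell (j + 1) f ξ) x

lemma continuousOn_halfWaveSum (hm : Measurable f) (hf : energy f ≠ ⊤) (h0 : Integrable (shell 0 f)) {x : Fin n → ℝ}
    (hx : ∑' j : ℕ, radMax ((j + 1 : ℕ) : ℝ) (shell (j + 1) f) x ≠ ⊤) :
    ContinuousOn (halfWaveSum ψ f x) (Icc (-1) 1 ×ˢ Icc 0 1) := by
  obtain ⟨B, hB0, hB⟩ := exists_waveMult_deriv_bound ψ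
  have hi : ∀ j : ℕ, Integrable (shell (j + 1) f) := fun j => integrable_shell hm hf (Nat.le_add_left 1 j)
  refine (continuous_fosc_waveMult ψ h0 x).continuousOn.add ?_
  refine continuousOn_tsum (u := fun j : ℕ => B * (radMax ((j + 1 : ℕ) : ℝ) (shell (j + 1) f) x).toReal)
    (fun j => (continuous_fosc_waveMult ψ (hi j) x).continuousOn) ((ENNReal.summable_toReal hx).mul_left B) fun j p hp => ?_
  obtain ⟨a', h1, h2, h3, h4⟩ := hB p hp
  have h5 := enorm_radial_le (hi j) (measurable_shell hm _) (j := ((j + 1 : ℕ) : ℝ)) (fun ξ hξ => ?_) h1 h2 h3 h4 x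
  · have h6 := ENNReal.toReal_mono (ENNReal.mul_ne_top ENNReal.ofReal_ne_top (radMax_lt_top (hi j) _ x).ne) h5
    rwa [ENNReal.toReal_mul, ENNReal.toReal_ofReal hB0, toReal_enorm] at h6
  · have : ξ ∈ annulus n (j + 1) := by
      by_contra h; exact hξ (indicator_of_notMem h _)
    exact ⟨this.1, this.2.le⟩

lemma iUnion_annulus (n : ℕ) : ⋃ j, annulus n j = univ := by
  refine eq_univ_of_forall fun ξ => mem_iUnion.2 ⟨⌊‖ξ‖⌋₊, Nat.floor_le (norm_nonneg _), Nat.lt_floor_add_one _⟩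

lemma halfWave_eq_sum {x : Fin n → ℝ} {p : ℝ × ℝ} (hi : Integrable fun ξ => waveMult ψ p ‖ξ‖ * f ξ) :
    halfWave ψ f x p = halfWaveSum ψ f x p := by
  have h1 := hasSum_integral_iUnion (measurableSet_annulus n) (annulus_pairwise_disjoint n)
    (f := fun ξ : EuclideanSpace ℝ (Fin n) => waveMult ψ p ‖ξ‖ * f ξ * cis (∑ k, x k * ξ k)) (μ := volume)
    (integrable_osc hi (measurable_coord n) x).integrableOn
  rw [iUnion_annulus, Measure.restrict_univ] at h1
  have h2 : ∀ j, ∫ ξ in annulus n j, waveMult ψ p ‖ξ‖ * f ξ * cis (∑ k, x k * ξ k) =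
      fosc (fun ξ => waveMult ψ p ‖ξ‖ * shell j f ξ) x := fun j => by
    rw [← integral_indicator (measurableSet_annulus n j)]
    refine integral_congr_ae (Eventually.of_forall fun ξ => ?_)
    by_cases hξ : ξ ∈ annulus n j
    · simp [shell, hξ]
    · simp [shell, hξ]
  simp_rw [h2] at h1
  rw [halfWaveSum, ← h1.summable.tsum_eq_zero_add, h1.tsum_eq]
  rfl

lemma integrable_waveMult (hm : Measurable f) (hf : energy f ≠ ⊤) (h0 : Integrable (shell 0 f)) {p : ℝ × ℝ} (hp : 0 < p.2) :
    Integrable fun ξ => waveMult ψ p ‖ξ‖ * f ξ := by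
  obtain ⟨B, hB0, hB⟩ := exists_waveMult_bound ψ
  set K := 2 ^ (n + 1) * ((Finset.Iic ((n + 1, 0) : ℕ × ℕ)).sup fun m => SchwartzMap.seminorm ℝ m.1 m.2) ψ with hK
  have hdecay : ∀ y : ℝ, ‖ψ y‖ ≤ K * (1 + ‖y‖) ^ (-((n:ℝ) + 1)) := fun y => by
    have h1 := SchwartzMap.one_add_le_sup_seminorm_apply (𝕜 := ℝ) (m := (n + 1, 0)) (k := n + 1) (n := 0) le_rfl le_rfl ψ y
    rw [norm_iteratedFDeriv_zero] at h1
    have h2 : 0 < 1 + ‖y‖ := by positivity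
    rw [Real.rpow_neg h2.le, ← div_eq_mul_inv, le_div_iff₀ (by positivity), mul_comm,
      show (n:ℝ) + 1 = ((n + 1 : ℕ) : ℝ) by push_cast; rfl, Real.rpow_natCast]
    exact h1
  have hint : Integrable fun ξ : EuclideanSpace ℝ (Fin n) => (1 + ‖p.2 • ξ‖) ^ (-((n:ℝ) + 1)) :=
    (integrable_one_add_norm (μ := (volume : Measure (EuclideanSpace ℝ (Fin n)))) (r := (n:ℝ) + 1) (by simp)).comp_smul hp.ne'
  have hen : Integrable fun ξ : EuclideanSpace ℝ (Fin n) => ‖ξ‖ ^ 2 * ‖f ξ‖ ^ 2 := by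
    refine ⟨by fun_prop, ?_⟩
    refine (lintegral_mono fun ξ => ?_).trans_lt hf.lt_top
    simp [enorm_mul, enorm_pow]
  have hbd : Integrable fun ξ => B * ‖shell 0 f ξ‖ + (B * (K * (1 + ‖p.2 • ξ‖) ^ (-((n:ℝ) + 1))) + ‖ξ‖ ^ 2 * ‖f ξ‖ ^ 2) :=
    (h0.norm.const_mul B).add (((hint.const_mul K).const_mul B).add hen)
  refine hbd.mono' (((measurable_waveMult ψ p).comp measurable_norm).mul hm).aestronglyMeasurable (Eventually.of_forall fun ξ => ?_)
  rw [norm_mul]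
  have hw : ‖waveMult ψ p ‖ξ‖‖ ≤ K * (1 + ‖p.2 • ξ‖) ^ (-((n:ℝ) + 1)) := by
    rw [waveMult, norm_mul, norm_cis, mul_one, Complex.norm_real]
    have := hdecay (p.2 * ‖ξ‖)
    rwa [norm_mul, norm_norm, ← norm_smul] at this
  have h2 := hB p ‖ξ‖
  set w := ‖waveMult ψ p ‖ξ‖‖ with hw'
  have hw0 : 0 ≤ w := norm_nonneg _
  have hww : w * w ≤ B * (K * (1 + ‖p.2 • ξ‖) ^ (-((n:ℝ) + 1))) := mul_le_mul h2 hw hw0 hB0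
  have hfn := norm_nonneg (f ξ)
  by_cases hξ : ξ ∈ annulus n 0
  · have h3 : shell 0 f ξ = f ξ := indicator_of_mem hξ _
    rw [h3]
    have := mul_le_mul_of_nonneg_right h2 hfn
    have : 0 ≤ ‖ξ‖ ^ 2 * ‖f ξ‖ ^ 2 := by positivity
    nlinarith [mul_nonneg hw0 hw0]
  · have h3 : 1 ≤ ‖ξ‖ := by
      by_contra h
      exact hξ ⟨by simp, by push_cast; linarith⟩
    have h4 : ‖f ξ‖ ^ 2 ≤ ‖ξ‖ ^ 2 * ‖f ξ‖ ^ 2 := le_mul_of_one_le_left (by positivity) (one_le_pow₀ h3)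
    have : 0 ≤ B * ‖shell 0 f ξ‖ := by positivity
    nlinarith [sq_nonneg (w - ‖f ξ‖), mul_nonneg hw0 hw0]

lemma integrable_shell_zero (hn : 3 ≤ n) (hm : Measurable f) (hf : energy f ≠ ⊤) : Integrable (shell 0 f) := by
  have h1 : IntegrableOn (fun ξ : EuclideanSpace ℝ (Fin n) => ‖ξ‖ ^ (-(2:ℝ))) (ball 0 1) := by
    refine integrableOn_ball_of_norm_le_rpow (C := 1) (α := 2) (by simp; omega) (by simp; exact_mod_cast hn) ?_
      (measurable_norm.pow_const _).aestronglyMeasurable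
    refine Eventually.of_forall fun ξ => ?_
    rw [one_mul, Real.norm_of_nonneg (by positivity)]
  have hen : Integrable fun ξ : EuclideanSpace ℝ (Fin n) => ‖ξ‖ ^ 2 * ‖f ξ‖ ^ 2 := by
    refine ⟨by fun_prop, ?_⟩
    refine (lintegral_mono fun ξ => ?_).trans_lt hf.lt_top
    simp [enorm_mul, enorm_pow]
  have : NeZero n := ⟨by omega⟩
  have h0 : ∀ᵐ ξ : EuclideanSpace ℝ (Fin n), ξ ≠ 0 := by
    have : Nontrivial (EuclideanSpace ℝ (Fin n)) := Module.nontrivial_of_finrank_pos (R := ℝ) (by simp; omega)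
    exact compl_mem_ae_iff.2 (measure_singleton _)
  refine ((h1.integrable_indicator measurableSet_ball).add hen).mono' (measurable_shell hm 0).aestronglyMeasurable ?_
  filter_upwards [h0] with ξ hξ0
  have hp : 0 < ‖ξ‖ := norm_pos_iff.2 hξ0
  by_cases hξ : ξ ∈ annulus n 0
  · have h3 : shell 0 f ξ = f ξ := indicator_of_mem hξ _
    have h4 : ξ ∈ ball (0 : EuclideanSpace ℝ (Fin n)) 1 := by
      have := hξ.2
      simpa using this
    rw [h3, Pi.add_apply, indicator_of_mem h4, Real.rpow_neg hp.le]
    norm_cast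
    have h5 : (‖ξ‖ ^ 2)⁻¹ = ‖ξ‖⁻¹ ^ 2 := by rw [inv_pow]
    have h6 : ‖ξ‖⁻¹ * ‖ξ‖ = 1 := inv_mul_cancel₀ hp.ne'
    have h7 : ‖f ξ‖ = ‖ξ‖⁻¹ * (‖ξ‖ * ‖f ξ‖) := by rw [← mul_assoc, h6, one_mul]
    rw [h5, ← mul_pow]
    nlinarith [sq_nonneg (‖ξ‖⁻¹ - ‖ξ‖ * ‖f ξ‖), inv_pos.2 hp, mul_nonneg hp.le (norm_nonneg (f ξ))]
  · have h3 : shell 0 f ξ = 0 := indicator_of_notMem hξ _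
    rw [h3, norm_zero, Pi.add_apply]
    refine add_nonneg (indicator_nonneg (fun ξ _ => by positivity) _) (by positivity)

end

lemma energy_half_le {n : ℕ} {F₀ F₁ : EuclideanSpace ℝ (Fin n) → ℂ} (h0 : Integrable fun ξ => ‖ξ‖ ^ 2 * ‖F₀ ξ‖ ^ 2)
    (h1 : Integrable fun ξ => ‖F₁ ξ‖ ^ 2) {c : ℂ} (hc : ‖c‖ = 1) :
    energy (fun ξ => (1 / 2 : ℂ) * (F₀ ξ + c * ((‖ξ‖⁻¹ : ℝ) : ℂ) * F₁ ξ)) ≠ ⊤ := by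
  refine ((lintegral_mono fun ξ => ?_).trans_lt (h0.add h1).lintegral_lt_top).ne
  rw [← ofReal_norm, ← ofReal_norm, ← ENNReal.ofReal_pow (norm_nonneg _), ← ENNReal.ofReal_pow (norm_nonneg _),
    ← ENNReal.ofReal_mul (by positivity)]
  refine ENNReal.ofReal_le_ofReal ?_
  have h2 : ‖(1 / 2 : ℂ) * (F₀ ξ + c * ((‖ξ‖⁻¹ : ℝ) : ℂ) * F₁ ξ)‖ ≤ 1 / 2 * (‖F₀ ξ‖ + ‖ξ‖⁻¹ * ‖F₁ ξ‖) := by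
    rw [norm_mul]
    have : ‖c * ((‖ξ‖⁻¹ : ℝ) : ℂ) * F₁ ξ‖ = ‖ξ‖⁻¹ * ‖F₁ ξ‖ := by
      rw [norm_mul, norm_mul, hc, one_mul, Complex.norm_real, norm_inv, norm_norm]
    rw [← this]
    refine mul_le_mul (by norm_num) (norm_add_le _ _) (norm_nonneg _) (by norm_num)
  have h3 : ‖ξ‖ * ‖ξ‖⁻¹ ≤ 1 := mul_inv_le_one
  have h4 : ‖ξ‖ * (‖ξ‖⁻¹ * ‖F₁ ξ‖) ≤ ‖F₁ ξ‖ := by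
    rw [← mul_assoc]; exact mul_le_of_le_one_left (norm_nonneg _) h3
  have h5 : 0 ≤ ‖ξ‖ * ‖F₀ ξ‖ := by positivity
  rw [← mul_pow]
  calc _ ≤ (1 / 2 * (‖ξ‖ * ‖F₀ ξ‖ + ‖F₁ ξ‖)) ^ 2 := by
        refine pow_le_pow_left₀ (by positivity) ?_ 2
        have := mul_le_mul_of_nonneg_left h2 (norm_nonneg ξ)
        linarith
    _ ≤ _ := by
        simp only [Pi.add_apply]
        nlinarith [sq_nonneg (‖ξ‖ * ‖F₀ ξ‖ - ‖F₁ ξ‖)]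

lemma wavePartial_eq_halfWave {d : ℕ} {ψ : SchwartzMap ℝ ℝ} {F₀ F₁ f₁ f₂ : EuclideanSpace ℝ (Fin d) → ℂ}
    (h₁ : f₁ =ᵐ[volume] fun ξ => (1 / 2 : ℂ) * (F₀ ξ - Complex.I * ((‖ξ‖⁻¹ : ℝ) : ℂ) * F₁ ξ))
    (h₂ : f₂ =ᵐ[volume] fun ξ => (1 / 2 : ℂ) * (F₀ ξ + Complex.I * ((‖ξ‖⁻¹ : ℝ) : ℂ) * F₁ ξ))
    (x : EuclideanSpace ℝ (Fin d)) {t N : ℝ}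
    (hi₁ : Integrable fun ξ => waveMult ψ (t, N⁻¹) ‖ξ‖ * f₁ ξ) (hi₂ : Integrable fun ξ => waveMult ψ (-t, N⁻¹) ‖ξ‖ * f₂ ξ) :
    wavePartial d ψ F₀ F₁ x t N = halfWave ψ f₁ x.ofLp (t, N⁻¹) + halfWave ψ f₂ x.ofLp (-t, N⁻¹) := by
  unfold halfWave fosc osc
  rw [← integral_add (integrable_osc hi₁ (measurable_coord d) x.ofLp) (integrable_osc hi₂ (measurable_coord d) x.ofLp), wavePartial]
  refine integral_congr_ae ?_
  filter_upwards [h₁, h₂] with ξ e₁ e₂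
  have hin : ⟪x, ξ⟫_ℝ = ∑ k, x k * ξ k := by
    rw [PiLp.inner_apply]
    exact Finset.sum_congr rfl fun k _ => by simp [mul_comm]
  have c₁ : Complex.exp (Complex.I * (((⟪x, ξ⟫_ℝ : ℝ) : ℂ) + (t : ℂ) * ((‖ξ‖ : ℝ) : ℂ))) =
      cis (t * ‖ξ‖) * cis (∑ k, x k * ξ k) := by
    rw [← cis_add, cis, ← hin, add_comm]; push_cast; rfl
  have c₂ : Complex.exp (Complex.I * (((⟪x, ξ⟫_ℝ : ℝ) : ℂ) - (t : ℂ) * ((‖ξ‖ : ℝ) : ℂ))) =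
      cis (-t * ‖ξ‖) * cis (∑ k, x k * ξ k) := by
    rw [← cis_add, cis, ← hin, add_comm]; push_cast; ring_nf
  rw [c₁, c₂, e₁, e₂, waveMult, waveMult, div_eq_inv_mul ‖ξ‖ N]
  ring

lemma notMem_waveDivergenceSet {d : ℕ} (hd : 3 ≤ d) {ψ : SchwartzMap ℝ ℝ} {F₀ F₁ f₁ f₂ : EuclideanSpace ℝ (Fin d) → ℂ}
    (h₁ : f₁ =ᵐ[volume] fun ξ => (1 / 2 : ℂ) * (F₀ ξ - Complex.I * ((‖ξ‖⁻¹ : ℝ) : ℂ) * F₁ ξ))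
    (h₂ : f₂ =ᵐ[volume] fun ξ => (1 / 2 : ℂ) * (F₀ ξ + Complex.I * ((‖ξ‖⁻¹ : ℝ) : ℂ) * F₁ ξ))
    (hm₁ : Measurable f₁) (hm₂ : Measurable f₂) (he₁ : energy f₁ ≠ ⊤) (he₂ : energy f₂ ≠ ⊤) {x : EuclideanSpace ℝ (Fin d)}
    (hx₁ : ∑' j : ℕ, radMax ((j + 1 : ℕ) : ℝ) (shell (j + 1) f₁) x.ofLp ≠ ⊤)
    (hx₂ : ∑' j : ℕ, radMax ((j + 1 : ℕ) : ℝ) (shell (j + 1) f₂) x.ofLp ≠ ⊤) :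
    x ∉ waveDivergenceSet d ψ F₀ F₁ := by
  have i₁ := integrable_shell_zero hd hm₁ he₁
  have i₂ := integrable_shell_zero hd hm₂ he₂
  set S : Set (ℝ × ℝ) := Icc (-1) 1 ×ˢ Icc 0 1 with hS
  set H : ℝ × ℝ → ℂ := fun p => halfWaveSum ψ f₁ x.ofLp p + halfWaveSum ψ f₂ x.ofLp (-p.1, p.2) with hH
  have hHc : ContinuousOn H S := by
    refine (continuousOn_halfWaveSum ψ hm₁ he₁ i₁ hx₁).add
      ((continuousOn_halfWaveSum ψ hm₂ he₂ i₂ hx₂).comp (by fun_prop) ?_)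
    rintro ⟨t, ε⟩ ⟨⟨h3, h4⟩, h5⟩
    exact ⟨⟨by simpa using h4, by simpa using neg_le_neg h3⟩, h5⟩
  have hpart : ∀ t N : ℝ, 0 < N → wavePartial d ψ F₀ F₁ x t N = H (t, N⁻¹) := fun t N hN => by
    have a₁ := integrable_waveMult ψ hm₁ he₁ i₁ (p := (t, N⁻¹)) (inv_pos.2 hN)
    have a₂ := integrable_waveMult ψ hm₂ he₂ i₂ (p := (-t, N⁻¹)) (inv_pos.2 hN)
    rw [wavePartial_eq_halfWave h₁ h₂ x a₁ a₂, halfWave_eq_sum ψ a₁, halfWave_eq_sum ψ a₂]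
  have hlim : ∀ t : ℝ, |t| ≤ 1 → Tendsto (fun N : ℝ => wavePartial d ψ F₀ F₁ x t N) atTop (𝓝 (H (t, 0))) := fun t ht => by
    have hmem : (t, (0:ℝ)) ∈ S := ⟨abs_le.1 ht, by simp⟩
    have h3 : Tendsto (fun N : ℝ => (t, N⁻¹)) atTop (𝓝[S] (t, 0)) := by
      refine tendsto_nhdsWithin_iff.2 ⟨tendsto_const_nhds.prodMk_nhds tendsto_inv_atTop_zero, ?_⟩
      filter_upwards [eventually_ge_atTop (1:ℝ)] with N hN
      exact ⟨abs_le.1 ht, inv_nonneg.2 (by linarith), inv_le_one_of_one_le₀ hN⟩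
    refine ((hHc _ hmem).tendsto.comp h3).congr' ?_
    filter_upwards [eventually_gt_atTop (0:ℝ)] with N hN
    exact (hpart t N hN).symm
  have hsol : ∀ t : ℝ, |t| ≤ 1 → waveSol d ψ F₀ F₁ x t = H (t, 0) := fun t ht => (hlim t ht).limUnder_eq
  rw [waveDivergenceSet, mem_ofPred_eq, not_not]
  refine ⟨⟨_, hlim 0 (by simp)⟩, 1, one_pos, fun t _ ht => ⟨_, hlim t ht.le⟩, ?_⟩
  rw [hsol 0 (by simp)]
  have hmem : ((0:ℝ), (0:ℝ)) ∈ S := ⟨by simp, by simp⟩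
  have hev : ∀ᶠ t : ℝ in 𝓝[≠] 0, |t| ≤ 1 := by
    refine mem_nhdsWithin_of_mem_nhds ?_
    filter_upwards [Icc_mem_nhds (show (-1:ℝ) < 0 by norm_num) one_pos] with t ht
    exact abs_le.2 ht
  have h3 : Tendsto (fun t : ℝ => (t, (0:ℝ))) (𝓝[≠] 0) (𝓝[S] (0, 0)) := by
    refine tendsto_nhdsWithin_iff.2 ⟨(tendsto_id.mono_left nhdsWithin_le_nhds).prodMk_nhds tendsto_const_nhds, ?_⟩
    filter_upwards [hev] with t ht
    exact ⟨abs_le.1 ht, by simp⟩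
  refine ((hHc _ hmem).tendsto.comp h3).congr' ?_
  filter_upwards [hev] with t ht
  exact (hsol t ht).symm

theorem stmt4 (d : ℕ) (hd : 3 ≤ d) :
    ∃ α : ℝ, α < (d : ℝ) - 1 ∧
      ∀ (ψ : SchwartzMap ℝ ℝ), (∀ y, 0 < ψ y) → ψ 0 = (2 * Real.pi) ^ (-(d : ℝ) / 2) →
      ∀ F₀ F₁ : EuclideanSpace ℝ (Fin d) → ℂ,
        AEStronglyMeasurable F₀ volume → AEStronglyMeasurable F₁ volume →
        Integrable (fun ξ => ‖ξ‖ ^ 2 * ‖F₀ ξ‖ ^ 2) volume →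
        Integrable (fun ξ => ‖F₁ ξ‖ ^ 2) volume →
        dimH (waveDivergenceSet d ψ F₀ F₁) ≤ ENNReal.ofReal α := by
  obtain ⟨n, rfl⟩ : ∃ n, d = n + 1 := ⟨d - 1, by omega⟩
  obtain ⟨α, hα, hαn, hdim⟩ := exists_dimH_radMax n (by omega)
  refine ⟨α, by push_cast; linarith, fun ψ _ _ F₀ F₁ hF₀ hF₁ hi₀ hi₁ => ?_⟩
  set G₀ := hF₀.mk F₀ with hG₀
  set G₁ := hF₁.mk F₁ with hG₁
  have hm₀ : Measurable G₀ := hF₀.stronglyMeasurable_mk.measurable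
  have hm₁ : Measurable G₁ := hF₁.stronglyMeasurable_mk.measurable
  have e₀ : F₀ =ᵐ[volume] G₀ := hF₀.ae_eq_mk
  have e₁ : F₁ =ᵐ[volume] G₁ := hF₁.ae_eq_mk
  have hj₀ : Integrable fun ξ => ‖ξ‖ ^ 2 * ‖G₀ ξ‖ ^ 2 := hi₀.congr (by filter_upwards [e₀] with ξ h; rw [h])
  have hj₁ : Integrable fun ξ => ‖G₁ ξ‖ ^ 2 := hi₁.congr (by filter_upwards [e₁] with ξ h; rw [h])
  have hmf : ∀ c : ℂ, Measurable fun ξ => (1 / 2 : ℂ) * (G₀ ξ + c * ((‖ξ‖⁻¹ : ℝ) : ℂ) * G₁ ξ) := fun c => by fun_prop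
  set f : ℂ → EuclideanSpace ℝ (Fin (n + 1)) → ℂ := fun c ξ => (1 / 2 : ℂ) * (G₀ ξ + c * ((‖ξ‖⁻¹ : ℝ) : ℂ) * G₁ ξ) with hf
  have he : ∀ c : ℂ, ‖c‖ = 1 → energy (f c) ≠ ⊤ := fun c hc => energy_half_le hj₀ hj₁ hc
  have hI : ‖-Complex.I‖ = 1 := by simp
  set bad : ℂ → Set (Fin (n + 1) → ℝ) := fun c =>
    {x | ∑' j : ℕ, radMax ((j + 1 : ℕ) : ℝ) (shell (j + 1) (f c)) x = ⊤} with hbad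
  have hsub : waveDivergenceSet (n + 1) ψ F₀ F₁ ⊆ WithLp.toLp 2 '' (bad (-Complex.I) ∪ bad Complex.I) := by
    intro x hx
    refine ⟨x.ofLp, ?_, rfl⟩
    by_contra hcon
    rw [mem_union, not_or] at hcon
    refine notMem_waveDivergenceSet hd (f₁ := f (-Complex.I)) (f₂ := f Complex.I) ?_ ?_ (hmf _) (hmf _) (he _ hI)
      (he _ Complex.norm_I) hcon.1 hcon.2 hx
    · filter_upwards [e₀, e₁] with ξ h h'
      rw [h, h', hf]; ring
    · filter_upwards [e₀, e₁] with ξ h h'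
      rw [h, h']
  refine (dimH_mono hsub).trans ?_
  refine ((PiLp.lipschitzWith_toLp 2 fun _ : Fin (n + 1) => ℝ).dimH_image_le _).trans ?_
  rw [dimH_union]
  exact max_le (hdim _ (hmf _) (he _ hI)) (hdim _ (hmf _) (he _ Complex.norm_I))
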